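/- Let X be a finite quandle. Then the abelian group π₃^Q(BX), defined as the image of the homomorphism π₃(BX) → π₃(B^QX) induced by the inclusion of the rack space BX into the quandle space B^QX, is finitely generated. -/

import Mathlib

open scoped Topology TensorProduct

/-- A quandle: a set with a binary operation `op` (written `x * y` in the paper) such that
every element is idempotent, the operation is right self-distributive, and every right
translation is a bijection. -/
structure QuandleStruct (X : Type*) where
  op : X → X → X
  idem : ∀ x, op x x = x
  distrib : ∀ x y z, op (op x y) z = op (op x z) (op y z)
  rightBij : ∀ y, Function.Bijective fun x => op x y

/-- The points of the disjoint union `⋃_{n ≥ 0} ([0,1] × X)ⁿ` underlying the rack space. -/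
def PreRack (X : Type*) : Type _ := Σ n : ℕ, Fin n → (unitInterval × X)

/-- The topology of the disjoint union `⋃_{n ≥ 0} ([0,1] × X)ⁿ`, where `X` carries the
discrete topology. -/
instance PreRack.topologicalSpace (X : Type*) : TopologicalSpace (PreRack X) :=
  letI : TopologicalSpace X := ⊥
  inferInstanceAs (TopologicalSpace (Σ n : ℕ, Fin n → (unitInterval × X)))

/-- The points `(t₁,x₁,…,tₙ,xₙ)` of the disjoint union with `xᵢ = xᵢ₊₁` for some `i`
(in particular `n ≥ 2`). -/
def DegPt {X : Type*} (p : PreRack X) : Prop :=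
  ∃ i : Fin p.1, ∃ h : (i : ℕ) + 1 < p.1, (p.2 i).2 = (p.2 ⟨(i : ℕ) + 1, h⟩).2

namespace QuandleStruct

variable {X : Type*} (Q : QuandleStruct X)

/-- The identifications defining the rack space: deleting a coordinate whose
interval-entry equals `1` while acting by the corresponding quandle element on all
earlier entries, and deleting a coordinate whose interval-entry equals `0`. -/
inductive RackRel : PreRack X → PreRack X → Prop
  | one (n : ℕ) (f : Fin (n + 1) → unitInterval × X) (j : Fin (n + 1)) (h : (f j).1 = 1) :
      RackRel ⟨n + 1, f⟩
        ⟨n, j.removeNth fun i =>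
          if (i : ℕ) < (j : ℕ) then ((f i).1, Q.op (f i).2 (f j).2) else f i⟩
  | zero (n : ℕ) (f : Fin (n + 1) → unitInterval × X) (j : Fin (n + 1)) (h : (f j).1 = 0) :
      RackRel ⟨n + 1, f⟩ ⟨n, j.removeNth f⟩

/-- The rack space `BX` of a quandle. -/
def rackSpace : Type _ := Quot Q.RackRel

instance : TopologicalSpace Q.rackSpace := inferInstanceAs (TopologicalSpace (Quot Q.RackRel))

/-- The basepoint of `BX` : the image of the unique point with `n = 0`. -/
def rackBase : Q.rackSpace := Quot.mk _ ⟨0, fun i => i.elim0⟩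

end QuandleStruct

/-- The mapping cone of a continuous map `f : A → B`: the quotient of `(A × [0,1]) ⊕ B`
identifying `(a,1)` with `f a` and collapsing `A × {0}` to a point. -/
def MappingCone {A B : Type*} [TopologicalSpace A] [TopologicalSpace B] (f : A → B) : Type _ :=
  Quot fun p q : (A × unitInterval) ⊕ B =>
    (∃ a : A, p = Sum.inl (a, 1) ∧ q = Sum.inr (f a)) ∨
    (∃ a a' : A, p = Sum.inl (a, 0) ∧ q = Sum.inl (a', 0))

instance {A B : Type*} [TopologicalSpace A] [TopologicalSpace B] (f : A → B) :
    TopologicalSpace (MappingCone f) :=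
  inferInstanceAs (TopologicalSpace (Quot _))

/-- The canonical inclusion of the target into the mapping cone. -/
def MappingCone.incl {A B : Type*} [TopologicalSpace A] [TopologicalSpace B] (f : A → B) :
    C(B, MappingCone f) :=
  ⟨fun b => Quot.mk _ (Sum.inr b), (continuous_quot_mk).comp continuous_inr⟩

namespace QuandleStruct

variable {X : Type*} (Q : QuandleStruct X)

/-- The quandle space `B^Q X`: the mapping cone of the natural map to `BX` from the
subspace of degenerate points of the disjoint union. -/
def quandleSpace : Type _ :=
  MappingCone fun d : {p : PreRack X // DegPt p} => Quot.mk Q.RackRel d.1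

instance : TopologicalSpace Q.quandleSpace :=
  inferInstanceAs (TopologicalSpace (MappingCone _))

/-- The natural inclusion `BX → B^Q X`. -/
def inclQSp : C(Q.rackSpace, Q.quandleSpace) :=
  MappingCone.incl _

/-- The basepoint of `B^Q X`. -/
def quandleBase : Q.quandleSpace := Q.inclQSp Q.rackBase

end QuandleStruct

section PiMap

open Topology.Homotopy

variable {N : Type*} {X Y : Type*} [TopologicalSpace X] [TopologicalSpace Y] {x : X} {y : Y}

/-- Composition of a generalized loop with a based continuous map. -/
noncomputable def GenLoop.push (f : C(X, Y)) (hf : f x = y) (g : Ω^ N X x) : Ω^ N Y y :=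
  ⟨f.comp g.1, fun t ht => by
    show f (g.1 t) = y
    rw [g.2 t ht, hf]⟩

/-- The map on homotopy groups induced by a based continuous map. -/
noncomputable def HomotopyGroup.map (f : C(X, Y)) (hf : f x = y) :
    HomotopyGroup N X x → HomotopyGroup N Y y :=
  Quotient.map (GenLoop.push f hf)
    (fun _ _ h => Nonempty.map (fun H => H.compContinuousMap f) h)

lemma GenLoop.push_transAt [DecidableEq N] (f : C(X, Y)) (hf : f x = y) (i : N)
    (u v : Ω^ N X x) :
    GenLoop.push f hf (GenLoop.transAt i u v)
      = GenLoop.transAt i (GenLoop.push f hf u) (GenLoop.push f hf v) := by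
  ext t
  show f (GenLoop.transAt i u v t) = GenLoop.transAt i _ _ t
  simp only [GenLoop.transAt, GenLoop.coe_copy]
  split_ifs <;> rfl

/-- The homomorphism on homotopy groups induced by a based continuous map. -/
noncomputable def HomotopyGroup.hom [DecidableEq N] [Nonempty N] (f : C(X, Y)) (hf : f x = y) :
    HomotopyGroup N X x →* HomotopyGroup N Y y :=
  MonoidHom.mk' (HomotopyGroup.map f hf) (fun a b => by
    refine Quotient.inductionOn₂ a b fun p q => ?_
    have i : N := Classical.arbitrary N
    let mkX : (Ω^ N X x) → HomotopyGroup N X x := fun a => ⟦a⟧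
    let mkY : (Ω^ N Y y) → HomotopyGroup N Y y := fun a => ⟦a⟧
    have h1 : mkX p * mkX q = mkX (GenLoop.transAt i q p) :=
      HomotopyGroup.mul_spec (i := i)
    have h2 : mkY (GenLoop.push f hf p) * mkY (GenLoop.push f hf q)
        = mkY (GenLoop.transAt i (GenLoop.push f hf q) (GenLoop.push f hf p)) :=
      HomotopyGroup.mul_spec (i := i)
    calc HomotopyGroup.map f hf (mkX p * mkX q)
        = HomotopyGroup.map f hf (mkX (GenLoop.transAt i q p)) := by rw [h1]
      _ = mkY (GenLoop.push f hf (GenLoop.transAt i q p)) := rfl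
      _ = mkY (GenLoop.transAt i (GenLoop.push f hf q) (GenLoop.push f hf p)) := by
            rw [GenLoop.push_transAt]
      _ = HomotopyGroup.map f hf (mkX p) * HomotopyGroup.map f hf (mkX q) := h2.symm)

end PiMap

namespace QuandleStruct

variable {X : Type*} (Q : QuandleStruct X)

/-- The group `π₃^Q(BX)`: the image of `π₃(BX) → π₃(B^QX)` induced by the inclusion. -/
noncomputable def pi3Q : Subgroup (π_ 3 Q.quandleSpace Q.quandleBase) :=
  (HomotopyGroup.hom (N := Fin 3) Q.inclQSp rfl).range

end QuandleStruct

noncomputable instance pi3QCommGroup {X : Type*} (Q : QuandleStruct X) : CommGroup ↥Q.pi3Q :=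
  { (inferInstance : Group ↥Q.pi3Q) with
    mul_comm := fun a b =>
      Subtype.ext (mul_comm (a : π_ 3 Q.quandleSpace Q.quandleBase)
        (b : π_ 3 Q.quandleSpace Q.quandleBase)) }

namespace RackPi3

open scoped unitInterval Topology.Homotopy
open Set

set_option linter.unusedSectionVars false

section Cubes

variable {ι : Type} [Fintype ι] [DecidableEq ι] {Z : Type} [TopologicalSpace Z]

/-- The endpoint of the unit interval named by a Boolean. -/
def ev (b : Bool) : I := if b then 1 else 0

@[simp] lemma ev_true : ev true = 1 := rfl
@[simp] lemma ev_false : ev false = 0 := rfl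

/-- The points of the cube with some coordinate in `D` equal to an endpoint. -/
def bd (D : Finset ι) : Set (ι → I) := {x | ∃ i ∈ D, ∃ b, x i = ev b}

/-- The maximal distance of the `D`-coordinates to the centre, normalised to the unit interval. -/
noncomputable def cubeNorm (D : Finset ι) (x : ι → I) : NNReal :=
  D.sup fun i => ‖2 * (x i : ℝ) - 1‖₊

lemma continuous_cubeNorm (D : Finset ι) : Continuous (cubeNorm D) := by
  unfold cubeNorm
  refine Continuous.finset_sup_apply fun i _ => ?_
  fun_prop

lemma cubeNorm_le_one (D : Finset ι) (x : ι → I) : cubeNorm D x ≤ 1 := by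
  refine Finset.sup_le fun i _ => ?_
  rw [← NNReal.coe_le_coe, coe_nnnorm, Real.norm_eq_abs, abs_le]
  have h0 := (x i).2.1
  have h1 := (x i).2.2
  constructor <;> push_cast <;> linarith

lemma cubeNorm_eq_one {D : Finset ι} {x : ι → I} (hx : x ∈ bd D) : cubeNorm D x = 1 := by
  refine le_antisymm (cubeNorm_le_one D x) ?_
  obtain ⟨i, hi, b, hb⟩ := hx
  refine le_trans ?_ (Finset.le_sup (f := fun i => ‖2 * (x i : ℝ) - 1‖₊) hi)
  rw [← NNReal.coe_le_coe, coe_nnnorm, Real.norm_eq_abs, hb]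
  cases b <;> norm_num [ev]

/-- The scaling factor of the radial retraction. -/
noncomputable def scaleFac (D : Finset ι) (p : (ι → I) × I) : ℝ :=
  max (cubeNorm D p.1 : ℝ) ((2 - (p.2 : ℝ)) / 2)

lemma scaleFac_pos (D : Finset ι) (p : (ι → I) × I) : 0 < scaleFac D p := by
  refine lt_max_of_lt_right ?_
  have := p.2.2.2
  linarith

lemma continuous_scaleFac (D : Finset ι) : Continuous (scaleFac D) := by
  unfold scaleFac
  have := continuous_cubeNorm D
  fun_prop

/-- The union of the bottom and the `D`-sides of the cylinder over the cube. -/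
def openBox (D : Finset ι) : Set ((ι → I) × I) := {p | p.2 = 0 ∨ p.1 ∈ bd D}

/-- The radial retraction of the cylinder over the cube onto the bottom and the sides. -/
noncomputable def boxRetr (D : Finset ι) (p : (ι → I) × I) : (ι → I) × I :=
  (fun i => if i ∈ D then
      projIcc 0 1 zero_le_one ((1 + (2 * (p.1 i : ℝ) - 1) / scaleFac D p) / 2) else p.1 i,
    projIcc 0 1 zero_le_one (2 - (2 - (p.2 : ℝ)) / scaleFac D p))

lemma continuous_boxRetr (D : Finset ι) : Continuous (boxRetr D) := by
  unfold boxRetr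
  have h := continuous_scaleFac D
  have h0 : ∀ p, scaleFac D p ≠ 0 := fun p => (scaleFac_pos D p).ne'
  refine Continuous.prodMk (continuous_pi fun i => ?_) ?_
  · split_ifs
    · refine continuous_projIcc.comp ?_
      refine Continuous.div_const (continuous_const.add (Continuous.div ?_ h h0)) _
      fun_prop
    · fun_prop
  · refine continuous_projIcc.comp (continuous_const.sub (Continuous.div ?_ h h0))
    fun_prop

lemma boxRetr_mem (D : Finset ι) (p : (ι → I) × I) : boxRetr D p ∈ openBox D := by
  have hpos := scaleFac_pos D p
  rcases le_total (cubeNorm D p.1 : ℝ) ((2 - (p.2 : ℝ)) / 2) with h | h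
  · left
    have e : scaleFac D p = (2 - (p.2 : ℝ)) / 2 := max_eq_right h
    have : (2 : ℝ) - (2 - (p.2 : ℝ)) / scaleFac D p = 0 := by
      rw [e] at hpos ⊢
      have h2 : (2 - (p.2 : ℝ)) ≠ 0 := by linarith
      field_simp
      ring
    simp only [boxRetr, this]
    exact projIcc_left _
  · right
    have e : scaleFac D p = cubeNorm D p.1 := max_eq_left h
    have hD : D.Nonempty := by
      by_contra hD
      rw [Finset.not_nonempty_iff_eq_empty] at hD
      rw [e, hD] at hpos
      simp [cubeNorm] at hpos
    obtain ⟨i, hi, him⟩ := Finset.exists_mem_eq_sup D hD (fun i => ‖2 * (p.1 i : ℝ) - 1‖₊)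
    have e2 : scaleFac D p = |2 * (p.1 i : ℝ) - 1| := by
      rw [e, cubeNorm, him, coe_nnnorm, Real.norm_eq_abs]
    rcases le_total 0 (2 * (p.1 i : ℝ) - 1) with h' | h'
    · refine ⟨i, hi, true, ?_⟩
      rw [abs_of_nonneg h'] at e2
      have : (1 + (2 * (p.1 i : ℝ) - 1) / scaleFac D p) / 2 = 1 := by
        rw [← e2, div_self hpos.ne']
        norm_num
      simp only [boxRetr, if_pos hi, this]
      exact projIcc_right _
    · refine ⟨i, hi, false, ?_⟩
      rw [abs_of_nonpos h'] at e2
      have : (1 + (2 * (p.1 i : ℝ) - 1) / scaleFac D p) / 2 = 0 := by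
        rw [show 2 * (p.1 i : ℝ) - 1 = - scaleFac D p by linarith, neg_div, div_self hpos.ne']
        norm_num
      simp only [boxRetr, if_pos hi, this]
      exact projIcc_left _

lemma boxRetr_eq {D : Finset ι} {p : (ι → I) × I} (hp : p ∈ openBox D) : boxRetr D p = p := by
  have e : scaleFac D p = 1 := by
    rcases hp with h | h
    · have := cubeNorm_le_one D p.1
      rw [scaleFac, h]
      have h2 : (cubeNorm D p.1 : ℝ) ≤ 1 := by exact_mod_cast this
      rw [max_eq_right] <;> simp [h2]
    · rw [scaleFac, cubeNorm_eq_one h]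
      have := p.2.2.1
      rw [max_eq_left] <;> push_cast <;> linarith
  refine Prod.ext (funext fun i => ?_) ?_
  · simp only [boxRetr, e, div_one]
    split_ifs
    · have : (1 + (2 * (p.1 i : ℝ) - 1)) / 2 = p.1 i := by ring
      rw [this, projIcc_val]
    · rfl
  · simp only [boxRetr, e, div_one]
    have : (2 : ℝ) - (2 - (p.2 : ℝ)) = p.2 := by ring
    rw [this, projIcc_val]

/-- A function on the cube which depends only on the coordinates in `D`. -/
def DepOn (D : Finset ι) {S W : Type*} (f : (ι → S) → W) : Prop :=
  ∀ x y, (∀ i ∈ D, x i = y i) → f x = f y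

/-- Replace the coordinates outside `D` by zero. -/
def keep (D : Finset ι) (x : ι → I) : ι → I := fun i => if i ∈ D then x i else 0

lemma continuous_keep (D : Finset ι) : Continuous (keep D) := by
  refine continuous_pi fun i => ?_
  unfold keep
  split_ifs <;> fun_prop

lemma keep_apply_of_mem {D : Finset ι} {i : ι} (hi : i ∈ D) (x : ι → I) : keep D x i = x i :=
  if_pos hi

lemma keep_eq_of {D : Finset ι} {x y : ι → I} (h : ∀ i ∈ D, x i = y i) :
    keep D x = keep D y := by
  funext i
  unfold keep
  split_ifs with hi
  · exact h i hi
  · rfl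

lemma DepOn.keep {D : Finset ι} {W : Type*} {f : (ι → I) → W} (h : DepOn D f) (x : ι → I) :
    f (keep D x) = f x :=
  h _ _ fun _ hi => keep_apply_of_mem hi x

lemma keep_mem_bd {D : Finset ι} {x : ι → I} (hx : x ∈ bd D) : RackPi3.keep D x ∈ bd D := by
  obtain ⟨i, hi, b, hb⟩ := hx
  exact ⟨i, hi, b, by rw [keep_apply_of_mem hi, hb]⟩

/-- Homotopy extension for the cube relative to the `D`-sides. -/
theorem exists_box_extension (D : Finset ι) {g : (ι → I) × I → Z}
    (hg : ContinuousOn g (openBox D)) :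
    ∃ G : C((ι → I) × I, Z), (∀ p ∈ openBox D, G p = g p) ∧ ∀ p, ∃ q ∈ openBox D, G p = g q :=
  ⟨⟨fun p => g (boxRetr D p), hg.comp_continuous (continuous_boxRetr D) (boxRetr_mem D)⟩,
    fun p hp => by simp [boxRetr_eq hp], fun p => ⟨_, boxRetr_mem D p, rfl⟩⟩

lemma isClosed_bd (D : Finset ι) : IsClosed (bd D) := by
  have : bd D = ⋃ i ∈ D, ⋃ b : Bool, {x : ι → I | x i = ev b} := by
    ext x
    simp [bd]
  rw [this]
  refine isClosed_biUnion_finset fun i _ => isClosed_iUnion_of_finite fun b => ?_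
  exact isClosed_eq (continuous_apply i) continuous_const

/-- Gluing functions which are given on the individual faces of the cube. -/
theorem exists_face_glue [Nonempty Z] {T : Type} [TopologicalSpace T] (D : Finset ι)
    (H : ι → Bool → (ι → I) × T → Z)
    (hH : ∀ i ∈ D, ∀ b, ContinuousOn (H i b) {p | p.1 i = ev b})
    (hc : ∀ i ∈ D, ∀ b, ∀ j ∈ D, ∀ b', ∀ p : (ι → I) × T, p.1 i = ev b → p.1 j = ev b' →
      H i b p = H j b' p) :
    ∃ g : (ι → I) × T → Z, ContinuousOn g {p | p.1 ∈ bd D} ∧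
      ∀ i ∈ D, ∀ b, ∀ p : (ι → I) × T, p.1 i = ev b → g p = H i b p := by
  classical
  let g : (ι → I) × T → Z := fun p =>
    if h : p.1 ∈ bd D then H h.choose h.choose_spec.2.choose p else Classical.arbitrary Z
  have hg : ∀ i ∈ D, ∀ b, ∀ p : (ι → I) × T, p.1 i = ev b → g p = H i b p := by
    intro i hi b p hp
    have h : p.1 ∈ bd D := ⟨i, hi, b, hp⟩
    simp only [g, dif_pos h]
    exact hc _ h.choose_spec.1 _ _ hi _ _ h.choose_spec.2.choose_spec hp
  refine ⟨g, ?_, hg⟩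
  have : {p : (ι → I) × T | p.1 ∈ bd D} =
      ⋃ q : D × Bool, {p : (ι → I) × T | p.1 q.1 = ev q.2} := by
    ext x
    simp [bd]
  rw [this]
  refine (locallyFinite_of_finite _).continuousOn_iUnion (fun q => ?_) fun q => ?_
  · exact isClosed_eq ((continuous_apply _).comp continuous_fst) continuous_const
  · exact (hH q.1 q.1.2 q.2).congr fun p hp => hg _ q.1.2 _ _ hp

/-- Homotopy extension with the homotopy prescribed on the individual faces. -/
theorem exists_extension_of_faces [Nonempty Z] (D : Finset ι) (c : C(ι → I, Z))
    (H : ι → Bool → (ι → I) × I → Z)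
    (hH : ∀ i ∈ D, ∀ b, ContinuousOn (H i b) {p | p.1 i = ev b})
    (hc : ∀ i ∈ D, ∀ b, ∀ j ∈ D, ∀ b', ∀ p : (ι → I) × I, p.1 i = ev b → p.1 j = ev b' →
      H i b p = H j b' p)
    (h0 : ∀ i ∈ D, ∀ b, ∀ x : ι → I, x i = ev b → H i b (x, 0) = c x) :
    ∃ G : C((ι → I) × I, Z), (∀ x, G (x, 0) = c x) ∧
      (∀ i ∈ D, ∀ b, ∀ p : (ι → I) × I, p.1 i = ev b → G p = H i b p) ∧
      ∀ p, (∃ x, G p = c x) ∨ ∃ i ∈ D, ∃ b, ∃ q : (ι → I) × I, q.1 i = ev b ∧ G p = H i b q := by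
  classical
  obtain ⟨g, hg, hgH⟩ := exists_face_glue D H hH hc
  let g' : (ι → I) × I → Z := fun p => if p.1 ∈ bd D then g p else c p.1
  have hb : ∀ p : (ι → I) × I, p.1 ∈ bd D → g' p = g p := fun p hp => if_pos hp
  have hz : ∀ p : (ι → I) × I, p.2 = 0 → g' p = c p.1 := by
    rintro ⟨x, t⟩ (rfl : t = 0)
    by_cases hx : x ∈ bd D
    · obtain ⟨i, hi, b, hb'⟩ := id hx
      rw [hb _ hx, hgH i hi b _ hb', h0 i hi b x hb']
    · exact if_neg hx
  have hcont : ContinuousOn g' (openBox D) := by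
    have : openBox D = {p : (ι → I) × I | p.2 = 0} ∪ {p | p.1 ∈ bd D} := rfl
    rw [this]
    refine ContinuousOn.union_of_isClosed ?_ ?_ (isClosed_eq continuous_snd continuous_const)
      ((isClosed_bd D).preimage continuous_fst)
    · exact (c.continuous.comp continuous_fst).continuousOn.congr fun p hp => hz p hp
    · exact hg.congr fun p hp => hb p hp
  obtain ⟨G, hG, hGv⟩ := exists_box_extension D hcont
  refine ⟨G, fun x => ?_, fun i hi b p hp => ?_, fun p => ?_⟩
  · rw [hG _ (Or.inl rfl), hz _ rfl]
  · have : p.1 ∈ bd D := ⟨i, hi, b, hp⟩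
    rw [hG _ (Or.inr this), hb _ this, hgH i hi b _ hp]
  · obtain ⟨q, hq, e⟩ := hGv p
    rcases hq with hq | hq
    · exact Or.inl ⟨q.1, by rw [e, hz _ hq]⟩
    · obtain ⟨i, hi, b, hb'⟩ := id hq
      exact Or.inr ⟨i, hi, b, q, hb', by rw [e, hb _ hq, hgH i hi b _ hb']⟩

/-- Every map from the boundary of a cube of dimension at most `n` into `V` extends over the
cube. -/
def ExtProp (V : Set Z) (n : ℕ) : Prop :=
  V.Nonempty ∧ ∀ (k : ℕ) (D : Finset (Fin k)), D.card ≤ n → ∀ g : (Fin k → I) → Z,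
    ContinuousOn g (bd D) → MapsTo g (bd D) V →
    ∃ G : C(Fin k → I, Z), (∀ x, G x ∈ V) ∧ EqOn G g (bd D)

/-- A contraction of a subset. -/
def Contractible (V : Set Z) : Prop :=
  ∃ K : Z × I → Z, ∃ v ∈ V, ContinuousOn K (V ×ˢ univ) ∧ (∀ z ∈ V, ∀ t, K (z, t) ∈ V) ∧
    (∀ z ∈ V, K (z, 0) = z) ∧ ∀ z ∈ V, K (z, 1) = v

theorem Contractible.extProp {V : Set Z} (hV : Contractible V) (n : ℕ) : ExtProp V n := by
  classical
  obtain ⟨K, v, hv, hK, hKV, hK0, hK1⟩ := hV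
  refine ⟨⟨v, hv⟩, fun k D _ g hg hgV => ?_⟩
  let g' : (Fin k → I) × I → Z := fun p => if p.1 ∈ bd D then K (g p.1, unitInterval.symm p.2) else v
  have hb : ∀ p : (Fin k → I) × I, p.1 ∈ bd D → g' p = K (g p.1, unitInterval.symm p.2) :=
    fun p hp => if_pos hp
  have hz : ∀ p : (Fin k → I) × I, p.2 = 0 → g' p = v := by
    rintro ⟨x, t⟩ (rfl : t = 0)
    by_cases hx : x ∈ bd D
    · rw [hb _ hx]
      simp only [unitInterval.symm_zero]
      exact hK1 _ (hgV hx)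
    · exact if_neg hx
  have hcont : ContinuousOn g' (openBox D) := by
    have : openBox D = {p : (Fin k → I) × I | p.2 = 0} ∪ {p | p.1 ∈ bd D} := rfl
    rw [this]
    refine ContinuousOn.union_of_isClosed ?_ ?_ (isClosed_eq continuous_snd continuous_const)
      ((isClosed_bd D).preimage continuous_fst)
    · exact continuousOn_const.congr fun p hp => hz p hp
    · refine ContinuousOn.congr ?_ fun p hp => hb p hp
      refine hK.comp ((hg.comp continuousOn_fst fun p hp => hp).prodMk ?_)
        fun p hp => ⟨hgV hp, mem_univ _⟩
      exact (unitInterval.continuous_symm.comp continuous_snd).continuousOn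
  obtain ⟨G, hG, hGv⟩ := exists_box_extension D hcont
  refine ⟨G.comp ⟨fun x => (x, 1), by fun_prop⟩, fun x => ?_, fun x hx => ?_⟩
  · obtain ⟨q, hq, e⟩ := hGv (x, 1)
    simp only [ContinuousMap.comp_apply, ContinuousMap.coe_mk, e]
    rcases hq with hq | hq
    · rw [hz _ hq]
      exact hv
    · rw [hb _ hq]
      exact hKV _ (hgV hq) _
  · simp only [ContinuousMap.comp_apply, ContinuousMap.coe_mk]
    rw [hG _ (Or.inr hx), hb _ hx]
    simp only [unitInterval.symm_one]
    exact hK0 _ (hgV hx)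

end Cubes

section Grid

variable {ι : Type} [Fintype ι] [DecidableEq ι] {Z : Type} [TopologicalSpace Z]

/-- The face of a cube, as a degenerate cube. -/
def face (i : ι) (b : Bool) (c : C(ι → I, Z)) : C(ι → I, Z) :=
  c.comp ⟨fun x => Function.update x i (ev b), by fun_prop⟩

@[simp] lemma face_apply (i : ι) (b : Bool) (c : C(ι → I, Z)) (x : ι → I) :
    face i b c x = c (Function.update x i (ev b)) := rfl

lemma face_comm {i j : ι} (h : i ≠ j) (b b' : Bool) (c : C(ι → I, Z)) :
    face i b (face j b' c) = face j b' (face i b c) := by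
  ext x
  simp only [face_apply]
  rw [Function.update_comm h]

lemma ev_injective : Function.Injective ev := by
  intro b b' h
  cases b <;> cases b' <;> simp_all [ev]

open Classical in
/-- The coordinates on which a cube genuinely depends. -/
noncomputable def cdim (c : C(ι → I, Z)) : Finset ι :=
  Finset.univ.filter fun i => ∃ x s, c (Function.update x i s) ≠ c x

lemma update_of_notMem_cdim {c : C(ι → I, Z)} {i : ι} (h : i ∉ cdim c) (x : ι → I) (s : I) :
    c (Function.update x i s) = c x := by
  simp only [cdim, Finset.mem_filter, Finset.mem_univ, true_and, not_exists, not_not] at h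
  exact h x s

lemma depOn_of_update {D : Finset ι} {W : Type*} {f : (ι → I) → W}
    (h : ∀ i ∉ D, ∀ x s, f (Function.update x i s) = f x) : DepOn D f := by
  intro x y hxy
  have key : ∀ S : Finset ι, f (fun i => if i ∈ S then y i else x i) = f x := by
    intro S
    induction S using Finset.induction_on with
    | empty => simp
    | insert i S hi ih =>
      rw [← ih]
      have e : (fun j => if j ∈ insert i S then y j else x j) =
          Function.update (fun j => if j ∈ S then y j else x j) i (y i) := by
        funext j
        by_cases hj : j = i
        · subst hj
          simp
        · simp [hj]
      rw [e]
      by_cases hD : i ∈ D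
      · congr 1
        funext j
        by_cases hj : j = i
        · subst hj
          simp [hi, hxy _ hD]
        · simp [hj]
      · exact h i hD _ _
  simpa using (key Finset.univ).symm

lemma depOn_cdim (c : C(ι → I, Z)) : DepOn (cdim c) c :=
  depOn_of_update fun _ hi x s => update_of_notMem_cdim hi x s

lemma cdim_subset {c : C(ι → I, Z)} {D : Finset ι} (h : DepOn D c) : cdim c ⊆ D := by
  intro i hi
  by_contra hD
  simp only [cdim, Finset.mem_filter, Finset.mem_univ, true_and] at hi
  obtain ⟨x, s, hs⟩ := hi
  refine hs (h _ _ fun j hj => Function.update_of_ne ?_ _ _)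
  rintro rfl
  exact hD hj

lemma cdim_face_subset (i : ι) (b : Bool) (c : C(ι → I, Z)) :
    cdim (face i b c) ⊆ (cdim c).erase i := by
  refine cdim_subset fun x y h => depOn_cdim c _ _ fun j hj => ?_
  by_cases hji : j = i
  · subst hji
    simp
  · simp only [ContinuousMap.coe_mk, Function.update_of_ne hji]
    exact h j (Finset.mem_erase.2 ⟨hji, hj⟩)

lemma card_cdim_face_lt {i : ι} {c : C(ι → I, Z)} (h : i ∈ cdim c) (b : Bool) :
    (cdim (face i b c)).card < (cdim c).card :=
  (Finset.card_le_card (cdim_face_subset i b c)).trans_lt (Finset.card_erase_lt_of_mem h)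

lemma face_of_notMem_cdim {c : C(ι → I, Z)} {i : ι} (h : i ∉ cdim c) (b : Bool) :
    face i b c = c := by
  ext x
  exact update_of_notMem_cdim h x _

/-- Recursion over the faces of a cube. -/
noncomputable def faceRec {K O : Type*} (κ : C(ι → I, Z) → K) (d : O)
    (Φ : K → Finset ι → (ι → Bool → O) → O) (c : C(ι → I, Z)) : O :=
  Φ (κ c) (cdim c) fun i b => if _h : i ∈ cdim c then faceRec κ d Φ (face i b c) else d
termination_by (cdim c).card
decreasing_by exact card_cdim_face_lt _h b

lemma finite_faceRec {K O : Type*} (κ : C(ι → I, Z) → K) (d : O)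
    (Φ : K → Finset ι → (ι → Bool → O) → O) (P : Set C(ι → I, Z))
    (hP : ∀ c ∈ P, ∀ i b, face i b c ∈ P) (hκ : (κ '' P).Finite) :
    (faceRec κ d Φ '' P).Finite := by
  have key : ∀ n, (faceRec κ d Φ '' {c ∈ P | (cdim c).card ≤ n}).Finite := by
    intro n
    induction n with
    | zero =>
      refine (hκ.image fun k => Φ k ∅ fun _ _ => d).subset ?_
      rintro _ ⟨c, ⟨hc, hc0⟩, rfl⟩
      have h0 : cdim c = ∅ := Finset.card_eq_zero.1 (Nat.le_zero.1 hc0)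
      refine ⟨κ c, ⟨c, hc, rfl⟩, ?_⟩
      rw [faceRec]
      simp [h0]
    | succ n ih =>
      have hfin : (univ.pi fun _ : ι => univ.pi fun _ : Bool =>
          insert d (faceRec κ d Φ '' {c ∈ P | (cdim c).card ≤ n})).Finite :=
        Set.Finite.pi fun _ => Set.Finite.pi fun _ => ih.insert d
      refine ((hκ.prod ((Set.toFinite (univ : Set (Finset ι))).prod hfin)).image
        fun q => Φ q.1 q.2.1 q.2.2).subset ?_
      rintro _ ⟨c, ⟨hc, hcn⟩, rfl⟩
      refine ⟨(κ c, cdim c, fun i b => if i ∈ cdim c then faceRec κ d Φ (face i b c) else d),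
        ⟨⟨c, hc, rfl⟩, mem_univ _, fun i _ b _ => ?_⟩, ?_⟩
      · by_cases hi : i ∈ cdim c
        · simp only [if_pos hi]
          refine Or.inr ⟨_, ⟨hP c hc i b, ?_⟩, rfl⟩
          have := card_cdim_face_lt hi b
          omega
        · simp only [if_neg hi]
          exact Or.inl rfl
      · rw [faceRec]
        simp
  refine (key (Fintype.card ι)).subset (image_mono fun c hc => ⟨hc, ?_⟩)
  exact Finset.card_le_univ _

/-- Construction of functions on cubes which are compatible with faces, by extension from the
boundary. -/
theorem exists_face_system [Nonempty Z] {W : Type} [TopologicalSpace W] {T : Type}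
    [TopologicalSpace T] [Nonempty W] {K : Type*}
    (κ : C(ι → I, Z) → K) (P : Set C(ι → I, Z)) (hP : ∀ c ∈ P, ∀ i b, face i b c ∈ P)
    (R : C(ι → I, Z) → C((ι → I) × T, W) → Prop)
    (step : ∀ (k : K) (D : Finset ι) (H : ι → Bool → C((ι → I) × T, W)),
      ∃ o : C((ι → I) × T, W), ∀ c ∈ P, κ c = k → cdim c = D →
        (∀ i ∈ D, ∀ b, R (face i b c) (H i b)) →
        (∀ i ∈ D, ∀ b, ∀ j ∈ D, ∀ b', ∀ p : (ι → I) × T, p.1 i = ev b → p.1 j = ev b' →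
          H i b p = H j b' p) →
        (∀ i ∈ D, ∀ b, ∀ x y : ι → I, ∀ t, (∀ j ∈ D.erase i, x j = y j) →
          H i b (x, t) = H i b (y, t)) →
        R c o ∧ (∀ x y : ι → I, ∀ t, (∀ i ∈ D, x i = y i) → o (x, t) = o (y, t)) ∧
        ∀ i ∈ D, ∀ b, ∀ p : (ι → I) × T, p.1 i = ev b → o p = H i b p) :
    ∃ 𝓗 : C(ι → I, Z) → C((ι → I) × T, W), (∀ c ∈ P, R c (𝓗 c)) ∧
      (∀ c ∈ P, ∀ x y : ι → I, ∀ t, (∀ i ∈ cdim c, x i = y i) → 𝓗 c (x, t) = 𝓗 c (y, t)) ∧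
      (∀ c ∈ P, ∀ i b x t, 𝓗 c (Function.update x i (ev b), t) = 𝓗 (face i b c) (x, t)) ∧
      ((κ '' P).Finite → (𝓗 '' P).Finite) := by
  choose Φ hΦ using step
  let d : C((ι → I) × T, W) := ContinuousMap.const _ (Classical.arbitrary W)
  let 𝓗 := faceRec κ d Φ
  have key : ∀ n, ∀ c ∈ P, (cdim c).card = n → R c (𝓗 c) ∧
      (∀ x y : ι → I, ∀ t, (∀ i ∈ cdim c, x i = y i) → 𝓗 c (x, t) = 𝓗 c (y, t)) ∧
      ∀ i b x t, 𝓗 c (Function.update x i (ev b), t) = 𝓗 (face i b c) (x, t) := by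
    intro n
    induction n using Nat.strong_induction_on with
    | _ n ih =>
      intro c hc hn
      have ihf : ∀ i ∈ cdim c, ∀ b, _ := fun i hi b =>
        ih _ (hn ▸ card_cdim_face_lt hi b) (face i b c) (hP c hc i b) rfl
      have e : 𝓗 c = Φ (κ c) (cdim c) fun i b => if i ∈ cdim c then 𝓗 (face i b c) else d := by
        simp only [𝓗]
        rw [faceRec]
        simp
      have hind : ∀ i ∈ cdim c, ∀ b, ∀ x y : ι → I, ∀ t, (∀ j ∈ (cdim c).erase i, x j = y j) →
          𝓗 (face i b c) (x, t) = 𝓗 (face i b c) (y, t) := fun i hi b x y t h =>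
        (ihf i hi b).2.1 x y t fun j hj => h j (cdim_face_subset i b c hj)
      have hind' : ∀ i ∈ cdim c, ∀ b, ∀ x : ι → I, ∀ s t,
          𝓗 (face i b c) (Function.update x i s, t) = 𝓗 (face i b c) (x, t) :=
        fun i hi b x s t => hind i hi b _ _ t fun j hj =>
          Function.update_of_ne (Finset.ne_of_mem_erase hj) _ _
      obtain ⟨h1, h2, h3⟩ := hΦ (κ c) (cdim c)
        (fun i b => if i ∈ cdim c then 𝓗 (face i b c) else d) c hc rfl rfl
        (fun i hi b => by simpa only [if_pos hi] using (ihf i hi b).1)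
        (by
          intro i hi b j hj b' p hpi hpj
          simp only [if_pos hi, if_pos hj]
          by_cases hij : i = j
          · subst hij
            rw [ev_injective (hpi.symm.trans hpj)]
          · have hpi' : Function.update p.1 i (ev b) = p.1 := by rw [← hpi]; simp
            have hpj' : Function.update p.1 j (ev b') = p.1 := by rw [← hpj]; simp
            have e1 := (ihf i hi b).2.2 j b' p.1 p.2
            have e2 := (ihf j hj b').2.2 i b p.1 p.2
            rw [hpj'] at e1
            rw [hpi', face_comm hij] at e2
            exact e1.trans e2.symm)
        (by
          intro i hi b x y t h
          simp only [if_pos hi]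
          exact hind i hi b x y t h)
      rw [← e] at h1 h2 h3
      refine ⟨h1, h2, fun i b x t => ?_⟩
      by_cases hi : i ∈ cdim c
      · rw [h3 i hi b (Function.update x i (ev b), t) (by simp)]
        simp only [if_pos hi]
        exact hind' i hi b x _ t
      · rw [face_of_notMem_cdim hi]
        refine h2 _ _ t fun j hj => Function.update_of_ne ?_ _ _
        rintro rfl
        exact hi hj
  exact ⟨𝓗, fun c hc => (key _ c hc rfl).1, fun c hc => (key _ c hc rfl).2.1,
    fun c hc => (key _ c hc rfl).2.2, finite_faceRec κ d Φ P hP⟩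

variable {N : ℕ}

/-- The small cube with index `Q` in the subdivision of the cube into `N ^ k` cubes. -/
noncomputable def gcell (N : ℕ) (Q : ι → Fin N) (x : ι → I) : ι → I := fun i =>
  ⟨((Q i : ℕ) + (x i : ℝ)) / N, by
    have h1 : ((Q i : ℕ) : ℝ) + 1 ≤ N := by exact_mod_cast (Q i).2
    have h2 := (x i).2.1
    have h3 := (x i).2.2
    have h4 : (0 : ℝ) ≤ ((Q i : ℕ) : ℝ) := by positivity
    have h5 : (0 : ℝ) < N := by linarith
    exact ⟨by positivity, by rw [div_le_one h5]; linarith⟩⟩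

lemma gcell_apply (Q : ι → Fin N) (x : ι → I) (i : ι) :
    (gcell N Q x i : ℝ) = ((Q i : ℕ) + (x i : ℝ)) / N := rfl

lemma continuous_gcell (Q : ι → Fin N) : Continuous (gcell N Q) := by
  refine continuous_pi fun i => Continuous.subtype_mk ?_ _
  fun_prop

/-- The restriction of a cube to a small cube. -/
noncomputable def sub (f : C(ι → I, Z)) (Q : ι → Fin N) : C(ι → I, Z) :=
  f.comp ⟨gcell N Q, continuous_gcell Q⟩

@[simp] lemma sub_apply (f : C(ι → I, Z)) (Q : ι → Fin N) (x : ι → I) :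
    sub f Q x = f (gcell N Q x) := rfl

/-- Coordinates relative to a small cube. -/
noncomputable def gcoord (Q : ι → Fin N) (y : ι → I) : ι → I := fun i =>
  projIcc 0 1 zero_le_one (N * (y i : ℝ) - (Q i : ℕ))

lemma continuous_gcoord (Q : ι → Fin N) : Continuous (gcoord Q) := by
  refine continuous_pi fun i => continuous_projIcc.comp ?_
  fun_prop

lemma gcoord_gcell (Q : ι → Fin N) (x : ι → I) : gcoord Q (gcell N Q x) = x := by
  funext i
  have h1 : ((Q i : ℕ) : ℝ) + 1 ≤ N := by exact_mod_cast (Q i).2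
  have h4 : (0 : ℝ) ≤ ((Q i : ℕ) : ℝ) := by positivity
  have h5 : (N : ℝ) ≠ 0 := by linarith
  simp only [gcoord, gcell_apply]
  have : (N : ℝ) * (((Q i : ℕ) + (x i : ℝ)) / N) - (Q i : ℕ) = x i := by
    field_simp
    ring
  rw [this, projIcc_val]

/-- The region occupied by a small cube. -/
def gregion (Q : ι → Fin N) : Set (ι → I) :=
  {y | ∀ i, ((Q i : ℕ) : ℝ) ≤ N * (y i : ℝ) ∧ N * (y i : ℝ) ≤ (Q i : ℕ) + 1}

lemma isClosed_gregion (Q : ι → Fin N) : IsClosed (gregion Q) := by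
  have : gregion Q = ⋂ i, ({y : ι → I | ((Q i : ℕ) : ℝ) ≤ N * (y i : ℝ)} ∩
      {y | N * (y i : ℝ) ≤ (Q i : ℕ) + 1}) := by
    ext y
    simp [gregion]
  rw [this]
  refine isClosed_iInter fun i => IsClosed.inter ?_ ?_
  · exact isClosed_le (by fun_prop) (by fun_prop)
  · exact isClosed_le (by fun_prop) (by fun_prop)

lemma gcell_gcoord {Q : ι → Fin N} {y : ι → I} (hy : y ∈ gregion Q) :
    gcell N Q (gcoord Q y) = y := by
  funext i
  have h1 : ((Q i : ℕ) : ℝ) + 1 ≤ N := by exact_mod_cast (Q i).2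
  have h4 : (0 : ℝ) ≤ ((Q i : ℕ) : ℝ) := by positivity
  have h5 : (N : ℝ) ≠ 0 := by linarith
  obtain ⟨h6, h7⟩ := hy i
  refine Subtype.ext ?_
  rw [gcell_apply, gcoord, projIcc_of_mem zero_le_one ⟨by linarith, by linarith⟩]
  field_simp
  ring

lemma gcell_mem_gregion (Q : ι → Fin N) (x : ι → I) : gcell N Q x ∈ gregion Q := by
  intro i
  have h1 : ((Q i : ℕ) : ℝ) + 1 ≤ N := by exact_mod_cast (Q i).2
  have h4 : (0 : ℝ) ≤ ((Q i : ℕ) : ℝ) := by positivity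
  have h5 : (0 : ℝ) < N := by linarith
  have h2 := (x i).2.1
  have h3 := (x i).2.2
  rw [gcell_apply, mul_div_cancel₀ _ h5.ne']
  constructor <;> linarith

lemma exists_mem_gregion (hN : 0 < N) (y : ι → I) : ∃ Q : ι → Fin N, y ∈ gregion Q := by
  have : ∀ i, ∃ q : Fin N, ((q : ℕ) : ℝ) ≤ N * (y i : ℝ) ∧ N * (y i : ℝ) ≤ (q : ℕ) + 1 := by
    intro i
    have h0 : (0 : ℝ) ≤ N * (y i : ℝ) := mul_nonneg (by positivity) (y i).2.1
    have h1 : N * (y i : ℝ) ≤ N := mul_le_of_le_one_right (by positivity) (y i).2.2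
    by_cases h : ⌊N * (y i : ℝ)⌋₊ < N
    · exact ⟨⟨_, h⟩, Nat.floor_le h0, (Nat.lt_floor_add_one _).le⟩
    · push Not at h
      have h2 : (N : ℝ) ≤ N * (y i : ℝ) := (Nat.cast_le.2 h).trans (Nat.floor_le h0)
      refine ⟨⟨N - 1, by omega⟩, ?_, ?_⟩
      · refine le_trans ?_ h2
        exact_mod_cast Nat.sub_le _ _
      · refine h1.trans ?_
        have : N ≤ N - 1 + 1 := by omega
        exact_mod_cast this
  choose Q hQ using this
  exact ⟨Q, hQ⟩

lemma exists_gcell_eq (hN : 0 < N) (y : ι → I) : ∃ (Q : ι → Fin N) (x : ι → I),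
    gcell N Q x = y := by
  obtain ⟨Q, hQ⟩ := exists_mem_gregion hN y
  exact ⟨Q, _, gcell_gcoord hQ⟩

lemma gcell_eq_cases {Q Q' : ι → Fin N} {x x' : ι → I} (h : gcell N Q x = gcell N Q' x')
    (i : ι) : (Q i = Q' i ∧ x i = x' i) ∨ ((Q i : ℕ) + 1 = Q' i ∧ x i = 1 ∧ x' i = 0) ∨
      ((Q' i : ℕ) + 1 = Q i ∧ x' i = 1 ∧ x i = 0) := by
  have h1 : ((Q i : ℕ) : ℝ) + 1 ≤ N := by exact_mod_cast (Q i).2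
  have h4 : (0 : ℝ) ≤ ((Q i : ℕ) : ℝ) := by positivity
  have h5 : (N : ℝ) ≠ 0 := by linarith
  have e := congrArg (Subtype.val) (congrFun h i)
  rw [gcell_apply, gcell_apply, div_left_inj' h5] at e
  have a0 := (x i).2.1
  have a1 := (x i).2.2
  have b0 := (x' i).2.1
  have b1 := (x' i).2.2
  rcases lt_trichotomy (Q i : ℕ) (Q' i : ℕ) with hl | he | hl
  · right; left
    have h6 : ((Q i : ℕ) : ℝ) + 1 ≤ (Q' i : ℕ) := by exact_mod_cast hl
    have h7 : (x i : ℝ) = 1 := by linarith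
    have h8 : (x' i : ℝ) = 0 := by linarith
    refine ⟨?_, Subtype.ext h7, Subtype.ext h8⟩
    have : ((Q i : ℕ) : ℝ) + 1 = (Q' i : ℕ) := by linarith
    exact_mod_cast this
  · left
    refine ⟨Fin.ext he, Subtype.ext ?_⟩
    rw [he] at e
    linarith
  · right; right
    have h6 : ((Q' i : ℕ) : ℝ) + 1 ≤ (Q i : ℕ) := by exact_mod_cast hl
    have h7 : (x' i : ℝ) = 1 := by linarith
    have h8 : (x i : ℝ) = 0 := by linarith
    refine ⟨?_, Subtype.ext h7, Subtype.ext h8⟩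
    have : ((Q' i : ℕ) : ℝ) + 1 = (Q i : ℕ) := by linarith
    exact_mod_cast this

/-- Gluing maps given on the small cubes of a subdivision. -/
theorem exists_grid_glue {T : Type} [TopologicalSpace T] (hN : 0 < N)
    (h : (ι → Fin N) → C((ι → I) × T, Z))
    (hc : ∀ (Q : ι → Fin N) (i : ι) (q : Fin N), (Q i : ℕ) + 1 = q → ∀ x t,
      h Q (Function.update x i 1, t) = h (Function.update Q i q) (Function.update x i 0, t)) :
    ∃ H : C((ι → I) × T, Z), ∀ Q x t, H (gcell N Q x, t) = h Q (x, t) := by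
  have hc' : ∀ (Q : ι → Fin N) (i : ι) (q : Fin N), (Q i : ℕ) + 1 = q → ∀ (x : ι → I) t,
      x i = 1 → h Q (x, t) = h (Function.update Q i q) (Function.update x i 0, t) := by
    intro Q i q hq x t hx
    rw [← hc Q i q hq, ← hx]
    simp
  have wd : ∀ (Q Q' : ι → Fin N) (x x' : ι → I) t, gcell N Q x = gcell N Q' x' →
      h Q (x, t) = h Q' (x', t) := by
    intro Q Q' x x' t hQ
    have key : ∀ S : Finset ι, h (fun i => if i ∈ S then Q' i else Q i)
        (fun i => if i ∈ S then x' i else x i, t) = h Q (x, t) := by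
      intro S
      induction S using Finset.induction_on with
      | empty => simp
      | insert i S hi ih =>
        rw [← ih]
        have e1 : (fun j => if j ∈ insert i S then Q' j else Q j) =
            Function.update (fun j => if j ∈ S then Q' j else Q j) i (Q' i) := by
          funext j
          by_cases hj : j = i
          · subst hj
            simp
          · simp [hj]
        have e2 : (fun j => if j ∈ insert i S then x' j else x j) =
            Function.update (fun j => if j ∈ S then x' j else x j) i (x' i) := by
          funext j
          by_cases hj : j = i
          · subst hj
            simp
          · simp [hj]
        rw [e1, e2]
        set Q₀ : ι → Fin N := fun j => if j ∈ S then Q' j else Q j with hQ₀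
        set x₀ : ι → I := fun j => if j ∈ S then x' j else x j with hx₀
        have eQ : Q₀ i = Q i := by simp [hQ₀, hi]
        have ex : x₀ i = x i := by simp [hx₀, hi]
        rcases gcell_eq_cases hQ i with ⟨h1, h2⟩ | ⟨h1, h2, h3⟩ | ⟨h1, h2, h3⟩
        · rw [← h1, ← h2, ← eQ, ← ex]
          simp
        · rw [h3]
          exact (hc' Q₀ i (Q' i) (by rw [eQ, h1]) x₀ t (by rw [ex, h2])).symm
        · rw [hc' _ i (Q i) (by simpa using h1) _ t (by simpa using h2)]
          simp only [Function.update_idem]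
          rw [← h3, ← eQ, ← ex]
          simp
    simpa using (key Finset.univ).symm
  choose q hq using fun y : ι → I => exists_mem_gregion (N := N) hN y
  have hreg : ∀ (Q : ι → Fin N) (y : ι → I) t, y ∈ gregion Q →
      h (q y) (gcoord (q y) y, t) = h Q (gcoord Q y, t) := fun Q y t hy =>
    wd _ _ _ _ t (by rw [gcell_gcoord (hq y), gcell_gcoord hy])
  refine ⟨⟨fun p => h (q p.1) (gcoord (q p.1) p.1, p.2), ?_⟩, fun Q x t => ?_⟩
  · have hU : (⋃ Q : ι → Fin N, {p : (ι → I) × T | p.1 ∈ gregion Q}) = univ :=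
      eq_univ_of_forall fun p => mem_iUnion.2 ⟨q p.1, hq p.1⟩
    rw [← continuousOn_univ, ← hU]
    refine (locallyFinite_of_finite _).continuousOn_iUnion
      (fun Q => (isClosed_gregion Q).preimage continuous_fst) fun Q => ?_
    have : Continuous fun p : (ι → I) × T => h Q (gcoord Q p.1, p.2) :=
      (h Q).continuous.comp (((continuous_gcoord Q).comp continuous_fst).prodMk continuous_snd)
    exact this.continuousOn.congr fun p hp => hreg Q p.1 p.2 hp
  · simp only [ContinuousMap.coe_mk]
    rw [hreg Q _ t (gcell_mem_gregion Q x), gcoord_gcell]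

lemma gcell_update_one (Q : ι → Fin N) (i : ι) (q : Fin N) (hq : (Q i : ℕ) + 1 = q) (x : ι → I) :
    gcell N Q (Function.update x i 1) =
      gcell N (Function.update Q i q) (Function.update x i 0) := by
  funext j
  refine Subtype.ext ?_
  rw [gcell_apply, gcell_apply]
  by_cases hj : j = i
  · subst hj
    simp [← hq]
  · simp [hj]

lemma face_sub_succ (f : C(ι → I, Z)) (Q : ι → Fin N) (i : ι) (q : Fin N)
    (hq : (Q i : ℕ) + 1 = q) :
    face i true (sub f Q) = face i false (sub f (Function.update Q i q)) := by
  ext x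
  simp [gcell_update_one Q i q hq]

lemma gcell_mem_boundary_cases {Q : ι → Fin N} {x : ι → I} (h : gcell N Q x ∈ Cube.boundary ι) :
    ∃ i, ((Q i : ℕ) = 0 ∧ x i = 0) ∨ ((Q i : ℕ) + 1 = N ∧ x i = 1) := by
  obtain ⟨i, hi⟩ := h
  have h1 : ((Q i : ℕ) : ℝ) + 1 ≤ N := by exact_mod_cast (Q i).2
  have h4 : (0 : ℝ) ≤ ((Q i : ℕ) : ℝ) := by positivity
  have h5 : (N : ℝ) ≠ 0 := by linarith
  have a0 := (x i).2.1
  have a1 := (x i).2.2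
  refine ⟨i, hi.imp (fun h => ?_) fun h => ?_⟩
  · have e := congrArg Subtype.val h
    rw [gcell_apply, Set.Icc.coe_zero, div_eq_zero_iff, or_iff_left h5] at e
    have e1 : ((Q i : ℕ) : ℝ) = 0 := by linarith
    exact ⟨by exact_mod_cast e1, Subtype.ext (by rw [Set.Icc.coe_zero]; linarith)⟩
  · have e := congrArg Subtype.val h
    rw [gcell_apply, Set.Icc.coe_one, div_eq_one_iff_eq h5] at e
    have e1 : ((Q i : ℕ) : ℝ) + 1 = N := by linarith
    exact ⟨by exact_mod_cast e1, Subtype.ext (by rw [Set.Icc.coe_one]; linarith)⟩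

lemma gcell_update_mem_boundary {Q : ι → Fin N} {i : ι} {b : Bool}
    (h : ((Q i : ℕ) = 0 ∧ b = false) ∨ ((Q i : ℕ) + 1 = N ∧ b = true)) (x : ι → I) :
    gcell N Q (Function.update x i (ev b)) ∈ Cube.boundary ι := by
  refine ⟨i, h.imp (fun h => ?_) fun h => ?_⟩
  · refine Subtype.ext ?_
    rw [gcell_apply]
    simp [h.1, h.2]
  · have h5 : (N : ℝ) ≠ 0 := by
      have := h.1
      have : 0 < N := by omega
      positivity
    refine Subtype.ext ?_
    have e : ((Q i : ℕ) : ℝ) + 1 = N := by exact_mod_cast h.1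
    rw [gcell_apply]
    simp [h.2, e, h5]

/-- A system of homotopies of small cubes which is compatible with faces yields a homotopy of
generalised loops. -/
theorem exists_grid_homotopy {e : Z} (hN : 0 < N) (P : Set C(ι → I, Z))
    (𝓗 : C(ι → I, Z) → C((ι → I) × I, Z))
    (h0 : ∀ c ∈ P, ∀ x, 𝓗 c (x, 0) = c x)
    (hf : ∀ c ∈ P, ∀ i b x t, 𝓗 c (Function.update x i (ev b), t) = 𝓗 (face i b c) (x, t))
    (he : ∀ p, 𝓗 (ContinuousMap.const _ e) p = e)
    (f : Ω^ ι Z e) (hfP : ∀ Q : ι → Fin N, sub f.1 Q ∈ P) :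
    ∃ f' : Ω^ ι Z e, GenLoop.Homotopic f f' ∧ ∀ (Q : ι → Fin N) x,
      sub f'.1 Q x = 𝓗 (sub f.1 Q) (x, 1) := by
  obtain ⟨H, hH⟩ := exists_grid_glue hN (fun Q => 𝓗 (sub f.1 Q)) fun Q i q hq x t => by
    have h1 := hf _ (hfP Q) i true x t
    have h2 := hf _ (hfP (Function.update Q i q)) i false x t
    rw [face_sub_succ f.1 Q i q hq] at h1
    exact h1.trans h2.symm
  have hb : ∀ y ∈ Cube.boundary ι, ∀ t, H (y, t) = e := by
    intro y hy t
    obtain ⟨Q, x, rfl⟩ := exists_gcell_eq hN y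
    rw [hH]
    have : ∃ i b, (((Q i : ℕ) = 0 ∧ b = false) ∨ ((Q i : ℕ) + 1 = N ∧ b = true)) ∧
        x i = ev b := by
      obtain ⟨i, hi | hi⟩ := gcell_mem_boundary_cases hy
      · exact ⟨i, false, Or.inl ⟨hi.1, rfl⟩, hi.2⟩
      · exact ⟨i, true, Or.inr ⟨hi.1, rfl⟩, hi.2⟩
    obtain ⟨i, b, hQ, hx⟩ := this
    have hx' : Function.update x i (ev b) = x := by rw [← hx]; simp
    have hface : face i b (sub f.1 Q) = ContinuousMap.const _ e := by
      ext x'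
      exact f.2 _ (gcell_update_mem_boundary hQ x')
    rw [← hx', hf _ (hfP Q) i b, hface, he]
  have hz : ∀ y, H (y, 0) = f.1 y := by
    intro y
    obtain ⟨Q, x, rfl⟩ := exists_gcell_eq hN y
    rw [hH, h0 _ (hfP Q)]
    rfl
  refine ⟨⟨⟨fun y => H (y, 1), by fun_prop⟩, fun y hy => hb y hy 1⟩, ⟨⟨⟨⟨fun p => H (p.2, p.1),
    by fun_prop⟩, fun y => hz y, fun y => rfl⟩, fun t y hy => ?_⟩⟩, fun Q x => hH Q x 1⟩
  · simp only [ContinuousMap.coe_mk]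
    rw [hb y hy, f.2 y hy]

end Grid

section FiniteTypes

variable {k : ℕ} {Z : Type} [TopologicalSpace Z]

/-- A set of cubes containing all faces of its members. -/
def FaceClosed {ι : Type} [DecidableEq ι] (P : Set C(ι → I, Z)) : Prop :=
  ∀ c ∈ P, ∀ i b, face i b c ∈ P

lemma exists_fine_grid {ι : Type} [Fintype ι] [DecidableEq ι] {J : Type*} (O : J → Set Z)
    (hO : ∀ j, IsOpen (O j)) (f : C(ι → I, Z)) (hf : ∀ x, ∃ j, f x ∈ O j) :
    ∃ m : ℕ, ∀ Q : ι → Fin (2 ^ m), ∃ j, ∀ x, sub f Q x ∈ O j := by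
  obtain ⟨δ, hδ, h⟩ := lebesgue_number_lemma_of_metric (s := (univ : Set (ι → I))) isCompact_univ
    (c := fun j => f ⁻¹' O j) (fun j => (hO j).preimage f.continuous)
    (fun x _ => mem_iUnion.2 (hf x))
  obtain ⟨m, hm⟩ := exists_pow_lt_of_lt_one hδ (by norm_num : (1 / 2 : ℝ) < 1)
  refine ⟨m, fun Q => ?_⟩
  obtain ⟨j, hj⟩ := h (gcell (2 ^ m) Q fun _ => 0) (mem_univ _)
  refine ⟨j, fun x => hj ?_⟩
  rw [Metric.mem_ball, dist_pi_lt_iff hδ]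
  intro i
  rw [Subtype.dist_eq, Real.dist_eq]
  simp only [ContinuousMap.coe_mk, gcell_apply]
  rw [← sub_div]
  have h0 := (x i).2.1
  have h1 := (x i).2.2
  have e : ((Q i : ℕ) + (x i : ℝ) - ((Q i : ℕ) + ((0 : I) : ℝ))) / ((2 ^ m : ℕ) : ℝ) =
      (x i : ℝ) * (1 / 2) ^ m := by
    simp
    ring
  rw [e, abs_of_nonneg (by positivity)]
  exact lt_of_le_of_lt (mul_le_of_le_one_left (by positivity) h1) hm

/-- The finiteness hypothesis on an open cover: all components of the intersections are finite in
number and have the extension property. -/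
structure GoodCover {J : Type} [Fintype J] (O : J → Set Z) (n : ℕ) : Prop where
  isOpen : ∀ j, IsOpen (O j)
  finite : ∀ S : Finset J, S.Nonempty →
    {C | ∃ p ∈ ⋂ j ∈ S, O j, C = connectedComponentIn (⋂ j ∈ S, O j) p}.Finite
  ext : ∀ S : Finset J, S.Nonempty → ∀ p ∈ ⋂ j ∈ S, O j,
    ExtProp (connectedComponentIn (⋂ j ∈ S, O j) p) n

variable {J : Type} [Fintype J] (O : J → Set Z)

open Classical in
/-- The members of the cover containing a cube. -/
noncomputable def hull (c : C(Fin k → I, Z)) : Finset J :=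
  Finset.univ.filter fun j => ∀ x, c x ∈ O j

/-- The intersection of the members of the cover containing a cube. -/
def hullSet (c : C(Fin k → I, Z)) : Set Z := ⋂ j ∈ hull O c, O j

/-- The component containing a cube of the intersection of the members of the cover containing
it. -/
def carrier (c : C(Fin k → I, Z)) : Set Z := connectedComponentIn (hullSet O c) (c 0)

lemma mem_hullSet (c : C(Fin k → I, Z)) (x) : c x ∈ hullSet O c := by
  simp only [hullSet, mem_iInter, hull, Finset.mem_filter, Finset.mem_univ, true_and]
  exact fun j hj => hj x

lemma mem_carrier (c : C(Fin k → I, Z)) (x) : c x ∈ carrier O c := by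
  have h : IsPreconnected (range c) := isPreconnected_range c.continuous
  exact h.subset_connectedComponentIn ⟨0, rfl⟩ (by rintro _ ⟨y, rfl⟩; exact mem_hullSet O c y)
    ⟨x, rfl⟩

lemma carrier_face_subset (c : C(Fin k → I, Z)) (i b) :
    carrier O (face i b c) ⊆ carrier O c := by
  have h : hullSet O (face i b c) ⊆ hullSet O c := by
    refine biInter_subset_biInter_left fun j hj => ?_
    simp only [hull, Finset.mem_coe, Finset.mem_filter, Finset.mem_univ, true_and] at hj ⊢
    exact fun x => hj _
  refine (connectedComponentIn_mono _ h).trans ?_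
  rw [carrier, connectedComponentIn_eq (mem_carrier O c (Function.update 0 i (ev b)))]
  rfl

/-- The cubes contained in some member of the cover. -/
def smallCubes (k : ℕ) : Set C(Fin k → I, Z) := {c | ∃ j, ∀ x, c x ∈ O j}

lemma faceClosed_smallCubes : FaceClosed (smallCubes O k) := by
  rintro c ⟨j, hj⟩ i b
  exact ⟨j, fun x => hj _⟩

lemma hull_nonempty {c : C(Fin k → I, Z)} (hc : c ∈ smallCubes O k) : (hull O c).Nonempty := by
  obtain ⟨j, hj⟩ := hc
  exact ⟨j, by simpa [hull] using hj⟩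

variable {O}

lemma GoodCover.extProp_carrier {n : ℕ} (hO : GoodCover O n) {c : C(Fin k → I, Z)}
    (hc : c ∈ smallCubes O k) : ExtProp (carrier O c) n :=
  hO.ext _ (hull_nonempty O hc) _ (mem_hullSet O c 0)

lemma GoodCover.finite_carrier {n : ℕ} (hO : GoodCover O n) :
    (carrier O '' smallCubes O k).Finite := by
  have h : (⋃ S ∈ {S : Finset J | S.Nonempty},
      {C | ∃ p ∈ ⋂ j ∈ S, O j, C = connectedComponentIn (⋂ j ∈ S, O j) p}).Finite :=
    (toFinite _).biUnion fun S hS => hO.finite S hS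
  refine h.subset ?_
  rintro _ ⟨c, hc, rfl⟩
  simp only [mem_iUnion]
  exact ⟨hull O c, hull_nonempty O hc, c 0, mem_hullSet O c 0, rfl⟩

/-- Extension of a compatible system of faces inside a set with the extension property. -/
lemma ExtProp.exists_of_faces {V : Set Z} {n : ℕ} (hV : ExtProp V n) (D : Finset (Fin k))
    (hD : D.card ≤ n) (H : Fin k → Bool → (Fin k → I) → Z)
    (hH : ∀ i ∈ D, ∀ b, ContinuousOn (H i b) {p | p i = ev b})
    (hHV : ∀ i ∈ D, ∀ b p, p i = ev b → H i b p ∈ V)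
    (hc : ∀ i ∈ D, ∀ b, ∀ j ∈ D, ∀ b', ∀ p : Fin k → I, p i = ev b → p j = ev b' →
      H i b p = H j b' p) :
    ∃ G : C(Fin k → I, Z), (∀ x, G x ∈ V) ∧ ∀ i ∈ D, ∀ b p, p i = ev b → G p = H i b p := by
  have : Nonempty Z := ⟨hV.1.some⟩
  obtain ⟨g, hg, hgH⟩ := exists_face_glue (T := Unit) D (fun i b p => H i b p.1)
    (fun i hi b => (hH i hi b).comp continuousOn_fst fun p hp => hp)
    (fun i hi b j hj b' p => hc i hi b j hj b' p.1)
  obtain ⟨G, hG, hGg⟩ := hV.2 k D hD (fun x => g (x, ()))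
    (hg.comp (by fun_prop) fun p hp => hp) (by
      rintro x ⟨i, hi, b, hb⟩
      simp only
      rw [hgH i hi b (x, ()) hb]
      exact hHV i hi b x hb)
  refine ⟨G, hG, fun i hi b p hp => ?_⟩
  rw [hGg ⟨i, hi, b, hp⟩]
  exact hgH i hi b (p, ()) hp

theorem GoodCover.exists_tops {n : ℕ} (hO : GoodCover O n) (hn : k ≤ n) (e : Z) :
    ∃ top : C(Fin k → I, Z) → C(Fin k → I, Z), (top '' smallCubes O k).Finite ∧
      ∀ c ∈ smallCubes O k, (∀ x, top c x ∈ carrier O c) ∧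
        (c = ContinuousMap.const _ e → top c = ContinuousMap.const _ e) ∧
        DepOn (cdim c) (top c) ∧
        ∀ i b, face i b (top c) = top (face i b c) := by
  classical
  have : Nonempty Z := ⟨e⟩
  obtain ⟨𝓗, h1, h2, h3, h4⟩ := exists_face_system (T := Unit) (W := Z)
    (fun c : C(Fin k → I, Z) => (carrier O c, c = ContinuousMap.const _ e)) (smallCubes O k)
    (faceClosed_smallCubes O)
    (fun c o => (∀ p, o p ∈ carrier O c) ∧
      (c = ContinuousMap.const _ e → o = ContinuousMap.const _ e)) (by
    rintro ⟨V, q⟩ D H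
    by_cases hq : q
    · refine ⟨ContinuousMap.const _ e, fun c hc hκ hD _ _ _ => ?_⟩
      rw [Prod.mk.injEq] at hκ
      have hce : c = ContinuousMap.const _ e := hκ.2 ▸ hq
      have hD0 : D = ∅ := by
        rw [← hD]
        refine Finset.subset_empty.1 (cdim_subset fun x y _ => ?_)
        rw [hce]
        rfl
      refine ⟨⟨fun p => ?_, fun _ => rfl⟩, fun _ _ _ _ => rfl, ?_⟩
      · have := mem_carrier O c 0
        rw [hce] at this ⊢
        exact this
      · rw [hD0]
        simp
    by_cases hex : ∃ c ∈ smallCubes O k, carrier O c = V ∧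
        (∀ i ∈ D, ∀ b p, H i b p ∈ carrier O (face i b c)) ∧
        (∀ i ∈ D, ∀ b, ∀ j ∈ D, ∀ b', ∀ p : (Fin k → I) × Unit, p.1 i = ev b → p.1 j = ev b' →
          H i b p = H j b' p)
    swap
    · refine ⟨ContinuousMap.const _ e, fun c hc hκ hD hR hcomp _ => (hex ⟨c, hc, ?_, ?_, hcomp⟩).elim⟩
      · exact (Prod.mk.inj hκ).1
      · exact fun i hi b => (hR i hi b).1
    obtain ⟨c₀, hc₀, hV, hHV, hcomp⟩ := hex
    obtain ⟨G, hGV, hGH⟩ := (hO.extProp_carrier hc₀).exists_of_faces D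
      ((Finset.card_le_univ D).trans (by simpa using hn)) (fun i b p => H i b (p, ()))
      (fun i hi b => by fun_prop)
      (fun i hi b p hp => carrier_face_subset O _ _ _ (hHV i hi b _))
      (fun i hi b j hj b' p h h' => hcomp i hi b j hj b' (p, ()) h h')
    refine ⟨G.comp ⟨fun p => RackPi3.keep D p.1, (continuous_keep D).comp continuous_fst⟩,
      fun c hc hκ hD hR _ hdep => ⟨⟨fun p => ?_, fun hce => ?_⟩, fun x y t hxy => ?_,
        fun i hi b p hp => ?_⟩⟩
    · rw [(Prod.mk.inj hκ).1, ← hV]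
      exact hGV _
    · exact (hq ((Prod.mk.inj hκ).2 ▸ hce)).elim
    · simp only [ContinuousMap.comp_apply, ContinuousMap.coe_mk]
      rw [keep_eq_of hxy]
    · simp only [ContinuousMap.comp_apply, ContinuousMap.coe_mk]
      rw [hGH i hi b _ (by rw [keep_apply_of_mem hi, hp])]
      exact hdep i hi b _ _ _ fun j hj => keep_apply_of_mem (Finset.mem_of_mem_erase hj) _)
  refine ⟨fun c => (𝓗 c).comp ⟨fun x => (x, ()), by fun_prop⟩, ?_, fun c hc =>
    ⟨fun x => (h1 c hc).1 _, fun hce => ?_, fun x y hxy => h2 c hc x y _ hxy, fun i b => ?_⟩⟩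
  · have hfin := h4 ((hO.finite_carrier.prod (toFinite (univ : Set Prop))).subset (by
      rintro _ ⟨c, hc, rfl⟩
      exact ⟨⟨c, hc, rfl⟩, mem_univ _⟩))
    refine (hfin.image fun o => o.comp ⟨fun x => (x, ()), by fun_prop⟩).subset ?_
    rintro _ ⟨c, hc, rfl⟩
    exact ⟨_, ⟨c, hc, rfl⟩, rfl⟩
  · simp only [(h1 c hc).2 hce]
    rfl
  · ext x
    exact h3 c hc i b x ()

theorem GoodCover.exists_homotopies {n : ℕ} (hO : GoodCover O n) (hn : k + 1 ≤ n) (e : Z)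
    (top : C(Fin k → I, Z) → C(Fin k → I, Z))
    (htop : ∀ c ∈ smallCubes O k, (∀ x, top c x ∈ carrier O c) ∧
        (c = ContinuousMap.const _ e → top c = ContinuousMap.const _ e) ∧
        DepOn (cdim c) (top c) ∧
        ∀ i b, face i b (top c) = top (face i b c)) :
    ∃ 𝓗 : C(Fin k → I, Z) → C((Fin k → I) × I, Z), ∀ c ∈ smallCubes O k,
      (∀ x, 𝓗 c (x, 0) = c x) ∧ (∀ x, 𝓗 c (x, 1) = top c x) ∧
      (c = ContinuousMap.const _ e → ∀ p, 𝓗 c p = e) ∧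
      ∀ i b x t, 𝓗 c (Function.update x i (ev b), t) = 𝓗 (face i b c) (x, t) := by
  classical
  have : Nonempty Z := ⟨e⟩
  obtain ⟨𝓗, h1, h2, h3, h4⟩ := exists_face_system (T := I) (W := Z)
    (fun c : C(Fin k → I, Z) => c) (smallCubes O k)
    (faceClosed_smallCubes O)
    (fun c o => (∀ p, o p ∈ carrier O c) ∧ (∀ x, o (x, 0) = c x) ∧ (∀ x, o (x, 1) = top c x) ∧
      (c = ContinuousMap.const _ e → ∀ p, o p = e)) (by
    intro c D H
    by_cases hq : c = ContinuousMap.const _ e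
    · refine ⟨ContinuousMap.const _ e, ?_⟩
      rintro c' hc' hcc hD _ _ _
      subst hcc
      have hD0 : D = ∅ := by
        rw [← hD]
        refine Finset.subset_empty.1 (cdim_subset fun x y _ => ?_)
        rw [hq]
        rfl
      refine ⟨⟨fun p => ?_, fun x => ?_, fun x => ?_, fun _ _ => rfl⟩, fun _ _ _ _ => rfl, ?_⟩
      · have := mem_carrier O c' 0
        rw [hq] at this ⊢
        exact this
      · rw [hq]; rfl
      · rw [(htop c' hc').2.1 hq]; rfl
      · rw [hD0]
        simp
    by_cases hex : c ∈ smallCubes O k ∧ cdim c = D ∧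
        (∀ i ∈ D, ∀ b, (∀ p, H i b p ∈ carrier O (face i b c)) ∧
          (∀ x, H i b (x, 0) = face i b c x) ∧ (∀ x, H i b (x, 1) = top (face i b c) x)) ∧
        (∀ i ∈ D, ∀ b, ∀ j ∈ D, ∀ b', ∀ p : (Fin k → I) × I, p.1 i = ev b → p.1 j = ev b' →
          H i b p = H j b' p)
    swap
    · refine ⟨ContinuousMap.const _ e, ?_⟩
      rintro c' hc hcc hD hR hcomp _
      subst hcc
      exact (hex ⟨hc, hD, fun i hi b => ⟨(hR i hi b).1, (hR i hi b).2.1, (hR i hi b).2.2.1⟩,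
        hcomp⟩).elim
    obtain ⟨hc, hD, hHV, hcomp⟩ := hex
    let D' : Finset (Fin (k + 1)) := insert 0 (D.image Fin.succ)
    have hmem : ∀ i : Fin k, i.succ ∈ D' → i ∈ D := by
      intro i hi
      simp only [D', Finset.mem_insert, Finset.mem_image, Fin.succ_inj, exists_eq_right] at hi
      exact hi.resolve_left (Fin.succ_ne_zero i)
    let H' : Fin (k + 1) → Bool → (Fin (k + 1) → I) → Z := fun i b p =>
      Fin.cases (motive := fun _ => Z) (if b then top c (Fin.tail p) else c (Fin.tail p))
        (fun i => H i b (Fin.tail p, p 0)) i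
    have htail : Continuous fun p : Fin (k + 1) → I => (Fin.tail p : Fin k → I) :=
      continuous_pi fun i => continuous_apply _
    have hmix : ∀ i ∈ D, ∀ b b', ∀ p : Fin (k + 1) → I, p i.succ = ev b → p 0 = ev b' →
        H' i.succ b p = H' 0 b' p := by
      intro i hi b b' p h h'
      have hup : Function.update (Fin.tail p) i (ev b) = Fin.tail p := by
        rw [← h]
        exact Function.update_eq_self _ _
      simp only [H', Fin.cases_succ, Fin.cases_zero, h']
      cases b'
      · have := (hHV i hi b).2.1 (Fin.tail p)
        rw [face_apply, hup] at this
        simpa using this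
      · have := (hHV i hi b).2.2 (Fin.tail p)
        rw [← (htop c hc).2.2.2, face_apply, hup] at this
        simpa using this
    obtain ⟨G, hGV, hGH⟩ := (hO.extProp_carrier hc).exists_of_faces D'
      ((Finset.card_le_univ D').trans (by simpa using hn)) H'
      (fun i hi b => by
        refine Continuous.continuousOn ?_
        induction i using Fin.cases with
        | zero =>
          cases b
          · exact c.continuous.comp htail
          · exact (top c).continuous.comp htail
        | succ i =>
          simp only [H', Fin.cases_succ]
          fun_prop)
      (fun i hi b p hp => by
        induction i using Fin.cases with
        | zero =>
          cases b
          · exact mem_carrier O c _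
          · exact (htop c hc).1 _
        | succ i => exact carrier_face_subset O _ _ _ ((hHV i (hmem i hi) b).1 _))
      (fun i hi b j hj b' p h h' => by
        induction i using Fin.cases with
        | zero =>
          induction j using Fin.cases with
          | zero => rw [ev_injective (h.symm.trans h')]
          | succ j => exact (hmix j (hmem j hj) b' b p h' h).symm
        | succ i =>
          induction j using Fin.cases with
          | zero => exact hmix i (hmem i hi) b b' p h h'
          | succ j => exact hcomp i (hmem i hi) b j (hmem j hj) b' (Fin.tail p, p 0) h h')
    have hcons : Continuous fun p : (Fin k → I) × I =>
        (Fin.cons p.2 (RackPi3.keep D p.1) : Fin (k + 1) → I) := by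
      have := continuous_keep D
      refine continuous_pi fun i => ?_
      induction i using Fin.cases with
      | zero => exact continuous_snd
      | succ i => exact (continuous_apply i).comp (this.comp continuous_fst)
    have hD0 : (0 : Fin (k + 1)) ∈ D' := Finset.mem_insert_self _ _
    refine ⟨G.comp ⟨_, hcons⟩, ?_⟩
    rintro c' - hcc - hR - hdep
    subst hcc
    refine ⟨⟨fun p => hGV _, fun x => ?_, fun x => ?_, fun hce => (hq hce).elim⟩,
      fun x y t hxy => ?_, fun i hi b p hp => ?_⟩
    · simp only [ContinuousMap.comp_apply, ContinuousMap.coe_mk]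
      rw [hGH 0 hD0 false _ rfl]
      have := DepOn.keep (depOn_cdim c') x
      rw [hD] at this
      exact this
    · simp only [ContinuousMap.comp_apply, ContinuousMap.coe_mk]
      rw [hGH 0 hD0 true _ rfl]
      have := DepOn.keep (htop c' hc).2.2.1 x
      rw [hD] at this
      exact this
    · simp only [ContinuousMap.comp_apply, ContinuousMap.coe_mk]
      rw [keep_eq_of hxy]
    · simp only [ContinuousMap.comp_apply, ContinuousMap.coe_mk]
      rw [hGH i.succ (Finset.mem_insert_of_mem (Finset.mem_image_of_mem _ hi)) b _
        (by simp only [Fin.cons_succ]; rw [keep_apply_of_mem hi, hp])]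
      exact hdep i hi b _ _ _ fun j hj => keep_apply_of_mem (Finset.mem_of_mem_erase hj) _)
  exact ⟨𝓗, fun c hc => ⟨(h1 c hc).2.1, (h1 c hc).2.2.1, (h1 c hc).2.2.2, h3 c hc⟩⟩

/-- For a space with a good cover there is a finite set of cubes from which all generalised loops
can be assembled up to homotopy. -/
theorem GoodCover.exists_finite_types {n : ℕ} (hO : GoodCover O n) (hk : 0 < k) (hn : k + 1 ≤ n) (e : Z) :
    ∃ 𝒯 : Set C(Fin k → I, Z), 𝒯.Finite ∧ FaceClosed 𝒯 ∧
      ∀ f : Ω^ (Fin k) Z e, (∀ x, ∃ j, f x ∈ O j) →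
        ∃ (m : ℕ) (f' : Ω^ (Fin k) Z e), GenLoop.Homotopic f f' ∧
          ∀ Q : Fin k → Fin (2 ^ m), sub f'.1 Q ∈ 𝒯 := by
  obtain ⟨top, hfin, htop⟩ := hO.exists_tops (k := k) (by omega) e
  obtain ⟨𝓗, h𝓗⟩ := hO.exists_homotopies hn e top htop
  refine ⟨top '' smallCubes O k, hfin, ?_, fun f hf => ?_⟩
  · rintro _ ⟨c, hc, rfl⟩ i b
    exact ⟨face i b c, faceClosed_smallCubes O c hc i b, ((htop c hc).2.2.2 i b).symm⟩
  · obtain ⟨m, hm⟩ := exists_fine_grid O hO.isOpen f.1 hf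
    have hsub : ∀ Q : Fin k → Fin (2 ^ m), sub f.1 Q ∈ smallCubes O k := hm
    have he : ∀ p, 𝓗 (ContinuousMap.const _ e) p = e := by
      have h1 : ContinuousMap.const _ e ∈ smallCubes O k := by
        obtain ⟨j, hj⟩ := hf 0
        rw [GenLoop.boundary f 0 ⟨⟨0, hk⟩, Or.inl rfl⟩] at hj
        exact ⟨j, fun _ => hj⟩
      exact (h𝓗 _ h1).2.2.1 rfl
    obtain ⟨f', hf', hs⟩ := exists_grid_homotopy (by positivity) (smallCubes O k) 𝓗
      (fun c hc => (h𝓗 c hc).1) (fun c hc => (h𝓗 c hc).2.2.2) he f hsub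
    refine ⟨m, f', hf', fun Q => ⟨sub f.1 Q, hsub Q, ?_⟩⟩
    ext x
    rw [hs, (h𝓗 _ (hsub Q)).2.1]

end FiniteTypes

section Skeleta

variable {ι : Type} [Fintype ι] [DecidableEq ι] {Z : Type} [TopologicalSpace Z]

/-- A cube which is null-homotopic relative to its boundary. -/
def NullCube (e : Z) (c : C(ι → I, Z)) : Prop :=
  ∃ h : C((ι → I) × I, Z), (∀ x, h (x, 0) = c x) ∧ (∀ x, h (x, 1) = e) ∧
    ∀ x ∈ bd (cdim c), ∀ t, h (x, t) = e

lemma const_mem_of_sub {e : Z} {N : ℕ} (hN : 0 < N) [Nonempty ι] {P : Set C(ι → I, Z)}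
    (hP : FaceClosed P) (f : Ω^ ι Z e) (hf : ∀ Q : ι → Fin N, sub f.1 Q ∈ P) :
    ContinuousMap.const _ e ∈ P := by
  have i : ι := Classical.arbitrary ι
  have h := hP _ (hf fun _ => ⟨0, hN⟩) i false
  convert h
  ext x
  exact (f.2 _ (gcell_update_mem_boundary (Or.inl ⟨rfl, rfl⟩) x)).symm

/-- If the `d`-dimensional cubes in a finite set of types are null-homotopic then all loops
assembled from these types can be deformed, within finitely many types, so that they become constant
on the `d`-skeleton. -/
theorem exists_skeletal [Nonempty ι] (e : Z) (d : ℕ) (𝒯 : Set C(ι → I, Z)) (hfin : 𝒯.Finite)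
    (hface : FaceClosed 𝒯)
    (hlow : ∀ c ∈ 𝒯, (cdim c).card < d → c = ContinuousMap.const _ e)
    (hnull : ∀ c ∈ 𝒯, (cdim c).card = d → NullCube e c) :
    ∃ 𝒯' : Set C(ι → I, Z), 𝒯'.Finite ∧ FaceClosed 𝒯' ∧
      (∀ c ∈ 𝒯', (cdim c).card ≤ d → c = ContinuousMap.const _ e) ∧
      ∀ (N : ℕ), 0 < N → ∀ f : Ω^ ι Z e, (∀ Q : ι → Fin N, sub f.1 Q ∈ 𝒯) →
        ∃ f' : Ω^ ι Z e, GenLoop.Homotopic f f' ∧ ∀ Q : ι → Fin N, sub f'.1 Q ∈ 𝒯' := by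
  classical
  have : Nonempty Z := ⟨e⟩
  have hconst : cdim (ContinuousMap.const (ι → I) e) = ∅ :=
    Finset.subset_empty.1 (cdim_subset fun x y _ => rfl)
  obtain ⟨𝓗, h1, h2, h3, h4⟩ := exists_face_system (T := I) (W := Z)
    (fun c : C(ι → I, Z) => c) 𝒯 hface
    (fun c o => (∀ x, o (x, 0) = c x) ∧ (c = ContinuousMap.const _ e → ∀ p, o p = e) ∧
      ((cdim c).card ≤ d → ∀ x, o (x, 1) = e)) (by
    intro c D H
    by_cases hq : c = ContinuousMap.const _ e
    · refine ⟨ContinuousMap.const _ e, ?_⟩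
      rintro c' hc' hcc hD _ _ _
      subst hcc
      refine ⟨⟨fun x => ?_, fun _ _ => rfl, fun _ _ => rfl⟩, fun _ _ _ _ => rfl, ?_⟩
      · rw [hq]; rfl
      · rw [← hD, hq, hconst]
        simp
    by_cases hex : c ∈ 𝒯 ∧ cdim c = D ∧
        (∀ i ∈ D, ∀ b, (∀ x, H i b (x, 0) = face i b c x) ∧
          (face i b c = ContinuousMap.const _ e → ∀ p, H i b p = e)) ∧
        (∀ i ∈ D, ∀ b, ∀ j ∈ D, ∀ b', ∀ p : (ι → I) × I, p.1 i = ev b → p.1 j = ev b' →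
          H i b p = H j b' p) ∧
        (∀ i ∈ D, ∀ b, ∀ x y : ι → I, ∀ t, (∀ j ∈ D.erase i, x j = y j) →
          H i b (x, t) = H i b (y, t))
    swap
    · refine ⟨ContinuousMap.const _ e, ?_⟩
      rintro c' hc hcc hD hR hcomp hdep
      subst hcc
      exact (hex ⟨hc, hD, fun i hi b => ⟨(hR i hi b).1, (hR i hi b).2.1⟩, hcomp, hdep⟩).elim
    obtain ⟨hc, hD, hH, hcomp, hdep⟩ := hex
    have hDc := DepOn.keep (depOn_cdim c)
    rw [hD] at hDc
    suffices h : ∃ G : C((ι → I) × I, Z), (∀ x, G (x, 0) = c x) ∧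
        ((cdim c).card ≤ d → ∀ x, G (x, 1) = e) ∧
        ∀ i ∈ D, ∀ b, ∀ p : (ι → I) × I, p.1 i = ev b → G p = H i b p by
      obtain ⟨G, hG0, hG1, hGH⟩ := h
      refine ⟨G.comp ⟨fun p => (RackPi3.keep D p.1, p.2),
        ((continuous_keep D).comp continuous_fst).prodMk continuous_snd⟩, ?_⟩
      rintro c' - hcc - - - -
      subst hcc
      refine ⟨⟨fun x => ?_, fun h => (hq h).elim, fun hd x => hG1 hd _⟩,
        fun x y t hxy => ?_, fun i hi b p hp => ?_⟩
      · simp only [ContinuousMap.comp_apply, ContinuousMap.coe_mk]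
        rw [hG0, hDc]
      · simp only [ContinuousMap.comp_apply, ContinuousMap.coe_mk]
        rw [keep_eq_of hxy]
      · simp only [ContinuousMap.comp_apply, ContinuousMap.coe_mk]
        rw [hGH i hi b _ ((keep_apply_of_mem hi _).trans hp)]
        exact hdep i hi b _ _ _ fun j hj => keep_apply_of_mem (Finset.mem_of_mem_erase hj) _
    rcases lt_trichotomy (cdim c).card d with hlt | heq | hgt
    · exact (hq (hlow c hc hlt)).elim
    · obtain ⟨h, hh0, hh1, hhb⟩ := hnull c hc heq
      refine ⟨h, hh0, fun _ => hh1, fun i hi b p hp => ?_⟩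
      have hi' : i ∈ cdim c := hD ▸ hi
      rw [(hH i hi b).2 (hlow _ (hface c hc i b) (heq ▸ card_cdim_face_lt hi' b))]
      exact hhb p.1 ⟨i, hi', b, hp⟩ p.2
    · obtain ⟨G, hG0, hGH, -⟩ := exists_extension_of_faces D c (fun i b p => H i b p)
        (fun i hi b => by fun_prop) hcomp (fun i hi b x hx => by
          rw [(hH i hi b).1, face_apply, ← hx, Function.update_eq_self])
      exact ⟨G, hG0, fun h => (by omega), hGH⟩)
  let τ : C((ι → I) × I, Z) → C(ι → I, Z) := fun o => o.comp ⟨fun x => (x, 1), by fun_prop⟩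
  have hτ : ∀ c ∈ 𝒯, ∀ i b, face i b (τ (𝓗 c)) = τ (𝓗 (face i b c)) := by
    intro c hc i b
    ext x
    exact h3 c hc i b x 1
  refine ⟨τ '' (𝓗 '' 𝒯), (h4 (by simpa using hfin)).image τ, ?_, ?_, fun N hN f hf => ?_⟩
  · rintro _ ⟨_, ⟨c, hc, rfl⟩, rfl⟩ i b
    exact ⟨_, ⟨_, hface c hc i b, rfl⟩, (hτ c hc i b).symm⟩
  · have key : ∀ n, ∀ c ∈ 𝒯, (cdim c).card = n → (cdim (τ (𝓗 c))).card ≤ d →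
        τ (𝓗 c) = ContinuousMap.const _ e := by
      intro n
      induction n using Nat.strong_induction_on with
      | _ n ih =>
        intro c hc hn hd
        have hsub : cdim (τ (𝓗 c)) ⊆ cdim c := cdim_subset fun x y hxy => h2 c hc x y 1 hxy
        by_cases heq : cdim (τ (𝓗 c)) = cdim c
        · ext x
          exact (h1 c hc).2.2 (heq ▸ hd) x
        · obtain ⟨i, hi, hi'⟩ := Finset.exists_of_ssubset (hsub.ssubset_of_ne heq)
          have e1 := face_of_notMem_cdim hi' true
          rw [hτ c hc] at e1
          rw [← e1]
          refine ih _ (hn ▸ card_cdim_face_lt hi true) _ (hface c hc i true) rfl ?_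
          rw [e1]
          exact hd
    rintro _ ⟨_, ⟨c, hc, rfl⟩, rfl⟩ hd
    exact key _ c hc rfl hd
  · have he := const_mem_of_sub hN hface f hf
    obtain ⟨f', hf', hs⟩ := exists_grid_homotopy hN 𝒯 𝓗 (fun c hc => (h1 c hc).1) h3
      ((h1 _ he).2.1 rfl) f hf
    refine ⟨f', hf', fun Q => ⟨_, ⟨_, hf Q, rfl⟩, ?_⟩⟩
    ext x
    exact (hs Q x).symm

end Skeleta

section Assemble

variable {ι : Type} [Fintype ι] [DecidableEq ι] {Z : Type} [TopologicalSpace Z] {e : Z}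

/-- The class of a generalized loop. -/
def cls (f : Ω^ ι Z e) : HomotopyGroup ι Z e := Quotient.mk _ f

lemma cls_eq_iff {f g : Ω^ ι Z e} : cls f = cls g ↔ GenLoop.Homotopic f g := Quotient.eq

lemma cls_mul [Nonempty ι] (i : ι) (p q : Ω^ ι Z e) :
    cls p * cls q = cls (GenLoop.transAt i q p) := HomotopyGroup.mul_spec

lemma cls_const [Nonempty ι] : cls (GenLoop.const : Ω^ ι Z e) = 1 := HomotopyGroup.one_def.symm

lemma transAt_apply (i : ι) (f g : Ω^ ι Z e) (t : ι → I) : GenLoop.transAt i f g t =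
    if (t i : ℝ) ≤ 1 / 2
      then f (Function.update t i <| Set.projIcc 0 1 zero_le_one (2 * t i))
      else g (Function.update t i <| Set.projIcc 0 1 zero_le_one (2 * t i - 1)) := rfl

/-- The affine map `t ↦ (a + t) / 2` of the interval. -/
noncomputable def halve (b : Bool) (t : I) : I :=
  ⟨((if b then 1 else 0) + t) / 2, by
    have := t.2.1; have := t.2.2
    split_ifs <;> constructor <;> linarith⟩

lemma continuous_halve (b : Bool) : Continuous (halve b) := by
  unfold halve; fun_prop

/-- The half of a generalized loop which is constant on the middle hyperplane. -/
noncomputable def halfLoop (f : Ω^ ι Z e) (i : ι) (h : ∀ y : ι → I, (y i : ℝ) = 1 / 2 → f y = e)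
    (b : Bool) : Ω^ ι Z e :=
  ⟨⟨fun x => f (Function.update x i (halve b (x i))), by
    have := continuous_halve b
    have := f.1.continuous
    refine this.comp ?_
    fun_prop⟩, by
    rintro y ⟨j, hj⟩
    show f (Function.update y i (halve b (y i))) = e
    by_cases hji : j = i
    · subst hji
      rcases hj with hj | hj <;> rcases b with _ | _
      · exact f.2 _ ⟨j, Or.inl (by simp [halve, hj])⟩
      · exact h _ (by simp [halve, hj])
      · exact h _ (by simp [halve, hj])
      · exact f.2 _ ⟨j, Or.inr (by simp [halve, hj])⟩
    · exact f.2 _ ⟨j, by simpa [hji] using hj⟩⟩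

lemma cls_halfLoop [Nonempty ι] (f : Ω^ ι Z e) (i : ι)
    (h : ∀ y : ι → I, (y i : ℝ) = 1 / 2 → f y = e) :
    cls f = cls (halfLoop f i h true) * cls (halfLoop f i h false) := by
  rw [cls_mul i]
  congr 1
  ext t
  rw [transAt_apply]
  have h0 := (t i).2.1
  have h1 := (t i).2.2
  split_ifs with ht
  · show f t = f _
    congr 1
    ext j
    by_cases hj : j = i
    · subst hj
      simp [halve, projIcc, h0]
      rw [min_eq_right (by linarith)]
      ring
    · simp [hj]
  · show f t = f _
    congr 1
    ext j
    by_cases hj : j = i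
    · subst hj
      simp [halve, projIcc]
      rw [min_eq_right (by linarith), max_eq_right (by linarith)]
      ring
    · simp [hj]

lemma exists_dyadic_coord (m : ℕ) (t : I) :
    ∃ (q : ℕ) (x : I), q < 2 ^ m ∧ (t : ℝ) = (q + x) / 2 ^ m := by
  obtain ⟨Q, x, hx⟩ := exists_gcell_eq (ι := Unit) (N := 2 ^ m) (by positivity) fun _ => t
  refine ⟨Q (), x (), (Q ()).2, ?_⟩
  have := congrArg (fun y : Unit → I => (y () : ℝ)) hx
  simp only [gcell_apply] at this
  rw [← this]
  push_cast
  ring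

lemma cls_mem_closure_aux [Nonempty ι] (S : Set (Ω^ ι Z e)) (n : ℕ) : ∀ (m : ι → ℕ) (f : Ω^ ι Z e),
    ∑ i, m i = n →
    (∀ Q : ι → ℕ, (∀ i, Q i < 2 ^ m i) → ∃ c ∈ S, ∀ x y : ι → I,
      (∀ i, (y i : ℝ) = (Q i + x i) / 2 ^ m i) → f y = c x) →
    cls f ∈ Subgroup.closure (cls '' S) := by
  induction n with
  | zero =>
    intro m f hm hf
    have hm : ∀ i, m i = 0 := by simpa using hm
    obtain ⟨c, hc, hfc⟩ := hf (fun _ => 0) (by simp [hm])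
    refine Subgroup.subset_closure ⟨c, hc, ?_⟩
    congr 1
    ext x
    exact (hfc x x (by simp [hm])).symm
  | succ n ih =>
    intro m f hm hf
    obtain ⟨i, hi⟩ : ∃ i, m i ≠ 0 := by
      by_contra! h
      simp [h] at hm
    obtain ⟨l, hl⟩ := Nat.exists_eq_succ_of_ne_zero hi
    have hmid : ∀ y : ι → I, (y i : ℝ) = 1 / 2 → f y = e := by
      intro y hy
      choose q x hq hx using fun j => exists_dyadic_coord (m j) (y j)
      obtain ⟨c, hc, hfc⟩ := hf (Function.update q i (2 ^ l)) (fun j => by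
        by_cases hj : j = i
        · subst hj; simp [hl, pow_succ]
        · simp [hj, hq])
      rw [hfc (Function.update x i 0) y]
      · exact c.2 _ ⟨i, Or.inl (by simp)⟩
      · intro j
        by_cases hj : j = i
        · subst hj
          simp [hy, hl, pow_succ]
          field_simp
        · simp [hj, hx]
    rw [cls_halfLoop f i hmid]
    have hsum : ∑ j, (Function.update m i l) j = n := by
      have := Finset.sum_update_of_mem (Finset.mem_univ i) m l
      have h2 := Finset.sum_erase_add Finset.univ m (Finset.mem_univ i)
      rw [Finset.sdiff_singleton_eq_erase] at this
      omega
    have key : ∀ b, cls (halfLoop f i hmid b) ∈ Subgroup.closure (cls '' S) := by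
      intro b
      refine ih (Function.update m i l) _ hsum ?_
      intro Q hQ
      have hQi : Q i < 2 ^ l := by simpa using hQ i
      obtain ⟨c, hc, hfc⟩ := hf (Function.update Q i (Q i + if b then 2 ^ l else 0)) (fun j => by
        by_cases hj : j = i
        · subst hj
          simp only [Function.update_self, hl, pow_succ]
          split_ifs <;> omega
        · simpa [hj] using hQ j)
      refine ⟨c, hc, fun x y hxy => ?_⟩
      refine hfc x _ fun j => ?_
      by_cases hj : j = i
      · subst hj
        have := hxy j
        simp only [Function.update_self] at this ⊢
        simp only [halve, this, hl, pow_succ]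
        split_ifs <;> push_cast <;> field_simp <;> ring
      · have := hxy j
        simpa [hj] using this
    exact mul_mem (key true) (key false)

/-- A loop whose dyadic subcubes are loops from `S` lies in the subgroup generated by `S`. -/
theorem cls_mem_closure [Nonempty ι] (S : Set (Ω^ ι Z e)) (m : ℕ) (f : Ω^ ι Z e)
    (hf : ∀ Q : ι → Fin (2 ^ m), ∃ c ∈ S, sub f.1 Q = c.1) :
    cls f ∈ Subgroup.closure (cls '' S) := by
  refine cls_mem_closure_aux S _ (fun _ => m) f rfl ?_
  intro Q hQ
  obtain ⟨c, hc, h⟩ := hf fun i => ⟨Q i, hQ i⟩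
  refine ⟨c, hc, fun x y hxy => ?_⟩
  have := congrArg (fun g : C(ι → I, Z) => g x) h
  simp only [sub_apply] at this
  refine Eq.trans ?_ this
  show f.1 y = _
  congr 1
  ext i
  rw [gcell_apply, hxy]
  push_cast
  ring

end Assemble

section HSpace

/-- A multiplication with two-sided unit, continuous on locally compact parameter spaces. -/
structure HStr (Z : Type) [TopologicalSpace Z] (e : Z) where
  mul : Z → Z → Z
  e_mul : ∀ z, mul e z = z
  mul_e : ∀ z, mul z e = z
  cont : ∀ (T : Type) [TopologicalSpace T] [LocallyCompactSpace T] (f g : C(T, Z)),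
    Continuous fun x => mul (f x) (g x)

variable {Z : Type} [TopologicalSpace Z] {e : Z} (H : HStr Z e)
variable {T : Type} [TopologicalSpace T] [LocallyCompactSpace T]
variable {T' : Type} [TopologicalSpace T'] [LocallyCompactSpace T']

namespace HStr

/-- The pointwise product. -/
def cmul (f g : C(T, Z)) : C(T, Z) := ⟨fun x => H.mul (f x) (g x), H.cont T f g⟩

@[simp] lemma cmul_apply (f g : C(T, Z)) (x : T) : H.cmul f g x = H.mul (f x) (g x) := rfl

lemma mul_self_e : H.mul e e = e := H.e_mul e

/-- The pointwise product of a list of maps. -/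
def lprod : List C(T, Z) → C(T, Z)
  | [] => ContinuousMap.const _ e
  | f :: l => H.cmul f (lprod l)

lemma lprod_congr (l : List C(T, Z)) (l' : List C(T', Z)) (x : T) (y : T')
    (h : l.map (fun f => f x) = l'.map (fun f => f y)) : H.lprod l x = H.lprod l' y := by
  induction l generalizing l' with
  | nil => cases l' with
    | nil => rfl
    | cons a l' => simp at h
  | cons a l ih => cases l' with
    | nil => simp at h
    | cons b l' =>
      simp only [List.map_cons, List.cons.injEq] at h
      simp only [lprod, cmul_apply, h.1, ih l' h.2]

lemma lprod_eq_e (l : List C(T, Z)) (x : T) (h : ∀ f ∈ l, f x = e) : H.lprod l x = e := by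
  induction l with
  | nil => rfl
  | cons a l ih =>
    simp only [List.mem_cons, forall_eq_or_imp] at h
    simp only [lprod, cmul_apply, h.1, ih h.2, H.mul_self_e]

end HStr

end HSpace

section LoopProducts

variable {ι : Type} [Fintype ι] [DecidableEq ι] {Z : Type} [TopologicalSpace Z] {e : Z}
variable (H : HStr Z e)

lemma homotopic_of_map {f g : Ω^ ι Z e} (h : C((ι → I) × I, Z)) (h0 : ∀ x, h (x, 0) = f x)
    (h1 : ∀ x, h (x, 1) = g x) (hb : ∀ x ∈ Cube.boundary ι, ∀ t, h (x, t) = e) :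
    GenLoop.Homotopic f g := by
  refine ⟨⟨⟨h.comp ⟨Prod.swap, continuous_swap⟩, h0, h1⟩, ?_⟩⟩
  intro t x hx
  show h (x, t) = f x
  exact (hb x hx t).trans (f.2 x hx).symm

lemma exists_map_of_homotopic {f g : Ω^ ι Z e} (hfg : GenLoop.Homotopic f g) :
    ∃ h : C((ι → I) × I, Z), (∀ x, h (x, 0) = f x) ∧ (∀ x, h (x, 1) = g x) ∧
      ∀ x ∈ Cube.boundary ι, ∀ t, h (x, t) = e := by
  obtain ⟨K⟩ := hfg
  refine ⟨K.toHomotopy.toContinuousMap.comp ⟨Prod.swap, continuous_swap⟩,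
    fun x => K.apply_zero x, fun x => K.apply_one x, fun x hx t => ?_⟩
  exact (K.eq_fst t hx).trans (f.2 x hx)

namespace HStr

/-- The pointwise product of loops. -/
def lmul (f g : Ω^ ι Z e) : Ω^ ι Z e :=
  ⟨H.cmul f.1 g.1, fun y hy => by rw [cmul_apply, f.2 y hy, g.2 y hy, H.mul_self_e]⟩

lemma lmul_congr {f f' g g' : Ω^ ι Z e} (hf : GenLoop.Homotopic f f')
    (hg : GenLoop.Homotopic g g') : GenLoop.Homotopic (H.lmul f g) (H.lmul f' g') := by
  obtain ⟨h, h0, h1, hb⟩ := exists_map_of_homotopic hf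
  obtain ⟨k, k0, k1, kb⟩ := exists_map_of_homotopic hg
  refine homotopic_of_map (H.cmul h k) (fun x => ?_) (fun x => ?_) (fun x hx t => ?_)
  · rw [cmul_apply, h0, k0]; rfl
  · rw [cmul_apply, h1, k1]; rfl
  · rw [cmul_apply, hb x hx, kb x hx, H.mul_self_e]

lemma cls_lmul [Nonempty ι] (f g : Ω^ ι Z e) : cls (H.lmul f g) = cls f * cls g := by
  let i : ι := Classical.arbitrary ι
  have h1 : GenLoop.Homotopic (GenLoop.transAt i GenLoop.const f) f := by
    rw [← cls_eq_iff, ← cls_mul, cls_const, mul_one]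
  have h2 : GenLoop.Homotopic (GenLoop.transAt i g GenLoop.const) g := by
    rw [← cls_eq_iff, ← cls_mul, cls_const, one_mul]
  rw [← cls_eq_iff.2 (H.lmul_congr h1 h2), cls_mul i]
  congr 1
  ext t
  show H.mul (GenLoop.transAt i _ _ t) (GenLoop.transAt i _ _ t) = GenLoop.transAt i _ _ t
  simp only [transAt_apply]
  split_ifs
  · exact H.e_mul _
  · exact H.mul_e _

lemma cls_comm (H : HStr Z e) [Nonempty ι] (f g : Ω^ ι Z e) : cls f * cls g = cls g * cls f := by
  let i : ι := Classical.arbitrary ι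
  have h1 : GenLoop.Homotopic (GenLoop.transAt i GenLoop.const f) f := by
    rw [← cls_eq_iff, ← cls_mul, cls_const, mul_one]
  have h2 : GenLoop.Homotopic (GenLoop.transAt i g GenLoop.const) g := by
    rw [← cls_eq_iff, ← cls_mul, cls_const, one_mul]
  rw [← H.cls_lmul g f, ← cls_eq_iff.2 (H.lmul_congr h2 h1), cls_mul i]
  congr 1
  ext t
  show GenLoop.transAt i _ _ t = H.mul (GenLoop.transAt i _ _ t) (GenLoop.transAt i _ _ t)
  simp only [transAt_apply]
  split_ifs
  · exact (H.mul_e _).symm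
  · exact (H.e_mul _).symm

/-- The homotopy groups of a space with multiplication, as commutative groups. -/
@[reducible] noncomputable def commGroup [Nonempty ι] : CommGroup (HomotopyGroup ι Z e) :=
  { (inferInstance : Group (HomotopyGroup ι Z e)) with
    mul_comm := fun a b => Quotient.inductionOn₂ a b fun f g => H.cls_comm f g }

lemma cls_lprod [Nonempty ι] (l : List (Ω^ ι Z e)) (f : Ω^ ι Z e)
    (hf : f.1 = H.lprod (l.map Subtype.val)) : cls f = (l.map cls).prod := by
  induction l generalizing f with
  | nil =>
    rw [List.map_nil, List.prod_nil, ← cls_const]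
    congr 1
    exact Subtype.ext hf
  | cons a l ih =>
    let g : Ω^ ι Z e := ⟨H.lprod (l.map Subtype.val), fun y hy => H.lprod_eq_e _ _ (by
      intro k hk
      obtain ⟨k, -, rfl⟩ := List.mem_map.1 hk
      exact k.2 y hy)⟩
    have : f = H.lmul a g := Subtype.ext hf
    rw [this, cls_lmul, List.map_cons, List.prod_cons, ih g rfl]

end HStr

end LoopProducts

section BoundedSection

lemma exists_quasi_section_aux {C F : Type} [AddCommGroup C] [AddCommGroup F] [Finite F]
    {n : ℕ} (E : C ≃+ (Fin n →₀ ℤ) × F) :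
    ∃ (J : Type) (_ : Fintype J) (_ : DecidableEq J) (p : (J → ℤ) →+ C) (s : C → J → ℤ),
      (∀ x, p (s x) = x) ∧ s 0 = 0 ∧ (range fun x : C × C => s (x.1 + x.2) - s x.1 - s x.2).Finite := by
  classical
  have := Fintype.ofFinite F
  let δ : F → F → ℤ := fun t => if t = 0 then 0 else Pi.single t 1
  let q : ((Fin n ⊕ F) → ℤ) →+ (Fin n →₀ ℤ) × F :=
    { toFun := fun x => (Finsupp.equivFunOnFinite.symm fun i => x (Sum.inl i),
        ∑ t, x (Sum.inr t) • t)
      map_zero' := by ext <;> simp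
      map_add' := fun x y => by
        ext
        · simp
        · simp [add_smul, Finset.sum_add_distrib] }
  refine ⟨Fin n ⊕ F, inferInstance, inferInstance, E.symm.toAddMonoidHom.comp q,
    fun x => Sum.elim (E x).1 (δ (E x).2), fun x => ?_, ?_, ?_⟩
  · show E.symm (q _) = x
    rw [AddEquiv.symm_apply_eq]
    ext
    · simp [q]
    · simp only [q, δ, AddMonoidHom.coe_mk, ZeroHom.coe_mk, Sum.elim_inr]
      split_ifs with h
      · simp [h]
      · rw [Finset.sum_eq_single (E x).2 (fun b _ hb => by simp [hb]) (by simp)]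
        simp
  · ext i
    rcases i with i | i <;> simp [δ]
  · refine (Set.finite_range fun t : F × F =>
      (Sum.elim 0 (δ (t.1 + t.2) - δ t.1 - δ t.2) : Fin n ⊕ F → ℤ)).subset ?_
    rintro _ ⟨x, rfl⟩
    refine ⟨((E x.1).2, (E x.2).2), ?_⟩
    ext i
    rcases i with i | i <;> simp

/-- A finitely generated abelian group is a quotient of a free one by a map admitting a set-theoretic
section of bounded defect. -/
theorem exists_quasi_section (C : Type) [AddCommGroup C] [AddGroup.FG C] :
    ∃ (J : Type) (_ : Fintype J) (_ : DecidableEq J) (p : (J → ℤ) →+ C) (s : C → J → ℤ),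
      (∀ x, p (s x) = x) ∧ s 0 = 0 ∧ (range fun x : C × C => s (x.1 + x.2) - s x.1 - s x.2).Finite := by
  classical
  obtain ⟨n, ι, _, q, hq, k, ⟨E⟩⟩ := AddCommGroup.equiv_free_prod_directSum_zmod C
  have : ∀ i, NeZero (q i ^ k i) := fun i => ⟨pow_ne_zero _ (hq i).ne_zero⟩
  have : Finite (DirectSum ι fun i => ZMod (q i ^ k i)) :=
    Finite.of_equiv _ (DirectSum.addEquivProd fun i => ZMod (q i ^ k i)).symm.toEquiv
  exact exists_quasi_section_aux E

theorem exists_bounded_section (C : Type) [AddCommGroup C] [AddGroup.FG C] :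
    ∃ (J : Type) (_ : Fintype J) (_ : DecidableEq J) (p : (J → ℤ) →+ C) (s : C → J → ℤ),
      (∀ x, p (s x) = x) ∧ s 0 = 0 ∧ ∀ c, (range fun x => s (x + c) - s x).Finite := by
  obtain ⟨J, i, i', p, s, h, h0, hfin⟩ := exists_quasi_section C
  refine ⟨J, i, i', p, s, h, h0, fun c => (hfin.image fun y => y + s c).subset ?_⟩
  rintro _ ⟨x, rfl⟩
  exact ⟨_, ⟨(x, c), rfl⟩, by simp only; abel⟩

end BoundedSection

section Segments

variable {Z : Type} [TopologicalSpace Z] {e : Z} (H : HStr Z e)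
variable {V : Type} [AddCommGroup V] [Module ℝ V] [TopologicalSpace V] [IsTopologicalAddGroup V]
  [ContinuousSMul ℝ V]

/-- A map on a vector space restricted to a segment, as a loop. -/
noncomputable def segLoop (h : C(V, Z)) (u v : V) (hu : h u = e) (hv : h v = e) :
    Ω^ (Fin 1) Z e :=
  ⟨h.comp ⟨fun x : Fin 1 → I => u + (x 0 : ℝ) • (v - u), by fun_prop⟩, by
    rintro y ⟨i, hi⟩
    obtain rfl : i = 0 := Subsingleton.elim _ _
    show h (u + (y 0 : ℝ) • (v - u)) = e
    rcases hi with hi | hi <;> simp [hi, hu, hv]⟩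

open Classical in
/-- The class of a map on a vector space restricted to a segment. -/
noncomputable def cseg (e : Z) (h : C(V, Z)) (u v : V) : HomotopyGroup (Fin 1) Z e :=
  if hh : h u = e ∧ h v = e then cls (segLoop h u v hh.1 hh.2) else 1

lemma cseg_eq {h : C(V, Z)} {u v : V} (hu : h u = e) (hv : h v = e) :
    cseg e h u v = cls (segLoop h u v hu hv) := dif_pos ⟨hu, hv⟩

lemma coe_projIcc (x : ℝ) : (projIcc (0 : ℝ) 1 zero_le_one x : ℝ) = max 0 (min 1 x) := rfl

lemma cseg_mul (h : C(V, Z)) {u v w : V} (hu : h u = e) (hv : h v = e) (hw : h w = e) :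
    cseg e h v w * cseg e h u v = cseg e h u w := by
  rw [cseg_eq hu hv, cseg_eq hv hw, cseg_eq hu hw, cls_mul 0, cls_eq_iff]
  let cl : ℝ → ℝ := fun x => projIcc (0 : ℝ) 1 zero_le_one x
  have hcl : Continuous cl := continuous_subtype_val.comp continuous_projIcc
  let pw : I → V := fun x => u + cl (2 * x) • (v - u) + cl (2 * x - 1) • (w - v)
  have hpw : Continuous pw := by fun_prop
  refine homotopic_of_map (h.comp ⟨fun p => pw (p.1 0) + (p.2 : ℝ) •
    ((u + (p.1 0 : ℝ) • (w - u)) - pw (p.1 0)), by fun_prop⟩) ?_ ?_ ?_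
  · intro x
    rw [transAt_apply]
    show h _ = _
    simp only [ContinuousMap.coe_mk, Icc.coe_zero, zero_smul, add_zero]
    have h0 := (x 0).2.1
    have h1 := (x 0).2.2
    split_ifs with hx
    · show h _ = h _
      congr 1
      have : cl (2 * (x 0 : ℝ) - 1) = 0 := by
        simp only [cl, coe_projIcc]
        rw [min_eq_right (by linarith), max_eq_left (by linarith)]
      simp only [pw, this, zero_smul, add_zero]
      rfl
    · show h _ = h _
      congr 1
      have : cl (2 * (x 0 : ℝ)) = 1 := by
        simp only [cl, coe_projIcc]
        rw [min_eq_left (by linarith), max_eq_right (by linarith)]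
      simp only [pw, this, one_smul]
      rw [add_sub_cancel]
      rfl
  · intro x
    show h _ = h _
    congr 1
    simp
  · rintro x ⟨i, hi⟩ t
    obtain rfl : i = 0 := Subsingleton.elim _ _
    show h (pw (x 0) + (t : ℝ) • _) = e
    rcases hi with hi | hi
    · have h1 : pw (x 0) = u := by
        simp [pw, cl, hi, coe_projIcc]
      rw [h1, show (x, t).1 0 = 0 from hi]
      simp [hu]
    · have h1 : pw (x 0) = w := by
        simp only [pw, cl, hi, coe_projIcc]
        norm_num
      rw [h1, show (x, t).1 0 = 1 from hi]
      simp [hw]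

lemma cseg_congr {W : Type} [AddCommGroup W] [Module ℝ W] [TopologicalSpace W]
    [IsTopologicalAddGroup W] [ContinuousSMul ℝ W] {h : C(V, Z)} {k : C(W, Z)} {u v : V} {u' v' : W}
    (hh : ∀ t : I, h (u + (t : ℝ) • (v - u)) = k (u' + (t : ℝ) • (v' - u'))) :
    cseg e h u v = cseg e k u' v' := by
  have h0 := hh 0
  have h1 := hh 1
  simp at h0 h1
  unfold cseg
  by_cases hc : h u = e ∧ h v = e
  · rw [dif_pos hc, dif_pos ⟨h0 ▸ hc.1, h1 ▸ hc.2⟩]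
    congr 1
    ext x
    exact hh (x 0)
  · rw [dif_neg hc, dif_neg (by rwa [← h0, ← h1])]

lemma cseg_const {h : C(V, Z)} {u v : V} (hh : ∀ t : I, h (u + (t : ℝ) • (v - u)) = e) :
    cseg e h u v = 1 := by
  have h0 := hh 0
  have h1 := hh 1
  simp at h0 h1
  rw [cseg_eq h0 h1, ← cls_const]
  congr 1
  ext x
  exact hh (x 0)

lemma cseg_cmul [LocallyCompactSpace V] {h k : C(V, Z)} {u v : V} (hu : h u = e) (hv : h v = e)
    (ku : k u = e) (kv : k v = e) : cseg e (H.cmul h k) u v = cseg e h u v * cseg e k u v := by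
  rw [cseg_eq hu hv, cseg_eq ku kv, ← H.cls_lmul,
    cseg_eq (by simp [hu, ku, H.mul_self_e]) (by simp [hv, kv, H.mul_self_e])]
  rfl

/-- The periodic map of the line defined by a loop. -/
noncomputable def periodic (a : Ω^ (Fin 1) Z e) : C(ℝ, Z) :=
  ⟨fun x => a fun _ => ⟨Int.fract x, Int.fract_nonneg x, (Int.fract_lt_one x).le⟩, by
    let g : ℝ → Z := fun x => a fun _ => projIcc 0 1 zero_le_one x
    have hg : Continuous g := a.1.continuous.comp (continuous_pi fun _ => continuous_projIcc)
    have h01 : g 0 = g 1 := by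
      simp only [g, projIcc_left, projIcc_right]
      exact (a.2 _ ⟨0, Or.inl rfl⟩).trans (a.2 _ ⟨0, Or.inr rfl⟩).symm
    have := hg.continuousOn.comp_fract'' h01
    convert this using 1
    ext x
    simp only [Function.comp, g]
    rw [projIcc_of_mem _ ⟨Int.fract_nonneg x, (Int.fract_lt_one x).le⟩]⟩

lemma periodic_add_int (a : Ω^ (Fin 1) Z e) (x : ℝ) (n : ℤ) :
    periodic a (x + n) = periodic a x := by
  simp [periodic]

lemma periodic_coe (a : Ω^ (Fin 1) Z e) (t : I) : periodic a t = a fun _ => t := by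
  show a _ = _
  by_cases ht : t = 1
  · subst ht
    refine (a.2 _ ⟨0, Or.inl ?_⟩).trans (a.2 _ ⟨0, Or.inr rfl⟩).symm
    simp
  · congr 1
    ext i
    have : (t : ℝ) < 1 := lt_of_le_of_ne t.2.2 fun h => ht (Subtype.ext h)
    exact Int.fract_eq_self.2 ⟨t.2.1, this⟩

variable {J : Type} [Fintype J] [DecidableEq J]

/-- The vector of reals given by a vector of integers. -/
def rvec (n : J → ℤ) : J → ℝ := fun j => n j

@[simp] lemma rvec_zero : rvec (0 : J → ℤ) = 0 := by ext; simp [rvec]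

lemma rvec_add (m n : J → ℤ) : rvec (m + n) = rvec m + rvec n := by ext; simp [rvec]

lemma rvec_sub (m n : J → ℤ) : rvec (m - n) = rvec m - rvec n := by ext; simp [rvec]

/-- A homomorphism from a free abelian group to the fundamental group of a space with
multiplication is induced by a periodic map of a vector space. -/
theorem exists_periodic (H : HStr Z e) (p : (J → ℤ) →+ Additive (HomotopyGroup (Fin 1) Z e)) :
    ∃ l : C(J → ℝ, Z), (∀ x n, l (x + rvec n) = l x) ∧ l 0 = e ∧
      ∀ m n : J → ℤ, cseg e l (rvec m) (rvec n) = (p (n - m)).toMul := by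
  let _ := H.commGroup (ι := Fin 1)
  choose a ha using fun j => Quotient.exists_rep (p (Pi.single j 1)).toMul
  have ha : ∀ j, cls (a j) = (p (Pi.single j 1)).toMul := ha
  let l : C(J → ℝ, Z) := H.lprod (Finset.univ.toList.map fun j =>
    (periodic (a j)).comp ⟨fun x : J → ℝ => x j, continuous_apply j⟩)
  have hl0 : l 0 = e := by
    refine H.lprod_eq_e _ _ ?_
    intro f hf
    obtain ⟨j, -, rfl⟩ := List.mem_map.1 hf
    show periodic (a j) 0 = e
    have := periodic_coe (a j) 0
    simp only [Icc.coe_zero] at this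
    rw [this]
    exact (a j).2 _ ⟨0, Or.inl rfl⟩
  have hper : ∀ x n, l (x + rvec n) = l x := by
    intro x n
    refine H.lprod_congr _ _ _ _ ?_
    rw [List.map_map, List.map_map]
    refine List.map_congr_left fun j _ => ?_
    exact periodic_add_int (a j) (x j) (n j)
  have h_ray : ∀ n, l (rvec n) = e := fun n => by
    have := hper 0 n
    rwa [zero_add, hl0] at this
  have hshift : ∀ m n k, cseg e l (rvec (m + k)) (rvec (n + k)) = cseg e l (rvec m) (rvec n) := by
    intro m n k
    refine cseg_congr fun t => ?_
    rw [← hper (rvec m + _) k]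
    congr 1
    rw [rvec_add, rvec_add]
    module
  let φ : (J → ℤ) →+ Additive (HomotopyGroup (Fin 1) Z e) :=
    AddMonoidHom.mk' (fun n => Additive.ofMul (cseg e l 0 (rvec n))) (fun m n => by
      rw [← cseg_mul l hl0 (h_ray m) (h_ray (m + n))]
      have := hshift 0 n m
      rw [zero_add, add_comm n m, rvec_zero] at this
      rw [this, ofMul_mul, add_comm])
  have hφ : φ = p := by
    refine AddMonoidHom.functions_ext' _ _ _ fun j => ?_
    refine AddMonoidHom.ext_int ?_
    show Additive.ofMul (cseg e l 0 (rvec (Pi.single j 1))) = p (Pi.single j 1)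
    rw [cseg_eq hl0 (h_ray _), H.cls_lprod (Finset.univ.toList.map
      fun i => if i = j then a i else GenLoop.const)]
    · rw [List.map_map, Finset.prod_map_toList, Finset.prod_eq_single j]
      · simp [ha]
      · intro i _ hi
        simp [hi, cls_const]
      · simp
    · ext x
      refine H.lprod_congr _ _ _ _ ?_
      simp only [List.map_map]
      refine List.map_congr_left fun i _ => ?_
      simp only [Function.comp, ContinuousMap.comp_apply, ContinuousMap.coe_mk]
      by_cases hi : i = j
      · subst hi
        rw [if_pos rfl]
        have h1 : ((0 : J → ℝ) + (x 0 : ℝ) • (rvec (Pi.single i 1) - 0)) i = x 0 := by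
          simp [rvec]
        rw [h1, periodic_coe]
        show (a i) _ = (a i) _
        congr 1
        ext k
        rw [Subsingleton.elim k 0]
      · have := periodic_coe (a i) 0
        simp only [Icc.coe_zero] at this
        simp [hi, rvec, this]
        exact (a i).2 _ ⟨0, Or.inl rfl⟩
  refine ⟨l, hper, hl0, fun m n => ?_⟩
  have := hshift 0 (n - m) m
  rw [zero_add, sub_add_cancel, rvec_zero] at this
  rw [this, ← hφ]
  rfl

end Segments

section Trilinear

variable {V : Type} [AddCommGroup V] [Module ℝ V]

/-- Linear interpolation. -/
def lerp (t : I) (a b : V) : V := a + (t : ℝ) • (b - a)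

@[simp] lemma lerp_zero (a b : V) : lerp 0 a b = a := by simp [lerp]
@[simp] lemma lerp_one (a b : V) : lerp 1 a b = b := by simp [lerp]
@[simp] lemma lerp_self (t : I) (a : V) : lerp t a a = a := by simp [lerp]

/-- Trilinear interpolation between the values at the corners of a cube. -/
def tri (w : (Fin 3 → Bool) → V) (x : Fin 3 → I) : V :=
  lerp (x 2)
    (lerp (x 1) (lerp (x 0) (w ![false, false, false]) (w ![true, false, false]))
      (lerp (x 0) (w ![false, true, false]) (w ![true, true, false])))
    (lerp (x 1) (lerp (x 0) (w ![false, false, true]) (w ![true, false, true]))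
      (lerp (x 0) (w ![false, true, true]) (w ![true, true, true])))

lemma continuous_tri [TopologicalSpace V] [IsTopologicalAddGroup V] [ContinuousSMul ℝ V]
    (w : (Fin 3 → Bool) → V) : Continuous (tri w) := by
  unfold tri lerp
  fun_prop

lemma update_vec_bool : ∀ (b₀ b₁ b₂ b : Bool),
    Function.update ![b₀, b₁, b₂] 0 b = ![b, b₁, b₂] ∧
    Function.update ![b₀, b₁, b₂] 1 b = ![b₀, b, b₂] ∧
    Function.update ![b₀, b₁, b₂] 2 b = ![b₀, b₁, b] := by decide

lemma tri_update (w : (Fin 3 → Bool) → V) (x : Fin 3 → I) (i : Fin 3) (b : Bool) :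
    tri w (Function.update x i (ev b)) = tri (fun v => w (Function.update v i b)) x := by
  have h0 := fun b₀ b₁ b₂ b => (update_vec_bool b₀ b₁ b₂ b).1
  have h1 := fun b₀ b₁ b₂ b => (update_vec_bool b₀ b₁ b₂ b).2.1
  have h2 := fun b₀ b₁ b₂ b => (update_vec_bool b₀ b₁ b₂ b).2.2
  fin_cases i <;> cases b <;> simp [tri, h0, h1, h2]

@[simp] lemma tri_const (a : V) (x : Fin 3 → I) : tri (fun _ => a) x = a := by simp [tri]

lemma tri_add_const (w : (Fin 3 → Bool) → V) (a : V) (x : Fin 3 → I) :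
    tri (fun v => w v + a) x = tri w x + a := by
  simp only [tri, lerp]
  module

/-- The corners of a cube. -/
def corner {ι : Type} (v : ι → Bool) : ι → I := fun i => ev (v i)

lemma corner_update {ι : Type} [DecidableEq ι] (v : ι → Bool) (i : ι) (b : Bool) :
    corner (Function.update v i b) = Function.update (corner v) i (ev b) := by
  ext j
  by_cases h : j = i
  · subst h; simp [corner]
  · simp [corner, h]

lemma tri_edge (w : (Fin 3 → Bool) → V) (v : Fin 3 → Bool) (i : Fin 3) (s : I) :
    tri w (Function.update (corner v) i s) =
      lerp s (w (Function.update v i false)) (w (Function.update v i true)) := by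
  have h0 := fun b₀ b₁ b₂ b => (update_vec_bool b₀ b₁ b₂ b).1
  have h1 := fun b₀ b₁ b₂ b => (update_vec_bool b₀ b₁ b₂ b).2.1
  have h2 := fun b₀ b₁ b₂ b => (update_vec_bool b₀ b₁ b₂ b).2.2
  obtain ⟨a, b, c, rfl⟩ : ∃ a b c, v = ![a, b, c] :=
    ⟨v 0, v 1, v 2, by ext j; fin_cases j <;> rfl⟩
  fin_cases i <;> cases a <;> cases b <;> cases c <;> simp [tri, corner, h0, h1, h2]

lemma tri_corner (w : (Fin 3 → Bool) → V) (v : Fin 3 → Bool) : tri w (corner v) = w v := by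
  have := tri_edge w v 0 (ev (v 0))
  rw [← corner_update, Function.update_eq_self] at this
  rw [this]
  have h := Function.update_eq_self 0 v
  cases hv : v 0 <;> rw [hv] at h <;> simp [h]

end Trilinear

section Edges

variable {ι : Type} [Fintype ι] [DecidableEq ι] {Z : Type} [TopologicalSpace Z] {e : Z}

lemma FaceClosed.exists_restrict {P : Set C(ι → I, Z)} (hP : FaceClosed P) {c : C(ι → I, Z)}
    (hc : c ∈ P) (v : ι → Bool) (D : Finset ι) :
    ∃ c' ∈ P, ∀ x, c' x = c fun i => if i ∈ D then ev (v i) else x i := by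
  induction D using Finset.induction_on with
  | empty => exact ⟨c, hc, fun x => by simp⟩
  | insert i D hi ih =>
    obtain ⟨c', hc', h⟩ := ih
    refine ⟨face i (v i) c', hP _ hc' _ _, fun x => ?_⟩
    rw [face_apply, h]
    congr 1
    ext j
    by_cases hj : j = i
    · subst hj; simp [hi]
    · simp [hj]

lemma FaceClosed.corner_eq {P : Set C(ι → I, Z)} (hP : FaceClosed P)
    (h0 : ∀ c ∈ P, (cdim c).card ≤ 0 → c = ContinuousMap.const _ e) {c : C(ι → I, Z)}
    (hc : c ∈ P) (v : ι → Bool) : c (corner v) = e := by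
  obtain ⟨c', hc', h⟩ := hP.exists_restrict hc v Finset.univ
  have h1 : cdim c' ⊆ ∅ := cdim_subset fun x y _ => by simp [h]
  have := h0 c' hc' (by rw [Finset.subset_empty.1 h1]; rfl)
  rw [show corner v = fun i => if i ∈ Finset.univ then ev (v i) else (corner v) i by
    ext; simp [corner], ← h, this]
  rfl

/-- Extension of a map of the cube to the whole vector space, by clamping. -/
noncomputable def cext (c : C(ι → I, Z)) : C(ι → ℝ, Z) :=
  c.comp ⟨fun y i => projIcc 0 1 zero_le_one (y i), by fun_prop⟩

lemma cext_apply (c : C(ι → I, Z)) (y : ι → ℝ) :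
    cext c y = c fun i => projIcc 0 1 zero_le_one (y i) := rfl

lemma cext_coe (c : C(ι → I, Z)) (x : ι → I) : cext c (fun i => x i) = c x := by
  simp [cext_apply]

/-- The corners of a cube as vectors. -/
def cornerVec (v : ι → Bool) : ι → ℝ := fun i => corner v i

/-- The class of a cube along a segment joining two corners. -/
noncomputable def ecl (e : Z) (c : C(ι → I, Z)) (v v' : ι → Bool) : HomotopyGroup (Fin 1) Z e :=
  cseg e (cext c) (cornerVec v) (cornerVec v')

/-- The point of a segment joining two corners. -/
def cornerSeg (v v' : ι → Bool) (t : I) : ι → I := fun i =>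
  ⟨(ev (v i) : ℝ) + t * ((ev (v' i) : ℝ) - ev (v i)), by
    have := t.2.1
    have := t.2.2
    constructor <;> cases v i <;> cases v' i <;> simp <;> linarith⟩

lemma cext_cornerSeg (c : C(ι → I, Z)) (v v' : ι → Bool) (t : I) :
    cext c (cornerVec v + (t : ℝ) • (cornerVec v' - cornerVec v)) = c (cornerSeg v v' t) := by
  rw [← cext_coe]
  rfl

lemma ecl_face (c : C(ι → I, Z)) (i : ι) (b : Bool) (v v' : ι → Bool) :
    ecl e (face i b c) v v' = ecl e c (Function.update v i b) (Function.update v' i b) := by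
  refine cseg_congr fun t => ?_
  rw [cext_cornerSeg, cext_cornerSeg, face_apply]
  congr 1
  ext j
  by_cases hj : j = i
  · subst hj; simp [cornerSeg]
  · simp [cornerSeg, hj]

lemma ecl_self {c : C(ι → I, Z)} {v : ι → Bool} (h : c (corner v) = e) : ecl e c v v = 1 := by
  refine cseg_const fun t => ?_
  rw [cext_cornerSeg, ← h]
  congr 1
  ext j
  simp [cornerSeg, corner]

lemma ecl_mul {c : C(ι → I, Z)} (h : ∀ v, c (corner v) = e) (u v w : ι → Bool) :
    ecl e c v w * ecl e c u v = ecl e c u w :=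
  cseg_mul _ ((cext_coe _ _).trans (h u)) ((cext_coe _ _).trans (h v))
    ((cext_coe _ _).trans (h w))

/-- A one-dimensional cube with trivial class is null-homotopic. -/
lemma nullCube_of_path {c : C(ι → I, Z)} {i : ι} (hd : cdim c = {i}) (v : ι → Bool)
    (h : ∀ v, c (corner v) = e)
    (he : ecl e c (Function.update v i false) (Function.update v i true) = 1) : NullCube e c := by
  have hv : ∀ v, cext c (cornerVec v) = e := fun v => (cext_coe _ _).trans (h v)
  rw [ecl, cseg_eq (hv _) (hv _), ← cls_const, cls_eq_iff] at he
  obtain ⟨G, h0, h1, h2⟩ := exists_map_of_homotopic he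
  refine ⟨G.comp ⟨fun p => (fun _ => p.1 i, p.2), by fun_prop⟩, fun x => ?_, fun x => ?_,
    fun x hx t => ?_⟩
  · show G (_, 0) = _
    rw [h0]
    refine (cext_cornerSeg c _ _ _).trans ?_
    refine depOn_cdim c _ _ fun j hj => ?_
    rw [hd, Finset.mem_singleton] at hj
    subst hj
    ext
    simp [cornerSeg]
  · exact h1 _
  · rw [hd] at hx
    obtain ⟨j, hj, b, hb⟩ := hx
    rw [Finset.mem_singleton] at hj
    subst hj
    refine h2 _ ⟨0, ?_⟩ t
    cases b
    · exact Or.inl hb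
    · exact Or.inr hb

end Edges

section Lattice

variable {ι : Type} [Fintype ι] [DecidableEq ι] {Z : Type} [TopologicalSpace Z] {e : Z} {N : ℕ}

/-- The lattice point of a subdivided cube. -/
def latt (Q : ι → Fin N) (v : ι → Bool) : ι → ℕ := fun i => Q i + (v i).toNat

/-- Lattice points as vectors. -/
noncomputable def lattVec (N : ℕ) (P : ι → ℕ) : ι → ℝ := fun i => P i / N

lemma latt_update (Q : ι → Fin N) (i : ι) (q : Fin N) (h : (Q i : ℕ) + 1 = q) (v : ι → Bool) :
    latt Q (Function.update v i true) = latt (Function.update Q i q) (Function.update v i false) := by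
  ext j
  by_cases hj : j = i
  · subst hj; simp [latt, h]
  · simp [latt, hj]

lemma cseg_latt (f : C(ι → I, Z)) (Q : ι → Fin N) (v v' : ι → Bool) :
    cseg e (cext f) (lattVec N (latt Q v)) (lattVec N (latt Q v')) = ecl e (sub f Q) v v' := by
  refine cseg_congr fun t => ?_
  rw [cext_cornerSeg]
  show _ = f (gcell N Q _)
  rw [← cext_coe f]
  congr 1
  ext i
  rw [gcell_apply]
  simp only [lattVec, latt, cornerSeg, Pi.add_apply, Pi.smul_apply, Pi.sub_apply, smul_eq_mul]
  have : ∀ b : Bool, ((b.toNat : ℕ) : ℝ) = ev b := by intro b; cases b <;> simp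
  push_cast
  rw [this, this]
  ring

lemma exists_latt {P : ι → ℕ} (hP : ∀ i, P i ≤ N) {i : ι} (hi : 0 < P i) :
    ∃ (Q : ι → Fin N) (v : ι → Bool), latt Q v = P ∧ v i = true := by
  classical
  have hN : 0 < N := hi.trans_le (hP i)
  refine ⟨fun j => if h : P j = 0 then ⟨0, hN⟩ else ⟨P j - 1, by have := hP j; omega⟩,
    fun j => decide (P j ≠ 0), ?_, by simpa using hi.ne'⟩
  ext j
  simp only [latt]
  by_cases h : P j = 0 <;> simp [h]
  omega

end Lattice

section Kill

variable {Z : Type} [TopologicalSpace Z] {e : Z}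

lemma loop_lattVec {ι : Type} [Fintype ι] [DecidableEq ι] {N : ℕ} (hN : 0 < N) (f : Ω^ ι Z e)
    {i : ι} {P : ι → ℕ} (hP : P i = 0 ∨ P i = N) : cext f.1 (lattVec N P) = e := by
  have hN' : (N : ℝ) ≠ 0 := by positivity
  rw [cext_apply]
  refine f.2 _ ⟨i, hP.imp (fun h => ?_) fun h => ?_⟩ <;> simp [lattVec, h, hN']

lemma cseg_lattVec_of_boundary {N : ℕ} (hN : 0 < N) (f : Ω^ (Fin 3) Z e) {i : Fin 3}
    {P : Fin 3 → ℕ} (hP : P i = 0 ∨ P i = N) :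
    cseg e (cext f.1) 0 (lattVec N P) = 1 := by
  have hN' : (N : ℝ) ≠ 0 := by positivity
  rcases hP with h | h
  · refine cseg_const fun t => ?_
    rw [cext_apply]
    refine f.2 _ ⟨i, Or.inl ?_⟩
    simp [lattVec, h]
  · obtain ⟨j, hj⟩ : ∃ j : Fin 3, j ≠ i := exists_ne i
    rw [← cseg_mul (v := Pi.single i 1)]
    · rw [cseg_const, cseg_const, one_mul]
      · intro t
        rw [cext_apply]
        refine f.2 _ ⟨j, Or.inl ?_⟩
        simp [hj]
      · intro t
        rw [cext_apply]
        refine f.2 _ ⟨i, Or.inr ?_⟩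
        simp [lattVec, h, hN']
    · rw [cext_apply]
      exact f.2 _ ⟨i, Or.inl (by simp)⟩
    · rw [cext_apply]
      exact f.2 _ ⟨i, Or.inr (by simp)⟩
    · exact loop_lattVec hN f (Or.inr h)

/-- Loops assembled from finitely many types of cubes, constant on the vertices, can be deformed,
within finitely many types, so that all edges become null-homotopic. -/
theorem exists_null_edges (H : HStr Z e) (𝒯 : Set C(Fin 3 → I, Z)) (hfin : 𝒯.Finite)
    (hface : FaceClosed 𝒯)
    (hlow : ∀ c ∈ 𝒯, (cdim c).card ≤ 0 → c = ContinuousMap.const _ e) :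
    ∃ 𝒯' : Set C(Fin 3 → I, Z), 𝒯'.Finite ∧ FaceClosed 𝒯' ∧
      (∀ c ∈ 𝒯', (cdim c).card < 1 → c = ContinuousMap.const _ e) ∧
      (∀ c ∈ 𝒯', (cdim c).card = 1 → NullCube e c) ∧
      ∀ (N : ℕ), 0 < N → ∀ f : Ω^ (Fin 3) Z e, (∀ Q : Fin 3 → Fin N, sub f.1 Q ∈ 𝒯) →
        ∃ f' : Ω^ (Fin 3) Z e, GenLoop.Homotopic f f' ∧
          ∀ Q : Fin 3 → Fin N, sub f'.1 Q ∈ 𝒯' := by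
  classical
  let _ := H.commGroup (ι := Fin 1)
  have hcor : ∀ c ∈ 𝒯, ∀ v, c (corner v) = e := fun c hc => hface.corner_eq hlow hc
  let S : Set (Additive (HomotopyGroup (Fin 1) Z e)) :=
    (fun q : C(Fin 3 → I, Z) × (Fin 3 → Bool) × (Fin 3 → Bool) =>
      Additive.ofMul (ecl e q.1 q.2.1 q.2.2)) '' (𝒯 ×ˢ univ)
  have hS : S.Finite := (hfin.prod finite_univ).image _
  let C : AddSubgroup (Additive (HomotopyGroup (Fin 1) Z e)) := AddSubgroup.closure S
  have hCfg : AddGroup.FG C := (AddGroup.fg_iff_addSubgroup_fg C).2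
    ⟨hS.toFinset, by simp [C]⟩
  have hmem : ∀ c ∈ 𝒯, ∀ v v', Additive.ofMul (ecl e c v v') ∈ C := fun c hc v v' =>
    AddSubgroup.subset_closure ⟨(c, v, v'), ⟨hc, mem_univ _⟩, rfl⟩
  obtain ⟨J, _, _, p, s, hps, hs0, hsb⟩ := exists_bounded_section C
  obtain ⟨l, hlper, hl0, hlseg⟩ := exists_periodic H (C.subtype.comp p)
  have hlint : ∀ n : J → ℤ, l (rvec n) = e := fun n => by
    have := hlper 0 n
    rwa [zero_add, hl0] at this
  let K : C(Fin 3 → I, Z) → (Fin 3 → Bool) → (Fin 3 → Bool) → C := fun c v v' =>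
    if h : Additive.ofMul (ecl e c v v') ∈ C then ⟨_, h⟩ else 0
  have hK : ∀ c ∈ 𝒯, ∀ v v', (K c v v' : Additive (HomotopyGroup (Fin 1) Z e)) =
      Additive.ofMul (ecl e c v v') := fun c hc v v' => by
    simp only [K, dif_pos (hmem c hc v v')]
  let Δ : Set (J → ℤ) := ⋃ q ∈ 𝒯 ×ˢ (univ : Set ((Fin 3 → Bool) × (Fin 3 → Bool))),
    (fun n => -n) '' (range fun x : C => s (x + K q.1 q.2.1 q.2.2) - s x)
  have hΔ : Δ.Finite := (hfin.prod finite_univ).biUnion fun q _ => (hsb _).image _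
  let lt : ((Fin 3 → Bool) → J → ℤ) → C(Fin 3 → I, Z) := fun w =>
    l.comp ⟨tri fun v => rvec (w v), continuous_tri _⟩
  have hlt : ∀ w x, lt w x = l (tri (fun v => rvec (w v)) x) := fun _ _ => rfl
  have hltc : ∀ w v, lt w (corner v) = e := fun w v => by
    rw [hlt, tri_corner, hlint]
  have hltf : ∀ w i b, face i b (lt w) = lt fun v => w (Function.update v i b) := by
    intro w i b
    ext x
    rw [face_apply, hlt, hlt, tri_update]
  have hlte : ∀ w v i, ecl e (lt w) (Function.update v i false) (Function.update v i true) =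
      (p (w (Function.update v i true) - w (Function.update v i false)) :
        Additive (HomotopyGroup (Fin 1) Z e)).toMul := by
    intro w v i
    refine Eq.trans ?_ (hlseg _ _)
    refine cseg_congr fun t => ?_
    rw [cext_cornerSeg]
    rw [hlt, show cornerSeg (Function.update v i false) (Function.update v i true) t =
      Function.update (corner v) i t by
        ext j
        by_cases hj : j = i
        · subst hj; simp [cornerSeg]
        · simp [cornerSeg, corner, hj], tri_edge]
    rfl
  let good : C(Fin 3 → I, Z) → ((Fin 3 → Bool) → J → ℤ) → Prop := fun c w => ∀ v i,
    ecl e c (Function.update v i false) (Function.update v i true) *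
      (p (w (Function.update v i true) - w (Function.update v i false)) :
        Additive (HomotopyGroup (Fin 1) Z e)).toMul = 1
  let 𝒯' : Set C(Fin 3 → I, Z) := (fun q : C(Fin 3 → I, Z) × ((Fin 3 → Bool) → J → ℤ) =>
    H.cmul q.1 (lt q.2)) '' {q | q.1 ∈ 𝒯 ∧ q.2 ∈ Set.pi univ (fun _ => Δ) ∧ good q.1 q.2}
  have hcor' : ∀ c ∈ 𝒯', ∀ v, c (corner v) = e := by
    rintro _ ⟨⟨c, w⟩, ⟨hc, -, -⟩, rfl⟩ v
    show H.mul (c _) (lt w _) = e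
    rw [hcor c hc, hltc, H.mul_self_e]
  have hecl : ∀ c ∈ 𝒯', ∀ v i,
      ecl e c (Function.update v i false) (Function.update v i true) = 1 := by
    rintro _ ⟨⟨c, w⟩, ⟨hc, -, hg⟩, rfl⟩ v i
    refine Eq.trans ?_ (hg v i)
    rw [← hlte]
    have h1 : ∀ v, cext c (cornerVec v) = e := fun v => (cext_coe _ _).trans (hcor c hc v)
    have h2 : ∀ v, cext (lt w) (cornerVec v) = e := fun v => (cext_coe _ _).trans (hltc w v)
    exact cseg_cmul H (h1 _) (h1 _) (h2 _) (h2 _)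
  refine ⟨𝒯', ?_, ?_, ?_, ?_, ?_⟩
  · refine Finite.image _ ((hfin.prod (Finite.pi' fun _ => hΔ)).subset ?_)
    rintro ⟨c, w⟩ ⟨hc, hw, -⟩
    exact ⟨hc, fun v => hw v (mem_univ _)⟩
  · rintro _ ⟨⟨c, w⟩, ⟨hc, hw, hg⟩, rfl⟩ i b
    refine ⟨(face i b c, fun v => w (Function.update v i b)), ⟨hface c hc i b,
      fun v _ => hw _ (mem_univ _), ?_⟩, ?_⟩
    · intro v j
      rw [ecl_face]
      by_cases hj : j = i
      · subst hj
        simp [ecl_self (hcor c hc _)]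
      · simp only [Function.update_comm hj]
        exact hg _ j
    · ext x
      show H.mul (face i b c x) (lt _ x) = H.mul (c _) (lt w _)
      rw [← hltf]
      rfl
  · intro c hc hd
    ext x
    have := depOn_cdim c x (corner fun _ => false) fun j hj => by
      rw [Finset.card_eq_zero.1 (Nat.lt_one_iff.1 hd)] at hj
      simp at hj
    rw [this, hcor' c hc]
    rfl
  · intro c hc hd
    obtain ⟨i, hi⟩ := Finset.card_eq_one.1 hd
    exact nullCube_of_path hi (fun _ => false) (hcor' c hc) (hecl c hc _ i)
  · intro N hN f hf
    have hN' : (N : ℝ) ≠ 0 := by positivity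
    have hval : ∀ Q : Fin 3 → Fin N, ∀ v, cext f.1 (lattVec N (latt Q v)) = e := by
      intro Q v
      refine Eq.trans ?_ (hcor _ (hf Q) v)
      show _ = f.1 (gcell N Q _)
      rw [← cext_coe f.1]
      congr 1
      ext i
      rw [gcell_apply]
      simp only [lattVec, latt, corner]
      cases v i <;> simp
    have h0 : cext f.1 0 = e := by
      rw [cext_apply]
      exact f.2 _ ⟨0, Or.inl (by simp)⟩
    let g : (Fin 3 → ℕ) → Additive (HomotopyGroup (Fin 1) Z e) := fun P =>
      Additive.ofMul (cseg e (cext f.1) 0 (lattVec N P))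
    have hstep : ∀ Q : Fin 3 → Fin N, ∀ v v',
        g (latt Q v') = g (latt Q v) + Additive.ofMul (ecl e (sub f.1 Q) v v') := by
      intro Q v v'
      simp only [g]
      rw [← cseg_latt, ← ofMul_mul, mul_comm, cseg_mul _ h0 (hval Q v) (hval Q v')]
    have hgC : ∀ n, ∀ P : Fin 3 → ℕ, ∑ i, P i = n → (∀ i, P i ≤ N) → g P ∈ C := by
      intro n
      induction n with
      | zero =>
        intro P hP _
        have : P = 0 := by
          ext i
          simpa using Finset.sum_eq_zero_iff.1 hP i (Finset.mem_univ i)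
        have h1 : g P = 0 := by
          simp only [g]
          rw [cseg_lattVec_of_boundary hN f (i := 0) (Or.inl (by simp [this]))]
          rfl
        rw [h1]
        exact C.zero_mem
      | succ n ih =>
        intro P hP hPN
        obtain ⟨i, hi⟩ : ∃ i, 0 < P i := by
          by_contra! h
          have : ∑ i, P i = 0 := Finset.sum_eq_zero fun i _ => Nat.le_zero.1 (h i)
          omega
        obtain ⟨Q, v, hQ, hv⟩ := exists_latt hPN hi
        have h1 : ∑ j, latt Q (Function.update v i false) j = n := by
          have h2 : ∑ j, latt Q v j = n + 1 := hQ ▸ hP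
          rw [← Finset.add_sum_erase _ _ (Finset.mem_univ i)] at h2 ⊢
          rw [Finset.sum_congr rfl (g := latt Q v)]
          · have h3 : latt Q v i = Q i + 1 := by simp [latt, hv]
            have h4 : latt Q (Function.update v i false) i = Q i := by simp [latt]
            simp only [h3, h4] at h2 ⊢
            rw [add_right_comm] at h2
            exact Nat.succ_injective h2
          · intro j hj
            simp [latt, Finset.ne_of_mem_erase hj]
        rw [← hQ, hstep Q (Function.update v i false) v]
        refine C.add_mem (ih _ h1 fun j => ?_) (hmem _ (hf Q) _ _)
        have := (Q j).2
        simp only [latt]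
        cases Function.update v i false j <;> simp
    let g' : (Fin 3 → ℕ) → C := fun P => if h : g P ∈ C then ⟨g P, h⟩ else 0
    have hlattN : ∀ Q : Fin 3 → Fin N, ∀ v i, latt Q v i ≤ N := by
      intro Q v i
      have := (Q i).2
      simp only [latt]
      cases v i <;> simp
    have hg' : ∀ Q : Fin 3 → Fin N, ∀ v, (g' (latt Q v) : Additive _) = g (latt Q v) := by
      intro Q v
      simp only [g', dif_pos (hgC _ _ rfl (hlattN Q v))]
    have hstep' : ∀ Q : Fin 3 → Fin N, ∀ v v',
        g' (latt Q v') = g' (latt Q v) + K (sub f.1 Q) v v' := by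
      intro Q v v'
      ext
      rw [AddSubgroup.coe_add, hg', hg', hK _ (hf Q), hstep Q v v']
    have hgb : ∀ Q : Fin 3 → Fin N, ∀ v i, latt Q v i = 0 ∨ latt Q v i = N →
        s (g' (latt Q v)) = 0 := by
      intro Q v i h
      rw [show g' (latt Q v) = 0 by
        ext
        rw [hg']
        exact congrArg Additive.ofMul (cseg_lattVec_of_boundary hN f h), hs0]
    obtain ⟨u, hu⟩ := exists_grid_glue (T := PUnit) (Z := J → ℝ) hN
      (fun Q => ⟨fun x => tri (fun v => rvec (-s (g' (latt Q v)))) x.1,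
        (continuous_tri _).comp continuous_fst⟩) (by
      intro Q i q hq x _
      have h1 := tri_update (fun v => rvec (-s (g' (latt Q v)))) x i true
      have h2 := tri_update (fun v => rvec (-s (g' (latt (Function.update Q i q) v)))) x i false
      simp only [← latt_update Q i q hq] at h2
      exact h1.trans h2.symm)
    have hub : ∀ y ∈ Cube.boundary (Fin 3), u (y, ⟨⟩) = 0 := by
      intro y hy
      obtain ⟨Q, x, rfl⟩ := exists_gcell_eq hN y
      rw [hu]
      show tri (fun v => rvec (-s (g' (latt Q v)))) x = 0
      obtain ⟨i, h⟩ := gcell_mem_boundary_cases hy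
      obtain ⟨b, hb, hbv⟩ : ∃ b, x i = ev b ∧ ∀ v,
          latt Q (Function.update v i b) i = 0 ∨ latt Q (Function.update v i b) i = N := by
        rcases h with ⟨h1, h2⟩ | ⟨h1, h2⟩
        · exact ⟨false, h2, fun v => Or.inl (by simp [latt, h1])⟩
        · exact ⟨true, h2, fun v => Or.inr (by simp [latt, h1])⟩
      have h3 := tri_update (fun v => rvec (-s (g' (latt Q v)))) x i b
      rw [← hb, Function.update_eq_self] at h3
      rw [h3]
      simp [hgb Q _ i (hbv _)]
    let f' : Ω^ (Fin 3) Z e := ⟨H.cmul f.1 (l.comp ⟨fun x => u (x, ⟨⟩), by fun_prop⟩), by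
      intro y hy
      show H.mul (f y) (l (u (y, ⟨⟩))) = e
      rw [hub y hy, hl0, show f y = e from f.2 y hy, H.mul_self_e]⟩
    refine ⟨f', ?_, fun Q => ?_⟩
    · refine homotopic_of_map (H.cmul (f.1.comp ⟨Prod.fst, continuous_fst⟩)
        (l.comp ⟨fun p => (p.2 : ℝ) • u (p.1, ⟨⟩), by fun_prop⟩)) ?_ ?_ ?_
      · intro x
        show H.mul (f x) (l (((0 : I) : ℝ) • u (x, ⟨⟩))) = f x
        rw [Icc.coe_zero, zero_smul, hl0, H.mul_e]
      · intro x
        show H.mul (f x) (l (((1 : I) : ℝ) • u (x, ⟨⟩))) = H.mul (f x) (l (u (x, ⟨⟩)))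
        rw [Icc.coe_one, one_smul]
      · intro x hx t
        show H.mul (f x) (l ((t : ℝ) • u (x, ⟨⟩))) = e
        rw [hub x hx, smul_zero, hl0, show f x = e from f.2 x hx, H.mul_self_e]
    · let g0 := g' (latt Q fun _ => false)
      let w : (Fin 3 → Bool) → J → ℤ := fun v => -(s (g' (latt Q v)) - s g0)
      refine ⟨(sub f.1 Q, w), ⟨hf Q, fun v _ => ?_, fun v i => ?_⟩, ?_⟩
      · refine mem_biUnion (x := (sub f.1 Q, (fun _ => false), v)) ⟨hf Q, mem_univ _⟩
          ⟨_, ⟨g0, rfl⟩, ?_⟩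
        show -(s (g0 + K _ _ _) - s g0) = w v
        rw [← hstep' Q (fun _ => false) v]
      · have h1 : w (Function.update v i true) - w (Function.update v i false) =
            s (g' (latt Q (Function.update v i false))) -
              s (g' (latt Q (Function.update v i true))) := by
          simp only [w]
          abel
        show _ * (p (w _ - w _) : Additive (HomotopyGroup (Fin 1) Z e)).toMul = 1
        rw [h1, map_sub, hps, hps, hstep' Q (Function.update v i false) (Function.update v i true),
          sub_add_cancel_left, AddSubgroup.coe_neg, hK _ (hf Q)]
        simp
      · ext x
        show H.mul (f (gcell N Q x)) (l (tri (fun v => rvec (w v)) x)) =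
          H.mul (f (gcell N Q x)) (l (u (gcell N Q x, ⟨⟩)))
        congr 1
        rw [hu]
        show _ = l (tri (fun v => rvec (-s (g' (latt Q v)))) x)
        rw [← hlper _ (-s g0), ← tri_add_const]
        congr 2
        ext v
        rw [← rvec_add]
        congr 2
        simp only [w]
        abel

end Kill

section FiniteGeneration

variable {Z : Type} [TopologicalSpace Z] {e : Z}

lemma FaceClosed.eq_of_mem_bd {ι : Type} [Fintype ι] [DecidableEq ι] {𝒯 : Set C(ι → I, Z)}
    (hface : FaceClosed 𝒯) {d : ℕ}
    (hlow : ∀ c ∈ 𝒯, (cdim c).card < d → c = ContinuousMap.const _ e) {c : C(ι → I, Z)}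
    (hc : c ∈ 𝒯) (hd : (cdim c).card = d) {x : ι → I} (hx : x ∈ bd (cdim c)) : c x = e := by
  obtain ⟨i, hi, b, hb⟩ := hx
  have h := hlow _ (hface c hc i b) (hd ▸ card_cdim_face_lt hi b)
  have h' := congrArg (fun g : C(ι → I, Z) => g x) h
  simpa [face_apply, ← hb] using h'

lemma ExtProp.mono {V : Set Z} {n m : ℕ} (h : ExtProp V n) (hm : m ≤ n) : ExtProp V m :=
  ⟨h.1, fun k D hD => h.2 k D (hD.trans hm)⟩

lemma ExtProp.nullCube {k d : ℕ} (hZ : ExtProp (univ : Set Z) (d + 1)) {c : C(Fin k → I, Z)}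
    (hd : (cdim c).card = d) (hbd : ∀ x ∈ bd (cdim c), c x = e) : NullCube e c := by
  obtain ⟨D, hD⟩ : ∃ D, D = cdim c := ⟨_, rfl⟩
  rw [← hD] at hd hbd
  have hcont : Continuous (fun p : Fin (k + 1) → I => fun i : Fin k => p i.succ) := by fun_prop
  obtain ⟨G, -, hG⟩ := hZ.exists_of_faces (k := k + 1) (Finset.cons 0 (D.map (Fin.succEmb k)) (by simp))
    (by simp [hd])
    (fun i b p => if i = 0 ∧ b = false then c (fun i => p i.succ) else e) (fun i _ b => by
      split_ifs
      · exact (c.continuous.comp hcont).continuousOn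
      · exact continuousOn_const) (fun _ _ _ _ _ => mem_univ _) (by
      have key : ∀ j ∈ Finset.cons 0 (D.map (Fin.succEmb k)) (by simp), ∀ b', ∀ p : Fin (k + 1) → I,
          p j = ev b' → ¬ (j = 0 ∧ b' = false) → p 0 = ev false → c (fun i => p i.succ) = e := by
        intro j hj b' p hp hjb h0
        simp only [Finset.mem_cons, Finset.mem_map, Fin.coe_succEmb] at hj
        rcases hj with rfl | ⟨j, hj, rfl⟩
        · exact absurd ⟨rfl, ev_injective (hp.symm.trans h0)⟩ hjb
        · exact hbd _ ⟨j, hj, b', hp⟩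
      intro i hi b j hj b' p hp hp'
      split_ifs with h h' h'
      · rfl
      · exact key j hj b' p hp' h' (by rw [← h.1, hp, h.2])
      · exact (key i hi b p hp h (by rw [← h'.1, hp', h'.2])).symm
      · rfl)
  have hm : Continuous (fun p : (Fin k → I) × I =>
      (Fin.cons p.2 (RackPi3.keep D p.1) : Fin (k + 1) → I)) := by
    refine continuous_pi fun i => ?_
    induction i using Fin.cases with
    | zero => exact continuous_snd
    | succ i => exact (continuous_apply i).comp ((continuous_keep D).comp continuous_fst)
  have hdep := hD ▸ depOn_cdim c
  refine ⟨G.comp ⟨_, hm⟩, fun x => ?_, fun x => ?_, fun x hx t => ?_⟩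
  · refine (hG 0 (by simp) false _ (by simp)).trans ?_
    simp only [and_self, if_true]
    refine hdep _ _ fun i hi => ?_
    simp [keep_apply_of_mem hi, Fin.cons_succ]
  · refine (hG 0 (by simp) true _ (by simp)).trans ?_
    simp
  · rw [← hD] at hx
    obtain ⟨i, hi, b, hb⟩ := hx
    refine (hG i.succ (by simp [hi]) b _ ?_).trans ?_
    · simp [keep_apply_of_mem hi, Fin.cons_succ, hb]
    · simp

/-- If all generalized loops can be assembled from finitely many spheres then the homotopy group is
finitely generated. -/
theorem fg_of_types {k : ℕ} [Nonempty (Fin k)] (𝒯 : Set C(Fin k → I, Z)) (hfin : 𝒯.Finite)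
    (hface : FaceClosed 𝒯)
    (hlow : ∀ c ∈ 𝒯, (cdim c).card < k → c = ContinuousMap.const _ e)
    (h : ∀ f : Ω^ (Fin k) Z e, ∃ (m : ℕ) (f' : Ω^ (Fin k) Z e), GenLoop.Homotopic f f' ∧
      ∀ Q : Fin k → Fin (2 ^ m), sub f'.1 Q ∈ 𝒯) :
    Group.FG (HomotopyGroup (Fin k) Z e) := by
  have hS : {c : Ω^ (Fin k) Z e | c.1 ∈ 𝒯}.Finite := hfin.preimage Subtype.val_injective.injOn
  refine (Group.fg_iff).2 ⟨cls '' {c : Ω^ (Fin k) Z e | c.1 ∈ 𝒯}, ?_, hS.image _⟩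
  refine eq_top_iff.2 fun x _ => ?_
  obtain ⟨f, rfl⟩ := Quotient.exists_rep x
  obtain ⟨m, f', hff', hf'⟩ := h f
  have : cls f = cls f' := cls_eq_iff.2 hff'
  show cls f ∈ _
  rw [this]
  refine cls_mem_closure _ m f' fun Q => ⟨⟨sub f'.1 Q, ?_⟩, hf' Q, rfl⟩
  intro y hy
  by_cases hd : (cdim (sub f'.1 Q)).card < k
  · rw [hlow _ (hf' Q) hd]; rfl
  have hd' : (cdim (sub f'.1 Q)).card = k :=
    le_antisymm ((Finset.card_le_univ _).trans (by simp)) (not_lt.1 hd)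
  have hu : cdim (sub f'.1 Q) = Finset.univ := Finset.eq_univ_of_card _ (by simpa using hd')
  refine hface.eq_of_mem_bd hlow (hf' Q) hd' ?_
  obtain ⟨i, hi⟩ := hy
  refine ⟨i, by simp [hu], ?_⟩
  rcases hi with hi | hi
  exacts [⟨false, by simpa using hi⟩, ⟨true, by simpa using hi⟩]

end FiniteGeneration

section Components

variable {Z : Type} [TopologicalSpace Z]

lemma Contractible.isPreconnected {V : Set Z} (hV : Contractible V) : IsPreconnected V := by
  obtain ⟨K, v, hv, hK, hKV, hK0, hK1⟩ := hV
  have : IsPathConnected V := by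
    refine ⟨v, hv, fun {z} hz => JoinedIn.symm ?_⟩
    refine ⟨⟨⟨fun t => K (z, t), ?_⟩, hK0 z hz, hK1 z hz⟩, fun t => hKV z hz t⟩
    exact hK.comp_continuous (by fun_prop) fun t => ⟨hz, mem_univ _⟩
  exact this.isConnected.isPreconnected

lemma connectedComponentIn_eq_fibre {K : Type*} {W : Set Z} (φ : Z → K)
    (hopen : ∀ a, IsOpen (W ∩ φ ⁻¹' {a})) {p : Z} (hp : p ∈ W)
    (hc : IsPreconnected (W ∩ φ ⁻¹' {φ p})) :
    connectedComponentIn W p = W ∩ φ ⁻¹' {φ p} := by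
  refine Subset.antisymm ?_ (hc.subset_connectedComponentIn ⟨hp, rfl⟩ inter_subset_left)
  have hsub := connectedComponentIn_subset W p
  refine isPreconnected_connectedComponentIn.subset_left_of_subset_union (hopen (φ p))
    (isOpen_iUnion fun a => isOpen_iUnion fun _ : a ≠ φ p => hopen a) ?_ ?_
    ⟨p, mem_connectedComponentIn hp, hp, rfl⟩
  · rw [Set.disjoint_left]
    rintro x ⟨_, hx⟩ hx'
    simp only [mem_iUnion] at hx'
    obtain ⟨a, ha, _, hx'⟩ := hx'
    exact ha (hx'.symm.trans hx)
  · intro x hx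
    by_cases h : φ x = φ p
    · exact Or.inl ⟨hsub hx, h⟩
    · exact Or.inr (mem_iUnion.2 ⟨φ x, mem_iUnion.2 ⟨h, hsub hx, rfl⟩⟩)

/-- A cover is good if the pieces of its intersections, as cut out by locally constant functions,
are contractible. -/
lemma goodCover_of_fibres {J K : Type} [Fintype J] [Finite K] (O : J → Set Z) (n : ℕ)
    (hO : ∀ j, IsOpen (O j)) (φ : Finset J → Z → K)
    (hopen : ∀ S : Finset J, S.Nonempty → ∀ a, IsOpen ((⋂ j ∈ S, O j) ∩ φ S ⁻¹' {a}))
    (hc : ∀ S : Finset J, S.Nonempty → ∀ p ∈ ⋂ j ∈ S, O j,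
      Contractible ((⋂ j ∈ S, O j) ∩ φ S ⁻¹' {φ S p})) : GoodCover O n where
  isOpen := hO
  finite S hS := by
    refine (finite_range fun a : K => (⋂ j ∈ S, O j) ∩ φ S ⁻¹' {a}).subset ?_
    rintro _ ⟨p, hp, rfl⟩
    exact ⟨φ S p, (connectedComponentIn_eq_fibre _ (hopen S hS) hp (hc S hS p hp).isPreconnected).symm⟩
  ext S hS p hp := by
    rw [connectedComponentIn_eq_fibre _ (hopen S hS) hp (hc S hS p hp).isPreconnected]
    exact (hc S hS p hp).extProp n

end Components

section Approximation

variable {V : Type} [NormedAddCommGroup V] [NormedSpace ℝ V] [FiniteDimensional ℝ V]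

/-- The continuous functions on the cube which are restrictions of differentiable functions. -/
noncomputable def smoothSubalgebra (ι : Type) [Fintype ι] : Subalgebra ℝ C(ι → I, ℝ) where
  carrier := {g | ∃ G : (ι → ℝ) → ℝ, ContDiff ℝ 1 G ∧ ∀ x, g x = G fun i => x i}
  mul_mem' := by
    rintro a b ⟨A, hA, h⟩ ⟨B, hB, h'⟩
    exact ⟨fun x => A x * B x, hA.mul hB, fun x => by simp [h, h']⟩
  add_mem' := by
    rintro a b ⟨A, hA, h⟩ ⟨B, hB, h'⟩
    exact ⟨fun x => A x + B x, hA.add hB, fun x => by simp [h, h']⟩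
  algebraMap_mem' r := ⟨fun _ => r, contDiff_const, fun x => rfl⟩

lemma separatesPoints_smoothSubalgebra (ι : Type) [Fintype ι] :
    (smoothSubalgebra ι).SeparatesPoints := by
  intro x y hxy
  obtain ⟨i, hi⟩ := Function.ne_iff.1 hxy
  refine ⟨fun z => z i, ⟨⟨fun z => (z i : ℝ), by fun_prop⟩,
    ⟨fun z => z i, contDiff_apply ℝ ℝ i, fun _ => rfl⟩, rfl⟩, fun h => hi (Subtype.ext h)⟩

lemma exists_smooth_approx {ι : Type} [Fintype ι] (f : C(ι → I, ℝ)) {ε : ℝ} (hε : 0 < ε) :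
    ∃ G : (ι → ℝ) → ℝ, ContDiff ℝ 1 G ∧ ∀ x : ι → I, |G (fun j => x j) - f x| ≤ ε := by
  obtain ⟨⟨g, G, hG, hg⟩, h⟩ :=
    ContinuousMap.exists_mem_subalgebra_near_continuousMap_of_separatesPoints
      (smoothSubalgebra ι) (separatesPoints_smoothSubalgebra ι) f ε hε
  refine ⟨G, hG, fun x => ?_⟩
  rw [← hg x]
  exact ((g - f).norm_coe_le_norm x).trans h.le

/-- Maps from a cube to a space of larger dimension can be perturbed to avoid a given point. -/
theorem exists_approx_avoid {ι : Type} [Fintype ι] (h : Fintype.card ι < Module.finrank ℝ V)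
    (f : C(ι → I, V)) (c : V) {ε : ℝ} (hε : 0 < ε) :
    ∃ g : C(ι → I, V), (∀ x, ‖g x - f x‖ < ε) ∧ ∀ x, g x ≠ c := by
  let b := Module.finBasis ℝ V
  let M : ℝ := ∑ i, ‖b i‖ + 1
  have hM : 0 < M := by
    have : 0 ≤ ∑ i, ‖b i‖ := Finset.sum_nonneg fun _ _ => norm_nonneg _
    simp only [M]; linarith
  have hb : ∀ i, Continuous fun x => b.repr (f x) i := fun i =>
    ((b.coord i).continuous_of_finiteDimensional).comp f.continuous
  have key : ∀ i, ∃ G : (ι → ℝ) → ℝ, ContDiff ℝ 1 G ∧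
      ∀ x : ι → I, |G (fun j => x j) - b.repr (f x) i| ≤ ε / 2 / M := by
    intro i
    exact exists_smooth_approx ⟨_, hb i⟩ (by positivity)
  choose G hG hGf using key
  let F : (ι → ℝ) → V := fun x => ∑ i, G i x • b i
  have hF : ContDiff ℝ 1 F := ContDiff.sum fun i _ => (hG i).smul contDiff_const
  have hd : Dense (range F)ᶜ := hF.dense_compl_range_of_finrank_lt_finrank (by simpa using h)
  obtain ⟨u, hu, huc⟩ := hd.exists_dist_lt c (ε := ε / 2) (by positivity)
  refine ⟨⟨fun x => F (fun i => x i) + (c - u), ?_⟩, fun x => ?_, fun x hx => ?_⟩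
  · have := hF.continuous
    fun_prop
  · have h1 : ‖F (fun i => x i) - f x‖ ≤ ε / 2 := by
      have : F (fun i => x i) - f x = ∑ i, (G i (fun j => x j) - b.repr (f x) i) • b i := by
        conv_lhs => rw [← b.sum_repr (f x)]
        simp only [F, sub_smul, Finset.sum_sub_distrib]
      rw [this]
      calc _ ≤ ∑ i, ‖(G i (fun j => x j) - b.repr (f x) i) • b i‖ := norm_sum_le _ _
        _ ≤ ∑ i, ε / 2 / M * ‖b i‖ := Finset.sum_le_sum fun i _ => by
            rw [norm_smul]
            exact mul_le_mul_of_nonneg_right (hGf i x) (norm_nonneg _)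
        _ = ε / 2 / M * ∑ i, ‖b i‖ := by rw [Finset.mul_sum]
        _ ≤ ε / 2 / M * M := by gcongr; simp [M]
        _ = ε / 2 := by field_simp
    have h2 : ‖c - u‖ < ε / 2 := by rwa [← dist_eq_norm]
    calc ‖F (fun i => x i) + (c - u) - f x‖ = ‖(F (fun i => x i) - f x) + (c - u)‖ := by
          congr 1; abel
      _ ≤ _ := norm_add_le _ _
      _ < ε := by linarith
  · refine hu ⟨fun i => x i, ?_⟩
    have hx : F (fun i => x i) + (c - u) = c := hx
    have := sub_eq_zero.2 hx
    rw [← sub_eq_zero, ← this]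
    abel

end Approximation

section Punctured

/-- The complement of the origin in the complex plane. -/
abbrev Punc : Type := {z : ℂ × ℂ // z ≠ 0}

lemma extProp_punc : ExtProp (univ : Set Punc) 3 := by
  classical
  refine ⟨⟨⟨(1, 0), by simp⟩, mem_univ _⟩, fun k D hD g hg _ => ?_⟩
  have hz : Nonempty Punc := ⟨⟨(1, 0), by simp⟩⟩
  obtain ⟨f, hf⟩ := ContinuousMap.exists_restrict_eq (isClosed_bd D)
    ⟨fun x : bd D => (g x : ℂ × ℂ), continuous_subtype_val.comp hg.domRestrict⟩
  have hfg : ∀ x ∈ bd D, f x = g x := fun x hx => congrArg (fun u : C(bd D, ℂ × ℂ) => u ⟨x, hx⟩) hf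
  obtain ⟨δ, hδ, hfδ⟩ : ∃ δ > 0, ∀ x ∈ bd D, δ ≤ ‖f x‖ := by
    rcases (bd D).eq_empty_or_nonempty with h | h
    · exact ⟨1, one_pos, by simp [h]⟩
    · obtain ⟨x, hx, h⟩ := (isClosed_bd D).isCompact.exists_isMinOn h
        (f := fun x => ‖f x‖) (by fun_prop)
      refine ⟨‖f x‖, ?_, h⟩
      rw [hfg x hx]
      exact norm_pos_iff.2 (g x).2
  let up : C(D → I, Fin k → I) := ⟨fun y i => if h : i ∈ D then y ⟨i, h⟩ else 0, by
    refine continuous_pi fun i => ?_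
    split_ifs <;> fun_prop⟩
  obtain ⟨g₁, hg₁, hg₁0⟩ := exists_approx_avoid (ι := D) (by
    simp only [Fintype.card_coe, Module.finrank_prod, Complex.finrank_real_complex]; omega)
    (f.comp up) 0 hδ
  let res : C(Fin k → I, D → I) := ⟨fun x i => x i, by fun_prop⟩
  let sc : (Fin k → I) × I → Fin k → I := fun p i => if i ∈ D then p.1 i else p.2 * p.1 i
  have hsc : Continuous sc := by
    refine continuous_pi fun i => ?_
    simp only [sc]
    split_ifs <;> fun_prop
  have hscbd : ∀ p : (Fin k → I) × I, p.1 ∈ bd D → sc p ∈ bd D := by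
    rintro p ⟨i, hi, b, hb⟩
    exact ⟨i, hi, b, by simp [sc, hi, hb]⟩
  have hsc0 : ∀ x, sc (x, 0) = up (res x) := by
    intro x; ext i
    by_cases hi : i ∈ D <;> simp [sc, up, res, hi]
  have hsc1 : ∀ x, sc (x, 1) = x := by
    intro x; ext i
    by_cases hi : i ∈ D <;> simp [sc, hi]
  let H : (Fin k → I) × I → ℂ × ℂ := fun p =>
    f (sc p) + ((1 - p.2 : ℝ)) • (g₁ (res p.1) - f (up (res p.1)))
  have hH : Continuous H := by
    have := f.continuous; have := g₁.continuous
    fun_prop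
  have hH0 : ∀ x, H (x, 0) = g₁ (res x) := by
    intro x
    simp [H, hsc0]
  have hHne : ∀ p : (Fin k → I) × I, p.1 ∈ bd D ∨ p.2 = 0 → H p ≠ 0 := by
    rintro ⟨x, t⟩ (hp | rfl)
    · intro h0
      have h1 := hfδ _ (hscbd (x, t) hp)
      have h2 := hg₁ (res x)
      have h3 : f (sc (x, t)) = - (((1 - t : ℝ)) • (g₁ (res x) - f (up (res x)))) :=
        eq_neg_of_add_eq_zero_left h0
      rw [h3, norm_neg, norm_smul] at h1
      have ht := t.2.1; have ht' := t.2.2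
      have h4 : ‖(1 - t : ℝ)‖ ≤ 1 := by
        rw [Real.norm_eq_abs, abs_le]; constructor <;> linarith
      have h5 : ‖(1 - t : ℝ)‖ * ‖g₁ (res x) - f (up (res x))‖ ≤ 1 * ‖g₁ (res x) - f (up (res x))‖ :=
        mul_le_mul_of_nonneg_right h4 (norm_nonneg _)
      have h2' : ‖g₁ (res x) - f (up (res x))‖ < δ := h2
      linarith
    · rw [hH0]
      exact hg₁0 _
  let H' : (Fin k → I) × I → Punc := fun p => if h : H p ≠ 0 then ⟨H p, h⟩ else hz.some
  have hH' : ∀ p : (Fin k → I) × I, p.1 ∈ bd D ∨ p.2 = 0 → (H' p : ℂ × ℂ) = H p := by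
    intro p hp
    simp only [H', dif_pos (hHne p hp)]
  obtain ⟨G, -, hG, -⟩ := exists_extension_of_faces D
    (⟨fun x => H' (x, 0), by
      refine Continuous.subtype_mk (f := fun x => H (x, 0)) (by fun_prop)
        (fun x => hHne (x, 0) (Or.inr rfl)) |>.congr fun x => ?_
      exact Subtype.ext (hH' (x, 0) (Or.inr rfl)).symm⟩ : C(Fin k → I, Punc)) (fun _ _ => H')
    (fun i hi b => by
      refine Topology.IsInducing.subtypeVal.continuousOn_iff.2 ?_
      refine hH.continuousOn.congr fun p hp => hH' p (Or.inl ⟨i, hi, b, hp⟩))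
    (fun i hi b j hj b' p _ _ => rfl) (fun i hi b x _ => rfl)
  refine ⟨G.comp ⟨fun x => (x, 1), by fun_prop⟩, fun _ => mem_univ _, fun x hx => ?_⟩
  obtain ⟨i, hi, b, hb⟩ := id hx
  refine (hG i hi b (x, 1) hb).trans (Subtype.ext ?_)
  rw [hH' _ (Or.inl hx), ← hfg x hx]
  simp [H, hsc1]

/-- The real coordinates of a point of the complex plane. -/
def coordR : Fin 4 → ℂ × ℂ → ℝ := ![fun z => z.1.re, fun z => z.1.im, fun z => z.2.re, fun z => z.2.im]

lemma isLinear_coordR (i : Fin 4) : IsLinearMap ℝ (coordR i) := by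
  fin_cases i <;> constructor <;> simp [coordR]

lemma goodCover_punc : GoodCover (fun (j : Fin 4 × Bool) =>
    {z : Punc | 0 < (if j.2 then 1 else -1 : ℝ) * coordR j.1 z.1}) 4 := by
  have hlin : ∀ j : Fin 4 × Bool,
      IsLinearMap ℝ fun z => (if j.2 then 1 else -1 : ℝ) * coordR j.1 z := fun j =>
    ⟨fun x y => by rw [(isLinear_coordR j.1).map_add, mul_add], fun c x => by
      rw [(isLinear_coordR j.1).map_smul]; simp only [smul_eq_mul]; ring⟩
  have hcont : ∀ j : Fin 4 × Bool,
      Continuous fun z => (if j.2 then 1 else -1 : ℝ) * coordR j.1 z := fun j =>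
    (IsLinearMap.mk' _ (hlin j)).continuous_of_finiteDimensional
  have hopen : ∀ j : Fin 4 × Bool,
      IsOpen {z : Punc | 0 < (if j.2 then 1 else -1 : ℝ) * coordR j.1 z.1} := fun j =>
    isOpen_lt continuous_const ((hcont j).comp continuous_subtype_val)
  refine goodCover_of_fibres (K := Unit) _ _ hopen (fun _ _ => ()) (fun S _ a => ?_) fun S hS p hp => ?_
  · simpa using isOpen_biInter_finset fun j _ => hopen j
  · obtain ⟨j₀, hj₀⟩ := hS
    simp only [mem_iInter, mem_ofPred_eq] at hp
    let L : Punc × I → ℂ × ℂ := fun q => (1 - q.2 : ℝ) • q.1.1 + (q.2 : ℝ) • p.1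
    have hL : ∀ z : Punc, ∀ t : I, ∀ j : Fin 4 × Bool, 0 < (if j.2 then 1 else -1 : ℝ) * coordR j.1 z.1 →
        0 < (if j.2 then 1 else -1 : ℝ) * coordR j.1 p.1 →
        0 < (if j.2 then 1 else -1 : ℝ) * coordR j.1 (L (z, t)) := by
      intro z t j hz hp
      have h1 := (hlin j).map_add ((1 - t : ℝ) • z.1) ((t : ℝ) • p.1)
      have h2 := (hlin j).map_smul (1 - t : ℝ) z.1
      have h3 := (hlin j).map_smul (t : ℝ) p.1
      simp only [smul_eq_mul] at h1 h2 h3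
      simp only [L]
      rw [h1, h2, h3]
      have ht := t.2.1; have ht' := t.2.2
      rcases eq_or_lt_of_le ht with h | h
      · rw [← h]; simpa using hz
      · have := mul_nonneg (sub_nonneg.2 ht') hz.le
        have := mul_pos h hp
        linarith
    have hne : ∀ q ∈ {z : Punc | 0 < (if j₀.2 then 1 else -1 : ℝ) * coordR j₀.1 z.1} ×ˢ (univ : Set I),
        L q ≠ 0 := by
      rintro ⟨z, t⟩ ⟨hz, -⟩ h0
      have := hL z t j₀ hz (hp j₀ hj₀)
      rw [h0, (hlin j₀).map_zero] at this
      exact lt_irrefl _ this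
    let L' : Punc × I → Punc := fun q => if h : L q ≠ 0 then ⟨L q, h⟩ else p
    have hmem : ∀ z ∈ (⋂ j ∈ S, {z : Punc | 0 < (if j.2 then 1 else -1 : ℝ) * coordR j.1 z.1}) ∩
        (fun _ => ()) ⁻¹' {()}, ∀ j ∈ S, 0 < (if j.2 then 1 else -1 : ℝ) * coordR j.1 z.1 := by
      rintro z ⟨hz, -⟩
      simpa only [mem_iInter, mem_ofPred_eq] using hz
    have hL' : ∀ z : Punc, ∀ t : I, (∀ j ∈ S, 0 < (if j.2 then 1 else -1 : ℝ) * coordR j.1 z.1) →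
        (L' (z, t) : ℂ × ℂ) = L (z, t) := fun z t hz => by
      simp only [L', dif_pos (hne (z, t) ⟨hz j₀ hj₀, mem_univ _⟩)]
    refine ⟨L', p, ⟨by simpa only [mem_iInter, mem_ofPred_eq] using hp, rfl⟩, ?_, fun z hz t => ⟨?_, rfl⟩,
      fun z hz => ?_, fun z hz => ?_⟩
    · refine Topology.IsInducing.subtypeVal.continuousOn_iff.2 ?_
      have : Continuous L := by fun_prop
      refine this.continuousOn.congr fun q hq => hL' q.1 q.2 (hmem _ hq.1)
    · simp only [mem_iInter, mem_ofPred_eq]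
      intro j hj
      rw [hL' z t (hmem z hz)]
      exact hL z t j (hmem z hz j hj) (hp j hj)
    · exact Subtype.ext ((hL' z 0 (hmem z hz)).trans (by simp [L]))
    · exact Subtype.ext ((hL' z 1 (hmem z hz)).trans (by simp [L]))

theorem fg_pi_punc (e : Punc) : Group.FG (HomotopyGroup (Fin 3) Punc e) := by
  obtain ⟨𝒯, hfin, hface, h⟩ := goodCover_punc.exists_finite_types (k := 3) (by norm_num) (by norm_num) e
  have hcov : ∀ z : Punc, ∃ j : Fin 4 × Bool, 0 < (if j.2 then 1 else -1 : ℝ) * coordR j.1 z.1 := by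
    intro z
    by_contra! hz
    have h0 : ∀ i, coordR i z.1 = 0 := fun i => by
      have h1 := hz (i, true)
      have h2 := hz (i, false)
      simp at h1 h2
      linarith
    refine z.2 (Prod.ext (Complex.ext (h0 0) (h0 1)) (Complex.ext (h0 2) (h0 3)))
  have hnull : ∀ d : ℕ, d + 1 ≤ 3 → ∀ 𝒯 : Set C(Fin 3 → I, Punc), FaceClosed 𝒯 →
      (∀ c ∈ 𝒯, (cdim c).card < d → c = ContinuousMap.const _ e) →
      ∀ c ∈ 𝒯, (cdim c).card = d → NullCube e c := fun d hd 𝒯 hface hlow c hc hcd =>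
    (extProp_punc.mono hd).nullCube hcd fun x hx => hface.eq_of_mem_bd hlow hc hcd hx
  obtain ⟨𝒯₀, hfin₀, hface₀, hlow₀, h₀⟩ := exists_skeletal e 0 𝒯 hfin hface (by simp)
    (hnull 0 (by norm_num) 𝒯 hface (by simp))
  obtain ⟨𝒯₁, hfin₁, hface₁, hlow₁, h₁⟩ := exists_skeletal e 1 𝒯₀ hfin₀ hface₀
    (fun c hc hd => hlow₀ c hc (by omega))
    (hnull 1 (by norm_num) 𝒯₀ hface₀ fun c hc hd => hlow₀ c hc (by omega))
  obtain ⟨𝒯₂, hfin₂, hface₂, hlow₂, h₂⟩ := exists_skeletal e 2 𝒯₁ hfin₁ hface₁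
    (fun c hc hd => hlow₁ c hc (by omega))
    (hnull 2 (by norm_num) 𝒯₁ hface₁ fun c hc hd => hlow₁ c hc (by omega))
  refine fg_of_types 𝒯₂ hfin₂ hface₂ (fun c hc hd => hlow₂ c hc (by omega)) fun f => ?_
  obtain ⟨m, f', hf, hf'⟩ := h f fun x => hcov (f x)
  have hm : 0 < 2 ^ m := by positivity
  obtain ⟨f₀, hf₀, hf₀'⟩ := h₀ _ hm f' hf'
  obtain ⟨f₁, hf₁, hf₁'⟩ := h₁ _ hm f₀ hf₀'
  obtain ⟨f₂, hf₂, hf₂'⟩ := h₂ _ hm f₁ hf₁'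
  exact ⟨m, f₂, hf.trans (hf₀.trans (hf₁.trans hf₂)), hf₂'⟩

end Punctured

section Cochains

variable {A : Type} [AddCommGroup A]

/-- A compactly supported relative two-cocycle on the lattice is the coboundary of a compactly
supported relative one-cochain. -/
theorem exists_cobounding (N : ℕ) (hN : 0 < N) (θ : Fin 3 → (Fin 3 → ℕ) → A)
    (hlo : ∀ i P, P i = 0 → θ i P = 0) (hhi : ∀ i P, (∃ j, N ≤ P j) → θ i P = 0)
    (hc : ∀ P, θ 2 (P + Pi.single 2 1) - θ 2 P = (θ 0 (P + Pi.single 0 1) - θ 0 P) +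
      (θ 1 (P + Pi.single 1 1) - θ 1 P)) :
    ∃ b : Fin 3 → (Fin 3 → ℕ) → A,
      (∀ i j, i ≠ j → ∀ P, P j = 0 → b i P = 0) ∧ (∀ i P, (∃ j, N ≤ P j) → b i P = 0) ∧
      (∀ P, b 1 (P + Pi.single 0 1) - b 1 P - (b 0 (P + Pi.single 1 1) - b 0 P) = θ 2 P) ∧
      (∀ P, b 2 (P + Pi.single 0 1) - b 2 P - (b 0 (P + Pi.single 2 1) - b 0 P) = θ 1 P) ∧
      (∀ P, b 1 (P + Pi.single 2 1) - b 1 P - (b 2 (P + Pi.single 1 1) - b 2 P) = θ 0 P) := by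
  have e0 : ∀ x y z : ℕ, (![x, y, z] : Fin 3 → ℕ) + Pi.single 0 1 = ![x + 1, y, z] := by
    intro x y z; ext i; fin_cases i <;> simp
  have e1 : ∀ x y z : ℕ, (![x, y, z] : Fin 3 → ℕ) + Pi.single 1 1 = ![x, y + 1, z] := by
    intro x y z; ext i; fin_cases i <;> simp
  have e2 : ∀ x y z : ℕ, (![x, y, z] : Fin 3 → ℕ) + Pi.single 2 1 = ![x, y, z + 1] := by
    intro x y z; ext i; fin_cases i <;> simp
  have eP : ∀ P : Fin 3 → ℕ, ∃ x y z, P = ![x, y, z] := fun P =>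
    ⟨P 0, P 1, P 2, by ext i; fin_cases i <;> rfl⟩
  have hc' : ∀ x y z, θ 2 ![x, y, z + 1] - θ 2 ![x, y, z] = (θ 0 ![x + 1, y, z] - θ 0 ![x, y, z]) +
      (θ 1 ![x, y + 1, z] - θ 1 ![x, y, z]) := by
    intro x y z
    have := hc ![x, y, z]
    rwa [e0, e1, e2] at this
  let b0 : ℕ → ℕ → ℕ → A := fun x y z => - ∑ k ∈ Finset.range z, θ 1 ![x, y, k]
  let b1 : ℕ → ℕ → ℕ → A := fun x y z => ∑ k ∈ Finset.range z, θ 0 ![x, y, k]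
  let u : ℕ → ℕ → A := fun x y => ∑ i ∈ Finset.range x, b0 i y N
  have h2 : ∀ x y z, b1 (x + 1) y z - b1 x y z - (b0 x (y + 1) z - b0 x y z) = θ 2 ![x, y, z] := by
    intro x y z
    induction z with
    | zero => simp [b0, b1, hlo 2 ![x, y, 0] rfl]
    | succ z ih =>
      have h := hc' x y z
      simp only [b0, b1, Finset.sum_range_succ] at ih ⊢
      rw [← sub_eq_zero] at ih h ⊢
      rw [← sub_zero (0 : A)]
      nth_rewrite 1 [← ih]
      rw [← h]
      abel
  have hu1 : ∀ x y, u x (y + 1) - u x y = b1 x y N := by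
    intro x y
    induction x with
    | zero =>
      have : ∀ k, θ 0 ![0, y, k] = 0 := fun k => hlo 0 _ rfl
      simp [u, b1, this]
    | succ x ih =>
      have h := h2 x y N
      rw [hhi 2 _ ⟨2, le_rfl⟩] at h
      simp only [u, Finset.sum_range_succ] at ih ⊢
      rw [← sub_eq_zero] at ih ⊢
      rw [← sub_zero (0 : A)]
      nth_rewrite 1 [← ih]
      rw [← h]
      abel
  have hu0 : ∀ x y, u (x + 1) y - u x y = b0 x y N := by
    intro x y
    simp [u, Finset.sum_range_succ]
  have hb0y : ∀ x z, b0 x 0 z = 0 := fun x z => by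
    have : ∀ k, θ 1 ![x, 0, k] = 0 := fun k => hlo 1 _ rfl
    simp [b0, this]
  have hb0Y : ∀ x y z, N ≤ y → b0 x y z = 0 := fun x y z hy => by
    have : ∀ k, θ 1 ![x, y, k] = 0 := fun k => hhi 1 _ ⟨1, hy⟩
    simp [b0, this]
  have hb0X : ∀ x y z, N ≤ x → b0 x y z = 0 := fun x y z hy => by
    have : ∀ k, θ 1 ![x, y, k] = 0 := fun k => hhi 1 _ ⟨0, hy⟩
    simp [b0, this]
  have hb1x : ∀ y z, b1 0 y z = 0 := fun x z => by
    have : ∀ k, θ 0 ![0, x, k] = 0 := fun k => hlo 0 _ rfl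
    simp [b1, this]
  have hb1Y : ∀ x y z, N ≤ y → b1 x y z = 0 := fun x y z hy => by
    have : ∀ k, θ 0 ![x, y, k] = 0 := fun k => hhi 0 _ ⟨1, hy⟩
    simp [b1, this]
  have hb1X : ∀ x y z, N ≤ x → b1 x y z = 0 := fun x y z hy => by
    have : ∀ k, θ 0 ![x, y, k] = 0 := fun k => hhi 0 _ ⟨0, hy⟩
    simp [b1, this]
  have huy : ∀ x, u x 0 = 0 := fun x => by simp [u, hb0y]
  have huY : ∀ x y, N ≤ y → u x y = 0 := fun x y hy => by simp [u, hb0Y _ _ _ hy]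
  have huX : ∀ x y, N ≤ x → u x y = 0 := by
    intro x y hx
    induction y with
    | zero => exact huy x
    | succ y ih =>
      have := hu1 x y
      rwa [ih, sub_zero, hb1X _ _ _ hx] at this
  refine ⟨![fun P => if P 2 < N then b0 (P 0) (P 1) (P 2) else 0,
    fun P => if P 2 < N then b1 (P 0) (P 1) (P 2) else 0,
    fun P => if P 2 + 1 = N then - u (P 0) (P 1) else 0], ?_, ?_, ?_, ?_, ?_⟩
  · intro i j hij P hP
    obtain ⟨x, y, z, rfl⟩ := eP P
    fin_cases i <;> fin_cases j <;> simp at hij hP ⊢ <;> subst hP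
    · simp [hb0y]
    · simp [b0]
    · simp [hb1x]
    · exact (if_pos hN).trans rfl
    · simp [u]
    · simp [huy]
  · rintro i P ⟨j, hP⟩
    obtain ⟨x, y, z, rfl⟩ := eP P
    fin_cases i <;> fin_cases j <;> simp at hP ⊢
    · simp [hb0X _ _ _ hP]
    · simp [hb0Y _ _ _ hP]
    · exact if_neg (by omega)
    · simp [hb1X _ _ _ hP]
    · simp [hb1Y _ _ _ hP]
    · exact if_neg (by omega)
    · simp [huX _ _ hP]
    · simp [huY _ _ hP]
    · exact if_neg (by omega)
  · intro P
    obtain ⟨x, y, z, rfl⟩ := eP P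
    rw [e0, e1]
    by_cases hz : z < N
    · simpa [hz] using h2 x y z
    · simp [hz, hhi 2 ![x, y, z] ⟨2, not_lt.1 hz⟩]
  · intro P
    obtain ⟨x, y, z, rfl⟩ := eP P
    rw [e0, e2]
    rcases lt_trichotomy (z + 1) N with h | h | h
    · have hz : z < N := by omega
      simp [h, h.ne, hz, b0, Finset.sum_range_succ]
    · have hz : z < N := by omega
      have := hu0 x y
      have hb : b0 x y N = b0 x y z - θ 1 ![x, y, z] := by
        simp only [b0, ← h, Finset.sum_range_succ]; abel
      rw [hb] at this
      simp only [Matrix.cons_val_zero, Matrix.cons_val_one, Matrix.cons_val, h, lt_irrefl, hz, if_true,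
        if_false]
      rw [eq_add_of_sub_eq this]
      abel
    · have hz : ¬ z < N := by omega
      have hz' : ¬ z + 1 < N := by omega
      simp [hz, hz', h.ne', hhi 1 ![x, y, z] ⟨2, not_lt.1 hz⟩]
  · intro P
    obtain ⟨x, y, z, rfl⟩ := eP P
    rw [e1, e2]
    rcases lt_trichotomy (z + 1) N with h | h | h
    · have hz : z < N := by omega
      simp [h, h.ne, hz, b1, Finset.sum_range_succ]
    · have hz : z < N := by omega
      have := hu1 x y
      have hb : b1 x y N = b1 x y z + θ 0 ![x, y, z] := by
        simp only [b1, ← h, Finset.sum_range_succ]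
      rw [hb] at this
      simp only [Matrix.cons_val_zero, Matrix.cons_val_one, Matrix.cons_val, h, lt_irrefl, hz, if_true,
        if_false]
      rw [eq_add_of_sub_eq this]
      abel
    · have hz : ¬ z < N := by omega
      have hz' : ¬ z + 1 < N := by omega
      simp [hz, hz', h.ne', hhi 0 ![x, y, z] ⟨2, not_lt.1 hz⟩]

end Cochains

section Push

variable {Z : Type} [TopologicalSpace Z] {e : Z}

/-- Clamping a real number to the unit interval. -/
noncomputable def clampI (t : ℝ) : I := Set.projIcc 0 1 zero_le_one t

@[fun_prop] lemma continuous_clampI : Continuous clampI :=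
  continuous_projIcc (h := zero_le_one)

lemma clampI_of_le {t : ℝ} (h : t ≤ 0) : clampI t = 0 := Set.projIcc_of_le_left _ h

lemma clampI_of_ge {t : ℝ} (h : 1 ≤ t) : clampI t = 1 := Set.projIcc_of_right_le _ h

@[simp] lemma clampI_coe (t : I) : clampI t = t := Set.projIcc_val _ t

lemma clampI_of_mem {t : ℝ} (h0 : 0 ≤ t) (h1 : t ≤ 1) : (clampI t : ℝ) = t :=
  congrArg Subtype.val (Set.projIcc_of_mem zero_le_one ⟨h0, h1⟩)

/-- The map of the plane onto the unit square clamping the square `[-1,1]²`. -/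
noncomputable def planeToSquare (w : ℂ) : Fin 2 → I := ![clampI ((w.re + 1) / 2), clampI ((w.im + 1) / 2)]

lemma continuous_planeToSquare : Continuous planeToSquare := by
  refine continuous_pi fun i => ?_
  fin_cases i <;> simp [planeToSquare] <;> fun_prop

lemma planeToSquare_mem_boundary {w : ℂ} (h : 1 ≤ |w.re| ∨ 1 ≤ |w.im|) :
    planeToSquare w ∈ Cube.boundary (Fin 2) := by
  rcases h with h | h
  · refine ⟨0, ?_⟩
    rcases le_abs.1 h with h | h
    · exact Or.inr (clampI_of_ge (by linarith))
    · exact Or.inl (clampI_of_le (by linarith))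
  · refine ⟨1, ?_⟩
    rcases le_abs.1 h with h | h
    · exact Or.inr (clampI_of_ge (by linarith))
    · exact Or.inl (clampI_of_le (by linarith))

open Classical in
/-- The function on the punctured plane defining `push`. -/
noncomputable def pushFun (a : Ω^ (Fin 2) Z e) (z : ℂ × ℂ) : Z :=
  if z.2 = 0 then e else a (planeToSquare (Complex.I * z.1 / z.2))

lemma pushFun_eq_e (a : Ω^ (Fin 2) Z e) (z : ℂ × ℂ)
    (h : z.2 = 0 ∨ 1 ≤ |(Complex.I * z.1 / z.2).re| ∨ 1 ≤ |(Complex.I * z.1 / z.2).im|) :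
    pushFun a z = e := by
  unfold pushFun
  split_ifs with h0
  · rfl
  · exact a.2 _ (planeToSquare_mem_boundary (h.resolve_left h0))

lemma pushFun_mul (a : Ω^ (Fin 2) Z e) {u : ℂ} (hu : u ≠ 0) (z : ℂ × ℂ) :
    pushFun a (u * z.1, u * z.2) = pushFun a z := by
  unfold pushFun
  simp only [mul_eq_zero, hu, false_or]
  congr 3
  rw [mul_left_comm, mul_div_mul_left _ _ hu]

/-- The map of the punctured complex plane extending a two-dimensional loop on the unit square in the
affine chart of the projective line. -/
noncomputable def push (a : Ω^ (Fin 2) Z e) : C(Punc, Z) := ⟨fun z => pushFun a z.1, by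
  rw [continuous_iff_continuousAt]
  intro z
  by_cases h : z.1.2 = 0
  · have hz : z.1.1 ≠ 0 := fun h' => z.2 (Prod.ext h' h)
    have hev : ∀ᶠ y : Punc in 𝓝 z, ‖y.1.2‖ < ‖y.1.1‖ / 2 := by
      refine ContinuousAt.eventually_lt (by fun_prop) (by fun_prop) ?_
      rw [h, norm_zero]
      have := norm_pos_iff.2 hz
      linarith
    refine (continuousAt_const (y := e)).congr ?_
    filter_upwards [hev] with y hy
    refine (pushFun_eq_e a _ ?_).symm
    rcases eq_or_ne y.1.2 0 with h0 | h0
    · exact Or.inl h0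
    · right
      by_contra hcon
      push Not at hcon
      have h1 := Complex.norm_le_abs_re_add_abs_im (Complex.I * y.1.1 / y.1.2)
      have hp := norm_pos_iff.2 h0
      rw [norm_div, norm_mul, Complex.norm_I, one_mul] at h1
      have h2 : 2 < ‖y.1.1‖ / ‖y.1.2‖ := by
        rw [lt_div_iff₀ hp]; linarith
      linarith [hcon.1, hcon.2]
  · have hev : ∀ᶠ y : Punc in 𝓝 z, y.1.2 ≠ 0 :=
      ContinuousAt.eventually_ne (by fun_prop) h
    have hc : ContinuousAt (fun y : Punc => a (planeToSquare (Complex.I * y.1.1 / y.1.2))) z := by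
      have := a.1.continuous
      refine this.continuousAt.comp (continuous_planeToSquare.continuousAt.comp ?_)
      exact ContinuousAt.div (by fun_prop) (by fun_prop) h
    refine hc.congr ?_
    filter_upwards [hev] with y hy
    exact (if_neg hy).symm⟩

@[simp] lemma push_apply (a : Ω^ (Fin 2) Z e) (z : Punc) : push a z = pushFun a z.1 := rfl

/-- A map into the punctured complex plane given by its two coordinates. -/
noncomputable def mkPunc {T : Type} [TopologicalSpace T] (p q : C(T, ℂ)) (h : ∀ t, q t = 0 → p t ≠ 0) : C(T, Punc) :=
  ⟨fun t => ⟨(p t, q t), fun h0 => h t (congrArg Prod.snd h0) (congrArg Prod.fst h0)⟩, by fun_prop⟩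

/-- The bump function on the square. -/
noncomputable def bump (x y : I) : ℝ := x * (1 - x) * (y * (1 - y))

@[fun_prop] lemma Continuous.bump {T : Type} [TopologicalSpace T] {f g : T → I} (hf : Continuous f)
    (hg : Continuous g) : Continuous fun t => bump (f t) (g t) := by
  unfold RackPi3.bump; fun_prop

lemma bump_nonneg (x y : I) : 0 ≤ bump x y := by
  have := x.2.1; have := x.2.2; have := y.2.1; have := y.2.2
  unfold bump
  have : (0 : ℝ) ≤ 1 - x := by linarith
  have : (0 : ℝ) ≤ 1 - y := by linarith
  positivity

lemma bump_eq_zero {x y : I} : bump x y = 0 ↔ x = 0 ∨ x = 1 ∨ y = 0 ∨ y = 1 := by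
  have h1 : ∀ x : I, (1 - x : ℝ) = 0 ↔ x = 1 := fun x => by
    rw [sub_eq_zero, eq_comm, ← Icc.coe_one, Subtype.ext_iff]
  unfold bump
  simp only [mul_eq_zero, h1, Icc.coe_eq_zero]
  tauto

lemma mem_boundary_two {x : Fin 2 → I} : x ∈ Cube.boundary (Fin 2) ↔ bump (x 0) (x 1) = 0 := by
  rw [bump_eq_zero]
  simp [Cube.boundary, Fin.exists_fin_two, or_assoc]

/-- The phase `exp (2πi t)`. -/
noncomputable def phase (t : ℝ) : ℂ := Complex.exp (2 * Real.pi * t * Complex.I)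

@[fun_prop] lemma continuous_phase : Continuous phase := by unfold phase; fun_prop

lemma phase_ne_zero (t : ℝ) : phase t ≠ 0 := Complex.exp_ne_zero _

lemma phase_add (s t : ℝ) : phase (s + t) = phase s * phase t := by
  unfold phase; rw [← Complex.exp_add]; push_cast; ring_nf

@[simp] lemma phase_int (n : ℤ) : phase n = 1 := by
  unfold phase
  rw [Complex.exp_eq_one_iff]
  exact ⟨n, by push_cast; ring⟩

@[simp] lemma phase_zero : phase 0 = 1 := by simpa using phase_int 0

@[simp] lemma phase_one : phase 1 = 1 := by simpa using phase_int 1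

lemma phase_im (t : ℝ) : (phase t).im = Real.sin (2 * Real.pi * t) := by
  have : (2 * Real.pi * t * Complex.I : ℂ) = ((2 * Real.pi * t : ℝ) : ℂ) * Complex.I := by push_cast; ring
  rw [phase, this, Complex.exp_ofReal_mul_I_im]

lemma phase_re (t : ℝ) : (phase t).re = Real.cos (2 * Real.pi * t) := by
  have : (2 * Real.pi * t * Complex.I : ℂ) = ((2 * Real.pi * t : ℝ) : ℂ) * Complex.I := by push_cast; ring
  rw [phase, this, Complex.exp_ofReal_mul_I_re]

/-- The disc in the punctured complex plane bounded by the circle of winding number `m`, as a map of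
the square. -/
noncomputable def disc (m : ℤ) : C(Fin 2 → I, Punc) :=
  mkPunc ⟨fun x => (1 - (x 1 : ℝ) : ℂ) * phase (m * x 0) + (x 1 : ℝ), by fun_prop⟩
    ⟨fun x => (bump (x 0) (x 1) : ℂ), by fun_prop⟩ (by
      intro x hx
      simp only [ContinuousMap.coe_mk, Complex.ofReal_eq_zero, bump_eq_zero] at hx ⊢
      rcases hx with h | h | h | h <;> simp [h, phase_ne_zero])

lemma cls_eq_of_push (a : Ω^ (Fin 2) Z e) (p q : C((Fin 2 → I) × I, ℂ)) (h : ∀ t, q t = 0 → p t ≠ 0)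
    (hb : ∀ x ∈ Cube.boundary (Fin 2), ∀ t, pushFun a (p (x, t), q (x, t)) = e) (f g : Ω^ (Fin 2) Z e)
    (hf : ∀ x, f x = pushFun a (p (x, 0), q (x, 0))) (hg : ∀ x, g x = pushFun a (p (x, 1), q (x, 1))) :
    cls f = cls g :=
  cls_eq_iff.2 <| homotopic_of_map ((push a).comp (mkPunc p q h)) (fun x => (hf x).symm)
    (fun x => (hg x).symm) hb

/-- The image under `push` of a disc. -/
noncomputable def discLoop (a : Ω^ (Fin 2) Z e) (m : ℤ) : Ω^ (Fin 2) Z e :=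
  ⟨(push a).comp (disc m), fun x hx => pushFun_eq_e a _ (Or.inl (by
    have := mem_boundary_two.1 hx
    simp [disc, mkPunc, this]))⟩

lemma cls_discLoop_add (a : Ω^ (Fin 2) Z e) (m n : ℤ) :
    cls (discLoop a (m + n)) = cls (discLoop a n) * cls (discLoop a m) := by
  have hsym : ∀ t : I, t = 0 ∨ t = 1 → ∀ s : ℝ, phase ((1 - s) * ((m + n) * t) + s *
      (m * clampI (2 * t) + n * clampI (2 * t - 1))) = 1 := by
    rintro t (rfl | rfl) s
    · rw [clampI_of_le (by simp), clampI_of_le (by simp)]; simp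
    · rw [clampI_of_ge (by simp), clampI_of_ge (by norm_num)]
      have : (1 - s) * ((m + n) * (1 : I)) + s * (m * (1 : I) + n * (1 : I)) = ((m + n : ℤ) : ℝ) := by
        push_cast [Icc.coe_one]; ring
      rw [this, phase_int]
  rw [cls_mul 0]
  refine cls_eq_of_push a
    ⟨fun u => (1 - (u.1 1 : ℝ) : ℂ) * phase ((1 - u.2) * ((m + n) * u.1 0) + u.2 *
      (m * clampI (2 * u.1 0) + n * clampI (2 * u.1 0 - 1))) + (u.1 1 : ℝ), by fun_prop⟩
    ⟨fun u => (((1 - u.2) * bump (u.1 0) (u.1 1) + u.2 *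
      (bump (clampI (2 * u.1 0)) (u.1 1) + bump (clampI (2 * u.1 0 - 1)) (u.1 1)) : ℝ) : ℂ),
      by fun_prop⟩ ?_ ?_ _ _ ?_ ?_
  · rintro ⟨x, t⟩ hx
    simp only [ContinuousMap.coe_mk, Complex.ofReal_eq_zero] at hx ⊢
    have b1 := bump_nonneg (x 0) (x 1)
    have b2 := bump_nonneg (clampI (2 * x 0)) (x 1)
    have b3 := bump_nonneg (clampI (2 * x 0 - 1)) (x 1)
    have t0 := t.2.1
    have t1 := t.2.2
    have hA : (1 - (t : ℝ)) * bump (x 0) (x 1) = 0 := by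
      have h1 : 0 ≤ (1 - (t : ℝ)) * bump (x 0) (x 1) := mul_nonneg (by linarith) b1
      have h2 := mul_nonneg t0 (add_nonneg b2 b3)
      linarith
    have hB : (t : ℝ) * (bump (clampI (2 * x 0)) (x 1) + bump (clampI (2 * x 0 - 1)) (x 1)) = 0 := by
      linarith
    rcases mul_eq_zero.1 hA with h | h
    · have ht : (t : ℝ) = 1 := by linarith
      rw [ht, one_mul] at hB
      have hb2 : bump (clampI (2 * x 0)) (x 1) = 0 := by linarith
      have hb3 : bump (clampI (2 * x 0 - 1)) (x 1) = 0 := by linarith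
      rw [bump_eq_zero] at hb2 hb3
      by_cases hx1 : x 1 = 0
      · simp [hx1, phase_ne_zero]
      by_cases hx2 : x 1 = 1
      · simp [hx2]
      simp only [hx1, hx2, or_false] at hb2 hb3
      have : phase ((1 - t) * ((m + n) * x 0) + t *
          (m * clampI (2 * x 0) + n * clampI (2 * x 0 - 1))) = 1 := by
        rw [ht]
        rcases hb2 with h2 | h2 <;> rcases hb3 with h3 | h3 <;> rw [h2, h3] <;> simp
        simpa using phase_int (m + n)
      rw [this]; simp
    · rw [bump_eq_zero] at h
      rcases h with h | h | h | h
      · rw [hsym _ (Or.inl h)]; simp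
      · rw [hsym _ (Or.inr h)]; simp
      · simp [h, phase_ne_zero]
      · simp [h]
  · intro x hx t
    refine pushFun_eq_e a _ (Or.inl ?_)
    rw [mem_boundary_two] at hx
    simp only [ContinuousMap.coe_mk, Complex.ofReal_eq_zero, hx]
    rw [bump_eq_zero] at hx
    rcases hx with h | h | h | h
    · rw [h, clampI_of_le (by simp), clampI_of_le (by simp)]; simp [bump]
    · rw [h, clampI_of_ge (by simp), clampI_of_ge (by norm_num)]; simp [bump]
    · simp [h, bump]
    · simp [h, bump]
  · intro x
    show pushFun a _ = _
    simp [disc, mkPunc]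
  · intro x
    rw [transAt_apply]
    have hx0 := (x 0).2.1
    have hx1 := (x 0).2.2
    split_ifs with h
    · show pushFun a _ = _
      have h1 : clampI (2 * x 0 - 1) = 0 := clampI_of_le (by linarith)
      have h2 : bump 0 (x 1) = 0 := by simp [bump]
      simp only [ContinuousMap.coe_mk, h1, h2]
      simp [disc, mkPunc, clampI]
    · show pushFun a _ = _
      have h1 : clampI (2 * x 0) = 1 := clampI_of_ge (by linarith)
      have h2 : bump 1 (x 1) = 0 := by simp [bump]
      simp only [ContinuousMap.coe_mk, h1, h2]
      simp [disc, mkPunc, clampI, phase_add]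

lemma no_common_zero {s t : ℝ} (s0 : 0 ≤ s) (s1 : s ≤ 1) (t0 : 0 ≤ t) (t1 : t ≤ 1)
    (h1 : (1 - t) * Real.cos (2 * Real.pi * s) + -t = 0)
    (h2 : (1 - t) * Real.sin (2 * Real.pi * s) + t * (1 - 2 * s) = 0) : False := by
  have hp := Real.pi_pos
  have hsc := Real.sin_sq_add_cos_sq (2 * Real.pi * s)
  rcases eq_or_lt_of_le t0 with ht | ht
  · rw [← ht] at h1 h2
    have e1 : Real.cos (2 * Real.pi * s) = 0 := by linarith
    have e2 : Real.sin (2 * Real.pi * s) = 0 := by linarith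
    rw [e1, e2] at hsc
    norm_num at hsc
  rcases lt_trichotomy s (1 / 2) with h | h | h
  · have hs : 0 ≤ Real.sin (2 * Real.pi * s) :=
      Real.sin_nonneg_of_nonneg_of_le_pi (by positivity) (by nlinarith)
    have := mul_nonneg (sub_nonneg.2 t1) hs
    have := mul_pos ht (show 0 < 1 - 2 * s by linarith)
    linarith
  · have : Real.cos (2 * Real.pi * s) = -1 := by
      rw [h, show 2 * Real.pi * (1 / 2) = Real.pi by ring, Real.cos_pi]
    rw [this] at h1
    linarith
  · have hs : Real.sin (2 * Real.pi * s) ≤ 0 := by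
      have : Real.sin (2 * Real.pi * s) = Real.sin (2 * Real.pi * s - 2 * Real.pi) :=
        (Real.sin_sub_two_pi _).symm
      rw [this]
      exact Real.sin_nonpos_of_nonpos_of_neg_pi_le (by nlinarith) (by nlinarith)
    have := mul_nonpos_of_nonneg_of_nonpos (sub_nonneg.2 t1) hs
    have := mul_neg_of_pos_of_neg ht (show 1 - 2 * s < 0 by linarith)
    linarith

lemma cls_discLoop_one (a : Ω^ (Fin 2) Z e) : cls (discLoop a 1) = cls a := by
  have hre : ∀ X Y : ℝ, (Complex.I * ((Y : ℂ) - Complex.I * X)) = X + Y * Complex.I := fun X Y => by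
    rw [mul_sub, ← mul_assoc, Complex.I_mul_I]; ring
  let mid : Ω^ (Fin 2) Z e := ⟨(push a).comp (mkPunc
    ⟨fun x => ((2 * x 1 - 1 : ℝ) : ℂ) - Complex.I * (2 * x 0 - 1 : ℝ), by fun_prop⟩
    ⟨fun x => (bump (x 0) (x 1) : ℂ), by fun_prop⟩ (by
      intro x hx
      simp only [ContinuousMap.coe_mk, Complex.ofReal_eq_zero, bump_eq_zero] at hx ⊢
      intro h0
      have h1 := congrArg Complex.re h0
      have h2 := congrArg Complex.im h0
      simp at h1 h2
      rcases hx with h | h | h | h <;> simp [h] at h1 h2 <;> linarith)),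
    fun x hx => pushFun_eq_e a _ (Or.inl (by
      have := mem_boundary_two.1 hx
      simp [mkPunc, this]))⟩
  trans cls mid
  · refine cls_eq_of_push a
      ⟨fun u => (1 - (u.2 : ℝ) : ℂ) * ((1 - (u.1 1 : ℝ) : ℂ) * phase (u.1 0) + (u.1 1 : ℝ)) +
        (u.2 : ℝ) * (((2 * u.1 1 - 1 : ℝ) : ℂ) - Complex.I * (2 * u.1 0 - 1 : ℝ)), by fun_prop⟩
      ⟨fun u => (bump (u.1 0) (u.1 1) : ℂ), by fun_prop⟩ ?_ ?_ _ _ ?_ ?_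
    · rintro ⟨x, t⟩ hx
      simp only [ContinuousMap.coe_mk, Complex.ofReal_eq_zero, bump_eq_zero] at hx ⊢
      have t0 := t.2.1
      have t1 := t.2.2
      intro h0
      have h1 := congrArg Complex.re h0
      have h2 := congrArg Complex.im h0
      simp [phase_re, phase_im] at h1 h2
      rcases hx with h | h | h | h
      · simp [h] at h1 h2
        simp [h2] at h1
      · simp [h] at h1 h2
        norm_num at h2
        simp [h2] at h1
      · simp [h] at h1 h2
        exact no_common_zero (x 0).2.1 (x 0).2.2 t0 t1 h1 h2
      · simp [h] at h1 h2
        norm_num at h1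
    · intro x hx t
      refine pushFun_eq_e a _ (Or.inl ?_)
      rw [mem_boundary_two] at hx
      simp [hx]
    · intro x
      show pushFun a _ = _
      simp [disc, mkPunc]
    · intro x
      show pushFun a _ = _
      simp [mkPunc]
  · refine cls_eq_of_push a
      ⟨fun u => ((2 * u.1 1 - 1 : ℝ) : ℂ) - Complex.I * (2 * u.1 0 - 1 : ℝ), by fun_prop⟩
      ⟨fun u => (((1 - u.2) * bump (u.1 0) (u.1 1) + u.2 : ℝ) : ℂ), by fun_prop⟩ ?_ ?_ _ _ ?_ ?_
    · rintro ⟨x, t⟩ hx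
      simp only [ContinuousMap.coe_mk, Complex.ofReal_eq_zero] at hx ⊢
      have t0 := t.2.1
      have t1 := t.2.2
      have b1 := bump_nonneg (x 0) (x 1)
      have hA : 0 ≤ (1 - (t : ℝ)) * bump (x 0) (x 1) := mul_nonneg (by linarith) b1
      have ht : (t : ℝ) = 0 := by linarith
      rw [ht] at hx
      simp [bump_eq_zero] at hx
      intro h0
      have h1 := congrArg Complex.re h0
      have h2 := congrArg Complex.im h0
      simp at h1 h2
      rcases hx with h | h | h | h <;> simp [h] at h1 h2 <;> linarith
    · intro x hx t
      refine pushFun_eq_e a _ ?_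
      rw [mem_boundary_two] at hx
      simp only [ContinuousMap.coe_mk, hx, mul_zero, zero_add, hre, Complex.ofReal_eq_zero,
        Complex.div_ofReal_re, Complex.div_ofReal_im]
      rcases eq_or_lt_of_le t.2.1 with ht | ht
      · exact Or.inl ht.symm
      right
      rw [abs_div, abs_div, abs_of_pos ht, le_div_iff₀ ht, le_div_iff₀ ht]
      have t1 := t.2.2
      rw [bump_eq_zero] at hx
      rcases hx with h | h | h | h <;> simp [h] <;> norm_num [t1]
    · intro x
      show pushFun a _ = _
      simp [mkPunc]
    · intro x
      simp only [ContinuousMap.coe_mk, pushFun, hre]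
      simp
      congr 1
      ext i
      fin_cases i <;> simp [planeToSquare]

/-- The class of the image of the disc of winding number `m` is the `m`-th power. -/
theorem cls_discLoop (a : Ω^ (Fin 2) Z e) (m : ℤ) : cls (discLoop a m) = cls a ^ m := by
  let φ : Multiplicative ℤ →* HomotopyGroup (Fin 2) Z e := MonoidHom.mk' (fun m => cls (discLoop a m.toAdd))
    fun m n => by rw [mul_comm m n, toAdd_mul, cls_discLoop_add]
  have h := map_zpow φ (Multiplicative.ofAdd 1) m
  have h1 : φ (Multiplicative.ofAdd 1) = cls a := cls_discLoop_one a
  rw [h1] at h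
  rw [← h, ← ofAdd_zsmul, smul_eq_mul, mul_one]
  rfl

end Push

section Squares

variable {Z : Type} [TopologicalSpace Z] {e : Z} {T : Type} [TopologicalSpace T]

/-- Multiplication of a map into the punctured plane by a phase. -/
noncomputable def pmul (p : C(T, ℝ)) (g : C(T, Punc)) : C(T, Punc) :=
  ⟨fun t => ⟨(phase (p t) * (g t).1.1, phase (p t) * (g t).1.2), fun h => (g t).2 (by
    have h1 := congrArg Prod.fst h
    have h2 := congrArg Prod.snd h
    exact Prod.ext (by simpa [phase_ne_zero] using h1) (by simpa [phase_ne_zero] using h2))⟩, by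
    fun_prop⟩

lemma push_pmul (a : Ω^ (Fin 2) Z e) (p : C(T, ℝ)) (g : C(T, Punc)) (t : T) :
    push a (pmul p g t) = push a (g t) := pushFun_mul a (phase_ne_zero _) (g t).1

/-- The base point of the punctured plane. -/
noncomputable def puncBase : Punc := ⟨(1, 0), by simp⟩

/-- The disc of winding number `m`, chosen constant for `m = 0`. -/
noncomputable def disc' (m : ℤ) : C(Fin 2 → I, Punc) :=
  if m = 0 then ContinuousMap.const _ puncBase else disc m

lemma disc'_of_boundary (m : ℤ) (y : Fin 2 → I) (hy : y 0 = 0 ∨ y 0 = 1 ∨ y 1 = 0 ∨ y 1 = 1) :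
    (disc' m y).1 = ((1 - (y 1 : ℝ) : ℂ) * phase (m * y 0) + (y 1 : ℝ), 0) := by
  unfold disc'
  split_ifs with h
  · simp [h, puncBase]
  · have := bump_eq_zero.2 hy
    simp [disc, mkPunc, this]

/-- The image under `push` of a disc. -/
noncomputable def discLoop' (a : Ω^ (Fin 2) Z e) (m : ℤ) : Ω^ (Fin 2) Z e :=
  ⟨(push a).comp (disc' m), fun x hx => pushFun_eq_e a _ (Or.inl (by
    rw [disc'_of_boundary m x (bump_eq_zero.1 (mem_boundary_two.1 hx))]))⟩

lemma cls_discLoop' (a : Ω^ (Fin 2) Z e) (m : ℤ) : cls (discLoop' a m) = cls a ^ m := by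
  by_cases h : m = 0
  · subst h
    rw [zpow_zero, ← cls_const]
    congr 1
    ext x
    show push a (disc' 0 x) = e
    exact pushFun_eq_e a _ (Or.inl (by simp [disc', puncBase]))
  · rw [← cls_discLoop]
    congr 1
    ext x
    show push a (disc' m x) = push a (disc m x)
    rw [disc', if_neg h]

/-- The square with prescribed winding numbers of the edges. -/
noncomputable def sqMap (nb nr nt nl : ℤ) : C(Fin 2 → I, Punc) :=
  pmul ⟨fun y => (nb - (nb + nr - nt - nl) : ℝ) * (y 0 * (1 - y 1)) + nl * ((1 - y 0) * y 1) +
    (nl + nt : ℝ) * (y 0 * y 1), by fun_prop⟩ (disc' (nb + nr - nt - nl))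

lemma push_sqMap (a : Ω^ (Fin 2) Z e) (nb nr nt nl : ℤ) (y : Fin 2 → I) :
    push a (sqMap nb nr nt nl y) = discLoop' a (nb + nr - nt - nl) y := push_pmul _ _ _ _

lemma sqMap_bottom (nb nr nt nl : ℤ) (t : I) :
    (sqMap nb nr nt nl ![t, 0]).1 = (phase (nb * t), 0) := by
  simp only [sqMap, pmul, ContinuousMap.coe_mk]
  rw [disc'_of_boundary _ _ (by simp)]
  simp [← phase_add]
  ring_nf

lemma sqMap_top (nb nr nt nl : ℤ) (t : I) :
    (sqMap nb nr nt nl ![t, 1]).1 = (phase (nt * t), 0) := by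
  simp only [sqMap, pmul, ContinuousMap.coe_mk]
  rw [disc'_of_boundary _ _ (by simp)]
  simp
  rw [← mul_one (phase (nt * t)), ← phase_int nl, ← phase_add]
  ring_nf

lemma sqMap_left (nb nr nt nl : ℤ) (t : I) :
    (sqMap nb nr nt nl ![0, t]).1 = (phase (nl * t), 0) := by
  simp only [sqMap, pmul, ContinuousMap.coe_mk]
  rw [disc'_of_boundary _ _ (by simp)]
  simp

lemma sqMap_right (nb nr nt nl : ℤ) (t : I) :
    (sqMap nb nr nt nl ![1, t]).1 = (phase (nr * t), 0) := by
  simp only [sqMap, pmul, ContinuousMap.coe_mk]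
  rw [disc'_of_boundary _ _ (by simp)]
  have := phase_int (nb + nr - nt - nl)
  push_cast at this
  simp [this]
  rw [← mul_one (phase (nr * t)), ← phase_int (nt + nl - nr), ← phase_add]
  push_cast
  ring_nf

lemma sqMap_zero (y : Fin 2 → I) : sqMap 0 0 0 0 y = puncBase := by
  ext1
  simp [sqMap, pmul, disc', puncBase]

/-- Shifting the edges of a square by a coboundary multiplies the square by a phase. -/
lemma sqMap_shift (nb nr nt nl w00 w10 w01 w11 : ℤ) (y : Fin 2 → I) :
    (sqMap (nb + (w10 - w00)) (nr + (w11 - w10)) (nt + (w11 - w01)) (nl + (w01 - w00)) y).1 =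
      (phase (lerp (y 1) (lerp (y 0) (w00 : ℝ) w10) (lerp (y 0) (w01 : ℝ) w11)) *
        (sqMap nb nr nt nl y).1.1,
      phase (lerp (y 1) (lerp (y 0) (w00 : ℝ) w10) (lerp (y 0) (w01 : ℝ) w11)) *
        (sqMap nb nr nt nl y).1.2) := by
  have hm : nb + (w10 - w00) + (nr + (w11 - w10)) - (nt + (w11 - w01)) - (nl + (w01 - w00)) =
      nb + nr - nt - nl := by ring
  have hp : ∀ s t : ℝ, s = t + (-w00 : ℤ) → phase s = phase t := fun s t h => by
    rw [h, phase_add, phase_int, mul_one]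
  simp only [sqMap, pmul, ContinuousMap.coe_mk, hm, ← mul_assoc, ← phase_add]
  congr 2 <;> refine hp _ _ ?_ <;> simp only [lerp, smul_eq_mul] <;> push_cast <;> ring

/-- The first coordinate of a face of a cube. -/
def fa : Fin 3 → Fin 3 := ![2, 0, 0]

/-- The second coordinate of a face of a cube. -/
def fb : Fin 3 → Fin 3 := ![1, 2, 1]

/-- The corners of a face of a cube. -/
def fcor (i : Fin 3) (b s t : Bool) : Fin 3 → Bool :=
  Function.update (Function.update (Function.update ![false, false, false] i b) (fa i) s) (fb i) t

lemma fcor_zero (b s t : Bool) : fcor 0 b s t = ![b, t, s] := by revert b s t; decide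
lemma fcor_one (b s t : Bool) : fcor 1 b s t = ![s, b, t] := by revert b s t; decide
lemma fcor_two (b s t : Bool) : fcor 2 b s t = ![s, t, b] := by revert b s t; decide

lemma fcor_step_a : ∀ i b t, fcor i b false t (fa i) = false ∧
    Function.update (fcor i b false t) (fa i) true = fcor i b true t := by decide

lemma fcor_step_b : ∀ i b s, fcor i b s false (fb i) = false ∧
    Function.update (fcor i b s false) (fb i) true = fcor i b s true := by decide

lemma fa_ne : ∀ i, fa i ≠ i := by decide
lemma fb_ne : ∀ i, fb i ≠ i := by decide

lemma exists_third : ∀ i j : Fin 3, ∃ k, i ≠ k ∧ j ≠ k := by decide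

/-- The coboundary on a face of a cube of a cochain on the edges. -/
def cbd {A : Type} [AddCommGroup A] (ν : Fin 3 → (Fin 3 → Bool) → A) (i : Fin 3) (b : Bool) : A :=
  ν (fa i) (fcor i b false false) + ν (fb i) (fcor i b true false) - ν (fa i) (fcor i b false true) -
    ν (fb i) (fcor i b false false)

/-- The square on a face of a cube. -/
noncomputable def faceSq (ν : Fin 3 → (Fin 3 → Bool) → ℤ) (i : Fin 3) (b : Bool) : C(Fin 2 → I, Punc) :=
  sqMap (ν (fa i) (fcor i b false false)) (ν (fb i) (fcor i b true false))
    (ν (fa i) (fcor i b false true)) (ν (fb i) (fcor i b false false))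

lemma push_faceSq (a : Ω^ (Fin 2) Z e) (ν : Fin 3 → (Fin 3 → Bool) → ℤ) (i : Fin 3) (b : Bool)
    (y : Fin 2 → I) : push a (faceSq ν i b y) = discLoop' a (cbd ν i b) y := push_sqMap _ _ _ _ _ _

lemma faceSq_edge (ν : Fin 3 → (Fin 3 → Bool) → ℤ) (i j k : Fin 3) (hij : i ≠ j) (hik : i ≠ k)
    (hjk : j ≠ k) (b b' : Bool) (x : Fin 3 → I) (hx : x j = ev b') :
    (faceSq ν i b ![x (fa i), x (fb i)]).1 =
      (phase (ν k (Function.update (Function.update ![false, false, false] i b) j b') * x k), 0) := by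
  have h0 := fun b₀ b₁ b₂ b => (update_vec_bool b₀ b₁ b₂ b).1
  have h1 := fun b₀ b₁ b₂ b => (update_vec_bool b₀ b₁ b₂ b).2.1
  have h2 := fun b₀ b₁ b₂ b => (update_vec_bool b₀ b₁ b₂ b).2.2
  fin_cases i <;> fin_cases j <;> (try exact absurd rfl hij) <;> fin_cases k <;>
    (try exact absurd rfl hik) <;> (try exact absurd rfl hjk) <;> cases b' <;>
    simp [faceSq, fcor_zero, fcor_one, fcor_two, fa, fb, h0, h1, h2] at hx ⊢ <;>
    simp only [hx, sqMap_left, sqMap_right, sqMap_top, sqMap_bottom]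

lemma exists_fill (ν : Fin 3 → (Fin 3 → Bool) → ℤ) :
    ∃ G : C(Fin 3 → I, Punc), ∀ i b x, x i = ev b → G x = faceSq ν i b ![x (fa i), x (fb i)] := by
  obtain ⟨G, -, hG⟩ := extProp_punc.exists_of_faces (k := 3) Finset.univ le_rfl
    (fun i b x => faceSq ν i b ![x (fa i), x (fb i)])
    (fun i _ b => by
      refine Continuous.continuousOn ((faceSq ν i b).continuous.comp ?_)
      refine continuous_pi fun j => ?_
      fin_cases j <;> simp <;> fun_prop)
    (fun _ _ _ _ _ => mem_univ _) (by
      intro i _ b j _ b' x hi hj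
      by_cases hij : i = j
      · subst hij
        have : b = b' := ev_injective (hi.symm.trans hj)
        rw [this]
      · obtain ⟨k, hik, hjk⟩ := exists_third i j
        ext1
        rw [faceSq_edge ν i j k hij hik hjk b b' x hj, faceSq_edge ν j i k (Ne.symm hij) hjk hik b' b x hi,
          Function.update_comm hij])
  exact ⟨G, fun i b x hx => hG i (Finset.mem_univ _) b x hx⟩

lemma exists_primitive (ν ν' : Fin 3 → (Fin 3 → Bool) → ℤ) (h : ∀ i b, cbd ν i b = cbd ν' i b) :
    ∃ w : (Fin 3 → Bool) → ℤ, ∀ k v, v k = false →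
      ν k v = ν' k v + (w (Function.update v k true) - w v) := by
  have h0 := fun b₀ b₁ b₂ b => (update_vec_bool b₀ b₁ b₂ b).1
  have h1 := fun b₀ b₁ b₂ b => (update_vec_bool b₀ b₁ b₂ b).2.1
  have h2 := fun b₀ b₁ b₂ b => (update_vec_bool b₀ b₁ b₂ b).2.2
  refine ⟨fun v => (if v 0 then (ν 0 ![false, false, false] - ν' 0 ![false, false, false]) else 0) +
    (if v 1 then (ν 1 ![v 0, false, false] - ν' 1 ![v 0, false, false]) else 0) +
    (if v 2 then (ν 2 ![v 0, v 1, false] - ν' 2 ![v 0, v 1, false]) else 0), ?_⟩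
  intro k v hv
  obtain ⟨a, b, c, rfl⟩ : ∃ a b c, v = ![a, b, c] :=
    ⟨v 0, v 1, v 2, by ext j; fin_cases j <;> rfl⟩
  have H0 := fun b => h 0 b
  have H1 := fun b => h 1 b
  have H2 := fun b => h 2 b
  simp [cbd, fcor_zero, fcor_one, fcor_two, fa, fb] at H0 H1 H2
  fin_cases k <;> simp at hv <;> subst hv <;> simp [h0, h1, h2]
  · cases b <;> cases c <;> simp <;> linarith [H2.1, H2.2, H1.1, H1.2]
  · cases a <;> cases c <;> simp <;> linarith [H0.1, H0.2]
  · cases a <;> cases b <;> simp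

lemma tri_face (w : (Fin 3 → Bool) → ℝ) (i : Fin 3) (b : Bool) (x : Fin 3 → I) (hx : x i = ev b) :
    tri w x = lerp (x (fb i)) (lerp (x (fa i)) (w (fcor i b false false)) (w (fcor i b true false)))
      (lerp (x (fa i)) (w (fcor i b false true)) (w (fcor i b true true))) := by
  fin_cases i <;> cases b <;> simp [fcor_zero, fcor_one, fcor_two, fa, fb] at hx ⊢ <;>
    simp [tri, hx] <;> simp [lerp] <;> ring

/-- Fillings of cubes, which up to phase depend on the coboundary of the edge cochain only. -/
theorem exists_fillings : ∃ Φ : (Fin 3 → Bool → ℤ) → C(Fin 3 → I, Punc),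
    ∀ ν, ∃ p : C(Fin 3 → I, ℝ), ∀ i b x, x i = ev b →
      pmul p (Φ (cbd ν)) x = faceSq ν i b ![x (fa i), x (fb i)] := by
  have key : ∀ m : Fin 3 → Bool → ℤ, ∃ Φ : C(Fin 3 → I, Punc), ∀ ν, cbd ν = m →
      ∃ p : C(Fin 3 → I, ℝ), ∀ i b x, x i = ev b →
        pmul p Φ x = faceSq ν i b ![x (fa i), x (fb i)] := by
    intro m
    by_cases hm : ∃ ν', cbd ν' = m
    · obtain ⟨ν', rfl⟩ := hm
      obtain ⟨G, hG⟩ := exists_fill ν'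
      refine ⟨G, fun ν hν => ?_⟩
      obtain ⟨w, hw⟩ := exists_primitive ν ν' fun i b => congrFun (congrFun hν i) b
      refine ⟨⟨tri fun v => (w v : ℝ), continuous_tri _⟩, fun i b x hx => ?_⟩
      have e1 : ν (fa i) (fcor i b false false) = ν' (fa i) (fcor i b false false) +
          (w (fcor i b true false) - w (fcor i b false false)) := by
        rw [hw _ _ (fcor_step_a _ _ _).1, (fcor_step_a _ _ _).2]
      have e2 : ν (fb i) (fcor i b true false) = ν' (fb i) (fcor i b true false) +
          (w (fcor i b true true) - w (fcor i b true false)) := by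
        rw [hw _ _ (fcor_step_b _ _ _).1, (fcor_step_b _ _ _).2]
      have e3 : ν (fa i) (fcor i b false true) = ν' (fa i) (fcor i b false true) +
          (w (fcor i b true true) - w (fcor i b false true)) := by
        rw [hw _ _ (fcor_step_a _ _ _).1, (fcor_step_a _ _ _).2]
      have e4 : ν (fb i) (fcor i b false false) = ν' (fb i) (fcor i b false false) +
          (w (fcor i b false true) - w (fcor i b false false)) := by
        rw [hw _ _ (fcor_step_b _ _ _).1, (fcor_step_b _ _ _).2]
      ext1
      rw [faceSq, e1, e2, e3, e4, sqMap_shift]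
      simp only [pmul, ContinuousMap.coe_mk]
      rw [tri_face _ i b x hx, hG i b x hx]
      rfl
    · exact ⟨ContinuousMap.const _ puncBase, fun ν hν => absurd ⟨ν, hν⟩ hm⟩
  choose Φ hΦ using key
  exact ⟨Φ, fun ν => hΦ _ ν rfl⟩

/-- The restriction of a lattice cochain to a cube. -/
def loc {A : Type} (n : Fin 3 → (Fin 3 → ℕ) → A) (P : Fin 3 → ℕ) (k : Fin 3) (v : Fin 3 → Bool) : A :=
  n k fun i => P i + (v i).toNat

lemma fcor_self (i : Fin 3) (b s t : Bool) : fcor i b s t i = b := by revert i b s t; decide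

lemma fcor_of_ne (i j : Fin 3) (h : j ≠ i) (b b' s t : Bool) : fcor i b s t j = fcor i b' s t j := by
  revert i j b b' s t; decide

lemma loc_fcor {A : Type} (n : Fin 3 → (Fin 3 → ℕ) → A) (P P' : Fin 3 → ℕ) (i : Fin 3) 
    (h : P i + 1 = P' i) (h' : ∀ j, j ≠ i → P j = P' j) (k : Fin 3) (s t : Bool) :
    loc n P k (fcor i true s t) = loc n P' k (fcor i false s t) := by
  unfold loc
  congr 1
  ext j
  by_cases hj : j = i
  · subst hj
    simp [fcor_self, h]
  · rw [h' j hj, fcor_of_ne i j hj]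

lemma faceSq_loc (n : Fin 3 → (Fin 3 → ℕ) → ℤ) (P P' : Fin 3 → ℕ) (i : Fin 3) 
    (h : P i + 1 = P' i) (h' : ∀ j, j ≠ i → P j = P' j) :
    faceSq (loc n P) i true = faceSq (loc n P') i false := by
  simp only [faceSq, loc_fcor n P P' i h h']

/-- A relative integral cochain on the edges of the lattice gives a loop in the punctured plane with
values on cells determined up to phase by the coboundary. -/
theorem exists_lattice_fill : ∃ Φ : (Fin 3 → Bool → ℤ) → C(Fin 3 → I, Punc),
    ∀ (n : Fin 3 → (Fin 3 → ℕ) → ℤ) (N : ℕ), 0 < N →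
    (∀ i j, i ≠ j → ∀ P, P j = 0 → n i P = 0) → (∀ i P, (∃ j, N ≤ P j) → n i P = 0) →
    ∃ F : Ω^ (Fin 3) Punc puncBase, ∀ Q : Fin 3 → Fin N,
      (∃ p : C(Fin 3 → I, ℝ), sub F.1 Q = pmul p (Φ (cbd (loc n fun i => Q i)))) ∧
      ∀ i b x, x i = ev b → sub F.1 Q x = faceSq (loc n fun i => Q i) i b ![x (fa i), x (fb i)] := by
  obtain ⟨Φ, hΦ⟩ := exists_fillings
  refine ⟨Φ, fun n N hN hlo hhi => ?_⟩
  have := fun Q : Fin 3 → Fin N => hΦ (loc n fun i => Q i)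
  choose p hp using this
  obtain ⟨F, hF⟩ := exists_grid_glue (T := Unit) hN
    (fun Q => (pmul (p Q) (Φ (cbd (loc n fun i => Q i)))).comp ContinuousMap.fst) (by
      intro Q i q hq x t
      simp only [ContinuousMap.comp_apply, ContinuousMap.fst_apply]
      rw [hp Q i true _ (by simp), hp _ i false _ (by simp),
        faceSq_loc n _ (fun j => (Function.update Q i q j : ℕ)) i (by simp [hq])
          (fun j hj => by simp [hj])]
      simp [fa_ne, fb_ne])
  have hF' : ∀ Q x, F (gcell N Q x, ()) = pmul (p Q) (Φ (cbd (loc n fun i => Q i))) x := fun Q x => hF Q x ()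
  refine ⟨⟨F.comp ⟨fun x => (x, ()), by fun_prop⟩, ?_⟩, fun Q => ⟨⟨p Q, ?_⟩, ?_⟩⟩
  · intro y hy
    obtain ⟨Q, x, rfl⟩ := exists_gcell_eq hN y
    show F (gcell N Q x, ()) = puncBase
    rw [hF']
    obtain ⟨i, h | h⟩ := gcell_mem_boundary_cases hy
    · rw [hp Q i false x (by simpa using h.2)]
      have hz : ∀ k s t, i ≠ k → loc n (fun i => (Q i : ℕ)) k (fcor i false s t) = 0 := by
        intro k s t hk
        refine hlo k i hk.symm _ ?_
        simp [fcor_self, h.1]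
      simp only [faceSq, hz _ _ _ (fa_ne i).symm, hz _ _ _ (fb_ne i).symm, sqMap_zero]
    · rw [hp Q i true x (by simpa using h.2)]
      have hz : ∀ k s t, loc n (fun i => (Q i : ℕ)) k (fcor i true s t) = 0 := by
        intro k s t
        refine hhi k _ ⟨i, ?_⟩
        simp [fcor_self, h.1]
      simp only [faceSq, hz, sqMap_zero]
  · ext1 x
    exact hF' Q x
  · intro i b x hx
    rw [← hp Q i b x hx]
    exact hF' Q x

end Squares

section CubeBoundary

variable {Z : Type} [TopologicalSpace Z] {e : Z}

/-- A map of the interval preserving the set of end points. -/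
def PresEnds (α : C(I, I)) : Prop := ∀ s, s = 0 ∨ s = 1 → α s = 0 ∨ α s = 1

/-- Coordinatewise reparametrization of a loop. -/
def reparam (a : Ω^ (Fin 2) Z e) (α β : C(I, I)) (hα : PresEnds α) (hβ : PresEnds β) : Ω^ (Fin 2) Z e :=
  ⟨a.1.comp ⟨fun y => ![α (y 0), β (y 1)], by
    refine continuous_pi fun j => ?_
    fin_cases j <;> simp <;> fun_prop⟩, by
    rintro y ⟨j, hj⟩
    refine a.2 _ ⟨j, ?_⟩
    fin_cases j
    · exact hα _ hj
    · exact hβ _ hj⟩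

lemma continuous_lerpI {T : Type} [TopologicalSpace T] {f g h : T → I} (hf : Continuous f)
    (hg : Continuous g) (hh : Continuous h) :
    Continuous fun t => clampI (lerp (f t) (g t : ℝ) (h t)) := by
  unfold lerp; fun_prop

lemma cls_reparam_congr (a : Ω^ (Fin 2) Z e) (α β α' β' : C(I, I)) (hα : PresEnds α) (hβ : PresEnds β)
    (hα' : PresEnds α') (hβ' : PresEnds β') (h0 : ∀ s, s = 0 ∨ s = 1 → α s = α' s)
    (h1 : ∀ s, s = 0 ∨ s = 1 → β s = β' s) :
    cls (reparam a α β hα hβ) = cls (reparam a α' β' hα' hβ') := by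
  rw [cls_eq_iff]
  refine homotopic_of_map (a.1.comp ⟨fun u => ![clampI (lerp u.2 (α (u.1 0) : ℝ) (α' (u.1 0))),
    clampI (lerp u.2 (β (u.1 1) : ℝ) (β' (u.1 1)))], ?_⟩) ?_ ?_ ?_
  · refine continuous_pi fun j => ?_
    fin_cases j
    · exact continuous_lerpI (by fun_prop) (by fun_prop) (by fun_prop)
    · exact continuous_lerpI (by fun_prop) (by fun_prop) (by fun_prop)
  · intro x
    simp [reparam]
    rfl
  · intro x
    simp [reparam]
    rfl
  · rintro y ⟨j, hj⟩ t
    refine a.2 _ ⟨j, ?_⟩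
    fin_cases j
    · have hj' : y 0 = 0 ∨ y 0 = 1 := hj
      show clampI (lerp t (α (y 0) : ℝ) (α' (y 0))) = 0 ∨ clampI (lerp t (α (y 0) : ℝ) (α' (y 0))) = 1
      rw [← h0 _ hj', lerp_self, clampI_coe]
      exact hα _ hj'
    · have hj' : y 1 = 0 ∨ y 1 = 1 := hj
      show clampI (lerp t (β (y 1) : ℝ) (β' (y 1))) = 0 ∨ clampI (lerp t (β (y 1) : ℝ) (β' (y 1))) = 1
      rw [← h1 _ hj', lerp_self, clampI_coe]
      exact hβ _ hj'

lemma presEnds_id : PresEnds (ContinuousMap.id I) := fun _ h => h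

lemma presEnds_symm : PresEnds ⟨σ, by fun_prop⟩ := by
  rintro s (rfl | rfl) <;> simp

lemma cls_reparam (a : Ω^ (Fin 2) Z e) (α β : C(I, I)) (hα : PresEnds α) (hβ : PresEnds β)
    (h0 : ∀ s, s = 0 ∨ s = 1 → α s = s) (h1 : ∀ s, s = 0 ∨ s = 1 → β s = s) :
    cls (reparam a α β hα hβ) = cls a := by
  rw [cls_reparam_congr a α β _ _ hα hβ presEnds_id presEnds_id h0 h1]
  congr 1
  ext y
  show a ![y 0, y 1] = a y
  congr 1
  ext j; fin_cases j <;> rfl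

lemma cls_reparam_symm_left (a : Ω^ (Fin 2) Z e) (α β : C(I, I)) (hα : PresEnds α) (hβ : PresEnds β)
    (h0 : ∀ s, s = 0 ∨ s = 1 → α s = σ s) (h1 : ∀ s, s = 0 ∨ s = 1 → β s = s) :
    cls (reparam a α β hα hβ) = (cls a)⁻¹ := by
  rw [cls_reparam_congr a α β _ _ hα hβ presEnds_symm presEnds_id h0 h1]
  refine Eq.trans ?_ (HomotopyGroup.inv_spec (i := (0 : Fin 2)) (p := a)).symm
  show cls _ = cls _
  congr 1
  ext y
  show a ![σ (y 0), y 1] = a fun j => _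
  congr 1
  ext j; fin_cases j <;> rfl

lemma cls_reparam_symm_right (a : Ω^ (Fin 2) Z e) (α β : C(I, I)) (hα : PresEnds α) (hβ : PresEnds β)
    (h0 : ∀ s, s = 0 ∨ s = 1 → α s = s) (h1 : ∀ s, s = 0 ∨ s = 1 → β s = σ s) :
    cls (reparam a α β hα hβ) = (cls a)⁻¹ := by
  rw [cls_reparam_congr a α β _ _ hα hβ presEnds_id presEnds_symm h0 h1]
  refine Eq.trans ?_ (HomotopyGroup.inv_spec (i := (1 : Fin 2)) (p := a)).symm
  show cls _ = cls _
  congr 1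
  ext y
  show a ![y 0, σ (y 1)] = a fun j => _
  congr 1
  ext j; fin_cases j <;> rfl

/-- The inclusion of a square as a face of the cube. -/
def faceIncl (i : Fin 3) (t : I) (y : Fin 2 → I) : Fin 3 → I :=
  Function.update (Function.update (fun _ => t) (fa i) (y 0)) (fb i) (y 1)

lemma faceIncl_zero (t : I) (y : Fin 2 → I) : faceIncl 0 t y = ![t, y 1, y 0] := by
  ext j; fin_cases j <;> simp [faceIncl, fa, fb]

lemma faceIncl_one (t : I) (y : Fin 2 → I) : faceIncl 1 t y = ![y 0, t, y 1] := by
  ext j; fin_cases j <;> simp [faceIncl, fa, fb]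

lemma faceIncl_two (t : I) (y : Fin 2 → I) : faceIncl 2 t y = ![y 0, y 1, t] := by
  ext j; fin_cases j <;> simp [faceIncl, fa, fb]

lemma faceIncl_self (i : Fin 3) (t : I) (y : Fin 2 → I) : faceIncl i t y i = t := by
  fin_cases i <;> simp [faceIncl, fa, fb]

lemma faceIncl_eq (i : Fin 3) (x : Fin 3 → I) : faceIncl i (x i) ![x (fa i), x (fb i)] = x := by
  ext j
  fin_cases i <;> fin_cases j <;> simp [faceIncl, fa, fb]

/-- All edges of a cube are mapped to the base point. -/
def EdgesTriv (e : Z) (c : C(Fin 3 → I, Z)) : Prop :=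
  ∀ x i j, i ≠ j → (∃ b, x i = ev b) → (∃ b, x j = ev b) → c x = e

/-- The loop given by a face of a cube with trivial edges. -/
def faceLoop (c : C(Fin 3 → I, Z)) (hc : EdgesTriv e c) (i : Fin 3) (b : Bool) : Ω^ (Fin 2) Z e :=
  ⟨c.comp ⟨faceIncl i (ev b), by unfold faceIncl; fun_prop⟩, by
    rintro y ⟨j, hj⟩
    have hj' : ∃ b', y j = ev b' := by
      rcases hj with h | h
      · exact ⟨false, by simpa using h⟩
      · exact ⟨true, by simpa using h⟩
    refine hc _ i (![fa i, fb i] j) ?_ ⟨b, faceIncl_self _ _ _⟩ ?_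
    · fin_cases j
      · exact (fa_ne i).symm
      · exact (fb_ne i).symm
    · fin_cases j <;> fin_cases i <;> simpa [faceIncl, fa, fb] using hj'⟩

/-- The middle, left and right thirds of the interval. -/
noncomputable def midThird : C(I, I) := ⟨fun s => clampI (3 * s - 1), by fun_prop⟩

noncomputable def leftThird : C(I, I) := ⟨fun s => clampI (3 * s), by fun_prop⟩

noncomputable def rightThird : C(I, I) := ⟨fun s => clampI (3 - 3 * s), by fun_prop⟩

lemma thirds_cases (s : I) : (midThird s = 0 ∧ rightThird s = 1) ∨
    (leftThird s = 1 ∧ rightThird s = 1) ∨ (midThird s = 1 ∧ leftThird s = 1) := by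
  simp only [midThird, leftThird, rightThird, ContinuousMap.coe_mk]
  by_cases h1 : (s : ℝ) ≤ 1 / 3
  · exact Or.inl ⟨clampI_of_le (by linarith), clampI_of_ge (by linarith)⟩
  · by_cases h2 : (s : ℝ) ≤ 2 / 3
    · exact Or.inr (Or.inl ⟨clampI_of_ge (by linarith), clampI_of_ge (by linarith)⟩)
    · exact Or.inr (Or.inr ⟨clampI_of_ge (by linarith), clampI_of_ge (by linarith)⟩)

lemma midThird_ends (s : I) (h : s = 0 ∨ s = 1) : midThird s = s := by
  rcases h with rfl | rfl
  · exact clampI_of_le (by simp)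
  · exact clampI_of_ge (by norm_num)

lemma leftThird_ends (s : I) (h : s = 0 ∨ s = 1) : leftThird s = s := by
  rcases h with rfl | rfl
  · exact clampI_of_le (by simp)
  · exact clampI_of_ge (by norm_num)

lemma rightThird_ends (s : I) (h : s = 0 ∨ s = 1) : rightThird s = σ s := by
  rcases h with rfl | rfl
  · rw [unitInterval.symm_zero]; exact clampI_of_ge (by norm_num)
  · rw [unitInterval.symm_one]; exact clampI_of_le (by norm_num)

lemma presEnds_of_eq {α : C(I, I)} (h : ∀ s, s = 0 ∨ s = 1 → α s = s) : PresEnds α :=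
  fun s hs => by rw [h s hs]; exact hs

lemma presEnds_of_eq_symm {α : C(I, I)} (h : ∀ s, s = 0 ∨ s = 1 → α s = σ s) : PresEnds α :=
  fun s hs => by rw [h s hs]; rcases hs with rfl | rfl <;> simp

/-- The height function of an open box. -/
noncomputable def boxHeight (y : Fin 2 → I) : I :=
  min (min (leftThird (y 0)) (rightThird (y 0))) (min (leftThird (y 1)) (rightThird (y 1)))

lemma boxHeight_of_boundary {y : Fin 2 → I} (hy : y ∈ Cube.boundary (Fin 2)) : boxHeight y = 0 := by
  obtain ⟨j, hj⟩ := hy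
  refine le_antisymm ?_ (unitInterval.nonneg _)
  rcases (Fin.exists_fin_two (p := fun j => y j = 0 ∨ y j = 1)).1 ⟨j, hj⟩ with h | h
  · refine (min_le_left _ _).trans ?_
    rcases h with h | h
    · exact (min_le_left _ _).trans (by rw [leftThird_ends _ (Or.inl h), h])
    · exact (min_le_right _ _).trans (by rw [rightThird_ends _ (Or.inr h), h, unitInterval.symm_one])
  · refine (min_le_right _ _).trans ?_
    rcases h with h | h
    · exact (min_le_left _ _).trans (by rw [leftThird_ends _ (Or.inl h), h])
    · exact (min_le_right _ _).trans (by rw [rightThird_ends _ (Or.inr h), h, unitInterval.symm_one])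

/-- The alternating product of the faces of a cube with trivial edges is trivial. -/
lemma cls_faceLoop_two (H : HStr Z e) (c : C(Fin 3 → I, Z)) (hc : EdgesTriv e c) :
    cls (faceLoop c hc 2 false) = cls (faceLoop c hc 2 true) * (cls (faceLoop c hc 0 false) *
      ((cls (faceLoop c hc 0 true))⁻¹ * (cls (faceLoop c hc 1 false) *
        (cls (faceLoop c hc 1 true))⁻¹))) := by
  have hm := presEnds_of_eq midThird_ends
  have hl := presEnds_of_eq leftThird_ends
  have hr := presEnds_of_eq_symm rightThird_ends
  rw [← cls_reparam (faceLoop c hc 2 true) midThird midThird hm hm midThird_ends midThird_ends,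
    ← cls_reparam (faceLoop c hc 0 false) leftThird midThird hl hm leftThird_ends midThird_ends,
    ← cls_reparam_symm_left (faceLoop c hc 0 true) rightThird midThird hr hm rightThird_ends
      midThird_ends,
    ← cls_reparam (faceLoop c hc 1 false) midThird leftThird hm hl midThird_ends leftThird_ends,
    ← cls_reparam_symm_right (faceLoop c hc 1 true) midThird rightThird hm hr midThird_ends
      rightThird_ends]
  simp only [← H.cls_lmul]
  rw [cls_eq_iff]
  have edge : ∀ u v w : I, ((u = 0 ∨ u = 1) ∧ (v = 0 ∨ v = 1)) ∨ ((u = 0 ∨ u = 1) ∧ (w = 0 ∨ w = 1)) ∨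
      ((v = 0 ∨ v = 1) ∧ (w = 0 ∨ w = 1)) → c ![u, v, w] = e := by
    have key : ∀ u : I, (u = 0 ∨ u = 1) → ∃ b, u = ev b := by
      rintro u (rfl | rfl)
      · exact ⟨false, by simp⟩
      · exact ⟨true, by simp⟩
    rintro u v w (⟨h1, h2⟩ | ⟨h1, h2⟩ | ⟨h1, h2⟩)
    · exact hc _ 0 1 (by decide) (key _ h1) (key _ h2)
    · exact hc _ 0 2 (by decide) (key _ h1) (key _ h2)
    · exact hc _ 1 2 (by decide) (key _ h1) (key _ h2)
  have min1 : ∀ a : I, min a 1 = a := fun a => min_eq_left unitInterval.le_one'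
  have min1' : ∀ a : I, min 1 a = a := fun a => min_eq_right unitInterval.le_one'
  have hcomp : ∀ y : Fin 2 → I,
      H.lmul (reparam (faceLoop c hc 2 true) midThird midThird hm hm)
        (H.lmul (reparam (faceLoop c hc 0 false) leftThird midThird hl hm)
          (H.lmul (reparam (faceLoop c hc 0 true) rightThird midThird hr hm)
            (H.lmul (reparam (faceLoop c hc 1 false) midThird leftThird hm hl)
              (reparam (faceLoop c hc 1 true) midThird rightThird hm hr)))) y =
      c ![midThird (y 0), midThird (y 1), boxHeight y] := by
    intro y
    show H.mul (c (faceIncl 2 (ev true) ![midThird (y 0), midThird (y 1)]))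
      (H.mul (c (faceIncl 0 (ev false) ![leftThird (y 0), midThird (y 1)]))
      (H.mul (c (faceIncl 0 (ev true) ![rightThird (y 0), midThird (y 1)]))
      (H.mul (c (faceIncl 1 (ev false) ![midThird (y 0), leftThird (y 1)]))
        (c (faceIncl 1 (ev true) ![midThird (y 0), rightThird (y 1)]))))) = _
    rw [faceIncl_two, faceIncl_zero, faceIncl_zero, faceIncl_one, faceIncl_one]
    simp only [ev_true, ev_false, Matrix.cons_val_zero, Matrix.cons_val_one, boxHeight]
    rcases thirds_cases (y 0) with ⟨h1, h2⟩ | ⟨h1, h2⟩ | ⟨h1, h2⟩ <;>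
    rcases thirds_cases (y 1) with ⟨h3, h4⟩ | ⟨h3, h4⟩ | ⟨h3, h4⟩ <;>
    simp [h1, h2, h3, h4, edge, H.e_mul, H.mul_e, min1, min1']
  refine homotopic_of_map (c.comp ⟨fun u => ![clampI (lerp u.2 (u.1 0 : ℝ) (midThird (u.1 0))),
    clampI (lerp u.2 (u.1 1 : ℝ) (midThird (u.1 1))), clampI (u.2 * boxHeight u.1)], ?_⟩) ?_ ?_ ?_
  · refine continuous_pi fun j => ?_
    fin_cases j
    · exact continuous_lerpI (by fun_prop) (by fun_prop) (by fun_prop)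
    · exact continuous_lerpI (by fun_prop) (by fun_prop) (by fun_prop)
    · show Continuous fun u : (Fin 2 → I) × I => clampI (u.2 * boxHeight u.1)
      unfold boxHeight
      fun_prop
  · intro x
    show c ![clampI (lerp 0 (x 0 : ℝ) (midThird (x 0))), clampI (lerp 0 (x 1 : ℝ) (midThird (x 1))),
      clampI ((0 : I) * boxHeight x)] = c (faceIncl 2 (ev false) x)
    rw [faceIncl_two, lerp_zero, lerp_zero, clampI_coe, clampI_coe, clampI_of_le (by simp)]
    simp
  · intro x
    rw [hcomp]
    show c ![clampI (lerp 1 (x 0 : ℝ) (midThird (x 0))), clampI (lerp 1 (x 1 : ℝ) (midThird (x 1))),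
      clampI ((1 : I) * boxHeight x)] = _
    rw [lerp_one, lerp_one, clampI_coe, clampI_coe]
    simp
  · intro y hy t
    show c ![clampI (lerp t (y 0 : ℝ) (midThird (y 0))), clampI (lerp t (y 1 : ℝ) (midThird (y 1))),
      clampI (t * boxHeight y)] = e
    rw [boxHeight_of_boundary hy]
    have h3 : clampI ((t : ℝ) * (0 : I)) = 0 := clampI_of_le (by simp)
    rw [h3]
    obtain ⟨j, hj⟩ := hy
    rcases (Fin.exists_fin_two (p := fun j => y j = 0 ∨ y j = 1)).1 ⟨j, hj⟩ with h | h
    · refine edge _ _ _ (Or.inr (Or.inl ⟨?_, Or.inl rfl⟩))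
      rw [midThird_ends _ h, lerp_self, clampI_coe]; exact h
    · refine edge _ _ _ (Or.inr (Or.inr ⟨?_, Or.inl rfl⟩))
      rw [midThird_ends _ h, lerp_self, clampI_coe]; exact h

end CubeBoundary

section Squares

variable {Z : Type} [TopologicalSpace Z] {e : Z}

/-- Fixing some coordinates at end points. -/
def rst (v : Fin 3 → Bool) (D : Finset (Fin 3)) : C(Fin 3 → I, Fin 3 → I) :=
  ⟨fun x i => if i ∈ D then ev (v i) else x i, continuous_pi fun i => by split_ifs <;> fun_prop⟩

lemma rst_apply (v : Fin 3 → Bool) (D : Finset (Fin 3)) (x : Fin 3 → I) (i : Fin 3) :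
    rst v D x i = if i ∈ D then ev (v i) else x i := rfl

lemma edgesTriv_of_types {𝒯 : Set C(Fin 3 → I, Z)} (hface : FaceClosed 𝒯)
    (hlow : ∀ c ∈ 𝒯, (cdim c).card < 2 → c = ContinuousMap.const _ e) {c : C(Fin 3 → I, Z)}
    (hc : c ∈ 𝒯) : EdgesTriv e c := by
  rintro x i j hij ⟨b, hb⟩ ⟨b', hb'⟩
  obtain ⟨c', hc', h⟩ := hface.exists_restrict hc (Function.update (fun _ => b') i b) {i, j}
  have h1 : cdim c' ⊆ Finset.univ \ {i, j} := cdim_subset fun x y hxy => by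
    rw [h, h]
    congr 1
    ext k
    by_cases hk : k ∈ ({i, j} : Finset (Fin 3))
    · simp only [hk, if_true]
    · simp only [hk, if_false]
      rw [hxy k (by simp only [Finset.mem_sdiff, Finset.mem_univ, true_and]; exact hk)]
  have h2 : (Finset.univ \ {i, j} : Finset (Fin 3)).card = 1 := by
    rw [Finset.card_sdiff_of_subset (Finset.subset_univ _), Finset.card_pair hij]; rfl
  have h3 := hlow c' hc' (lt_of_le_of_lt (Finset.card_le_card h1) (by omega))
  have h4 := h x
  rw [h3] at h4
  refine Eq.trans ?_ h4.symm
  congr 1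
  ext k
  by_cases hki : k = i
  · subst hki; simp [hb]
  · by_cases hkj : k = j
    · subst hkj; simp [hb', Ne.symm hij]
    · simp [hki, hkj]

lemma EdgesTriv.rst_eq {c : C(Fin 3 → I, Z)} (hc : EdgesTriv e c) (v : Fin 3 → Bool)
    (D : Finset (Fin 3)) {i j : Fin 3} (hij : i ≠ j) {x : Fin 3 → I}
    (hi : i ∈ D ∨ ∃ b, x i = ev b) (hj : j ∈ D ∨ ∃ b, x j = ev b) : c (rst v D x) = e := by
  refine hc _ i j hij ?_ ?_
  · rw [rst_apply]
    split_ifs with h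
    · exact ⟨_, rfl⟩
    · exact hi.resolve_left h
  · rw [rst_apply]
    split_ifs with h
    · exact ⟨_, rfl⟩
    · exact hj.resolve_left h

lemma EdgesTriv.eq_const_of_cdim {c : C(Fin 3 → I, Z)} (hc : EdgesTriv e c) (v : Fin 3 → Bool)
    (D : Finset (Fin 3)) (hd : (cdim (c.comp (rst v D))).card < 2) :
    c.comp (rst v D) = ContinuousMap.const _ e := by
  have h1 : 1 < (Finset.univ \ cdim (c.comp (rst v D))).card := by
    rw [Finset.card_sdiff_of_subset (Finset.subset_univ _)]
    simp; omega
  obtain ⟨i, hi, j, hj, hij⟩ := Finset.one_lt_card.1 h1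
  simp only [Finset.mem_sdiff, Finset.mem_univ, true_and] at hi hj
  ext x
  rw [depOn_cdim (c.comp (rst v D)) x (fun k => if k = i ∨ k = j then 0 else x k) fun k hk => by
    rw [if_neg]
    rintro (rfl | rfl) <;> contradiction]
  exact hc.rst_eq v D hij (Or.inr ⟨false, by simp⟩) (Or.inr ⟨false, by simp⟩)

lemma exists_fa_fb : ∀ i k : Fin 3, i ≠ k → i = fa k ∨ i = fb k := by decide

lemma nullCube_of_faceLoop {c : C(Fin 3 → I, Z)} (hc : EdgesTriv e c)
    (hf : ∀ i b, cls (faceLoop c hc i b) = 1) (v : Fin 3 → Bool) (D : Finset (Fin 3))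
    (hd : (cdim (c.comp (rst v D))).card = 2) : NullCube e (c.comp (rst v D)) := by
  obtain ⟨k, hk⟩ : ∃ k, k ∉ cdim (c.comp (rst v D)) := by
    by_contra! h
    rw [Finset.eq_univ_of_forall h] at hd
    simp at hd
  by_cases hD : D ⊆ {k}
  · obtain ⟨b, hb⟩ : ∃ b, ∀ x, c.comp (rst v D) x = c (faceIncl k (ev b) ![x (fa k), x (fb k)]) := by
      refine ⟨if k ∈ D then v k else false, fun x => ?_⟩
      rw [depOn_cdim (c.comp (rst v D)) x (Function.update x k (ev (if k ∈ D then v k else false)))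
        fun j hj => by rw [Function.update_of_ne]; rintro rfl; contradiction]
      show c _ = c _
      congr 1
      refine Eq.trans ?_ ((faceIncl_eq k (Function.update x k
        (ev (if k ∈ D then v k else false)))).symm.trans ?_)
      · ext j
        rw [rst_apply]
        split_ifs with h1 h2 h2
        · obtain rfl : j = k := by simpa using hD h1
          simp
        · obtain rfl : j = k := by simpa using hD h1
          contradiction
        · rfl
        · rfl
      · rw [Function.update_self, Function.update_of_ne (fa_ne k), Function.update_of_ne (fb_ne k)]
    have h1 := hf k b
    rw [← cls_const, cls_eq_iff] at h1
    obtain ⟨h, h0, h1, hbd⟩ := exists_map_of_homotopic h1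
    refine ⟨h.comp ⟨fun u => (![u.1 (fa k), u.1 (fb k)], u.2), ?_⟩, fun x => ?_, fun x => ?_,
      fun x hx t => ?_⟩
    · refine Continuous.prodMk (continuous_pi fun j => ?_) continuous_snd
      fin_cases j <;> simp <;> fun_prop
    · exact (h0 _).trans (hb x).symm
    · exact h1 _
    · obtain ⟨i, hi, b', hb'⟩ := hx
      have hik : i ≠ k := by rintro rfl; contradiction
      have h01 : x i = 0 ∨ x i = 1 := by cases b' <;> simp at hb' <;> simp [hb']
      refine hbd _ ?_ t
      rcases exists_fa_fb i k hik with rfl | rfl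
      · exact ⟨0, h01⟩
      · exact ⟨1, h01⟩
  · obtain ⟨i, hi, hik⟩ := Finset.not_subset.1 hD
    have hik : i ≠ k := by simpa using hik
    have : c.comp (rst v D) = ContinuousMap.const _ e := by
      ext x
      rw [depOn_cdim (c.comp (rst v D)) x (Function.update x k 0)
        fun j hj => by rw [Function.update_of_ne]; rintro rfl; contradiction]
      exact hc.rst_eq v D hik (Or.inl hi) (Or.inr ⟨false, by simp⟩)
    rw [this]
    exact ⟨ContinuousMap.const _ e, fun _ => rfl, fun _ => rfl, fun _ _ _ => rfl⟩

lemma finite_quasi_add {C F : Type} [AddCommGroup C] [AddCommGroup F] {s : C → F}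
    (hs : (range fun x : C × C => s (x.1 + x.2) - s x.1 - s x.2).Finite) {S : Set C} (hS : S.Finite) :
    ∃ Δ : Set F, Δ.Finite ∧ ∀ x y z w : C, x + y - z - w ∈ S → s x + s y - s z - s w ∈ Δ := by
  refine ⟨(fun q : C × F × F × F => s q.1 + q.2.1 - q.2.2.1 + q.2.2.2) ''
    (S ×ˢ _ ×ˢ _ ×ˢ _), (hS.prod (hs.prod (hs.prod hs))).image _, fun x y z w h =>
    ⟨(x + y - z - w, _, _, _), ⟨h, ⟨(x + y - z - w, z + w), rfl⟩, ⟨(x, y), rfl⟩, ⟨(z, w), rfl⟩⟩, ?_⟩⟩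
  simp only
  rw [show x + y - z - w + (z + w) = x + y by abel]
  abel

lemma cbd_map {A B : Type} [AddCommGroup A] [AddCommGroup B] (φ : A →+ B)
    (ν : Fin 3 → (Fin 3 → Bool) → A) (i : Fin 3) (b : Bool) :
    φ (cbd ν i b) = cbd (fun k v => φ (ν k v)) i b := by
  simp [cbd]

lemma push_puncBase (a : Ω^ (Fin 2) Z e) : push a puncBase = e := by
  have := push_faceSq a (fun _ _ => 0) 0 false (fun _ => 0)
  rw [faceSq, sqMap_zero] at this
  rw [this]
  exact (discLoop' a _).2 _ ⟨0, Or.inl rfl⟩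

end Squares

section KillSquares

variable {Z : Type} [TopologicalSpace Z] {e : Z}

lemma cls_faceLoop_congr {c c' : C(Fin 3 → I, Z)} (hc : EdgesTriv e c) (hc' : EdgesTriv e c')
    {i : Fin 3} {b b' : Bool} (h : ∀ y, c (faceIncl i (ev b) y) = c' (faceIncl i (ev b') y)) :
    cls (faceLoop c hc i b) = cls (faceLoop c' hc' i b') := by
  congr 1
  ext y
  exact h y

lemma edgesTriv_const : EdgesTriv e (ContinuousMap.const (Fin 3 → I) e) := fun _ _ _ _ _ _ => rfl

open Classical in
/-- The cells of a subdivided loop, extended by the constant map. -/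
noncomputable def cellAt {N : ℕ} (f : Ω^ (Fin 3) Z e) (P : Fin 3 → ℕ) : C(Fin 3 → I, Z) :=
  if h : ∀ i, P i < N then sub f.1 (fun i => (⟨P i, h i⟩ : Fin N)) else ContinuousMap.const _ e

lemma cellAt_coe {N : ℕ} (f : Ω^ (Fin 3) Z e) (Q : Fin 3 → Fin N) :
    cellAt (N := N) f (fun i => Q i) = sub f.1 Q := by
  rw [cellAt, dif_pos fun i => (Q i).2]

lemma cellAt_of_zero {N : ℕ} (f : Ω^ (Fin 3) Z e) {P : Fin 3 → ℕ} {i : Fin 3} (h : P i = 0)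
    {x : Fin 3 → I} (hx : x i = 0) : cellAt (N := N) f P x = e := by
  unfold cellAt
  split_ifs with hP
  · refine f.2 _ ⟨i, Or.inl ?_⟩
    ext
    rw [ContinuousMap.coe_mk, gcell_apply]
    simp [h, hx]
  · rfl

lemma cellAt_step {N : ℕ} (f : Ω^ (Fin 3) Z e) (P : Fin 3 → ℕ) (i : Fin 3) (y : Fin 2 → I) :
    cellAt (N := N) f P (faceIncl i (ev true) y) =
      cellAt (N := N) f (P + Pi.single i 1) (faceIncl i (ev false) y) := by
  by_cases h : ∀ j, P j < N
  · by_cases h' : ∀ j, (P + Pi.single i 1 : Fin 3 → ℕ) j < N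
    · rw [cellAt, dif_pos h, cellAt, dif_pos h']
      show f _ = f _
      congr 1
      ext j
      rw [ContinuousMap.coe_mk, ContinuousMap.coe_mk, gcell_apply, gcell_apply]
      by_cases hj : j = i
      · subst hj
        rw [faceIncl_self, faceIncl_self]
        simp
      · have h1 : faceIncl i (ev true) y j = faceIncl i (ev false) y j := by
          rcases exists_fa_fb j i hj with rfl | rfl
          · fin_cases i <;> simp [faceIncl, fa, fb]
          · fin_cases i <;> simp [faceIncl, fa, fb]
        simp only [Pi.add_apply, h1, Pi.single_eq_of_ne hj, add_zero]
    · rw [cellAt, dif_pos h, cellAt, dif_neg h']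
      have h2 : P i + 1 = N := by
        by_contra hne
        refine h' fun j => ?_
        by_cases hj : j = i
        · subst hj
          have := h j
          simp only [Pi.add_apply, Pi.single_eq_same]
          omega
        · simpa [hj] using h j
      refine f.2 _ ⟨i, Or.inr ?_⟩
      ext
      rw [ContinuousMap.coe_mk, gcell_apply, faceIncl_self]
      have hN : (N : ℝ) ≠ 0 := by exact_mod_cast (Nat.zero_lt_of_lt (h i)).ne'
      have h3 : (P i : ℝ) + 1 = N := by exact_mod_cast h2
      simp [h3, hN]
  · have h' : ¬ ∀ j, (P + Pi.single i 1 : Fin 3 → ℕ) j < N := by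
      intro h'
      exact h fun j => lt_of_le_of_lt (by simp) (h' j)
    rw [cellAt, dif_neg h, cellAt, dif_neg h']
    rfl

/-- Loops assembled from finitely many types of cubes, constant on the edges, can be modified by
loops pushed forward from the punctured plane so that all squares become null-homotopic. -/
theorem exists_null_squares (H : HStr Z e) (𝒯 : Set C(Fin 3 → I, Z)) (hfin : 𝒯.Finite)
    (hface : FaceClosed 𝒯)
    (hlow : ∀ c ∈ 𝒯, (cdim c).card < 2 → c = ContinuousMap.const _ e) :
    ∃ (𝒯' : Set C(Fin 3 → I, Z)) (J : Type) (_ : Fintype J) (a : J → Ω^ (Fin 2) Z e),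
      𝒯'.Finite ∧ FaceClosed 𝒯' ∧
      (∀ c ∈ 𝒯', (cdim c).card < 2 → c = ContinuousMap.const _ e) ∧
      (∀ c ∈ 𝒯', (cdim c).card = 2 → NullCube e c) ∧
      ∀ (N : ℕ), 0 < N → ∀ f : Ω^ (Fin 3) Z e, (∀ Q : Fin 3 → Fin N, sub f.1 Q ∈ 𝒯) →
        ∃ (f' : Ω^ (Fin 3) Z e) (F : J → Ω^ (Fin 3) Punc puncBase),
          cls f' = cls f * (Finset.univ.toList.map fun j =>
            cls (GenLoop.push (push (a j)) (push_puncBase (a j)) (F j))).prod ∧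
          ∀ Q : Fin 3 → Fin N, sub f'.1 Q ∈ 𝒯' := by
  classical
  let _ := H.commGroup (ι := Fin 2)
  have hE : ∀ {c}, c ∈ 𝒯 → EdgesTriv e c := fun hc => edgesTriv_of_types hface hlow hc
  let fc : C(Fin 3 → I, Z) → Fin 3 → Bool → Additive (HomotopyGroup (Fin 2) Z e) := fun c i b =>
    if h : EdgesTriv e c then Additive.ofMul (cls (faceLoop c h i b)) else 0
  have hfc : ∀ {c} (h : EdgesTriv e c) i b, fc c i b = Additive.ofMul (cls (faceLoop c h i b)) :=
    fun h i b => dif_pos h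
  let S : Set (Additive (HomotopyGroup (Fin 2) Z e)) :=
    (fun q : C(Fin 3 → I, Z) × Fin 3 × Bool => fc q.1 q.2.1 q.2.2) '' (𝒯 ×ˢ univ)
  have hS : S.Finite := (hfin.prod finite_univ).image _
  let C : AddSubgroup (Additive (HomotopyGroup (Fin 2) Z e)) := AddSubgroup.closure S
  have hCfg : AddGroup.FG C := (AddGroup.fg_iff_addSubgroup_fg C).2
    ⟨hS.toFinset, by simp [C]⟩
  have hmem : ∀ c ∈ 𝒯, ∀ i b, fc c i b ∈ C := fun c hc i b =>
    AddSubgroup.subset_closure ⟨(c, i, b), ⟨hc, mem_univ _⟩, rfl⟩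
  obtain ⟨J, _, _, p, s, hps, hs0, hsb⟩ := exists_quasi_section C
  obtain ⟨Φ, hΦ⟩ := exists_lattice_fill
  let K : C(Fin 3 → I, Z) → Fin 3 → Bool → C := fun c i b =>
    if h : fc c i b ∈ C then ⟨_, h⟩ else 0
  have hK : ∀ c ∈ 𝒯, ∀ i b, (K c i b : Additive (HomotopyGroup (Fin 2) Z e)) = fc c i b :=
    fun c hc i b => by simp only [K, dif_pos (hmem c hc i b)]
  let KS : Set C := (fun q : C(Fin 3 → I, Z) × Fin 3 × Bool => K q.1 q.2.1 q.2.2) '' (𝒯 ×ˢ univ)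
  have hKS : KS.Finite := (hfin.prod finite_univ).image _
  obtain ⟨Δ, hΔ, hΔs⟩ := finite_quasi_add hsb hKS
  have ha : ∀ j, ∃ a : Ω^ (Fin 2) Z e,
      Additive.ofMul (cls a) = (p (Pi.single j 1) : Additive (HomotopyGroup (Fin 2) Z e)) := by
    intro j
    obtain ⟨a, ha⟩ := Quotient.exists_rep
      ((p (Pi.single j 1) : Additive (HomotopyGroup (Fin 2) Z e)).toMul)
    exact ⟨a, congrArg Additive.ofMul ha⟩
  choose a ha using ha
  have hp : ∀ m : J → ℤ, (p m : Additive (HomotopyGroup (Fin 2) Z e)) =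
      Additive.ofMul ((Finset.univ.toList.map fun j => cls (a j) ^ m j).prod) := by
    intro m
    rw [Finset.prod_map_toList, ofMul_prod]
    conv_lhs => rw [← Finset.univ_sum_single m]
    rw [map_sum, AddSubgroup.val_finsetSum]
    refine Finset.sum_congr rfl fun j _ => ?_
    rw [ofMul_zpow, ha, ← AddSubgroup.coe_zsmul, ← map_zsmul, ← Pi.single_smul]
    simp
  let L : List J := Finset.univ.toList
  let lt : (J → Fin 3 → Bool → ℤ) → C(Fin 3 → I, Z) := fun m =>
    H.lprod (L.map fun j => (push (a j)).comp (Φ (m j)))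
  let M : Set (J → Fin 3 → Bool → ℤ) := {m | ∀ i b, (fun j => m j i b) ∈ (fun x => -x) '' Δ}
  have hM : M.Finite := by
    have h1 : {m : Fin 3 → Bool → J → ℤ | ∀ i, m i ∈ {g : Bool → J → ℤ |
        ∀ b, g b ∈ (fun x => -x) '' Δ}}.Finite :=
      Finite.pi' fun _ => Finite.pi' fun _ => hΔ.image _
    refine Finite.of_finite_image (f := fun m : J → Fin 3 → Bool → ℤ => fun i b j => m j i b)
      (h1.subset ?_) ?_
    · rintro _ ⟨m, hm, rfl⟩
      exact fun i b => hm i b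
    · intro m _ m' _ h
      ext j i b
      exact congrFun (congrFun (congrFun h i) b) j
  let 𝒯₁ : Set C(Fin 3 → I, Z) := {c ∈ (fun q : C(Fin 3 → I, Z) × (J → Fin 3 → Bool → ℤ) =>
    H.cmul q.1 (lt q.2)) '' (𝒯 ×ˢ M) | ∃ h : EdgesTriv e c, ∀ i b, cls (faceLoop c h i b) = 1}
  have h𝒯₁ : 𝒯₁.Finite := ((hfin.prod hM).image _).subset fun c hc => hc.1
  let 𝒯' : Set C(Fin 3 → I, Z) := (fun q : C(Fin 3 → I, Z) × (Fin 3 → Bool) × Finset (Fin 3) =>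
    q.1.comp (rst q.2.1 q.2.2)) '' (𝒯₁ ×ˢ univ)
  refine ⟨𝒯', J, inferInstance, a, (h𝒯₁.prod finite_univ).image _, ?_, ?_, ?_, ?_⟩
  · rintro _ ⟨⟨c, v, D⟩, ⟨hc, -⟩, rfl⟩ i b
    refine ⟨(c, if i ∈ D then v else Function.update v i b, insert i D), ⟨hc, mem_univ _⟩, ?_⟩
    ext x
    show c _ = c _
    congr 1
    ext j
    show (rst _ _ x j : ℝ) = (rst v D (Function.update x i (ev b)) j : ℝ)
    simp only [rst_apply, Finset.mem_insert]
    by_cases hj : j = i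
    · subst hj
      by_cases hD : j ∈ D <;> simp [hD]
    · by_cases hD : j ∈ D <;> by_cases hi : i ∈ D <;> simp [hD, hj, hi]
  · rintro _ ⟨⟨c, v, D⟩, ⟨⟨-, hc, -⟩, -⟩, rfl⟩ hd
    exact hc.eq_const_of_cdim v D hd
  · rintro _ ⟨⟨c, v, D⟩, ⟨⟨-, hc, hc'⟩, -⟩, rfl⟩ hd
    exact nullCube_of_faceLoop hc hc' v D hd
  · intro N hN f hf
    have hcell : ∀ P, cellAt (N := N) f P ∈ 𝒯 := by
      intro P
      unfold cellAt
      split_ifs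
      · exact hf _
      · exact const_mem_of_sub hN hface f hf
    let θ : Fin 3 → (Fin 3 → ℕ) → C := fun i P => K (cellAt (N := N) f P) i false
    have hθ' : ∀ i P, θ i (P + Pi.single i 1) = K (cellAt (N := N) f P) i true := by
      intro i P
      ext
      rw [hK _ (hcell _), hK _ (hcell _), hfc (hE (hcell _)), hfc (hE (hcell _)),
        cls_faceLoop_congr _ _ (cellAt_step f P i)]
    have hθ0 : ∀ i P, (∀ y, cellAt (N := N) f P (faceIncl i (ev false) y) = e) → θ i P = 0 := by
      intro i P h
      ext
      rw [hK _ (hcell _), hfc (hE (hcell _)),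
        cls_faceLoop_congr (i := i) (b := false) (b' := false) _ (edgesTriv_const (e := e)) h]
      exact congrArg Additive.ofMul (cls_const (e := e))
    obtain ⟨β, hβlo, hβhi, hβ2, hβ1, hβ0⟩ := exists_cobounding N hN θ
      (fun i P h => hθ0 i P fun y => cellAt_of_zero f h (by rw [faceIncl_self]; simp))
      (fun i P ⟨j, hj⟩ => hθ0 i P fun y => by
        rw [cellAt, dif_neg fun h => absurd (h j) (not_lt.2 hj)]; rfl)
      (fun P => by
        rw [hθ', hθ', hθ']
        apply Subtype.ext
        have := cls_faceLoop_two H _ (hE (hcell P))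
        have := congrArg Additive.ofMul this
        simp only [ofMul_mul, ofMul_inv, ← hfc, ← hK _ (hcell P)] at this
        push_cast
        simp only [θ]
        rw [this]
        abel)
    have hβf : ∀ P i, cbd (loc β P) i false = θ i P := by
      have h1 : ∀ P k v, loc β P k v = β k (P + fun i => (v i).toNat) := fun _ _ _ => rfl
      have e0 : (fun i => (![false, false, false] i).toNat) = (0 : Fin 3 → ℕ) := by decide
      have e1 : (fun i => (![true, false, false] i).toNat) = (Pi.single 0 1 : Fin 3 → ℕ) := by decide
      have e2 : (fun i => (![false, true, false] i).toNat) = (Pi.single 1 1 : Fin 3 → ℕ) := by decide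
      have e3 : (fun i => (![false, false, true] i).toNat) = (Pi.single 2 1 : Fin 3 → ℕ) := by decide
      intro P i
      fin_cases i
      · refine Eq.trans ?_ (hβ0 P)
        simp only [cbd, h1, fcor_zero, Fin.zero_eta, e0, e1, e2, e3, add_zero]
        simp only [fa, fb, Matrix.cons_val]
        abel
      · refine Eq.trans ?_ (hβ1 P)
        simp only [cbd, h1, fcor_one, Fin.mk_one, e0, e1, e2, e3, add_zero]
        simp only [fa, fb, Matrix.cons_val]
        abel
      · refine Eq.trans ?_ (hβ2 P)
        simp only [cbd, h1, fcor_two, Fin.reduceFinMk, e0, e1, e2, e3, add_zero]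
        simp only [fa, fb, Matrix.cons_val]
        abel
    have hβ : ∀ P i b, cbd (loc β P) i b = K (cellAt (N := N) f P) i b := by
      intro P i b
      cases b
      · exact hβf P i
      · rw [← hθ', ← hβf]
        have h1 := loc_fcor β P (P + Pi.single i 1) i (by simp) (fun j hj => by simp [hj])
        simp only [cbd, h1]
    let n : J → Fin 3 → (Fin 3 → ℕ) → ℤ := fun j i P => -s (β i P) j
    choose F hF using fun j => hΦ (n j) N hN
      (fun i k hik P hP => by simp [n, hβlo i k hik P hP, hs0])
      (fun i P hP => by simp [n, hβhi i P hP, hs0])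
    let G : J → Ω^ (Fin 3) Z e := fun j =>
      GenLoop.push (push (a j)) (push_puncBase (a j)) (F j)
    let f' : Ω^ (Fin 3) Z e := ⟨H.lprod ((f :: L.map G).map Subtype.val), fun y hy =>
      H.lprod_eq_e _ _ (by
        intro k hk
        obtain ⟨k, -, rfl⟩ := List.mem_map.1 hk
        exact k.2 y hy)⟩
    refine ⟨f', F, ?_, fun Q => ?_⟩
    · rw [H.cls_lprod (f :: L.map G) f' rfl, List.map_cons, List.prod_cons, List.map_map]
      rfl
    let m : J → Fin 3 → Bool → ℤ := fun j => cbd (loc (n j) fun i => Q i)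
    have hsub : sub f'.1 Q = H.cmul (sub f.1 Q) (lt m) := by
      ext x
      show H.mul (f _) (H.lprod _ _) = H.mul (f _) (H.lprod _ _)
      congr 1
      refine H.lprod_congr _ _ _ _ ?_
      rw [List.map_map, List.map_map, List.map_map]
      refine List.map_congr_left fun j _ => ?_
      obtain ⟨q, hq⟩ := (hF j Q).1
      have h1 := congrArg (fun g : C(Fin 3 → I, Punc) => g x) hq
      show push (a j) (F j _) = push (a j) (Φ (m j) x)
      rw [← push_pmul (a j) q]
      exact congrArg (push (a j)) h1
    have hm : ∀ i b, (fun j => m j i b) = - cbd (loc (fun i P => s (β i P)) fun i => Q i) i b := by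
      intro i b
      ext j
      simp only [m, n, cbd, loc, Pi.neg_apply, Pi.sub_apply, Pi.add_apply]
      abel
    have hpm : ∀ i b, p (fun j => m j i b) = - K (sub f.1 Q) i b := by
      intro i b
      rw [hm, map_neg, cbd_map, ← cellAt_coe, ← hβ]
      simp only [loc, hps]
      rfl
    refine ⟨(sub f'.1 Q, fun _ => false, ∅), ⟨⟨⟨(sub f.1 Q, m), ⟨hf Q, fun i b => ?_⟩, hsub.symm⟩,
      ?_⟩, mem_univ _⟩, ?_⟩
    · rw [hm]
      refine ⟨_, hΔs _ _ _ _ ?_, rfl⟩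
      refine ⟨(cellAt (N := N) f fun i => Q i, i, b), ⟨hcell _, mem_univ _⟩, ?_⟩
      exact (hβ _ i b).symm
    · have hval : ∀ i b x, x i = ev b → sub f'.1 Q x = H.mul (sub f.1 Q x)
          (H.lprod ((L.map fun j => discLoop' (a j) (m j i b)).map Subtype.val)
            ![x (fa i), x (fb i)]) := by
        intro i b x hx
        show H.mul (f _) (H.lprod _ _) = H.mul (f _) (H.lprod _ _)
        congr 1
        refine H.lprod_congr _ _ _ _ ?_
        rw [List.map_map, List.map_map, List.map_map, List.map_map]
        refine List.map_congr_left fun j _ => ?_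
        show push (a j) (F j _) = discLoop' (a j) (m j i b) _
        rw [← push_faceSq, ← (hF j Q).2 i b x hx]
        rfl
      have hedge : EdgesTriv e (sub f'.1 Q) := by
        rintro x i k hik ⟨b, hb⟩ ⟨b', hb'⟩
        rw [hval i b x hb, hE (hf Q) x i k hik ⟨b, hb⟩ ⟨b', hb'⟩, H.e_mul]
        refine H.lprod_eq_e _ _ ?_
        intro g hg
        obtain ⟨g, -, rfl⟩ := List.mem_map.1 hg
        have h01 : x k = 0 ∨ x k = 1 := by cases b' <;> simp at hb' <;> simp [hb']
        rcases exists_fa_fb k i hik.symm with rfl | rfl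
        · exact g.2 _ ⟨0, h01⟩
        · exact g.2 _ ⟨1, h01⟩
      refine ⟨hedge, fun i b => ?_⟩
      have h1 := H.cls_lprod (faceLoop _ (hE (hf Q)) i b :: L.map fun j => discLoop' (a j) (m j i b))
        (faceLoop _ hedge i b) (by
          ext y
          refine (hval i b _ (faceIncl_self _ _ _)).trans ?_
          refine congrArg (fun z => H.mul (sub f.1 Q (faceIncl i (ev b) y)) (H.lprod _ z)) ?_
          ext j
          fin_cases j <;> fin_cases i <;> simp [faceIncl, fa, fb])
      rw [h1, List.map_cons, List.prod_cons, List.map_map]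
      have h2 := hp fun j => m j i b
      rw [hpm, AddSubgroup.coe_neg, hK _ (hf Q), hfc (hE (hf Q))] at h2
      rw [show (cls ∘ fun j => discLoop' (a j) (m j i b)) = fun j => cls (a j) ^ m j i b from
        funext fun j => cls_discLoop' _ _]
      have h3 := congrArg Additive.toMul h2
      rw [toMul_neg, toMul_ofMul, toMul_ofMul] at h3
      rw [← h3, mul_inv_cancel]
    · ext x
      rfl

end KillSquares

section AbstractFiniteness

variable {Z : Type} [TopologicalSpace Z] {e : Z}

lemma nullCube_of_card_zero (hpath : ∀ z : Z, Joined z e) {ι : Type} [Fintype ι] [DecidableEq ι]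
    {c : C(ι → I, Z)} (hc : (cdim c).card = 0) : NullCube e c := by
  obtain ⟨γ⟩ := hpath (c 0)
  have h0 : cdim c = ∅ := Finset.card_eq_zero.1 hc
  refine ⟨⟨fun p => γ p.2, by fun_prop⟩, fun x => ?_, fun x => ?_, ?_⟩
  · show γ 0 = c x
    rw [γ.source]
    exact depOn_cdim c _ _ fun i hi => by simp [h0] at hi
  · exact γ.target
  · rw [h0]
    rintro x ⟨i, hi, -⟩
    simp at hi

/-- The third homotopy group of a path connected space with multiplication is finitely generated
if spheres can be deformed into a subset with a good cover. -/
theorem fg_pi_three (H : HStr Z e) (hpath : ∀ z : Z, Joined z e) {J : Type} [Fintype J]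
    {O : J → Set Z} (hO : GoodCover O 4)
    (h : ∀ f : Ω^ (Fin 3) Z e, ∃ f' : Ω^ (Fin 3) Z e, GenLoop.Homotopic f f' ∧ ∀ x, ∃ j, f' x ∈ O j) :
    Group.FG (HomotopyGroup (Fin 3) Z e) := by
  obtain ⟨𝒯₀, fin₀, face₀, h₀⟩ := hO.exists_finite_types (k := 3) (by norm_num) (by norm_num) e
  obtain ⟨𝒯₁, fin₁, face₁, low₁, h₁⟩ := exists_skeletal e 0 𝒯₀ fin₀ face₀ (by simp)
    fun c _ hc => nullCube_of_card_zero hpath hc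
  obtain ⟨𝒯₂, fin₂, face₂, low₂, null₂, h₂⟩ := exists_null_edges H 𝒯₁ fin₁ face₁ low₁
  obtain ⟨𝒯₃, fin₃, face₃, low₃, h₃⟩ := exists_skeletal e 1 𝒯₂ fin₂ face₂ low₂ null₂
  obtain ⟨𝒯₄, L, _, a, fin₄, face₄, low₄, null₄, h₄⟩ := exists_null_squares H 𝒯₃ fin₃ face₃
    fun c hc hd => low₃ c hc (Nat.le_of_lt_succ hd)
  obtain ⟨𝒯₅, fin₅, face₅, low₅, h₅⟩ := exists_skeletal e 2 𝒯₄ fin₄ face₄ low₄ null₄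
  obtain ⟨S, hS, hSfin⟩ := Group.fg_iff.1 (fg_pi_punc puncBase)
  let φ : L → HomotopyGroup (Fin 3) Punc puncBase →* HomotopyGroup (Fin 3) Z e := fun j =>
    HomotopyGroup.hom (push (a j)) (push_puncBase (a j))
  let S₅ : Set (Ω^ (Fin 3) Z e) := {c | c.1 ∈ 𝒯₅}
  have hS₅ : S₅.Finite := fin₅.preimage Subtype.val_injective.injOn
  refine Group.fg_iff.2 ⟨cls '' S₅ ∪ ⋃ j, φ j '' S, ?_,
    (hS₅.image _).union (finite_iUnion fun j => hSfin.image _)⟩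
  refine eq_top_iff.2 fun x _ => ?_
  obtain ⟨f, rfl⟩ := Quotient.exists_rep x
  obtain ⟨f', hff', hf'⟩ := h f
  obtain ⟨m, f₀, hf₀, hs₀⟩ := h₀ f' hf'
  obtain ⟨f₁, hf₁, hs₁⟩ := h₁ (2 ^ m) (by positivity) f₀ hs₀
  obtain ⟨f₂, hf₂, hs₂⟩ := h₂ (2 ^ m) (by positivity) f₁ hs₁
  obtain ⟨f₃, hf₃, hs₃⟩ := h₃ (2 ^ m) (by positivity) f₂ hs₂
  obtain ⟨f₄, F, hf₄, hs₄⟩ := h₄ (2 ^ m) (by positivity) f₃ hs₃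
  obtain ⟨f₅, hf₅, hs₅⟩ := h₅ (2 ^ m) (by positivity) f₄ hs₄
  have hcls : cls f = cls f₃ := by
    rw [cls_eq_iff]
    exact (hff'.trans hf₀).trans (hf₁.trans (hf₂.trans hf₃))
  show cls f ∈ _
  rw [hcls, eq_mul_inv_iff_mul_eq.2 hf₄.symm, cls_eq_iff.2 hf₅]
  refine Subgroup.mul_mem _ ?_ (Subgroup.inv_mem _ (Subgroup.list_prod_mem _ ?_))
  · refine Subgroup.closure_mono subset_union_left (cls_mem_closure S₅ m f₅ fun Q => ?_)
    refine ⟨⟨sub f₅.1 Q, fun y hy => ?_⟩, hs₅ Q, rfl⟩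
    by_cases hd : (cdim (sub f₅.1 Q)).card < 3
    · rw [low₅ _ (hs₅ Q) (Nat.le_of_lt_succ hd)]; rfl
    have hd' : (cdim (sub f₅.1 Q)).card = 3 :=
      le_antisymm ((Finset.card_le_univ _).trans (by simp)) (not_lt.1 hd)
    have hu : cdim (sub f₅.1 Q) = Finset.univ := Finset.eq_univ_of_card _ (by simpa using hd')
    refine face₅.eq_of_mem_bd (d := 3) (fun c hc hd => low₅ c hc (Nat.le_of_lt_succ hd))
      (hs₅ Q) hd' ?_
    obtain ⟨i, hi⟩ := hy
    refine ⟨i, by simp [hu], ?_⟩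
    rcases hi with hi | hi
    exacts [⟨false, by simpa using hi⟩, ⟨true, by simpa using hi⟩]
  · intro y hy
    obtain ⟨j, -, rfl⟩ := List.mem_map.1 hy
    have h1 : cls (F j) ∈ Subgroup.closure S := hS ▸ Subgroup.mem_top _
    have h2 : φ j (cls (F j)) ∈ (Subgroup.closure S).map (φ j) := ⟨_, h1, rfl⟩
    rw [MonoidHom.map_closure] at h2
    exact Subgroup.closure_mono ((subset_iUnion _ j).trans subset_union_right) h2

end AbstractFiniteness

section Words

variable {X : Type} (Q : QuandleStruct X)

/-- Right translations of a quandle. -/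
noncomputable def rho (x : X) : Equiv.Perm X := Equiv.ofBijective _ (Q.rightBij x)

/-- The inner automorphism group. -/
def Inn : Subgroup (Equiv.Perm X) := Subgroup.closure (range (rho Q))

noncomputable def rhoG (x : X) : Inn Q := ⟨rho Q x, Subgroup.subset_closure ⟨x, rfl⟩⟩

lemma rhoG_apply (x y : X) : (rhoG Q x).1 y = Q.op y x := rfl

lemma inn_op (p : Inn Q) (a b : X) : p.1 (Q.op a b) = Q.op (p.1 a) (p.1 b) := by
  obtain ⟨p, hp⟩ := p
  show p (Q.op a b) = Q.op (p a) (p b)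
  induction hp using Subgroup.closure_induction generalizing a b with
  | mem x hx =>
    obtain ⟨c, rfl⟩ := hx
    exact Q.distrib a b c
  | one => rfl
  | mul x y _ _ hx hy => rw [Equiv.Perm.mul_apply, hy, hx]; rfl
  | inv x _ hx =>
    apply x.injective
    rw [hx]
    simp

lemma rhoG_conj (p : Inn Q) (x : X) : rhoG Q (p.1 x) * p = p * rhoG Q x := by
  ext y
  show Q.op (p.1 y) (p.1 x) = p.1 (Q.op y x)
  rw [inn_op]

/-- Words with letters labelled by `κ × X`, together with an inner automorphism. -/
def Raw (κ : Type) : Type := List (κ × X) × Inn Q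

namespace Raw

variable {Q} {κ κ' : Type}

/-- The action on words. -/
def act (q : Inn Q) (L : List (κ × X)) : List (κ × X) := L.map fun l => (l.1, q.1 l.2)

@[simp] lemma act_nil (q : Inn Q) : act q ([] : List (κ × X)) = [] := rfl
@[simp] lemma act_cons (q : Inn Q) (l) (L : List (κ × X)) :
    act q (l :: L) = (l.1, q.1 l.2) :: act q L := rfl
@[simp] lemma act_append (q : Inn Q) (L L' : List (κ × X)) :
    act q (L ++ L') = act q L ++ act q L' := List.map_append
lemma act_one (L : List (κ × X)) : act (1 : Inn Q) L = L := by
  induction L with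
  | nil => rfl
  | cons l L ih => rw [act_cons, ih]; rfl
lemma act_mul (q r : Inn Q) (L : List (κ × X)) : act (r * q) L = act r (act q L) := by
  induction L with
  | nil => rfl
  | cons l L ih => rw [act_cons, act_cons, act_cons, ih]; rfl
lemma act_fst (q : Inn Q) (L : List (κ × X)) : (act q L).map Prod.fst = L.map Prod.fst := by
  induction L with
  | nil => rfl
  | cons l L ih => rw [act_cons, List.map_cons, ih]; rfl

instance : Monoid (Raw Q κ) where
  one := ([], 1)
  mul a b := (act b.2 a.1 ++ b.1, b.2 * a.2)
  mul_assoc a b c := by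
    show (act c.2 (act b.2 a.1 ++ b.1) ++ c.1, c.2 * (b.2 * a.2)) =
      (act (c.2 * b.2) a.1 ++ (act c.2 b.1 ++ c.1), (c.2 * b.2) * a.2)
    rw [act_append, act_mul, mul_assoc, List.append_assoc]
  one_mul a := by
    show (act a.2 [] ++ a.1, a.2 * 1) = a
    rw [mul_one]; rfl
  mul_one a := by
    show (act 1 a.1 ++ [], 1 * a.2) = a
    rw [act_one, one_mul, List.append_nil]; rfl

lemma one_def : (1 : Raw Q κ) = ([], 1) := rfl
lemma mul_def (a b : Raw Q κ) : a * b = (act b.2 a.1 ++ b.1, b.2 * a.2) := rfl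

/-- The word without letters. -/
def grp (p : Inn Q) : Raw Q κ := ([], p)

/-- A single letter. -/
def letter (l : κ × X) : Raw Q κ := ([l], 1)

lemma grp_mul (p q : Inn Q) : (grp p * grp q : Raw Q κ) = grp (q * p) := rfl

lemma grp_one : (grp 1 : Raw Q κ) = 1 := rfl

lemma letter_mul_grp (l : κ × X) (q : Inn Q) :
    letter l * grp q = (grp q * letter (l.1, q.1 l.2) : Raw Q κ) := by
  show ([(l.1, q.1 l.2)], q * 1) = ([(l.1, q.1 l.2)], 1 * q)
  rw [mul_one, one_mul]

lemma prod_letter (L : List (κ × X)) : (L.map letter).prod = ((L, 1) : Raw Q κ) := by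
  induction L with
  | nil => rfl
  | cons l L ih =>
    rw [List.map_cons, List.prod_cons, ih]
    show (act 1 [l] ++ L, 1 * 1) = _
    rw [act_one, one_mul]; rfl

lemma eq_prod (w : Raw Q κ) : w = grp w.2 * (w.1.map letter).prod := by
  rw [prod_letter]
  show w = ([] ++ w.1, 1 * w.2)
  rw [one_mul]; rfl

lemma hom_ext {M : Type} [Monoid M] {f g : Raw Q κ →* M} (h1 : ∀ p, f (grp p) = g (grp p))
    (h2 : ∀ l, f (letter l) = g (letter l)) : f = g := by
  ext w
  rw [eq_prod w, map_mul, map_mul, h1, map_list_prod, map_list_prod, List.map_map, List.map_map]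
  congr 3
  funext l
  exact h2 l

/-- The homomorphism determined by compatible images of letters. -/
def lift (F : κ × X → Raw Q κ') (hF : ∀ l (q : Inn Q), F l * grp q = grp q * F (l.1, q.1 l.2)) :
    Raw Q κ →* Raw Q κ' where
  toFun w := grp w.2 * (w.1.map F).prod
  map_one' := by show grp 1 * 1 = _; rw [grp_one, mul_one]
  map_mul' a b := by
    have key : ∀ (L : List (κ × X)) (q : Inn Q),
        (L.map F).prod * grp q = grp q * ((act q L).map F).prod := by
      intro L q
      induction L with
      | nil => rw [act_nil, List.map_nil, List.prod_nil, one_mul, mul_one]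
      | cons l L ih =>
        rw [act_cons, List.map_cons, List.map_cons, List.prod_cons, List.prod_cons, mul_assoc, ih,
          ← mul_assoc, hF, mul_assoc]
    show grp (b.2 * a.2) * ((act b.2 a.1 ++ b.1).map F).prod = _
    rw [List.map_append, List.prod_append, ← grp_mul, mul_assoc, ← mul_assoc (grp b.2), ← key]
    simp only [mul_assoc]

lemma lift_grp (F : κ × X → Raw Q κ') (hF) (p : Inn Q) : lift F hF (grp p) = grp p := by
  show grp p * 1 = _
  rw [mul_one]

lemma lift_letter (F : κ × X → Raw Q κ') (hF) (l : κ × X) : lift F hF (letter l) = F l := by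
  show grp 1 * ([l].map F).prod = _
  rw [grp_one, one_mul, List.map_singleton, List.prod_singleton]

lemma lift_apply (F : κ × X → Raw Q κ') (hF) (w : Raw Q κ) :
    lift F hF w = grp w.2 * (w.1.map F).prod := rfl

/-- Relabelling of the letters. -/
def mapL (c : κ → κ') : Raw Q κ →* Raw Q κ' where
  toFun w := (w.1.map fun l => (c l.1, l.2), w.2)
  map_one' := rfl
  map_mul' a b := by
    show ((act b.2 a.1 ++ b.1).map _, b.2 * a.2) = (act b.2 (a.1.map _) ++ b.1.map _, b.2 * a.2)
    rw [List.map_append]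
    congr 2
    simp only [act, List.map_map]
    rfl

lemma mapL_grp (c : κ → κ') (p : Inn Q) : mapL c (grp p) = grp p := rfl
lemma mapL_letter (c : κ → κ') (l : κ × X) : mapL c (letter (Q := Q) l) = letter (c l.1, l.2) := rfl

/-- The image of a letter in the normal form. -/
noncomputable def nf1 (l : I × X) : Raw Q I :=
  if l.1 = 0 then 1 else if l.1 = 1 then grp (rhoG Q l.2) else letter l

lemma nf1_mul_grp (l : I × X) (q : Inn Q) :
    nf1 l * grp q = (grp q * nf1 (l.1, q.1 l.2) : Raw Q I) := by
  unfold nf1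
  split_ifs with h0 h1
  · rw [one_mul, mul_one]
  · rw [grp_mul, grp_mul, rhoG_conj]
  · exact letter_mul_grp l q

/-- The normal form of a word. -/
noncomputable def nf : Raw Q I →* Raw Q I := lift nf1 nf1_mul_grp

lemma nf_grp (p : Inn Q) : nf (grp p) = grp p := lift_grp _ _ p
lemma nf_letter (l : I × X) : nf (Q := Q) (letter l) = nf1 l := lift_letter _ _ l

lemma nf_map_nf {c : I → I} (h0 : c 0 = 0) (h1 : c 1 = 1) (w : Raw Q I) :
    nf (mapL c (nf w)) = nf (mapL c w) := by
  have : (nf.comp ((mapL c).comp nf)) = (nf (Q := Q)).comp (mapL c) := by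
    refine hom_ext (fun p => ?_) fun l => ?_
    · show nf (mapL c (nf (grp p))) = nf (mapL c (grp p))
      rw [nf_grp]
    · show nf (mapL c (nf (letter l))) = nf (mapL c (letter l))
      rw [nf_letter, mapL_letter, nf_letter]
      unfold nf1
      by_cases hl0 : l.1 = 0
      · rw [if_pos hl0, hl0, h0, if_pos rfl, map_one, map_one]
      by_cases hl1 : l.1 = 1
      · rw [if_neg hl0, if_pos hl1, hl1, h1, if_neg one_ne_zero, if_pos rfl, mapL_grp, nf_grp]
      · rw [if_neg hl0, if_neg hl1, mapL_letter, nf_letter]; rfl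
  exact DFunLike.congr_fun this w

lemma mapL_id (w : Raw Q κ) : mapL id w = w := by
  show (w.1.map id, w.2) = w
  rw [List.map_id]; rfl

lemma mapL_mapL {κ'' : Type} (c : κ → κ') (d : κ' → κ'') (w : Raw Q κ) :
    mapL d (mapL c w) = mapL (d ∘ c) w := by
  show ((w.1.map _).map _, w.2) = (w.1.map _, w.2)
  rw [List.map_map]; rfl

lemma nf_nf (w : Raw Q I) : nf (nf w) = nf w := by
  simpa only [mapL_id] using nf_map_nf (c := id) rfl rfl w

open Classical in
lemma nf_fst (w : Raw Q I) :
    (nf w).1.map Prod.fst = (w.1.map Prod.fst).filter fun t => t ≠ 0 ∧ t ≠ 1 := by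
  show (grp w.2 * (w.1.map nf1).prod).1.map Prod.fst = _
  rw [mul_def]
  show ([] ++ _ : List (I × X)).map Prod.fst = _
  rw [List.nil_append]
  obtain ⟨L, p⟩ := w
  show ((L.map nf1).prod : Raw Q I).1.map Prod.fst = (L.map Prod.fst).filter _
  induction L with
  | nil => rfl
  | cons l L ih =>
    rw [List.map_cons, List.prod_cons, mul_def]
    show (act _ _ ++ _).map Prod.fst = _
    rw [List.map_append, ih, act_fst, List.map_cons, List.filter_cons]
    unfold nf1
    split_ifs with h1 h2 h3 h4 h5
    all_goals first | rfl | (exfalso; simp_all; done)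

lemma nf_eq_self {w : Raw Q I} (h : ∀ l ∈ w.1, l.1 ≠ 0 ∧ l.1 ≠ 1) : nf w = w := by
  conv_rhs => rw [eq_prod w]
  show grp w.2 * (w.1.map nf1).prod = _
  congr 2
  refine List.map_congr_left fun l hl => ?_
  unfold nf1
  rw [if_neg (h l hl).1, if_neg (h l hl).2]

lemma nf_reduced (w : Raw Q I) : ∀ l ∈ (nf w).1, l.1 ≠ 0 ∧ l.1 ≠ 1 := by
  classical
  intro l hl
  have : l.1 ∈ (nf w).1.map Prod.fst := List.mem_map_of_mem hl
  rw [nf_fst, List.mem_filter] at this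
  simpa using this.2

end Raw

end Words

section WordTopology

variable {X : Type} (Q : QuandleStruct X)

open Raw

/-- Words as tuples, together with an inner automorphism. -/
def Pre : Type := PreRack X × Inn Q

instance : TopologicalSpace (Inn Q) := ⊥
instance : DiscreteTopology (Inn Q) := ⟨rfl⟩
instance : TopologicalSpace (Pre Q) := inferInstanceAs (TopologicalSpace (PreRack X × Inn Q))

variable {Q}

/-- The cube of words with given labels. -/
def cell (n : ℕ) (a : Fin n → X) (p : Inn Q) (t : Fin n → I) : Pre Q :=
  (⟨n, fun i => (t i, a i)⟩, p)

lemma eq_cell (w : Pre Q) : w = cell w.1.1 (fun i => (w.1.2 i).2) w.2 (fun i => (w.1.2 i).1) := rfl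

/-- A word as a point of the disjoint union. -/
def preMk (n : ℕ) (f : Fin n → I × X) : PreRack X := ⟨n, f⟩

lemma nhds_preRack (n : ℕ) (a : Fin n → X) (t : Fin n → I) :
    𝓝 (preMk n fun i => (t i, a i)) =
      Filter.map (fun t' : Fin n → I => preMk n fun i => (t' i, a i)) (𝓝 t) := by
  let _ : TopologicalSpace X := ⊥
  have : DiscreteTopology X := ⟨rfl⟩
  let s : (Fin n → I × X) → PreRack X := preMk n
  have hs : Topology.IsOpenEmbedding s := by
    change Topology.IsOpenEmbedding (@Sigma.mk ℕ (fun n : ℕ => Fin n → I × X) n)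
    exact Topology.IsOpenEmbedding.sigmaMk
  let u : (Fin n → I) → (Fin n → I × X) := fun t' i => (t' i, a i)
  have hu : Topology.IsOpenEmbedding u := by
    have hc : Continuous u := continuous_pi fun i => by
      exact (continuous_apply i).prodMk continuous_const
    refine Topology.IsOpenEmbedding.of_continuous_injective_isOpenMap hc ?_ ?_
    · intro t t' h
      funext i
      exact congrArg Prod.fst (congrFun h i)
    · have hr : Continuous fun f : Fin n → I × X => fun i => (f i).1 := by fun_prop
      intro V hV
      have : u '' V = (fun f : Fin n → I × X => fun i => (f i).1) ⁻¹' V ∩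
          ⋂ i, (fun f : Fin n → I × X => (f i).2) ⁻¹' {a i} := by
        ext f
        constructor
        · rintro ⟨t', ht', rfl⟩
          exact ⟨ht', mem_iInter.2 fun i => rfl⟩
        · rintro ⟨h1, h2⟩
          refine ⟨_, h1, funext fun i => Prod.ext rfl ?_⟩
          exact (mem_iInter.1 h2 i).symm
      rw [this]
      refine (hV.preimage hr).inter (isOpen_iInter_of_finite fun i => ?_)
      exact (isOpen_discrete _).preimage (continuous_snd.comp (continuous_apply i))
  exact ((hs.comp hu).map_nhds_eq t).symm

lemma nhds_cell (n : ℕ) (a : Fin n → X) (p : Inn Q) (t : Fin n → I) :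
    𝓝 (cell n a p t) = Filter.map (cell n a p) (𝓝 t) := by
  have h1 : 𝓝 (cell n a p t) = 𝓝 (cell n a p t).1 ×ˢ 𝓝 p := nhds_prod_eq
  rw [h1, nhds_discrete (Inn Q), Filter.prod_pure]
  exact (congrArg _ (nhds_preRack n a t)).trans Filter.map_map

lemma continuous_cell (n : ℕ) (a : Fin n → X) (p : Inn Q) : Continuous (cell n a p) :=
  continuous_iff_continuousAt.2 fun t => by
    rw [ContinuousAt, nhds_cell]
    exact Filter.tendsto_map

instance : LocallyCompactSpace (Pre Q) where
  local_compact_nhds w s hs := by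
    rw [eq_cell w] at hs ⊢
    rw [nhds_cell, Filter.mem_map] at hs
    obtain ⟨K, hK, hKs, hc⟩ := local_compact_nhds hs
    refine ⟨cell _ _ _ '' K, ?_, image_subset_iff.2 hKs, hc.image (continuous_cell _ _ _)⟩
    rw [nhds_cell]
    exact Filter.image_mem_map hK

/-- The word underlying a tuple. -/
def raw (w : Pre Q) : Raw Q I := (List.ofFn w.1.2, w.2)

lemma raw_cell (n : ℕ) (a : Fin n → X) (p : Inn Q) (t : Fin n → I) :
    raw (cell n a p t) = (List.ofFn fun i => (t i, a i), p) := rfl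

lemma exists_raw (w : Raw Q I) : ∃ w', raw w' = w :=
  ⟨(⟨w.1.length, w.1.get⟩, w.2), by
    show (List.ofFn w.1.get, w.2) = w
    rw [List.ofFn_get]; rfl⟩

variable (Q) in
/-- Reduced words. -/
def Yt : Type := {w : Raw Q I // ∀ l ∈ w.1, l.1 ≠ 0 ∧ l.1 ≠ 1}

/-- The reduced form of a word. -/
noncomputable def nfY (w : Raw Q I) : Yt Q := ⟨nf w, nf_reduced w⟩

noncomputable def qY (w : Pre Q) : Yt Q := nfY (raw w)

noncomputable instance : TopologicalSpace (Yt Q) := TopologicalSpace.coinduced qY inferInstance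

lemma nfY_val (y : Yt Q) : nfY y.1 = y := Subtype.ext (nf_eq_self y.2)

lemma isQuotientMap_qY : Topology.IsQuotientMap (qY (Q := Q)) :=
  ⟨⟨rfl⟩, fun y => by
    obtain ⟨w, hw⟩ := exists_raw y.1
    exact ⟨w, by rw [qY, hw, nfY_val]⟩⟩

lemma isOpen_Yt {V : Set (Yt Q)} : IsOpen V ↔ IsOpen (qY ⁻¹' V) :=
  isQuotientMap_qY.isOpen_preimage.symm

/-- The base point. -/
def oneY : Yt Q := ⟨1, fun l hl => by simp [Raw.one_def] at hl⟩

noncomputable def mulY (y z : Yt Q) : Yt Q := nfY (y.1 * z.1)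

lemma mulY_nfY (v w : Raw Q I) : mulY (nfY v) (nfY w) = nfY (v * w) := by
  refine Subtype.ext ?_
  show nf (nf v * nf w) = nf (v * w)
  rw [map_mul, nf_nf, nf_nf, map_mul]

lemma continuous_mulPre : Continuous fun z : Pre Q × Pre Q => nfY (raw z.1 * raw z.2) := by
  refine continuous_iff_continuousAt.2 fun ⟨v, w⟩ => ?_
  rw [eq_cell v, eq_cell w]
  generalize v.1.1 = n, (fun i => (v.1.2 i).2) = a, v.2 = p, (fun i => (v.1.2 i).1) = t
  generalize w.1.1 = m, (fun i => (w.1.2 i).2) = b, w.2 = q, (fun i => (w.1.2 i).1) = s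
  rw [ContinuousAt, nhds_prod_eq, nhds_cell, nhds_cell, Filter.prod_map_map_eq, ← nhds_prod_eq,
    Filter.tendsto_map'_iff]
  have key : ∀ (t : Fin n → I) (s : Fin m → I), nfY (raw (cell n a p t) * raw (cell m b q s)) =
      qY (cell (n + m) (Fin.append (fun i => q.1 (a i)) b) (q * p) (Fin.append t s)) := by
    intro t s
    unfold qY
    congr 1
    refine Prod.ext ?_ rfl
    show (List.ofFn fun i => (t i, a i)).map _ ++ (List.ofFn fun i => (s i, b i)) =
      List.ofFn fun i => (Fin.append t s i, Fin.append (fun i => q.1 (a i)) b i)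
    rw [List.map_ofFn, ← List.ofFn_fin_append]
    congr 1
    funext i
    refine Fin.addCases (fun i => ?_) (fun i => ?_) i <;> simp [raw_cell]
  have hc : Continuous fun z : (Fin n → I) × (Fin m → I) =>
      nfY (raw (cell n a p z.1) * raw (cell m b q z.2)) := by
    simp only [key]
    refine isQuotientMap_qY.continuous.comp ((continuous_cell _ _ _).comp (continuous_pi fun i => ?_))
    refine Fin.addCases (fun i => ?_) (fun i => ?_) i <;> simp <;> fun_prop
  exact hc.continuousAt

lemma continuous_mul_pre_Y : Continuous fun z : Pre Q × Yt Q => mulY (qY z.1) z.2 := by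
  refine isQuotientMap_qY.continuous_lift_prod_right ?_
  simp only [qY, mulY_nfY]
  exact continuous_mulPre

lemma continuous_mulY {T : Type} [TopologicalSpace T] [LocallyCompactSpace T] (f g : C(T, Yt Q)) :
    Continuous fun x => mulY (f x) (g x) := by
  have h2 : Continuous fun z : Pre Q × T => (z.1, g z.2) :=
    continuous_fst.prodMk (g.continuous.comp continuous_snd)
  have h3 : Continuous fun z : Pre Q × T => mulY (qY z.1) (g z.2) := by
    exact Continuous.comp (g := fun z : Pre Q × Yt Q => mulY (qY z.1) z.2)
      (f := fun z : Pre Q × T => (z.1, g z.2)) continuous_mul_pre_Y h2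
  have h1 : Continuous fun z : Yt Q × T => mulY z.1 (g z.2) :=
    isQuotientMap_qY.continuous_lift_prod_left (g := fun z : Yt Q × T => mulY z.1 (g z.2)) h3
  have h4 : Continuous fun x => (f x, x) := f.continuous.prodMk continuous_id
  exact Continuous.comp (g := fun z : Yt Q × T => mulY z.1 (g z.2)) (f := fun x => (f x, x)) h1 h4

/-- The multiplication of reduced words. -/
noncomputable def hstrY : HStr (Yt Q) oneY where
  mul := mulY
  e_mul z := by
    show nfY (1 * z.1) = z
    rw [one_mul, nfY_val]
  mul_e z := by
    show nfY (z.1 * 1) = z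
    rw [mul_one, nfY_val]
  cont _ _ _ f g := continuous_mulY f g

/-- Coordinatewise change of a reduced word. -/
noncomputable def cmap (c : I → I) (y : Yt Q) : Yt Q := nfY (mapL c y.1)

lemma cmap_nfY {c : I → I} (h0 : c 0 = 0) (h1 : c 1 = 1) (w : Raw Q I) :
    cmap c (nfY w) = nfY (mapL c w) := Subtype.ext (nf_map_nf h0 h1 w)

lemma cmap_cmap {c d : I → I} (h0 : d 0 = 0) (h1 : d 1 = 1) (y : Yt Q) :
    cmap d (cmap c y) = cmap (d ∘ c) y := by
  show cmap d (nfY (mapL c y.1)) = _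
  rw [cmap_nfY h0 h1, mapL_mapL]; rfl

lemma cmap_congr {c d : I → I} {y : Yt Q} (h : ∀ l ∈ y.1.1, c l.1 = d l.1) :
    cmap c y = cmap d y := by
  unfold cmap
  congr 1
  refine Prod.ext (List.map_congr_left fun l hl => ?_) rfl
  rw [h l hl]

lemma cmap_id (y : Yt Q) : cmap id y = y := by
  rw [cmap, mapL_id, nfY_val]

lemma cmap_one (c : I → I) : cmap c (oneY : Yt Q) = oneY := nfY_val _

lemma continuousAt_cmap {T : Type} [TopologicalSpace T] {c : T → I → I} {w : Pre Q} {s : T}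
    (hc : ∀ l ∈ (raw w).1, ContinuousAt (fun z : T × I => c z.1 z.2) (s, l.1)) :
    ContinuousAt (fun z : Pre Q × T => nfY (mapL (c z.2) (raw z.1))) (w, s) := by
  rw [eq_cell w] at hc ⊢
  generalize w.1.1 = n, (fun i => (w.1.2 i).2) = a, w.2 = p, (fun i => (w.1.2 i).1) = t at hc ⊢
  rw [ContinuousAt, nhds_prod_eq, nhds_cell, ← Filter.map_id (f := 𝓝 s), Filter.prod_map_map_eq,
    ← nhds_prod_eq, Filter.tendsto_map'_iff]
  have key : ∀ (t : Fin n → I) (s : T), nfY (mapL (c s) (raw (cell n a p t))) =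
      qY (cell n a p fun i => c s (t i)) := by
    intro t s
    unfold qY
    congr 1
    refine Prod.ext ?_ rfl
    show (List.ofFn fun i => (t i, a i)).map _ = _
    rw [List.map_ofFn]; rfl
  have h : ContinuousAt (fun z : (Fin n → I) × T => qY (cell n a p fun i => c z.2 (z.1 i))) (t, s) := by
    refine ContinuousAt.comp (g := fun t' => qY (cell n a p t'))
      (f := fun z : (Fin n → I) × T => fun i => c z.2 (z.1 i))
      (isQuotientMap_qY.continuous.comp (continuous_cell n a p)).continuousAt ?_
    refine continuousAt_pi.2 fun i => ?_
    have hi := hc (t i, a i) (by rw [raw_cell, List.mem_ofFn]; exact ⟨i, rfl⟩)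
    exact ContinuousAt.comp (g := fun z : T × I => c z.1 z.2)
      (f := fun z : (Fin n → I) × T => (z.2, z.1 i)) (x := (t, s)) hi (by fun_prop)
  have h2 := h.tendsto
  simp only [← key] at h2
  exact h2

/-- Reduced words with all letters in `U`. -/
def inU (U : Set I) : Set (Yt Q) := {y | ∀ l ∈ y.1.1, l.1 ∈ U}

lemma forall_fst (L : List (I × X)) (p : I → Prop) : (∀ l ∈ L, p l.1) ↔ ∀ t ∈ L.map Prod.fst, p t := by
  simp

lemma nfY_mem_inU {U : Set I} (h0 : 0 ∈ U) (h1 : 1 ∈ U) (w : Raw Q I) :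
    nfY w ∈ inU U ↔ ∀ l ∈ w.1, l.1 ∈ U := by
  classical
  show (∀ l ∈ (nf w).1, l.1 ∈ U) ↔ _
  rw [forall_fst _ (· ∈ U), forall_fst _ (· ∈ U), nf_fst]
  constructor
  · intro h t ht
    by_cases h0' : t = 0
    · rwa [h0']
    by_cases h1' : t = 1
    · rwa [h1']
    exact h t (List.mem_filter.2 ⟨ht, by simp [h0', h1']⟩)
  · exact fun h t ht => h t (List.mem_filter.1 ht).1

/-- Sets of words described by locally constant data on the letters are open. -/
lemma isOpen_pattern {κ β : Type} {U : Set I} (h0 : 0 ∈ U) (h1 : 1 ∈ U) (F : I → κ)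
    (hF : ∀ t ∈ U, ∀ᶠ t' in 𝓝 t, t' ∈ U ∧ F t' = F t) (Φ : Raw Q κ → β)
    (hΦ : ∀ w, Φ (mapL F (nf w)) = Φ (mapL F w)) (A : Set β) :
    IsOpen {y : Yt Q | y ∈ inU U ∧ Φ (mapL F y.1) ∈ A} := by
  rw [isOpen_Yt, isOpen_iff_mem_nhds]
  rintro w ⟨hw1, hw2⟩
  rw [qY, nfY_mem_inU h0 h1] at hw1
  rw [qY, nfY, hΦ] at hw2
  rw [eq_cell w] at hw1 hw2 ⊢
  generalize w.1.1 = n, (fun i => (w.1.2 i).2) = a, w.2 = p, (fun i => (w.1.2 i).1) = t at hw1 hw2 ⊢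
  rw [nhds_cell, Filter.mem_map]
  have hev : ∀ᶠ t' in 𝓝 t, ∀ i, t' i ∈ U ∧ F (t' i) = F (t i) := by
    rw [Filter.eventually_all]
    intro i
    have := hF (t i) (hw1 (t i, a i) (by rw [raw_cell, List.mem_ofFn]; exact ⟨i, rfl⟩))
    exact (continuous_apply i).continuousAt.eventually this
  filter_upwards [hev] with t' ht'
  refine ⟨?_, ?_⟩
  · rw [qY, nfY_mem_inU h0 h1]
    intro l hl
    rw [raw_cell, List.mem_ofFn] at hl
    obtain ⟨i, rfl⟩ := hl
    exact (ht' i).1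
  · rw [qY, nfY, hΦ]
    have : mapL F (raw (cell n a p t')) = mapL F (raw (cell n a p t)) := by
      refine Prod.ext ?_ rfl
      show (List.ofFn fun i => (t' i, a i)).map _ = (List.ofFn fun i => (t i, a i)).map _
      rw [List.map_ofFn, List.map_ofFn]
      congr 1
      funext i
      show (F (t' i), a i) = (F (t i), a i)
      rw [(ht' i).2]
    rwa [this]

lemma isOpen_inU {U : Set I} (hU : IsOpen U) (h0 : 0 ∈ U) (h1 : 1 ∈ U) :
    IsOpen (inU U : Set (Yt Q)) := by
  have := isOpen_pattern (Q := Q) h0 h1 (fun _ => ()) (fun t ht => by simpa using hU.mem_nhds ht)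
    (fun _ => ()) (fun _ => rfl) univ
  simpa using this

lemma continuousOn_cmap {T : Type} [TopologicalSpace T] [LocallyCompactSpace T] {U : Set I}
    (hU : IsOpen U) (hU0 : 0 ∈ U) (hU1 : 1 ∈ U) {c : T → I → I} (h0 : ∀ s, c s 0 = 0)
    (h1 : ∀ s, c s 1 = 1)
    (hc : ∀ s, ∀ t ∈ U, ContinuousAt (fun z : T × I => c z.1 z.2) (s, t)) :
    ContinuousOn (fun z : Yt Q × T => cmap (c z.2) z.1) (inU U ×ˢ univ) := by
  have hV := isOpen_inU (Q := Q) hU hU0 hU1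
  have hq := isQuotientMap_qY.restrictPreimage_isOpen hV
  have hcont : Continuous fun z : ↥(inU U : Set (Yt Q)) × T => cmap (c z.2) z.1.1 := by
    refine hq.continuous_lift_prod_left ?_
    refine continuous_iff_continuousAt.2 fun ⟨⟨w, hw⟩, s⟩ => ?_
    have hw' : ∀ l ∈ (raw w).1, l.1 ∈ U := (nfY_mem_inU hU0 hU1 _).1 hw
    have h := continuousAt_cmap (c := c) (w := w) (s := s) fun l hl => hc s _ (hw' l hl)
    have h2 := ContinuousAt.comp (f := fun z : ↥(qY ⁻¹' inU U : Set (Pre Q)) × T => (z.1.1, z.2))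
      (x := (⟨w, hw⟩, s)) h (by fun_prop)
    refine h2.congr (Filter.Eventually.of_forall fun z => ?_)
    show nfY (mapL (c z.2) (raw z.1.1)) = cmap (c z.2) (nfY (raw z.1.1))
    rw [cmap_nfY (h0 _) (h1 _)]
  rintro ⟨y, s⟩ ⟨hy, -⟩
  refine ContinuousAt.continuousWithinAt ?_
  have hemb : Topology.IsOpenEmbedding (fun z : ↥(inU U : Set (Yt Q)) × T => (z.1.1, z.2)) :=
    hV.isOpenEmbedding_subtypeVal.prodMap Topology.IsOpenEmbedding.id
  exact (hemb.continuousAt_iff (x := (⟨y, hy⟩, s))).1 hcont.continuousAt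

lemma continuous_cmap {T : Type} [TopologicalSpace T] [LocallyCompactSpace T] {c : T → I → I}
    (h0 : ∀ s, c s 0 = 0) (h1 : ∀ s, c s 1 = 1) (hc : Continuous fun z : T × I => c z.1 z.2) :
    Continuous (fun z : Yt Q × T => cmap (c z.2) z.1) := by
  have h := continuousOn_cmap (Q := Q) isOpen_univ (mem_univ _) (mem_univ _) h0 h1
    fun s t _ => hc.continuousAt
  have hu : (inU univ : Set (Yt Q)) = univ := eq_univ_of_forall fun y l _ => mem_univ _
  rwa [hu, univ_prod_univ, continuousOn_univ] at h

end WordTopology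

section WordPaths

variable {X : Type} {Q : QuandleStruct X}

open Raw

lemma nf_zero (L : List (I × X)) (h : ∀ l ∈ L, l.1 = 0) (p : Inn Q) :
    nf ((L, p) : Raw Q I) = grp p := by
  show grp p * (L.map nf1).prod = grp p
  rw [List.prod_eq_one, mul_one]
  intro x hx
  obtain ⟨l, hl, rfl⟩ := List.mem_map.1 hx
  exact if_pos (h l hl)

lemma joined_I (s t : I) : Joined s t := by
  have : PathConnectedSpace I := isPathConnected_iff_pathConnectedSpace.1
    ((convex_Icc (0 : ℝ) 1).isPathConnected ⟨0, by simp⟩)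
  exact PathConnectedSpace.joined s t

lemma joined_cell (n : ℕ) (a : Fin n → X) (p : Inn Q) (t t' : Fin n → I) :
    Joined (qY (cell n a p t)) (qY (cell n a p t')) :=
  Joined.map (f := fun t => qY (cell n a p t))
    ⟨Path.pi fun i => (joined_I (t i) (t' i)).some⟩
    (isQuotientMap_qY.continuous.comp (continuous_cell n a p))

lemma joined_grp (z : Yt Q) : Joined z (nfY (grp z.1.2)) := by
  have h := joined_cell z.1.1.length (fun i => (z.1.1.get i).2) z.1.2
    (fun i => (z.1.1.get i).1) 0
  have h1 : qY (cell z.1.1.length (fun i => (z.1.1.get i).2) z.1.2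
      (fun i => (z.1.1.get i).1)) = z := by
    rw [qY]
    refine Eq.trans (congrArg nfY ?_) (nfY_val z)
    refine Prod.ext ?_ rfl
    exact List.ofFn_get _
  have h2 : qY (cell z.1.1.length (fun i => (z.1.1.get i).2) z.1.2 0) = nfY (grp z.1.2) := by
    refine Subtype.ext ?_
    show nf _ = nf (grp z.1.2)
    rw [raw_cell, nf_zero, nf_grp]
    intro l hl
    obtain ⟨i, rfl⟩ := List.mem_ofFn.1 hl
    rfl
  rwa [h1, h2] at h

lemma joined_rho (x : X) (p : Inn Q) : Joined (nfY (grp (rhoG Q x * p))) (nfY (grp p)) := by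
  have h := joined_cell 1 (fun _ => x) p (fun _ => 1) (fun _ => 0)
  have h1 : qY (cell 1 (fun _ => x) p (fun _ => 1)) = nfY (grp (rhoG Q x * p)) := by
    refine Subtype.ext ?_
    show grp p * ((List.ofFn fun _ : Fin 1 => ((1 : I), x)).map nf1).prod = nf _
    rw [nf_grp, ← grp_mul]
    simp [nf1]
  have h2 : qY (cell 1 (fun _ => x) p (fun _ => 0)) = nfY (grp p) := by
    refine Subtype.ext ?_
    show nf _ = nf (grp p)
    rw [raw_cell, nf_zero, nf_grp]
    intro l hl
    obtain ⟨i, rfl⟩ := List.mem_ofFn.1 hl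
    rfl
  rwa [h1, h2] at h

lemma joined_oneY (z : Yt Q) : Joined z oneY := by
  refine (joined_grp z).trans ?_
  obtain ⟨p, hp⟩ := z.1.2
  induction hp using Subgroup.closure_induction_left with
  | one => exact (nfY_val (oneY : Yt Q)) ▸ Joined.refl _
  | mul_left x hx y hy ih =>
    obtain ⟨x, rfl⟩ := hx
    exact (joined_rho x ⟨y, hy⟩).trans ih
  | inv_mul_cancel x hx y hy ih =>
    obtain ⟨x, rfl⟩ := hx
    refine Joined.trans ?_ ih
    have h := joined_rho x ((rhoG Q x)⁻¹ * (⟨y, hy⟩ : Inn Q))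
    rw [mul_inv_cancel_left] at h
    exact h.symm

end WordPaths

section Count

variable {X : Type} {Q : QuandleStruct X}

open Raw

open Classical in
/-- The number of letters with a given property. -/
noncomputable def cnt (P : I → Prop) (w : Raw Q I) : ℕ := w.1.countP fun l => P l.1

lemma cnt_nf {P : I → Prop} (h0 : ¬P 0) (h1 : ¬P 1) (w : Raw Q I) : cnt P (nf w) = cnt P w := by
  classical
  have h : ∀ L : List (I × X), (L.countP fun l => decide (P l.1)) =
      (L.map Prod.fst).countP fun t => decide (P t) := fun L => by
    rw [List.countP_map]; rfl
  unfold cnt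
  rw [h, h, nf_fst, List.countP_filter]
  congr 1
  funext t
  by_cases hP : P t
  · have h0' : t ≠ 0 := fun h => h0 (h ▸ hP)
    have h1' : t ≠ 1 := fun h => h1 (h ▸ hP)
    simp [hP, h0', h1']
  · simp [hP]

lemma cnt_mapL {P : I → Prop} {c : I → I} {w : Raw Q I} (h : ∀ l ∈ w.1, P (c l.1) ↔ P l.1) :
    cnt P (mapL c w) = cnt P w := by
  classical
  unfold cnt
  show (w.1.map _).countP _ = _
  rw [List.countP_map]
  refine List.countP_congr fun l hl => ?_
  simpa using h l hl

lemma cnt_mono {P P' : I → Prop} {w : Raw Q I} (h : ∀ l ∈ w.1, P l.1 → P' l.1) :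
    cnt P w ≤ cnt P' w := by
  classical
  exact List.countP_mono_left fun l hl hP => by simpa using h l hl (by simpa using hP)

lemma cnt_le_length (P : I → Prop) (w : Raw Q I) : cnt P w ≤ w.1.length := List.countP_le_length

lemma imp_of_cnt_eq {P P' : I → Prop} {w : Raw Q I} (h : ∀ l ∈ w.1, P l.1 → P' l.1)
    (he : cnt P' w ≤ cnt P w) : ∀ l ∈ w.1, P' l.1 → P l.1 := by
  classical
  obtain ⟨L, p⟩ := w
  unfold cnt at he
  change ∀ l ∈ L, _ at h
  change ∀ l ∈ L, _
  change L.countP _ ≤ L.countP _ at he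
  induction L with
  | nil => simp
  | cons l L ih =>
    have hm : (L.countP fun l => decide (P l.1)) ≤ L.countP fun l => decide (P' l.1) :=
      List.countP_mono_left fun l hl hP => by
        simpa using h l (List.mem_cons_of_mem _ hl) (by simpa using hP)
    have hl := h l List.mem_cons_self
    rw [List.countP_cons, List.countP_cons] at he
    have key : (P' l.1 → P l.1) ∧
        (L.countP fun l => decide (P' l.1)) ≤ L.countP fun l => decide (P l.1) := by
      by_cases h1 : P l.1 <;> by_cases h2 : P' l.1 <;> simp [h1, h2] at he hl ⊢ <;> omega
    intro l' hl'
    rcases List.mem_cons.1 hl' with rfl | hl'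
    · exact key.1
    · exact ih (fun l hl => h l (List.mem_cons_of_mem _ hl)) key.2 l' hl'

lemma length_nf (w : Raw Q I) : (nf w).1.length = cnt (fun t => t ≠ 0 ∧ t ≠ 1) w := by
  classical
  have : (nf w).1.length = ((nf w).1.map Prod.fst).length := by rw [List.length_map]
  rw [this, nf_fst, cnt, ← List.countP_eq_length_filter, List.countP_map]
  refine List.countP_congr fun l _ => ?_
  simp

end Count

section Thresholds

/-- Distance to the endpoints of the unit interval. -/
noncomputable def dep (t : I) : ℝ := min (t : ℝ) (1 - t)

@[fun_prop] lemma continuous_dep : Continuous dep := by unfold dep; fun_prop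

lemma dep_zero : dep 0 = 0 := by simp [dep]
lemma dep_one : dep 1 = 0 := by simp [dep]

lemma lt_dep {r : ℝ} {t : I} : r < dep t ↔ r < t ∧ (t : ℝ) < 1 - r := by
  rw [dep, lt_min_iff]; constructor <;> rintro ⟨h1, h2⟩ <;> constructor <;> linarith

lemma dep_lt {r : ℝ} {t : I} : dep t < r ↔ (t : ℝ) < r ∨ 1 - r < t := by
  rw [dep, min_lt_iff]; constructor <;> rintro (h | h) <;> first | (left; linarith) | (right; linarith)

/-- The point dividing an interval in a given ratio. -/
noncomputable def ratioI (s a b : I) : I :=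
  ⟨(1 - s) * a + s * b, by
    have := s.2.1; have := s.2.2; have := a.2.1; have := a.2.2; have := b.2.1; have := b.2.2
    constructor <;> nlinarith⟩

lemma ratioI_coe (s a b : I) : (ratioI s a b : ℝ) = (1 - s) * a + s * b := rfl
lemma ratioI_self (s a : I) : ratioI s a a = a := Subtype.ext (by rw [ratioI_coe]; ring)
lemma ratioI_zero (a b : I) : ratioI 0 a b = a := Subtype.ext (by rw [ratioI_coe]; simp)
lemma ratioI_one (a b : I) : ratioI 1 a b = b := Subtype.ext (by rw [ratioI_coe]; simp)
lemma ratioI_lt {s a b : I} {r : ℝ} (ha : (a : ℝ) < r) (hb : (b : ℝ) < r) : (ratioI s a b : ℝ) < r := by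
  have := s.2.1; have := s.2.2
  have h := (convex_Iio r) ha hb (sub_nonneg.2 s.2.2) s.2.1 (sub_add_cancel _ _)
  simpa [ratioI_coe] using h
lemma lt_ratioI {s a b : I} {r : ℝ} (ha : r < a) (hb : r < b) : r < ratioI s a b := by
  have h := (convex_Ioi r) ha hb (sub_nonneg.2 s.2.2) s.2.1 (sub_add_cancel _ _)
  simpa [ratioI_coe] using h
@[fun_prop] lemma continuous_ratioI {T : Type} [TopologicalSpace T] {s a b : T → I}
    (hs : Continuous s) (ha : Continuous a) (hb : Continuous b) :
    Continuous fun x => ratioI (s x) (a x) (b x) := by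
  unfold ratioI; fun_prop

noncomputable def thr (n : Fin 4) : ℝ := (4 - (n : ℕ)) / 10

lemma thr_pos (n : Fin 4) : 0 < thr n := by
  have : ((n : ℕ) : ℝ) ≤ 3 := by exact_mod_cast Nat.le_of_lt_succ n.2
  unfold thr; linarith

lemma thr_le (n : Fin 4) : thr n ≤ 2 / 5 := by
  have : (0 : ℝ) ≤ ((n : ℕ) : ℝ) := by positivity
  unfold thr; linarith

lemma thr_anti {m n : Fin 4} (h : m ≤ n) : thr n ≤ thr m := by
  have : ((m : ℕ) : ℝ) ≤ (n : ℕ) := by exact_mod_cast h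
  unfold thr; linarith

lemma thr_succ {m n : Fin 4} (h : (n : ℕ) = m + 1) : thr n = thr m - 1 / 10 := by
  unfold thr; rw [h]; push_cast; ring

def midP (n : Fin 4) (t : I) : Prop := thr n + 1 / 20 < dep t
def extP (n : Fin 4) (t : I) : Prop := dep t < thr n

lemma not_midP_of_extP {n : Fin 4} {t : I} (h : extP n t) : ¬midP n t := by
  unfold extP at h; unfold midP; linarith

lemma extP_zero (n : Fin 4) : extP n 0 := by rw [extP, dep_zero]; exact thr_pos n
lemma extP_one (n : Fin 4) : extP n 1 := by rw [extP, dep_one]; exact thr_pos n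

lemma isOpen_midP (n : Fin 4) : IsOpen {t | midP n t} := isOpen_lt continuous_const continuous_dep
lemma isOpen_extP (n : Fin 4) : IsOpen {t | extP n t} := isOpen_lt continuous_dep continuous_const

/-- The letters which are clearly above or below all thresholds of `S`. -/
def clear (S : Finset (Fin 4)) : Set I := {t | ∀ n ∈ S, extP n t ∨ midP n t}

lemma isOpen_clear (S : Finset (Fin 4)) : IsOpen (clear S) := by
  have : clear S = ⋂ n ∈ S, ({t | extP n t} ∪ {t | midP n t}) := by
    ext t; simp [clear]
  rw [this]
  exact isOpen_biInter_finset fun n _ => (isOpen_extP n).union (isOpen_midP n)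

lemma zero_mem_clear (S) : (0 : I) ∈ clear S := fun n _ => Or.inl (extP_zero n)
lemma one_mem_clear (S) : (1 : I) ∈ clear S := fun n _ => Or.inl (extP_one n)

open Classical in
/-- The position of a letter relative to the thresholds of `S`. -/
noncomputable def pat (S : Finset (Fin 4)) (t : I) (n : Fin 4) : Option Bool :=
  if n ∈ S ∧ ¬midP n t then some (decide ((t : ℝ) < 1 / 2)) else none

variable {S : Finset (Fin 4)}

lemma pat_zero {n : Fin 4} (h : n ∈ S) : pat S 0 n = some true := by
  rw [pat, if_pos ⟨h, not_midP_of_extP (extP_zero n)⟩]; simp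

lemma pat_one {n : Fin 4} (h : n ∈ S) : pat S 1 n = some false := by
  rw [pat, if_pos ⟨h, not_midP_of_extP (extP_one n)⟩]; norm_num

lemma midP_iff {n : Fin 4} (h : n ∈ S) (t : I) : midP n t ↔ pat S t n = none := by
  unfold pat; split_ifs with hn
  · simp [hn.2]
  · simp only [iff_true]; tauto

lemma eq_half {t : I} {n : Fin 4} (h : extP n t) : (t : ℝ) ≠ 1 / 2 := by
  intro ht
  have := thr_le n
  rw [extP, dep, ht] at h
  norm_num at h
  linarith

lemma pat_eventually {t : I} (ht : t ∈ clear S) : ∀ᶠ t' in 𝓝 t, t' ∈ clear S ∧ pat S t' = pat S t := by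
  have key : ∀ n, ∀ᶠ t' in 𝓝 t, pat S t' n = pat S t n := by
    intro n
    by_cases hn : n ∈ S
    · rcases ht n hn with h | h
      · have h1 := (isOpen_extP n).mem_nhds h
        have h2 : ∀ᶠ t' : I in 𝓝 t, ((t' : ℝ) < 1 / 2 ↔ (t : ℝ) < 1 / 2) := by
          rcases lt_or_gt_of_ne (eq_half h) with h' | h'
          · filter_upwards [(isOpen_lt continuous_subtype_val continuous_const).mem_nhds h']
              with t' ht'
            exact iff_of_true ht' h'
          · filter_upwards [(isOpen_lt continuous_const continuous_subtype_val).mem_nhds h']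
              with t' ht'
            exact iff_of_false (not_lt.2 (le_of_lt ht')) (not_lt.2 h'.le)
        filter_upwards [h1, h2] with t' ht' h2'
        rw [pat, pat, if_pos ⟨hn, not_midP_of_extP ht'⟩, if_pos ⟨hn, not_midP_of_extP h⟩]
        simp only [h2']
      · filter_upwards [(isOpen_midP n).mem_nhds h] with t' ht'
        rw [(midP_iff hn _).1 ht', (midP_iff hn _).1 h]
    · refine Filter.Eventually.of_forall fun t' => ?_
      simp [pat, hn]
  filter_upwards [(isOpen_clear S).mem_nhds ht, Filter.eventually_all.2 key] with t' h1 h2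
  exact ⟨h1, funext h2⟩

lemma ext_side {n : Fin 4} {t : I} (h : extP n t) :
    ((t : ℝ) < 1 / 2 ↔ (t : ℝ) < thr n) ∧ (¬(t : ℝ) < 1 / 2 ↔ 1 - thr n < t) := by
  have := thr_le n
  rw [extP, dep_lt] at h
  rcases h with h | h <;> constructor <;> constructor <;> intro h' <;> linarith

lemma pat_ratioI {a b : I} (ha : a ∈ clear S) (hb : b ∈ clear S) (h : pat S a = pat S b) (s : I) :
    ratioI s a b ∈ clear S ∧ pat S (ratioI s a b) = pat S a := by
  have key : ∀ n ∈ S, (extP n (ratioI s a b) ∨ midP n (ratioI s a b)) ∧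
      pat S (ratioI s a b) n = pat S a n := by
    intro n hn
    have hp := congrFun h n
    by_cases hm : midP n a
    · have hm' : midP n b := by rwa [midP_iff hn, ← hp, ← midP_iff hn]
      have : midP n (ratioI s a b) := by
        rw [midP, lt_dep] at hm hm' ⊢
        exact ⟨lt_ratioI hm.1 hm'.1, ratioI_lt hm.2 hm'.2⟩
      exact ⟨Or.inr this, by rw [(midP_iff hn _).1 this, (midP_iff hn _).1 hm]⟩
    · have hm' : ¬midP n b := by rwa [midP_iff hn, ← hp, ← midP_iff hn]
      have hea := (ha n hn).resolve_right hm
      have heb := (hb n hn).resolve_right hm'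
      rw [pat, pat, if_pos ⟨hn, hm⟩, if_pos ⟨hn, hm'⟩] at hp
      have hp' : (a : ℝ) < 1 / 2 ↔ (b : ℝ) < 1 / 2 := by simpa using hp
      have hfin : extP n (ratioI s a b) ∧ ((ratioI s a b : ℝ) < 1 / 2 ↔ (a : ℝ) < 1 / 2) := by
        have hle := thr_le n
        by_cases hs : (a : ℝ) < 1 / 2
        · have h1 := ratioI_lt (s := s) ((ext_side hea).1.1 hs) ((ext_side heb).1.1 (hp'.1 hs))
          exact ⟨dep_lt.2 (Or.inl h1), by constructor <;> intro <;> linarith⟩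
        · have h1 := lt_ratioI (s := s) ((ext_side hea).2.1 hs)
            ((ext_side heb).2.1 fun h => hs (hp'.2 h))
          exact ⟨dep_lt.2 (Or.inr h1), by constructor <;> intro <;> linarith⟩
      refine ⟨Or.inl hfin.1, ?_⟩
      rw [pat, pat, if_pos ⟨hn, not_midP_of_extP hfin.1⟩, if_pos ⟨hn, hm⟩]
      simp only [hfin.2]
  refine ⟨fun n hn => (key n hn).1, funext fun n => ?_⟩
  by_cases hn : n ∈ S
  · exact (key n hn).2
  · simp [pat, hn]

open Classical in
/-- A point with given position. -/
noncomputable def pick (S : Finset (Fin 4)) (p : Fin 4 → Option Bool) : I :=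
  if p = pat S 0 then 0 else if p = pat S 1 then 1 else
    if h : ∃ t ∈ clear S, pat S t = p then h.choose else 0

noncomputable def ctr (S : Finset (Fin 4)) (t : I) : I := pick S (pat S t)

lemma ctr_spec {t : I} (ht : t ∈ clear S) : ctr S t ∈ clear S ∧ pat S (ctr S t) = pat S t := by
  unfold ctr pick
  split_ifs with h0 h1 h2
  · exact ⟨zero_mem_clear S, h0.symm⟩
  · exact ⟨one_mem_clear S, h1.symm⟩
  · exact h2.choose_spec
  · exact absurd ⟨t, ht, rfl⟩ h2

lemma ctr_congr {t t' : I} (h : pat S t = pat S t') : ctr S t = ctr S t' :=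
  congrArg (pick S) h

lemma ctr_zero : ctr S 0 = 0 := if_pos rfl

lemma ctr_one (hS : S.Nonempty) : ctr S 1 = 1 := by
  obtain ⟨n, hn⟩ := hS
  have : pat S 1 ≠ pat S 0 := fun h => by
    have := congrFun h n
    rw [pat_zero hn, pat_one hn] at this
    simp at this
  unfold ctr pick
  rw [if_neg this, if_pos rfl]

lemma midP_of_ctr {t : I} (ht : t ∈ clear S) {m : Fin 4} (hm : m ∈ S) (hmax : ∀ n ∈ S, n ≤ m)
    (h : ctr S t ≠ 0 ∧ ctr S t ≠ 1) : midP m t := by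
  by_contra hmid
  have he := (ht m hm).resolve_right hmid
  have hall : ∀ n ∈ S, ¬midP n t := fun n hn => by
    refine not_midP_of_extP ?_
    unfold extP at he ⊢
    linarith [thr_anti (hmax n hn)]
  by_cases hs : (t : ℝ) < 1 / 2
  · refine h.1 ((ctr_congr (funext fun n => ?_)).trans ctr_zero)
    by_cases hn : n ∈ S
    · rw [pat_zero hn, pat, if_pos ⟨hn, hall n hn⟩]; simpa using hs
    · simp [pat, hn]
  · refine h.2 ((ctr_congr (funext fun n => ?_)).trans (ctr_one ⟨m, hm⟩))
    by_cases hn : n ∈ S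
    · rw [pat_one hn, pat, if_pos ⟨hn, hall n hn⟩]; simpa using hs
    · simp [pat, hn]

end Thresholds

section CoverY

variable {X : Type} (Q : QuandleStruct X)

open Raw

/-- The words with exactly `n` letters above the `n`-th threshold. -/
def covO (n : Fin 4) : Set (Yt Q) := {y | y ∈ inU (clear {n}) ∧ cnt (midP n) y.1 = n}

variable {Q}

lemma not_midP_zero (n : Fin 4) : ¬midP n 0 := not_midP_of_extP (extP_zero n)
lemma not_midP_one (n : Fin 4) : ¬midP n 1 := not_midP_of_extP (extP_one n)

lemma isOpen_covO (n : Fin 4) : IsOpen (covO Q n) := by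
  classical
  have h := isOpen_pattern (Q := Q) (zero_mem_clear {n}) (one_mem_clear {n}) (midP n)
    (fun t ht => by
      filter_upwards [pat_eventually ht] with t' ht'
      refine ⟨ht'.1, propext ?_⟩
      rw [midP_iff (Finset.mem_singleton_self n), midP_iff (Finset.mem_singleton_self n), ht'.2])
    (fun w => w.1.countP fun l => l.1)
    (fun w => by
      have := cnt_nf (not_midP_zero n) (not_midP_one n) w
      unfold cnt at this
      show ((nf w).1.map _).countP _ = (w.1.map _).countP _
      rw [List.countP_map, List.countP_map]
      exact this) {(n : ℕ)}
  refine (congrArg IsOpen ?_).mpr h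
  ext y
  refine and_congr_right fun _ => ?_
  show _ ↔ (y.1.1.map _).countP _ = _
  rw [List.countP_map]
  rfl

lemma mem_covers {S : Finset (Fin 4)} {y : Yt Q} : y ∈ ⋂ n ∈ S, covO Q n ↔
    y ∈ inU (clear S) ∧ ∀ n ∈ S, cnt (midP n) y.1 = n := by
  simp only [mem_iInter, covO, inU, clear, mem_ofPred_eq, Finset.mem_singleton, forall_eq]
  constructor
  · exact fun h => ⟨fun l hl n hn => (h n hn).1 l hl, fun n hn => (h n hn).2⟩
  · exact fun h n hn => ⟨fun l hl => h.1 l hl n hn, h.2 n hn⟩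

/-- The contraction of the letters. -/
noncomputable def ctn (S : Finset (Fin 4)) (s t : I) : I := ratioI s t (ctr S t)

variable {S : Finset (Fin 4)}

lemma ctn_spec {t : I} (ht : t ∈ clear S) (s : I) :
    ctn S s t ∈ clear S ∧ pat S (ctn S s t) = pat S t :=
  pat_ratioI ht (ctr_spec ht).1 (ctr_spec ht).2.symm s

lemma ctn_at_zero (s : I) : ctn S s 0 = 0 := by rw [ctn, ctr_zero, ratioI_self]
lemma ctn_at_one (hS : S.Nonempty) (s : I) : ctn S s 1 = 1 := by rw [ctn, ctr_one hS, ratioI_self]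

lemma cmap_ctn_mem (hS : S.Nonempty) {y : Yt Q} (hy : y ∈ ⋂ n ∈ S, covO Q n) (s : I) :
    cmap (ctn S s) y ∈ ⋂ n ∈ S, covO Q n := by
  rw [mem_covers] at hy ⊢
  constructor
  · rw [cmap, nfY_mem_inU (zero_mem_clear S) (one_mem_clear S)]
    intro l hl
    obtain ⟨l', hl', rfl⟩ := List.mem_map.1 hl
    exact (ctn_spec (hy.1 l' hl') s).1
  · intro n hn
    show cnt (midP n) (nf _) = n
    rw [cnt_nf (not_midP_zero n) (not_midP_one n), cnt_mapL, hy.2 n hn]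
    intro l hl
    rw [midP_iff hn, midP_iff hn, (ctn_spec (hy.1 l hl) s).2]

lemma cmap_ctr_ctn (hS : S.Nonempty) {y : Yt Q} (hy : y ∈ inU (clear S)) (s : I) :
    cmap (ctr S) (cmap (ctn S s) y) = cmap (ctr S) y := by
  rw [cmap_cmap ctr_zero (ctr_one hS)]
  exact cmap_congr fun l hl => ctr_congr (ctn_spec (hy l hl) s).2

variable (Q) in
/-- The words with at most three letters, all of them values of some `ctr S`. -/
def finWords : Set (Yt Q) :=
  {y | y.1.1.length ≤ 3 ∧ ∀ l ∈ y.1.1, l.1 ∈ ⋃ S, range (ctr S)}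

lemma finite_finWords [Finite X] : (finWords Q).Finite := by
  have hE : (⋃ S, range (ctr S)).Finite := finite_iUnion fun S =>
    (finite_range (pick S)).subset (by rintro _ ⟨t, rfl⟩; exact ⟨_, rfl⟩)
  set E := ⋃ S, range (ctr S) with hEd
  have : Finite E := hE
  have hf : Finite (Inn Q) := inferInstance
  have h1 : {L : List (E × X) | L.length ≤ 3}.Finite := List.finite_length_le _ _
  have h2 : Finite ({L : List (E × X) | L.length ≤ 3} : Set _) := h1
  refine (finite_range fun z : ({L : List (E × X) | L.length ≤ 3} : Set _) × Inn Q =>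
    nfY (mapL Subtype.val ((z.1.1, z.2) : Raw Q E))).subset ?_
  rintro y ⟨hy1, hy2⟩
  let L : List (E × X) := y.1.1.attach.map fun l => ((⟨l.1.1, hy2 l.1 l.2⟩ : ↥E), l.1.2)
  have hL : L.length ≤ 3 := by simpa [L] using hy1
  refine ⟨(⟨L, hL⟩, y.1.2), ?_⟩
  refine Eq.trans (congrArg nfY ?_) (nfY_val y)
  refine Prod.ext ?_ rfl
  show (y.1.1.attach.map _).map _ = y.1.1
  rw [List.map_map]
  exact List.attach_map_subtype_val _

lemma cmap_ctr_mem (hS : S.Nonempty) {y : Yt Q} (hy : y ∈ ⋂ n ∈ S, covO Q n) :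
    cmap (ctr S) y ∈ finWords Q := by
  rw [mem_covers] at hy
  constructor
  · show (nf _).1.length ≤ 3
    rw [length_nf]
    have hm := S.max'_mem hS
    have h1 : cnt (fun t => t ≠ 0 ∧ t ≠ 1) (mapL (ctr S) y.1) =
        cnt (fun t => ctr S t ≠ 0 ∧ ctr S t ≠ 1) y.1 := by
      classical
      unfold cnt
      show (y.1.1.map _).countP _ = _
      rw [List.countP_map]
      rfl
    rw [h1]
    have h2 : cnt (fun t => ctr S t ≠ 0 ∧ ctr S t ≠ 1) y.1 ≤ cnt (midP (S.max' hS)) y.1 :=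
      cnt_mono fun l hl h => midP_of_ctr (hy.1 l hl) hm (fun n hn => S.le_max' n hn) h
    rw [hy.2 _ hm] at h2
    omega
  · intro l hl
    have h3 : (nfY (mapL (ctr S) y.1) : Yt Q) ∈ inU (range (ctr S)) := by
      rw [nfY_mem_inU (U := range (ctr S)) ⟨0, ctr_zero⟩ ⟨1, ctr_one hS⟩]
      intro l hl
      obtain ⟨l', hl', rfl⟩ := List.mem_map.1 hl
      exact ⟨_, rfl⟩
    exact mem_iUnion.2 ⟨S, h3 l hl⟩

open Classical in
noncomputable def toFin (y : Yt Q) : finWords Q :=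
  if h : y ∈ finWords Q then ⟨y, h⟩ else ⟨oneY, Nat.zero_le 3, fun l hl => by
    change l ∈ [] at hl
    simp at hl⟩

theorem goodCover_covO [Finite X] : GoodCover (covO Q) 4 := by
  have : Finite (finWords Q) := finite_finWords
  refine goodCover_of_fibres _ _ isOpen_covO (fun S y => toFin (cmap (ctr S) y)) ?_ ?_
  · intro S hS a
    have h1 : IsOpen (⋂ n ∈ S, covO Q n) := isOpen_biInter_finset fun n _ => isOpen_covO n
    have h2 := isOpen_pattern (Q := Q) (zero_mem_clear S) (one_mem_clear S) (ctr S)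
      (fun t ht => by
        filter_upwards [pat_eventually ht] with t' ht'
        exact ⟨ht'.1, ctr_congr ht'.2⟩) (fun w => toFin (nfY w))
      (fun w => congrArg toFin (Subtype.ext (nf_map_nf ctr_zero (ctr_one hS) w))) {a}
    have h3 : (⋂ n ∈ S, covO Q n) ∩ (fun y => toFin (cmap (ctr S) y)) ⁻¹' {a} =
        (⋂ n ∈ S, covO Q n) ∩
          {y : Yt Q | y ∈ inU (clear S) ∧ toFin (nfY (mapL (ctr S) y.1)) ∈ ({a} : Set _)} := by
      ext y
      constructor
      · exact fun h => ⟨h.1, (mem_covers.1 h.1).1, h.2⟩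
      · exact fun h => ⟨h.1, h.2.2⟩
    rw [h3]
    exact h1.inter h2
  · intro S hS p hp
    have hmemS : ∀ y ∈ (⋂ n ∈ S, covO Q n), ∀ s, cmap (ctn S s) y ∈ (⋂ n ∈ S, covO Q n) ∩
        (fun y => toFin (cmap (ctr S) y)) ⁻¹' {toFin (cmap (ctr S) y)} := fun y hy s =>
      ⟨cmap_ctn_mem hS hy s, congrArg toFin (cmap_ctr_ctn hS (mem_covers.1 hy).1 s)⟩
    have h1 : ∀ y : Yt Q, cmap (ctn S 1) y = cmap (ctr S) y := fun y =>
      cmap_congr fun l _ => ratioI_one _ _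
    refine ⟨fun z => cmap (ctn S z.2) z.1, cmap (ctr S) p, ?_, ?_, ?_, ?_, ?_⟩
    · have := hmemS p hp 1
      rwa [h1] at this
    · have hcont : ContinuousOn (fun z : Yt Q × I => cmap (ctn S z.2) z.1)
          (inU (clear S) ×ˢ univ) := by
        refine continuousOn_cmap (isOpen_clear S) (zero_mem_clear S) (one_mem_clear S)
          ctn_at_zero (ctn_at_one hS) fun s t ht => ?_
        have hc : ContinuousAt (fun z : I × I => ratioI z.1 z.2 (ctr S t)) (s, t) := by
          have : Continuous fun z : I × I => ratioI z.1 z.2 (ctr S t) := by fun_prop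
          exact this.continuousAt
        refine hc.congr ?_
        have := (continuous_snd.continuousAt (x := (s, t))).eventually (pat_eventually ht)
        filter_upwards [this] with z hz
        rw [ctn, ctr_congr hz.2]
      exact hcont.mono fun z hz => ⟨(mem_covers.1 hz.1.1).1, mem_univ _⟩
    · rintro z ⟨hz, hz'⟩ s
      have := hmemS z hz s
      rwa [show toFin (cmap (ctr S) z) = _ from hz'] at this
    · intro z _
      exact (cmap_congr fun l _ => ratioI_zero _ _).trans (cmap_id z)
    · rintro z ⟨hz, hz'⟩
      show cmap (ctn S 1) z = _
      rw [h1]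
      have h2 : toFin (cmap (ctr S) z) = toFin (cmap (ctr S) p) := hz'
      unfold toFin at h2
      rw [dif_pos (cmap_ctr_mem hS hz), dif_pos (cmap_ctr_mem hS hp)] at h2
      exact congrArg Subtype.val h2

/-- Words with at most three letters are covered. -/
lemma exists_mem_covO {y : Yt Q} (hy : y.1.1.length ≤ 3) : ∃ n, y ∈ covO Q n := by
  have hab : ∀ n : Fin 4, cnt (midP n) y.1 ≤ cnt (fun t => ¬extP n t) y.1 := fun n =>
    cnt_mono fun l _ h h' => not_midP_of_extP h' h
  have hba : ∀ m n : Fin 4, (n : ℕ) = m + 1 → cnt (fun t => ¬extP m t) y.1 ≤ cnt (midP n) y.1 := by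
    intro m n h
    refine cnt_mono fun l _ h' => ?_
    have := thr_succ h
    unfold extP at h'
    unfold midP
    linarith
  have h3 : cnt (fun t => ¬extP 3 t) y.1 ≤ 3 := (cnt_le_length _ _).trans hy
  have hex : ∃ n : Fin 4, cnt (midP n) y.1 = n ∧ cnt (fun t => ¬extP n t) y.1 = n := by
    have a0 := hab 0; have a1 := hab 1; have a2 := hab 2; have a3 := hab 3
    have b0 := hba 0 1 rfl; have b1 := hba 1 2 rfl; have b2 := hba 2 3 rfl
    by_cases e0 : cnt (fun t => ¬extP 0 t) y.1 = 0
    · exact ⟨0, by simpa using (by omega : cnt (midP 0) y.1 = 0), by simpa using e0⟩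
    by_cases e1 : cnt (fun t => ¬extP 1 t) y.1 ≤ 1
    · exact ⟨1, by show _ = 1; omega, by show _ = 1; omega⟩
    by_cases e2 : cnt (fun t => ¬extP 2 t) y.1 ≤ 2
    · exact ⟨2, by show _ = 2; omega, by show _ = 2; omega⟩
    · exact ⟨3, by show _ = 3; omega, by show _ = 3; omega⟩
  obtain ⟨n, hn, hn'⟩ := hex
  refine ⟨n, fun l hl m hm => ?_, hn⟩
  obtain rfl := Finset.mem_singleton.1 hm
  by_cases h : extP m l.1
  · exact Or.inl h
  · exact Or.inr (imp_of_cnt_eq (P := midP m) (P' := fun t => ¬extP m t)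
      (fun l _ h h' => not_midP_of_extP h' h) (by rw [hn, hn']) l hl h)

end CoverY

section Coordinates

variable {X : Type} {Q : QuandleStruct X}

open Raw

lemma isOpen_cnt_le {P : I → Prop} (hP : IsClosed {t | P t}) (h0 : ¬P 0) (h1 : ¬P 1) (M : ℕ) :
    IsOpen {y : Yt Q | cnt P y.1 ≤ M} := by
  classical
  rw [isOpen_Yt, isOpen_iff_mem_nhds]
  intro w hw
  change cnt P (nf (raw w)) ≤ M at hw
  rw [cnt_nf h0 h1] at hw
  rw [eq_cell w] at hw ⊢
  generalize w.1.1 = n, (fun i => (w.1.2 i).2) = a, w.2 = p, (fun i => (w.1.2 i).1) = t at hw ⊢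
  rw [nhds_cell, Filter.mem_map]
  have hev : ∀ᶠ t' in 𝓝 t, ∀ i, P (t' i) → P (t i) := by
    rw [Filter.eventually_all]
    intro i
    by_cases hi : P (t i)
    · exact Filter.Eventually.of_forall fun _ _ => hi
    · have := (continuous_apply (A := fun _ : Fin n => I) i).continuousAt (x := t)
        (hP.isOpen_compl.mem_nhds hi)
      filter_upwards [this] with t' ht' h
      exact absurd h ht'
  filter_upwards [hev] with t' ht'
  show cnt P (nf (raw (cell n a p t'))) ≤ M
  rw [cnt_nf h0 h1]
  refine le_trans ?_ hw
  unfold cnt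
  rw [raw_cell, raw_cell]
  show (List.ofFn _).countP _ ≤ (List.ofFn _).countP _
  rw [List.ofFn_eq_map, List.ofFn_eq_map, List.countP_map, List.countP_map]
  exact List.countP_mono_left fun i _ h => by
    simp only [Function.comp_apply, decide_eq_true_eq] at h ⊢
    exact ht' i h

/-- Letters which are not close to the endpoints. -/
def inner (t : I) : Prop := 1 / 4 < dep t

lemma not_inner_zero : ¬inner 0 := by rw [inner, dep_zero]; norm_num
lemma not_inner_one : ¬inner 1 := by rw [inner, dep_one]; norm_num

/-- Letters which are not at the boundary of the set of inner letters. -/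
def offQuarter : Set I := {t | dep t ≠ 1 / 4}

lemma isOpen_offQuarter : IsOpen offQuarter := isOpen_ne_fun continuous_dep continuous_const
lemma zero_mem_offQuarter : (0 : I) ∈ offQuarter := by
  show dep 0 ≠ _; rw [dep_zero]; norm_num
lemma one_mem_offQuarter : (1 : I) ∈ offQuarter := by
  show dep 1 ≠ _; rw [dep_one]; norm_num

lemma inner_eventually {t : I} (ht : t ∈ offQuarter) : ∀ᶠ t' in 𝓝 t, (inner t' ↔ inner t) := by
  rcases lt_or_gt_of_ne ht with h | h
  · filter_upwards [(isOpen_lt continuous_dep continuous_const).mem_nhds h] with t' ht'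
    have h2 : dep t' < 1 / 4 := ht'
    exact iff_of_false (not_lt.2 h2.le) (not_lt.2 h.le)
  · filter_upwards [(isOpen_lt continuous_const continuous_dep).mem_nhds h] with t' ht'
    exact iff_of_true ht' h

open Classical in
/-- The sequence of inner letters. -/
noncomputable def innerList (w : Raw Q I) : List I := (w.1.map Prod.fst).filter fun t => inner t

lemma innerList_nf (w : Raw Q I) : innerList (nf w) = innerList w := by
  classical
  unfold innerList
  rw [nf_fst, List.filter_filter]
  refine List.filter_congr fun t _ => ?_
  by_cases h : inner t
  · have h0 : t ≠ 0 := fun e => not_inner_zero (e ▸ h)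
    have h1 : t ≠ 1 := fun e => not_inner_one (e ▸ h)
    simp [h, h0, h1]
  · simp [h]

noncomputable def coord (i : ℕ) (y : Yt Q) : I := (innerList y.1).getD i 0

lemma coord_qY (i : ℕ) (w : Pre Q) : coord i (qY w) = (innerList (raw w)).getD i 0 := by
  show (innerList (nf (raw w))).getD i 0 = _
  rw [innerList_nf]

lemma continuousOn_coord (i : ℕ) : ContinuousOn (coord (Q := Q) i) (inU offQuarter) := by
  classical
  have hV := isOpen_inU (Q := Q) isOpen_offQuarter zero_mem_offQuarter one_mem_offQuarter
  have hq := isQuotientMap_qY.restrictPreimage_isOpen hV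
  rw [continuousOn_iff_continuous_domRestrict, hq.continuous_iff, continuous_iff_continuousAt]
  rintro ⟨w, hw⟩
  have hw' : ∀ l ∈ (raw w).1, l.1 ∈ offQuarter :=
    (nfY_mem_inU zero_mem_offQuarter one_mem_offQuarter _).1 hw
  have key : ContinuousAt (fun w : Pre Q => coord i (qY w)) w := by
    clear hw
    simp only [coord_qY]
    rw [eq_cell w] at hw' ⊢
    generalize w.1.1 = n, (fun i => (w.1.2 i).2) = a, w.2 = p, (fun i => (w.1.2 i).1) = t at hw' ⊢
    rw [ContinuousAt, nhds_cell, Filter.tendsto_map'_iff]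
    have hev : ∀ᶠ t' in 𝓝 t, ∀ j, (inner (t' j) ↔ inner (t j)) := by
      rw [Filter.eventually_all]
      intro j
      have := hw' (t j, a j) (by rw [raw_cell, List.mem_ofFn]; exact ⟨j, rfl⟩)
      exact (continuous_apply j).continuousAt.eventually (inner_eventually this)
    let L : List (Fin n) := (List.finRange n).filter fun j => inner (t j)
    have hL : ∀ᶠ t' in 𝓝 t, innerList (raw (cell n a p t')) = L.map t' := by
      filter_upwards [hev] with t' ht'
      unfold innerList
      rw [raw_cell]
      show ((List.ofFn _).map _).filter _ = _
      rw [List.ofFn_eq_map, List.map_map, List.filter_map]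
      congr 1
      refine List.filter_congr fun j _ => ?_
      simp only [Function.comp_apply, ht' j]
    have hcont : Continuous fun t' : Fin n → I => (L.map t').getD i 0 := by
      by_cases h : i < L.length
      · have : (fun t' : Fin n → I => (L.map t').getD i 0) = fun t' => t' L[i] := by
          funext t'
          simp [List.getD, h]
        rw [this]
        fun_prop
      · have : (fun t' : Fin n → I => (L.map t').getD i 0) = fun t' => 0 := by
          funext t'
          simp [List.getD, h]
        rw [this]
        fun_prop
    have h2 : Filter.Tendsto (fun t' => (innerList (raw (cell n a p t'))).getD i 0) (𝓝 t)
        (𝓝 ((L.map t).getD i 0)) := by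
      refine hcont.continuousAt.tendsto.congr' ?_
      filter_upwards [hL] with t' ht'
      rw [ht']
    rw [hL.self_of_nhds]
    exact h2
  exact ContinuousAt.comp (f := fun z : ↥(qY ⁻¹' inU offQuarter : Set (Pre Q)) => z.1)
    (g := fun w : Pre Q => coord i (qY w)) (x := ⟨w, hw⟩) key
    continuousAt_subtype_val

open Classical in
/-- A retraction of letters onto `0`, `1/2` and `1`. -/
noncomputable def trico (t : I) : I :=
  if inner t then ⟨1 / 2, by norm_num, by norm_num⟩ else if (t : ℝ) < 1 / 2 then 0 else 1

lemma trico_zero : trico 0 = 0 := by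
  rw [trico, if_neg not_inner_zero, if_pos (by norm_num)]
lemma trico_one : trico 1 = 1 := by
  rw [trico, if_neg not_inner_one, if_neg (by norm_num)]

lemma trico_ne (t : I) : (trico t ≠ 0 ∧ trico t ≠ 1) ↔ inner t := by
  unfold trico
  split_ifs with h h'
  · refine iff_of_true ⟨fun e => ?_, fun e => ?_⟩ h <;>
    · have := congrArg Subtype.val e
      norm_num at this
  · simp [h]
  · simp [h]

lemma trico_eventually {t : I} (ht : t ∈ offQuarter) :
    ∀ᶠ t' in 𝓝 t, t' ∈ offQuarter ∧ trico t' = trico t := by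
  have h1 := isOpen_offQuarter.mem_nhds ht
  by_cases h : inner t
  · filter_upwards [h1, inner_eventually ht] with t' h1 h2
    exact ⟨h1, by rw [trico, trico, if_pos (h2.2 h), if_pos h]⟩
  · have h2 : ∀ᶠ t' : I in 𝓝 t, ((t' : ℝ) < 1 / 2 ↔ (t : ℝ) < 1 / 2) := by
      have hne : (t : ℝ) ≠ 1 / 2 := fun e => h (by rw [inner, dep, e]; norm_num)
      rcases lt_or_gt_of_ne hne with h' | h'
      · filter_upwards [(isOpen_lt continuous_subtype_val continuous_const).mem_nhds h']
          with t' ht'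
        exact iff_of_true ht' h'
      · filter_upwards [(isOpen_lt continuous_const continuous_subtype_val).mem_nhds h']
          with t' ht'
        exact iff_of_false (not_lt.2 (le_of_lt ht')) (not_lt.2 h'.le)
    filter_upwards [h1, inner_eventually ht, h2] with t' h1 h2 h3
    refine ⟨h1, ?_⟩
    rw [trico, trico, if_neg (fun e => h (h2.1 e)), if_neg h]
    simp only [h3]

lemma eq_of_trico {L L' : List (I × X)}
    (hL : ∀ l ∈ L, inner l.1) (h : L.map (fun l => (trico l.1, l.2)) = L'.map fun l => (trico l.1, l.2)) :
    L.map Prod.snd = L'.map Prod.snd := by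
  have := congrArg (List.map Prod.snd) h
  simpa [List.map_map, Function.comp_def] using this

/-- The local form of short words near a word with inner letters. -/
lemma local_form {N : ℕ} {y₀ : Yt Q} (hlen : y₀.1.1.length = N) (hin : ∀ l ∈ y₀.1.1, inner l.1) :
    ∃ (a : Fin N → X) (p : Inn Q), (∀ i, ContinuousAt (coord (Q := Q) i) y₀) ∧
      ∀ᶠ y in 𝓝 y₀, y.1.1.length ≤ N → y.1 = raw (cell N a p fun i => coord i y) := by
  classical
  have hV := isOpen_inU (Q := Q) isOpen_offQuarter zero_mem_offQuarter one_mem_offQuarter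
  have hy₀ : y₀ ∈ inU offQuarter := fun l hl => ne_of_gt (hin l hl)
  subst hlen
  refine ⟨fun i => (y₀.1.1.get i).2, y₀.1.2, fun i =>
    (continuousOn_coord i).continuousAt (hV.mem_nhds hy₀), ?_⟩
  have hopen := isOpen_pattern (Q := Q) zero_mem_offQuarter one_mem_offQuarter trico
    (fun t ht => trico_eventually ht) (fun w => nf w)
    (fun w => nf_map_nf trico_zero trico_one w) {nf (mapL trico y₀.1)}
  filter_upwards [hopen.mem_nhds ⟨hy₀, rfl⟩] with y hy hlen
  have hy2 : nf (mapL trico y.1) = nf (mapL trico y₀.1) := hy.2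
  have hcnt : ∀ w : Raw Q I, (nf (mapL trico w)).1.length = cnt inner w := by
    intro w
    rw [length_nf, cnt, cnt]
    show (w.1.map _).countP _ = _
    rw [List.countP_map]
    refine List.countP_congr fun l _ => ?_
    simpa using trico_ne l.1
  have hstab : ∀ w : Raw Q I, (∀ l ∈ w.1, inner l.1) → nf (mapL trico w) = mapL trico w := by
    intro w hw
    refine nf_eq_self fun l hl => ?_
    obtain ⟨l', hl', rfl⟩ := List.mem_map.1 hl
    exact (trico_ne _).2 (hw l' hl')
  have htrue : ∀ w : Raw Q I, cnt (fun _ => True) w = w.1.length := by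
    intro w; simp [cnt]
  have h0 : cnt inner y₀.1 = y₀.1.1.length := by
    rw [← htrue]
    exact le_antisymm (cnt_mono fun _ _ _ => trivial) (cnt_mono fun l hl _ => hin l hl)
  have h1 : cnt inner y.1 = y₀.1.1.length := by rw [← hcnt, hy2, hcnt, h0]
  have hyin : ∀ l ∈ y.1.1, inner l.1 := fun l hl =>
    imp_of_cnt_eq (P := inner) (P' := fun _ => True) (fun _ _ _ => trivial)
      (by rw [htrue, h1]; exact hlen) l hl trivial
  rw [hstab _ hin, hstab _ hyin] at hy2
  have hsnd := eq_of_trico hyin (congrArg Prod.fst hy2)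
  have hp : y.1.2 = y₀.1.2 := by
    have := congrArg Prod.snd hy2
    exact this
  have hl : y.1.1.length = y₀.1.1.length := by
    have := congrArg List.length hsnd
    simpa using this
  have hfst : innerList y.1 = y.1.1.map Prod.fst := by
    unfold innerList
    refine List.filter_eq_self.2 fun t ht => ?_
    obtain ⟨l, hl, rfl⟩ := List.mem_map.1 ht
    simpa using hyin l hl
  refine Prod.ext ?_ hp
  rw [raw_cell]
  refine List.ext_getElem (by simpa using hl) fun i hi hi' => ?_
  rw [List.getElem_ofFn]
  refine Prod.ext ?_ ?_
  · simp only [coord, hfst]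
    simp [List.getD, hi]
  · have := List.getElem_of_eq hsnd (i := i) (by simpa using hi)
    simpa using this

end Coordinates

section Deform

variable {X : Type} {Q : QuandleStruct X}

open Raw

/-- The stretching of the unit interval about its midpoint. -/
noncomputable def stretch (δ : ℝ) (t : I) : I := clampI (((t : ℝ) - 1 / 2) / (2 * δ) + 1 / 2)

lemma stretch_far {δ : ℝ} (hδ : 0 < δ) {t : I} (h : ¬|(t : ℝ) - 1 / 2| ≤ δ) :
    stretch δ t = 0 ∨ stretch δ t = 1 := by
  rw [not_le, lt_abs] at h
  rcases h with h | h
  · right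
    refine clampI_of_ge ?_
    have : (1 : ℝ) / 2 ≤ ((t : ℝ) - 1 / 2) / (2 * δ) := by
      rw [le_div_iff₀ (by linarith)]; linarith
    linarith
  · left
    refine clampI_of_le ?_
    have : ((t : ℝ) - 1 / 2) / (2 * δ) ≤ -(1 / 2) := by
      rw [div_le_iff₀ (by linarith)]; linarith
    linarith

lemma stretch_zero {δ : ℝ} (hδ : 0 < δ) (h : δ < 1 / 2) : stretch δ 0 = 0 := by
  refine clampI_of_le ?_
  have : (((0 : I) : ℝ) - 1 / 2) / (2 * δ) ≤ -(1 / 2) := by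
    rw [div_le_iff₀ (by linarith), Icc.coe_zero]; linarith
  linarith

lemma stretch_one {δ : ℝ} (hδ : 0 < δ) (h : δ < 1 / 2) : stretch δ 1 = 1 := by
  refine clampI_of_ge ?_
  have : (1 : ℝ) / 2 ≤ (((1 : I) : ℝ) - 1 / 2) / (2 * δ) := by
    rw [le_div_iff₀ (by linarith), Icc.coe_one]; linarith
  linarith

variable {ι : Type} [Fintype ι] [DecidableEq ι]

/-- Stretching the letters of words with few letters near the midpoint. -/
lemma homotopic_short {δ : ℝ} (hδ : 0 < δ) (hδ' : δ < 1 / 2) {M : ℕ} (f : Ω^ ι (Yt Q) oneY)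
    (h : ∀ x, cnt (fun t => |(t : ℝ) - 1 / 2| ≤ δ) (f x).1 ≤ M) :
    ∃ f' : Ω^ ι (Yt Q) oneY, GenLoop.Homotopic f f' ∧ ∀ x, (f' x).1.1.length ≤ M := by
  have hc : Continuous (stretch δ) := by unfold stretch; fun_prop
  have hcont : Continuous fun z : Yt Q × I => cmap (fun t => ratioI z.2 t (stretch δ t)) z.1 :=
    continuous_cmap (c := fun s t => ratioI s t (stretch δ t))
      (fun s => by rw [stretch_zero hδ hδ', ratioI_self])
      (fun s => by rw [stretch_one hδ hδ', ratioI_self]) (by fun_prop)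
  let H : C((ι → I) × I, Yt Q) := ⟨fun z => cmap (fun t => ratioI z.2 t (stretch δ t)) (f z.1),
    Continuous.comp (g := fun z : Yt Q × I => cmap (fun t => ratioI z.2 t (stretch δ t)) z.1)
      (f := fun z : (ι → I) × I => (f z.1, z.2)) hcont
      ((f.1.continuous.comp continuous_fst).prodMk continuous_snd)⟩
  have hb : ∀ x ∈ Cube.boundary ι, ∀ t, H (x, t) = oneY := by
    intro x hx t
    show cmap _ (f x) = oneY
    rw [GenLoop.boundary f x hx, cmap_one]
  let f' : Ω^ ι (Yt Q) oneY := ⟨⟨fun x => H (x, 1), by fun_prop⟩, fun x hx => hb x hx 1⟩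
  refine ⟨f', homotopic_of_map H (fun x => ?_) (fun x => rfl) hb, fun x => ?_⟩
  · show cmap (fun t => ratioI 0 t (stretch δ t)) (f x) = f x
    exact (cmap_congr (d := id) fun l _ => ratioI_zero _ _).trans (cmap_id _)
  · have h1 : f' x = cmap (stretch δ) (f x) := cmap_congr fun l _ => ratioI_one _ _
    rw [h1]
    show (nf _).1.length ≤ M
    rw [length_nf]
    refine le_trans ?_ (h x)
    classical
    unfold cnt
    show ((f x).1.1.map _).countP _ ≤ _
    rw [List.countP_map]
    refine List.countP_mono_left fun l _ hl => ?_
    simp only [Function.comp_apply, decide_eq_true_eq] at hl ⊢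
    by_contra hfar
    rcases stretch_far hδ hfar with h | h
    · exact hl.1 h
    · exact hl.2 h

lemma isClosed_nearHalf (δ : ℝ) : IsClosed {t : I | |(t : ℝ) - 1 / 2| ≤ δ} :=
  isClosed_le (by fun_prop) continuous_const

lemma not_nearHalf_zero {δ : ℝ} (h : δ < 1 / 2) : ¬|((0 : I) : ℝ) - 1 / 2| ≤ δ := by
  rw [Icc.coe_zero, zero_sub, abs_neg, abs_of_pos (by norm_num)]; linarith

lemma not_nearHalf_one {δ : ℝ} (h : δ < 1 / 2) : ¬|((1 : I) : ℝ) - 1 / 2| ≤ δ := by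
  rw [Icc.coe_one, abs_of_pos (by norm_num)]; linarith

/-- Every cube can be deformed to have bounded word length. -/
lemma exists_bounded (f : Ω^ ι (Yt Q) oneY) :
    ∃ (M : ℕ) (f' : Ω^ ι (Yt Q) oneY), GenLoop.Homotopic f f' ∧ ∀ x, (f' x).1.1.length ≤ M := by
  have hδ : (1 / 4 : ℝ) < 1 / 2 := by norm_num
  have hopen : ∀ M : ℕ, IsOpen {x | cnt (fun t => |(t : ℝ) - 1 / 2| ≤ 1 / 4) (f x).1 ≤ M} :=
    fun M => (isOpen_cnt_le (isClosed_nearHalf _) (not_nearHalf_zero hδ) (not_nearHalf_one hδ)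
      M).preimage f.1.continuous
  obtain ⟨M, hM⟩ := isCompact_univ.elim_directed_cover _ hopen
    (fun x _ => mem_iUnion.2 ⟨cnt (fun t => |(t : ℝ) - 1 / 2| ≤ 1 / 4) (f x).1, le_refl (cnt _ _)⟩)
    (directed_of_isDirected_le fun M N h x hx => le_trans (show _ ≤ M from hx) h)
  obtain ⟨f', h1, h2⟩ := homotopic_short (δ := 1 / 4) (by norm_num) hδ f fun x => hM (mem_univ x)
  exact ⟨M, f', h1, h2⟩

/-- A cube whose words have few letters equal to the midpoint can be shortened. -/
lemma exists_shorter {M : ℕ} (f : Ω^ ι (Yt Q) oneY)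
    (h : ∀ x, cnt (fun t => (t : ℝ) = 1 / 2) (f x).1 ≤ M) :
    ∃ f' : Ω^ ι (Yt Q) oneY, GenLoop.Homotopic f f' ∧ ∀ x, (f' x).1.1.length ≤ M := by
  let δ : ℕ → ℝ := fun k => 1 / ((k : ℝ) + 3)
  have hδ0 : ∀ k, 0 < δ k := fun k => by positivity
  have hδ1 : ∀ k, δ k < 1 / 2 := fun k =>
    one_div_lt_one_div_of_lt (by norm_num) (by have : (0 : ℝ) ≤ k := by positivity
                                               linarith)
  have hanti : ∀ k m, k ≤ m → δ m ≤ δ k := fun k m hkm =>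
    one_div_le_one_div_of_le (by positivity) (by have : (k : ℝ) ≤ m := by exact_mod_cast hkm
                                                 linarith)
  have hlim : ∀ r : ℝ, 0 < r → ∃ k, δ k < r := by
    intro r hr
    obtain ⟨k, hk⟩ := exists_nat_gt (1 / r)
    refine ⟨k, ?_⟩
    rw [div_lt_iff₀ hr] at hk
    rw [div_lt_iff₀ (by positivity)]
    nlinarith
  have hopen : ∀ k, IsOpen {x | cnt (fun t => |(t : ℝ) - 1 / 2| ≤ δ k) (f x).1 ≤ M} :=
    fun k => (isOpen_cnt_le (isClosed_nearHalf _) (not_nearHalf_zero (hδ1 k))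
      (not_nearHalf_one (hδ1 k)) M).preimage f.1.continuous
  have hcov : univ ⊆ ⋃ k, {x | cnt (fun t => |(t : ℝ) - 1 / 2| ≤ δ k) (f x).1 ≤ M} := by
    intro x _
    have key : ∀ L : List (I × X), ∃ k, ∀ l ∈ L, |(l.1 : ℝ) - 1 / 2| ≤ δ k → (l.1 : ℝ) = 1 / 2 := by
      intro L
      induction L with
      | nil => exact ⟨0, by simp⟩
      | cons l L ih =>
        obtain ⟨k, hk⟩ := ih
        by_cases hl : (l.1 : ℝ) = 1 / 2
        · refine ⟨k, fun l' hl' h => ?_⟩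
          rcases List.mem_cons.1 hl' with rfl | hl'
          · exact hl
          · exact hk _ hl' h
        · obtain ⟨m, hm⟩ := hlim |(l.1 : ℝ) - 1 / 2| (abs_pos.2 (sub_ne_zero.2 hl))
          refine ⟨max k m, fun l' hl' h => ?_⟩
          rcases List.mem_cons.1 hl' with rfl | hl'
          · exact absurd (h.trans (hanti m _ (le_max_right k m))) (not_le.2 hm)
          · exact hk _ hl' (h.trans (hanti k _ (le_max_left k m)))
    obtain ⟨k, hk⟩ := key (f x).1.1
    exact mem_iUnion.2 ⟨k, (cnt_mono hk).trans (h x)⟩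
  have hmono : ∀ k m, k ≤ m → {x | cnt (fun t => |(t : ℝ) - 1 / 2| ≤ δ k) (f x).1 ≤ M} ⊆
      {x | cnt (fun t => |(t : ℝ) - 1 / 2| ≤ δ m) (f x).1 ≤ M} := by
    intro k m hkm x hx
    have h1 : cnt (fun t => |(t : ℝ) - 1 / 2| ≤ δ m) (f x).1 ≤
        cnt (fun t => |(t : ℝ) - 1 / 2| ≤ δ k) (f x).1 :=
      cnt_mono fun l _ hl => le_trans hl (hanti k m hkm)
    exact h1.trans hx
  obtain ⟨k, hk⟩ := isCompact_univ.elim_directed_cover _ hopen hcov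
    (directed_of_isDirected_le fun k m hkm => hmono k m hkm)
  exact homotopic_short (hδ0 k) (hδ1 k) f fun x => hk (mem_univ x)

/-- A cutoff function vanishing near the boundary of the cube. -/
noncomputable def cut {N : ℕ} (t : Fin N → I) : ℝ := ∏ i, (clampI (16 * (dep (t i) - 5 / 16)) : ℝ)

lemma cut_eq_zero {N : ℕ} {t : Fin N → I} {i : Fin N} (h : dep (t i) ≤ 5 / 16) : cut t = 0 := by
  refine Finset.prod_eq_zero (Finset.mem_univ i) ?_
  rw [clampI_of_le (by linarith), Icc.coe_zero]

lemma cut_eq_one {N : ℕ} {t : Fin N → I} (h : ∀ i, 3 / 8 ≤ dep (t i)) : cut t = 1 := by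
  refine Finset.prod_eq_one fun i _ => ?_
  have := h i
  rw [clampI_of_ge (by linarith), Icc.coe_one]

lemma cut_mem {N : ℕ} (t : Fin N → I) : 0 ≤ cut t ∧ cut t ≤ 1 :=
  ⟨Finset.prod_nonneg fun _ _ => (clampI _).2.1,
    Finset.prod_le_one (fun _ _ => (clampI _).2.1) fun _ _ => (clampI _).2.2⟩

/-- Moving the letters towards `v`. -/
noncomputable def moved {N : ℕ} (s : I) (v : Fin N → ℝ) (t : Fin N → I) (i : Fin N) : I :=
  clampI (t i + s * cut t * (v i - t i))

lemma continuous_moved {N : ℕ} :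
    Continuous fun z : I × (Fin N → ℝ) × (Fin N → I) => moved z.1 z.2.1 z.2.2 := by
  unfold moved cut; fun_prop

lemma moved_of_cut {N : ℕ} {s : I} {v : Fin N → ℝ} {t : Fin N → I} (h : s * cut t = 0) :
    moved s v t = t := by
  funext i
  rw [moved, h, zero_mul, add_zero, clampI_coe]

lemma moved_ne_half {N : ℕ} {v : Fin N → ℝ} {t : Fin N → I}
    (hv : (∀ i, 5 / 16 ≤ dep (t i)) → ∀ i, |v i - t i| < 1 / 16) (hne : v ≠ fun _ => 1 / 2) :
    ∃ i, (moved 1 v t i : ℝ) ≠ 1 / 2 := by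
  have hhalf : ∀ r : ℝ, (clampI r : ℝ) = 1 / 2 → r = 1 / 2 := by
    intro r hr
    rcases le_or_gt r 0 with h | h
    · rw [clampI_of_le h] at hr; norm_num at hr
    rcases le_or_gt 1 r with h' | h'
    · rw [clampI_of_ge h'] at hr; norm_num at hr
    rwa [clampI_of_mem h.le h'.le] at hr
  by_contra! hall
  have hall' : ∀ i, (t i : ℝ) + cut t * (v i - t i) = 1 / 2 := fun i => by
    simpa using hhalf _ (hall i)
  by_cases h1 : ∀ i, 3 / 8 ≤ dep (t i)
  · refine hne (funext fun i => ?_)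
    have := hall' i
    rw [cut_eq_one h1] at this
    linarith
  · push Not at h1
    obtain ⟨i, hi⟩ := h1
    have hti : 1 / 8 < |(t i : ℝ) - 1 / 2| := by
      rw [lt_abs]
      rcases dep_lt.1 hi with h | h
      · right; linarith
      · left; linarith
    by_cases h2 : ∀ i, 5 / 16 ≤ dep (t i)
    · have h3 := hv h2 i
      have h4 : |cut t * (v i - t i)| ≤ |v i - t i| := by
        rw [abs_mul, abs_of_nonneg (cut_mem t).1]
        exact mul_le_of_le_one_left (abs_nonneg _) (cut_mem t).2
      have h5 : (t i : ℝ) - 1 / 2 = -(cut t * (v i - t i)) := by linarith [hall' i]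
      rw [h5, abs_neg] at hti
      linarith
    · push Not at h2
      obtain ⟨j, hj⟩ := h2
      have := hall' i
      rw [cut_eq_zero hj.le, zero_mul, add_zero] at this
      rw [this] at hti
      norm_num at hti

open Classical in
/-- Moving the letters of words of length `N`. -/
noncomputable def pert (N : ℕ) (s : I) (v : Fin N → ℝ) (y : Yt Q) : Yt Q :=
  if h : y.1.1.length = N then
    qY (cell N (fun i => (y.1.1.get (i.cast h.symm)).2) y.1.2
      (moved s v fun i => (y.1.1.get (i.cast h.symm)).1))
  else y

lemma pert_of_eq {N : ℕ} {s : I} {v : Fin N → ℝ} {y : Yt Q} {a : Fin N → X} {p : Inn Q}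
    {t : Fin N → I} (h : y.1 = raw (cell N a p t)) :
    pert N s v y = qY (cell N a p (moved s v t)) := by
  obtain ⟨w, hw⟩ := y
  change w = _ at h
  subst h
  have hlen : (raw (cell N a p t)).1.length = N := List.length_ofFn
  refine (dif_pos hlen).trans ?_
  have hget : ∀ i : Fin N, (raw (cell N a p t)).1.get (i.cast hlen.symm) = (t i, a i) := by
    intro i
    rw [List.get_eq_getElem]
    exact List.getElem_ofFn _
  simp only [hget]
  rfl

lemma qY_of_eq {N : ℕ} {y : Yt Q} {a : Fin N → X} {p : Inn Q} {t : Fin N → I}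
    (h : y.1 = raw (cell N a p t)) : qY (cell N a p t) = y := by
  rw [qY, ← h, nfY_val]

lemma exists_cell {N : ℕ} {y : Yt Q} (h : y.1.1.length = N) :
    ∃ a p t, y.1 = raw (cell N a p t) := by
  subst h
  refine ⟨fun i => (y.1.1.get i).2, y.1.2, fun i => (y.1.1.get i).1, Prod.ext ?_ rfl⟩
  exact (List.ofFn_get _).symm

lemma pert_eq_self {N : ℕ} {s : I} {v : Fin N → ℝ} {y : Yt Q}
    (h : cnt (fun t => 5 / 16 ≤ dep t) y.1 < N ∨ s = 0) : pert N s v y = y := by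
  by_cases hl : y.1.1.length = N
  · obtain ⟨a, p, t, ht⟩ := exists_cell hl
    rw [pert_of_eq ht, moved_of_cut, qY_of_eq ht]
    rcases h with h | h
    · rw [mul_eq_zero]
      right
      by_contra hcut
      refine absurd h (not_lt.2 ?_)
      have hall : ∀ l ∈ y.1.1, 5 / 16 ≤ dep l.1 := by
        intro l hl
        rw [ht, raw_cell, List.mem_ofFn] at hl
        obtain ⟨i, rfl⟩ := hl
        by_contra hi
        exact hcut (cut_eq_zero (not_le.1 hi).le)
      calc N = cnt (fun _ => True) y.1 := by simp [cnt, hl]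
        _ ≤ _ := cnt_mono fun l hl _ => hall l hl
    · rw [h, Icc.coe_zero, zero_mul]
  · exact dif_neg hl

lemma cnt_lt_of_exists {N : ℕ} {P : I → Prop} {a : Fin N → X} {p : Inn Q} {t : Fin N → I} {i : Fin N}
    (h : ¬P (t i)) : cnt P (raw (cell N a p t)) < N := by
  classical
  by_contra hN
  have := imp_of_cnt_eq (P := P) (P' := fun _ => True) (w := raw (cell N a p t))
    (fun _ _ _ => trivial) ((cnt_le_length _ _).trans (le_trans (le_of_eq List.length_ofFn)
      (not_lt.1 hN))) (t i, a i) (by rw [raw_cell, List.mem_ofFn]; exact ⟨i, rfl⟩) trivial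
  exact h this

/-- The main step in shortening words. -/
lemma exists_fewer_half {N : ℕ} (hN : Fintype.card ι < N) (hN0 : 0 < N) (f : Ω^ ι (Yt Q) oneY)
    (hf : ∀ x, (f x).1.1.length ≤ N) :
    ∃ f' : Ω^ ι (Yt Q) oneY, GenLoop.Homotopic f f' ∧
      ∀ x, cnt (fun t => (t : ℝ) = 1 / 2) (f' x).1 ≤ N - 1 := by
  have hdeep : IsClosed {t : I | 5 / 16 ≤ dep t} := isClosed_le continuous_const continuous_dep
  have hlow : IsOpen {x | cnt (fun t => 5 / 16 ≤ dep t) (f x).1 ≤ N - 1} :=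
    (isOpen_cnt_le hdeep (by rw [dep_zero]; norm_num) (by rw [dep_one]; norm_num) _).preimage
      f.1.continuous
  let E : Set (ι → I) := {x | cnt (fun t => 5 / 16 ≤ dep t) (f x).1 ≤ N - 1}ᶜ
  have hE : IsClosed E := hlow.isClosed_compl
  have hfull : ∀ x ∈ E, (f x).1.1.length = N ∧ ∀ l ∈ (f x).1.1, 5 / 16 ≤ dep l.1 := by
    intro x hx
    have h1 : N ≤ cnt (fun t => 5 / 16 ≤ dep t) (f x).1 := by
      have : ¬cnt (fun t => 5 / 16 ≤ dep t) (f x).1 ≤ N - 1 := hx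
      omega
    refine ⟨le_antisymm (hf x) (h1.trans (cnt_le_length _ _)), fun l hl => ?_⟩
    exact imp_of_cnt_eq (P := fun t => 5 / 16 ≤ dep t) (P' := fun _ => True) (fun _ _ _ => trivial)
      ((cnt_le_length _ _).trans ((hf x).trans h1)) l hl trivial
  have hinner : ∀ x ∈ E, ∀ l ∈ (f x).1.1, inner l.1 := fun x hx l hl =>
    lt_of_lt_of_le (by norm_num) ((hfull x hx).2 l hl)
  have hloc := fun x (hx : x ∈ E) => local_form (hfull x hx).1 (hinner x hx)
  have hcoord : ∀ x ∈ E, ∀ i, ContinuousAt (fun x => coord i (f x)) x := by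
    intro x hx i
    obtain ⟨a, p, hc, -⟩ := hloc x hx
    exact ContinuousAt.comp (g := coord i) (f := fun x => f x) (hc i) f.1.continuous.continuousAt
  let τ : C(E, Fin N → ℝ) := ⟨fun x i => (coord i (f x.1) : ℝ), continuous_pi fun i =>
    continuous_subtype_val.comp (continuous_iff_continuousAt.2 fun x =>
      ContinuousAt.comp (g := fun x => coord i (f x)) (f := fun x : E => x.1)
        (hcoord x.1 x.2 i) continuousAt_subtype_val)⟩
  obtain ⟨τ', hτ'⟩ := ContinuousMap.exists_restrict_eq hE τ
  obtain ⟨g, hg, hgne⟩ := exists_approx_avoid (ι := ι) (V := Fin N → ℝ) (by simpa using hN) τ'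
    (fun _ => 1 / 2) (ε := 1 / 16) (by norm_num)
  have hgE : ∀ x ∈ E, ∀ i : Fin N, |g x i - coord i (f x)| < 1 / 16 := by
    intro x hx i
    have h1 : τ' x i = coord i (f x) := congrFun (DFunLike.congr_fun hτ' ⟨x, hx⟩) i
    have h2 := (norm_le_pi_norm (g x - τ' x) i).trans_lt (hg x)
    rwa [Pi.sub_apply, h1, Real.norm_eq_abs] at h2
  have hcont : Continuous fun z : (ι → I) × I => pert N z.2 (g z.1) (f z.1) := by
    refine continuous_iff_continuousAt.2 fun ⟨x, s⟩ => ?_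
    by_cases hx : x ∈ E
    · obtain ⟨a, p, hc, hev⟩ := hloc x hx
      have hev2 : ∀ᶠ z : (ι → I) × I in 𝓝 (x, s),
          qY (cell N a p (moved z.2 (g z.1) fun i => coord i (f z.1))) =
            pert N z.2 (g z.1) (f z.1) := by
        have h3 : Filter.Tendsto (fun z : (ι → I) × I => f z.1) (𝓝 (x, s)) (𝓝 (f x)) :=
          (f.1.continuous.comp continuous_fst).continuousAt
        filter_upwards [h3.eventually hev] with z hz
        exact (pert_of_eq (hz (hf z.1))).symm
      refine ContinuousAt.congr ?_ hev2
      have h4 : ContinuousAt (fun z : (ι → I) × I => fun i : Fin N => coord i (f z.1)) (x, s) :=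
        continuousAt_pi.2 fun i => ContinuousAt.comp (g := fun x => coord i (f x))
          (f := fun z : (ι → I) × I => z.1) (x := (x, s)) (hcoord x hx i) continuousAt_fst
      have h5 : ContinuousAt (fun z : (ι → I) × I => (z.2, g z.1, fun i : Fin N => coord i (f z.1)))
          (x, s) := continuousAt_snd.prodMk
            ((g.continuous.comp continuous_fst).continuousAt.prodMk h4)
      have h6 : ContinuousAt (fun z : (ι → I) × I =>
          moved z.2 (g z.1) fun i : Fin N => coord i (f z.1)) (x, s) :=
        ContinuousAt.comp (g := fun z : I × (Fin N → ℝ) × (Fin N → I) => moved z.1 z.2.1 z.2.2)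
          (f := fun z : (ι → I) × I => (z.2, g z.1, fun i : Fin N => coord i (f z.1)))
          continuous_moved.continuousAt h5
      exact ContinuousAt.comp (g := fun t => qY (cell N a p t))
        (f := fun z : (ι → I) × I => moved z.2 (g z.1) fun i : Fin N => coord i (f z.1))
        (isQuotientMap_qY.continuous.comp (continuous_cell N a p)).continuousAt h6
    · have hx' : ∀ᶠ z : (ι → I) × I in 𝓝 (x, s), f z.1 = pert N z.2 (g z.1) (f z.1) := by
        have := (continuousAt_fst (p := (x, s))).eventually (hE.isOpen_compl.mem_nhds hx)
        filter_upwards [this] with z hz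
        refine (pert_eq_self (Or.inl ?_)).symm
        have : cnt (fun t => 5 / 16 ≤ dep t) (f z.1).1 ≤ N - 1 := not_not.1 hz
        omega
      exact ContinuousAt.congr (f.1.continuous.comp continuous_fst).continuousAt hx'
  let H : C((ι → I) × I, Yt Q) := ⟨_, hcont⟩
  have hb : ∀ x ∈ Cube.boundary ι, ∀ t, H (x, t) = oneY := by
    intro x hx t
    show pert N t (g x) (f x) = oneY
    rw [GenLoop.boundary f x hx]
    refine pert_eq_self (Or.inl ?_)
    show List.countP _ [] < N
    simpa using hN0
  let f' : Ω^ ι (Yt Q) oneY := ⟨⟨fun x => H (x, 1), by fun_prop⟩, fun x hx => hb x hx 1⟩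
  refine ⟨f', homotopic_of_map H (fun x => pert_eq_self (Or.inr rfl)) (fun x => rfl) hb,
    fun x => ?_⟩
  refine Nat.le_sub_one_of_lt ?_
  show cnt _ (pert N 1 (g x) (f x)).1 < N
  by_cases hl : (f x).1.1.length = N
  · obtain ⟨a, p, t, ht⟩ := exists_cell hl
    rw [pert_of_eq ht]
    show cnt _ (nf _) < N
    rw [cnt_nf (by norm_num) (by norm_num)]
    obtain ⟨i, hi⟩ := moved_ne_half (v := g x) (t := t) (fun hdeep i => by
      have hxE : x ∈ E := by
        show ¬cnt (fun t => 5 / 16 ≤ dep t) (f x).1 ≤ N - 1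
        have : N ≤ cnt (fun t => 5 / 16 ≤ dep t) (f x).1 := by
          calc N = cnt (fun _ => True) (f x).1 := by simp [cnt, hl]
            _ ≤ _ := cnt_mono fun l hl _ => by
              rw [ht, raw_cell, List.mem_ofFn] at hl
              obtain ⟨i, rfl⟩ := hl
              exact hdeep i
        omega
      obtain ⟨a', p', -, hev⟩ := hloc x hxE
      have h1 := hev.self_of_nhds (hf x)
      have h2 : (fun i => (t i, a i)) = fun i : Fin N => (coord i (f x), a' i) :=
        List.ofFn_injective (congrArg Prod.fst (ht.symm.trans h1))
      have h3 : t i = coord i (f x) := congrArg Prod.fst (congrFun h2 i)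
      rw [h3]
      exact hgE x hxE i) (hgne x)
    exact cnt_lt_of_exists hi
  · have : pert N 1 (g x) (f x) = f x := dif_neg hl
    rw [this]
    exact (cnt_le_length _ _).trans_lt (lt_of_le_of_ne (hf x) hl)

/-- Every cube can be deformed into short words. -/
theorem exists_length_le_three (f : Ω^ (Fin 3) (Yt Q) oneY) :
    ∃ f' : Ω^ (Fin 3) (Yt Q) oneY, GenLoop.Homotopic f f' ∧ ∀ x, (f' x).1.1.length ≤ 3 := by
  obtain ⟨M, f', h1, h2⟩ := exists_bounded f
  have key : ∀ (k : ℕ) (g : Ω^ (Fin 3) (Yt Q) oneY), (∀ x, (g x).1.1.length ≤ 3 + k) →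
      ∃ f' : Ω^ (Fin 3) (Yt Q) oneY, GenLoop.Homotopic g f' ∧ ∀ x, (f' x).1.1.length ≤ 3 := by
    intro k
    induction k with
    | zero => exact fun g hg => ⟨g, GenLoop.Homotopic.refl g, hg⟩
    | succ k ih =>
      intro g hg
      obtain ⟨g₁, h1, h2⟩ := exists_fewer_half (N := 3 + (k + 1)) (by simp) (by omega) g hg
      obtain ⟨g₂, h3, h4⟩ := exists_shorter g₁ h2
      obtain ⟨g₃, h5, h6⟩ := ih g₂ h4
      exact ⟨g₃, (h1.trans h3).trans h5, h6⟩
  obtain ⟨f'', h3, h4⟩ := key M f' fun x => (h2 x).trans (by omega)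
  exact ⟨f'', h1.trans h3, h4⟩

theorem fg_pi_three_Yt [Finite X] : Group.FG (HomotopyGroup (Fin 3) (Yt Q) oneY) :=
  fg_pi_three hstrY joined_oneY goodCover_covO fun f => by
    obtain ⟨f', h, hl⟩ := exists_length_le_three f
    exact ⟨f', h, fun x => exists_mem_covO (hl x)⟩

end Deform

section Covering

variable {X : Type} {Q : QuandleStruct X}

open Raw

/-- A word with given letters and inner automorphism. -/
def mk {κ : Type} (L : List (κ × X)) (p : Inn Q) : Raw Q κ := (L, p)

lemma mk_mul_mk {κ : Type} (L L' : List (κ × X)) (p q : Inn Q) :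
    mk L p * mk L' q = mk (act q L ++ L') (q * p) := rfl

lemma nf_split (L₁ L₂ : List (I × X)) (l : I × X) (p : Inn Q) :
    nf (mk (L₁ ++ l :: L₂) p) = nf (mk L₁ p) * nf1 l * nf (mk L₂ 1) := by
  have h : mk (L₁ ++ l :: L₂) p = mk L₁ p * letter l * mk L₂ 1 := by
    show _ = mk L₁ p * mk [l] 1 * mk L₂ 1
    rw [mk_mul_mk, mk_mul_mk, act_one, act_one, one_mul, one_mul, List.append_assoc]
    rfl
  rw [h, map_mul, map_mul, nf_letter]

lemma nf_remove_zero {L₁ L₂ : List (I × X)} {l : I × X} (h : l.1 = 0) (p : Inn Q) :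
    nf (mk (L₁ ++ l :: L₂) p) = nf (mk (L₁ ++ L₂) p) := by
  rw [nf_split, nf1, if_pos h, mul_one, ← map_mul, mk_mul_mk, act_one, one_mul]

lemma nf_remove_one {L₁ L₂ : List (I × X)} {l : I × X} (h : l.1 = 1) (p : Inn Q) :
    nf (mk (L₁ ++ l :: L₂) p) = nf (mk (act (rhoG Q l.2) L₁ ++ L₂) (rhoG Q l.2 * p)) := by
  have h0 : l.1 ≠ 0 := by rw [h]; exact one_ne_zero
  have hg : (grp (rhoG Q l.2) : Raw Q I) = mk [] (rhoG Q l.2) := rfl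
  rw [nf_split, nf1, if_neg h0, if_pos h, ← nf_grp, ← map_mul, ← map_mul, hg, mk_mul_mk, mk_mul_mk,
    act_one, one_mul, List.append_nil]

lemma ofFn_split {α : Type} {n : ℕ} (f : Fin (n + 1) → α) (j : Fin (n + 1)) :
    ∃ L₁ L₂, L₁.length = (j : ℕ) ∧ List.ofFn f = L₁ ++ f j :: L₂ := by
  refine ⟨(List.ofFn f).take j, (List.ofFn f).drop (j + 1), ?_, ?_⟩
  · rw [List.length_take, List.length_ofFn]; omega
  · have h : (j : ℕ) < (List.ofFn f).length := by rw [List.length_ofFn]; exact j.2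
    have : f j = (List.ofFn f)[(j : ℕ)] := by rw [List.getElem_ofFn]
    rw [this, List.cons_getElem_drop_succ, List.take_append_drop]

lemma ofFn_removeNth {α : Type} {n : ℕ} {f : Fin (n + 1) → α} {j : Fin (n + 1)} {L₁ L₂ : List α}
    {l : α} (hj : L₁.length = (j : ℕ)) (h : List.ofFn f = L₁ ++ l :: L₂) (c : α → α) :
    List.ofFn (j.removeNth fun i => if (i : ℕ) < (j : ℕ) then c (f i) else f i) =
      L₁.map c ++ L₂ := by
  have hn : L₁.length + L₂.length = n := by
    have := congrArg List.length h
    simp at this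
    omega
  have hf : ∀ i : Fin (n + 1), f i = (L₁ ++ l :: L₂)[(i : ℕ)]'(by rw [← h, List.length_ofFn]; exact i.2) := by
    intro i
    have := List.getElem_of_eq h (i := i) (by rw [List.length_ofFn]; exact i.2)
    rw [← this, List.getElem_ofFn]
  refine List.ext_getElem (by simp [hn]) fun i hi hi' => ?_
  rw [List.getElem_ofFn]
  simp only [Fin.removeNth, hf]
  by_cases hij : i < L₁.length
  · have h1 : (j.succAbove ⟨i, by simpa using hi⟩ : ℕ) = i := by
      rw [Fin.succAbove_of_castSucc_lt _ _ (by rw [Fin.lt_def]; simpa [← hj] using hij)]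
      rfl
    simp only [h1]
    rw [if_pos (hj ▸ hij)]
    rw [List.getElem_append_left (bs := l :: L₂) hij, List.getElem_append_left (by simpa using hij),
      List.getElem_map]
  · have h1 : (j.succAbove ⟨i, by simpa using hi⟩ : ℕ) = i + 1 := by
      rw [Fin.succAbove_of_le_castSucc _ _ (by rw [Fin.le_def]; simpa [← hj] using hij)]
      rfl
    simp only [h1]
    rw [if_neg (by omega)]
    rw [List.getElem_append_right (bs := l :: L₂) (by omega),
      List.getElem_append_right (by simpa using hij)]
    simp only [List.length_map]
    have h2 : i + 1 - L₁.length = (i - L₁.length) + 1 := by omega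
    simp only [h2, List.getElem_cons_succ]

lemma ofFn_removeNth' {α : Type} {n : ℕ} {f : Fin (n + 1) → α} {j : Fin (n + 1)} {L₁ L₂ : List α}
    {l : α} (hj : L₁.length = (j : ℕ)) (h : List.ofFn f = L₁ ++ l :: L₂) :
    List.ofFn (j.removeNth f) = L₁ ++ L₂ := by
  simpa using ofFn_removeNth hj h id

variable (Q) in
/-- The class of a word in the rack space. -/
def toBX (L : List (I × X)) : Q.rackSpace := Quot.mk Q.RackRel (preMk L.length L.get)

lemma toBX_ofFn (w : PreRack X) : toBX Q (List.ofFn w.2) = Quot.mk Q.RackRel w := by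
  have := List.equivSigmaTuple.apply_symm_apply w
  exact congrArg (Quot.mk Q.RackRel) this

lemma exists_split (L₁ L₂ : List (I × X)) (l : I × X) :
    ∃ (n : ℕ) (f : Fin (n + 1) → I × X) (j : Fin (n + 1)), f j = l ∧ L₁.length = (j : ℕ) ∧
      List.ofFn f = L₁ ++ l :: L₂ := by
  have hl : (L₁ ++ l :: L₂).length = L₁.length + L₂.length + 1 := by simp; omega
  refine ⟨L₁.length + L₂.length, fun i => (L₁ ++ l :: L₂).get (i.cast hl.symm),
    ⟨L₁.length, by omega⟩, ?_, rfl, ?_⟩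
  · simp
  · refine List.ext_getElem (by rw [List.length_ofFn, hl]) fun i hi hi' => ?_
    rw [List.getElem_ofFn]
    rfl

lemma toBX_remove_zero {L₁ L₂ : List (I × X)} {l : I × X} (h : l.1 = 0) :
    toBX Q (L₁ ++ l :: L₂) = toBX Q (L₁ ++ L₂) := by
  obtain ⟨n, f, j, hf, hj, hL⟩ := exists_split L₁ L₂ l
  rw [← hL, ← ofFn_removeNth' hj hL]
  have h1 := toBX_ofFn (Q := Q) (preMk _ f)
  have h2 := toBX_ofFn (Q := Q) (preMk _ (j.removeNth f))
  exact h1.trans ((Quot.sound (QuandleStruct.RackRel.zero n f j (by rw [hf, h]))).trans h2.symm)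

lemma toBX_remove_one {L₁ L₂ : List (I × X)} {l : I × X} (h : l.1 = 1) :
    toBX Q (L₁ ++ l :: L₂) = toBX Q (act (rhoG Q l.2) L₁ ++ L₂) := by
  obtain ⟨n, f, j, hf, hj, hL⟩ := exists_split L₁ L₂ l
  have h3 : List.ofFn (j.removeNth fun i =>
      if (i : ℕ) < (j : ℕ) then ((f i).1, Q.op (f i).2 (f j).2) else f i) =
      act (rhoG Q l.2) L₁ ++ L₂ := by
    rw [hf]
    exact ofFn_removeNth hj hL fun l' => (l'.1, Q.op l'.2 l.2)
  rw [← hL, ← h3]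
  have h1 := toBX_ofFn (Q := Q) (preMk _ f)
  have h2 := toBX_ofFn (Q := Q) (preMk _ (j.removeNth fun i =>
      if (i : ℕ) < (j : ℕ) then ((f i).1, Q.op (f i).2 (f j).2) else f i))
  exact h1.trans ((Quot.sound (QuandleStruct.RackRel.one n f j (by rw [hf, h]))).trans h2.symm)

lemma toBX_nf (w : Raw Q I) : toBX Q (nf w).1 = toBX Q w.1 := by
  obtain ⟨L, p⟩ := w
  show toBX Q (nf (mk L p)).1 = toBX Q L
  induction hn : L.length generalizing L p with
  | zero =>
    rw [nf_eq_self (w := mk L p)]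
    · rfl
    · show ∀ l ∈ L, _
      rw [List.length_eq_zero_iff.1 hn]
      simp
  | succ n ih =>
    by_cases h : ∀ l ∈ L, l.1 ≠ 0 ∧ l.1 ≠ 1
    · rw [nf_eq_self (w := mk L p) h]
      rfl
    push Not at h
    obtain ⟨l, hl, h⟩ := h
    obtain ⟨L₁, L₂, rfl⟩ := List.append_of_mem hl
    have hlen : L₁.length + L₂.length = n := by simp at hn; omega
    by_cases h0 : l.1 = 0
    · rw [nf_remove_zero h0, toBX_remove_zero h0]
      exact ih _ _ (by simpa using hlen)
    · have h1 := h h0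
      rw [nf_remove_one h1, toBX_remove_one h1]
      exact ih _ _ (by simpa [act] using hlen)

/-- The projection onto the rack space. -/
def proj (y : Yt Q) : Q.rackSpace := toBX Q y.1.1

lemma proj_qY (w : Pre Q) : proj (qY w) = Quot.mk Q.RackRel w.1 :=
  (toBX_nf (raw w)).trans (toBX_ofFn w.1)

lemma isQuotientMap_proj : Topology.IsQuotientMap (proj (Q := Q)) := by
  have h1 : Topology.IsQuotientMap (Prod.fst : PreRack X × Inn Q → PreRack X) :=
    isOpenMap_fst.isQuotientMap continuous_fst Prod.fst_surjective
  have h2 : Topology.IsQuotientMap (Quot.mk Q.RackRel) := isQuotientMap_quot_mk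
  have h3 : Topology.IsQuotientMap (proj ∘ qY (Q := Q)) := by
    have : proj ∘ qY (Q := Q) = Quot.mk Q.RackRel ∘ Prod.fst := funext proj_qY
    rw [this]
    exact h2.comp h1
  exact Topology.IsQuotientMap.of_comp isQuotientMap_qY.continuous
    (isQuotientMap_qY.continuous_iff.2 h3.continuous) h3

instance : MulAction (Inn Q) (Yt Q) where
  smul g y := ⟨(y.1.1, y.1.2 * g⁻¹), y.2⟩
  one_smul y := Subtype.ext (Prod.ext rfl (by show y.1.2 * 1⁻¹ = _; rw [inv_one, mul_one]))
  mul_smul g h y := Subtype.ext (Prod.ext rfl (by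
    show y.1.2 * (g * h)⁻¹ = y.1.2 * h⁻¹ * g⁻¹
    rw [mul_inv_rev, mul_assoc]))

lemma smul_val (g : Inn Q) (y : Yt Q) : (g • y).1 = grp g⁻¹ * y.1 := rfl

lemma smul_nfY (g : Inn Q) (w : Raw Q I) : g • nfY w = nfY (grp g⁻¹ * w) := by
  refine Subtype.ext ?_
  show grp g⁻¹ * nf w = nf (grp g⁻¹ * w)
  rw [map_mul, nf_grp]

lemma nfY_mem_orbit (L : List (I × X)) (p q : Inn Q) :
    nfY (mk L p) ∈ MulAction.orbit (Inn Q) (nfY (mk L q)) :=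
  ⟨p⁻¹ * q, by
    show (p⁻¹ * q) • nfY (mk L q) = _
    rw [smul_nfY]
    congr 1
    show mk ([] ++ L) (q * (p⁻¹ * q)⁻¹) = _
    rw [mul_inv_rev, inv_inv, mul_inv_cancel_left]; rfl⟩

/-- The orbit of a point of the rack space. -/
noncomputable def toOrbit : Q.rackSpace → MulAction.orbitRel.Quotient (Inn Q) (Yt Q) :=
  Quot.lift (fun w => Quotient.mk _ (nfY (mk (List.ofFn w.2) 1))) fun a b h => by
    refine Quotient.sound ?_
    show nfY _ ∈ MulAction.orbit _ _
    cases h with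
    | one n f j h =>
      obtain ⟨L₁, L₂, hj, hL⟩ := ofFn_split f j
      have h3 : List.ofFn (j.removeNth fun i =>
          if (i : ℕ) < (j : ℕ) then ((f i).1, Q.op (f i).2 (f j).2) else f i) =
          act (rhoG Q (f j).2) L₁ ++ L₂ :=
        ofFn_removeNth hj hL fun l' => (l'.1, Q.op l'.2 (f j).2)
      have h4 : nfY (mk (Q := Q) (List.ofFn f) 1) =
          nfY (mk (act (rhoG Q (f j).2) L₁ ++ L₂) (rhoG Q (f j).2 * 1)) :=
        Subtype.ext ((congrArg (fun L => nf (mk L 1)) hL).trans (nf_remove_one h 1))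
      show nfY (mk (List.ofFn f) 1) ∈ MulAction.orbit _ (nfY (mk (List.ofFn _) 1))
      rw [h3, h4]
      exact nfY_mem_orbit _ _ _
    | zero n f j h =>
      obtain ⟨L₁, L₂, hj, hL⟩ := ofFn_split f j
      have h3 : List.ofFn (j.removeNth f) = L₁ ++ L₂ := ofFn_removeNth' hj hL
      have h4 : nfY (mk (Q := Q) (List.ofFn f) 1) = nfY (mk (L₁ ++ L₂) 1) :=
        Subtype.ext ((congrArg (fun L => nf (mk L 1)) hL).trans (nf_remove_zero h 1))
      show nfY (mk (List.ofFn f) 1) ∈ MulAction.orbit _ (nfY (mk (List.ofFn _) 1))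
      rw [h3, h4]
      exact nfY_mem_orbit _ _ _

lemma toOrbit_proj (y : Yt Q) : toOrbit (proj y) = Quotient.mk _ y := by
  refine Quotient.sound ?_
  show nfY (mk (List.ofFn y.1.1.get) 1) ∈ MulAction.orbit _ y
  rw [List.ofFn_get]
  have := nfY_mem_orbit y.1.1 1 y.1.2
  have h : nfY (mk y.1.1 y.1.2) = y := nfY_val y
  rwa [h] at this

lemma proj_eq_iff {y z : Yt Q} : proj y = proj z ↔ y ∈ MulAction.orbit (Inn Q) z := by
  constructor
  · intro h
    have h1 := congrArg toOrbit h
    rw [toOrbit_proj, toOrbit_proj] at h1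
    exact Quotient.exact h1
  · rintro ⟨g, rfl⟩
    rfl

lemma exists_disjoint (y : Yt Q) :
    ∃ U ∈ 𝓝 y, ∀ g : Inn Q, ((g • ·) '' U ∩ U).Nonempty → g = 1 := by
  classical
  obtain ⟨a, ⟨ha0, ha1⟩, hay⟩ := (Ioo_infinite (show (0 : I) < 1 from zero_lt_one)).exists_notMem_finset
    (y.1.1.map Prod.fst).toFinset
  let F : I → I := fun t => if t < a then 0 else 1
  have hF0 : F 0 = 0 := if_pos ha0
  have hF1 : F 1 = 1 := if_neg ha1.not_gt
  let U : Set I := {t | t ≠ a}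
  have hF : ∀ t ∈ U, ∀ᶠ t' in 𝓝 t, t' ∈ U ∧ F t' = F t := by
    intro t ht
    rcases lt_or_gt_of_ne ht with h | h
    · filter_upwards [isOpen_Iio.mem_nhds h] with t' h'
      exact ⟨ne_of_lt h', (if_pos h').trans (if_pos h).symm⟩
    · filter_upwards [isOpen_Ioi.mem_nhds h] with t' h'
      exact ⟨ne_of_gt h', (if_neg (not_lt_of_gt h')).trans (if_neg (not_lt_of_gt h)).symm⟩
  have hopen := isOpen_pattern (Q := Q) (U := U) (ne_of_lt ha0) (ne_of_gt ha1) F hF (fun w => (nf w).2)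
    (fun w => congrArg Prod.snd (nf_map_nf hF0 hF1 w)) {(nf (mapL F y.1)).2}
  refine ⟨_, hopen.mem_nhds ⟨fun l hl hla => ?_, rfl⟩, ?_⟩
  · exact hay (List.mem_toFinset.2 (List.mem_map.2 ⟨l, hl, hla⟩))
  · rintro g ⟨_, ⟨z, hz, rfl⟩, hgz⟩
    have h1 : (nf (mapL F z.1)).2 = (nf (mapL F y.1)).2 := hz.2
    have h2 : (nf (mapL F (g • z).1)).2 = (nf (mapL F y.1)).2 := hgz.2
    have h3 : (nf (mapL F (g • z).1)).2 = (nf (mapL F z.1)).2 * g⁻¹ := by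
      rw [smul_val, map_mul, map_mul, mapL_grp, nf_grp]; rfl
    rw [h3, h1] at h2
    exact inv_eq_one.1 (mul_eq_left.1 h2)

lemma isQuotientCoveringMap_proj : IsQuotientCoveringMap (proj (Q := Q)) (Inn Q) where
  toIsQuotientMap := isQuotientMap_proj
  continuous_const_smul g := by
    refine isQuotientMap_qY.continuous_iff.2 ?_
    have h : Continuous fun w : Pre Q => ((w.1, w.2 * g⁻¹) : PreRack X × Inn Q) := by
      exact continuous_fst.prodMk ((continuous_of_discreteTopology
        (f := fun p : Inn Q => p * g⁻¹)).comp continuous_snd)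
    have h2 : (fun y : Yt Q => g • y) ∘ qY = fun w : Pre Q => qY ((w.1, w.2 * g⁻¹) : Pre Q) := by
      funext w
      show g • nfY (raw w) = nfY _
      rw [smul_nfY]
      rfl
    rw [h2]
    exact isQuotientMap_qY.continuous.comp h
  apply_eq_iff_mem_orbit := proj_eq_iff
  disjoint := exists_disjoint

/-- The projection as a continuous map. -/
def projC : C(Yt Q, Q.rackSpace) := ⟨proj, isQuotientMap_proj.continuous⟩

lemma projC_oneY : projC (oneY : Yt Q) = Q.rackBase :=
  congrArg (Quot.mk Q.RackRel) (Sigma.ext rfl (heq_of_eq (funext fun i => i.elim0)))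

end Covering

section Lifting

variable {X : Type} {Q : QuandleStruct X}

/-- Cubes in the rack space lift to reduced words. -/
lemma exists_lift (f : Ω^ (Fin 3) Q.rackSpace Q.rackBase) :
    ∃ F : Ω^ (Fin 3) (Yt Q) oneY, GenLoop.push projC projC_oneY F = f := by
  have cov : IsCoveringMap (proj (Q := Q)) := isQuotientCoveringMap_proj.isCoveringMap
  let H : C(I × (Fin 3 → I), Q.rackSpace) := ⟨fun z => f fun i => z.1 * z.2 i,
    f.1.continuous.comp (by fun_prop)⟩
  have hbase : f (fun _ => 0) = Q.rackBase := GenLoop.boundary f _ ⟨0, Or.inl rfl⟩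
  have hH0 : ∀ x, H (0, x) = proj (ContinuousMap.const (Fin 3 → I) (oneY : Yt Q) x) := by
    intro x
    show f (fun i => 0 * x i) = projC oneY
    simp only [zero_mul]
    rw [hbase, projC_oneY]
  let K := cov.liftHomotopy H _ hH0
  have hK : ∀ z, proj (K z) = H z := fun z => congrFun (cov.liftHomotopy_lifts H _ hH0) z
  have hK0 : ∀ x, K (0, x) = oneY := fun x => cov.liftHomotopy_zero H _ hH0 x
  have hF0 : K (1, fun _ => 0) = oneY := by
    rw [← hK0 fun _ => 0]
    refine cov.const_of_comp (g := fun s : I => K (s, fun _ => 0)) (by fun_prop) (fun s s' => ?_) 1 0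
    rw [hK, hK]
    show f (fun i => s * 0) = f (fun i => s' * 0)
    simp only [mul_zero]
  have hproj : ∀ x, proj (K (1, x)) = f x := by
    intro x
    rw [hK]
    show f (fun i => 1 * x i) = f x
    simp only [one_mul]
  have hface : ∀ (i : Fin 3) (c : I), (c = 0 ∨ c = 1) → ∀ x y : Fin 3 → I, x i = c → y i = c →
      K (1, x) = K (1, y) := by
    intro i c hc x y hx hy
    have key := cov.const_of_comp (g := fun x : Fin 3 → I => K (1, Function.update x i c))
      (by fun_prop) (fun x x' => by
        have hb : ∀ x : Fin 3 → I, f (Function.update x i c) = Q.rackBase := fun x =>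
          GenLoop.boundary f _ ⟨i, by rw [Function.update_self]; exact hc⟩
        rw [hproj, hproj, hb, hb]) x y
    have hx' : Function.update x i c = x := by rw [← hx, Function.update_eq_self]
    have hy' : Function.update y i c = y := by rw [← hy, Function.update_eq_self]
    simpa only [hx', hy'] using key
  refine ⟨⟨⟨fun x => K (1, x), by fun_prop⟩, fun x hx => ?_⟩, ?_⟩
  · obtain ⟨i, hi⟩ := hx
    show K (1, x) = oneY
    rw [← hF0]
    rcases hi with hi | hi
    · exact hface i 0 (Or.inl rfl) _ _ hi rfl
    · obtain ⟨j, hj⟩ := exists_ne i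
      rw [hface i 1 (Or.inr rfl) x (Function.update (fun _ => 0) i 1) hi (Function.update_self ..)]
      exact hface j 0 (Or.inl rfl) _ _ (Function.update_of_ne hj ..) rfl
  · congr 1
    ext x
    exact hproj x

theorem fg_pi_three_rackSpace [Finite X] :
    Group.FG (HomotopyGroup (Fin 3) Q.rackSpace Q.rackBase) := by
  have := fg_pi_three_Yt (Q := Q)
  refine Group.fg_of_surjective (f := HomotopyGroup.hom (N := Fin 3) projC projC_oneY) fun z => ?_
  induction z using Quotient.inductionOn with
  | h f =>
    obtain ⟨F, rfl⟩ := exists_lift f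
    exact ⟨Quotient.mk _ F, rfl⟩

end Lifting

end RackPi3

/-- Let `X` be a finite quandle. Then the abelian group `π₃^Q(BX)`, the image of
`π₃(BX) → π₃(B^QX)` induced by the inclusion of the rack space into the quandle space,
is finitely generated. -/
theorem pi3Q_finitelyGenerated {X : Type} [Finite X] (Q : QuandleStruct X) :
    Group.FG ↥Q.pi3Q := by
  have : Group.FG (HomotopyGroup (Fin 3) Q.rackSpace Q.rackBase) := RackPi3.fg_pi_three_rackSpace
  exact Group.fg_range (HomotopyGroup.hom (N := Fin 3) Q.inclQSp rfl)
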